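/- The set of almost reducible cocycles is open in (ℝ ∖ ℚ) × C^ω(ℝ/ℤ, SL(2,ℝ)): if (α, A) is almost reducible and (α^{(n)}, A^{(n)}) → (α, A) with α^{(n)} ∈ ℝ ∖ ℚ, then (α^{(n)}, A^{(n)}) is almost reducible for all sufficiently large n. -/

import Mathlib

open Complex Real Filter

noncomputable section

attribute [local instance] Matrix.normedAddCommGroup Matrix.normedSpace

/-- 2×2 complex matrices (holomorphic extensions of real matrix maps). -/
abbrev M2 : Type := Matrix (Fin 2) (Fin 2) ℂ

/-- The horizontal strip of half-width `ε` around the real axis. -/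
def Strip (ε : ℝ) : Set ℂ := {z : ℂ | |z.im| < ε}

/-- Iterates of the cocycle: `cocycleIter α A k z = A(z+(k-1)α) ⋯ A(z)`, with value `1` for `k=0`. -/
def cocycleIter (α : ℝ) (A : ℂ → M2) : ℕ → ℂ → M2
  | 0 => fun _ => 1
  | k + 1 => fun z => A (z + (k : ℂ) * (α : ℂ)) * cocycleIter α A k z

/-- `A ∈ C^ω_ε(ℝ/ℤ, SL(2,ℝ))`: a 1-periodic holomorphic map on the strip of half-width `ε`,
real-valued on `ℝ`, with determinant 1. -/
def IsSL2Strip (ε : ℝ) (A : ℂ → M2) : Prop :=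
  DifferentiableOn ℂ A (Strip ε) ∧ (∀ z : ℂ, A (z + 1) = A z) ∧
  (∀ x : ℝ, ∀ i j, (A (x : ℝ) i j).im = 0) ∧ (∀ z ∈ Strip ε, (A z).det = 1)

/-- `B ∈ C^ω_ε(ℝ/ℤ, PSL(2,ℝ))`: a holomorphic map on the strip of half-width `ε`,
real-valued on `ℝ`, with determinant 1, which is 1-periodic up to sign. -/
def IsPSL2Strip (ε : ℝ) (B : ℂ → M2) : Prop :=
  DifferentiableOn ℂ B (Strip ε) ∧
  (∃ s : ℂ, (s = 1 ∨ s = -1) ∧ ∀ z : ℂ, B (z + 1) = s • B z) ∧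
  (∀ x : ℝ, ∀ i j, (B (x : ℝ) i j).im = 0) ∧ (∀ z ∈ Strip ε, (B z).det = 1)

/-- The rotation matrix `R_θ` (with holomorphic dependence on `θ`). -/
def Rot (θ : ℂ) : M2 :=
  !![Complex.cos (2 * π * θ), -Complex.sin (2 * π * θ);
     Complex.sin (2 * π * θ), Complex.cos (2 * π * θ)]

def AlmostReducible (α εA : ℝ) (A : ℂ → M2) : Prop :=
  ∃ ε : ℝ, 0 < ε ∧ ε ≤ εA ∧ ∃ B : ℕ → ℂ → M2, (∀ n, IsPSL2Strip ε (B n)) ∧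
    ∃ A₀ : M2, ∀ δ : ℝ, 0 < δ → ∃ N : ℕ, ∀ n : ℕ, N ≤ n → ∀ z ∈ Strip ε,
      ‖B n (z + (α : ℂ)) * A z * (B n z)⁻¹ - A₀‖ ≤ δ

abbrev V2 : Type := Fin 2 → ℂ

lemma M2.norm_mul_le (M N : M2) : ‖M * N‖ ≤ 2 * ‖M‖ * ‖N‖ := by
  rw [Matrix.norm_le_iff (by positivity)]
  intro i j
  rw [Matrix.mul_apply, Fin.sum_univ_two]
  have h1 := Matrix.norm_entry_le_entrywise_sup_norm M (i := i) (j := 0)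
  have h2 := Matrix.norm_entry_le_entrywise_sup_norm M (i := i) (j := 1)
  have h3 := Matrix.norm_entry_le_entrywise_sup_norm N (i := 0) (j := j)
  have h4 := Matrix.norm_entry_le_entrywise_sup_norm N (i := 1) (j := j)
  calc ‖M i 0 * N 0 j + M i 1 * N 1 j‖ ≤ ‖M i 0‖ * ‖N 0 j‖ + ‖M i 1‖ * ‖N 1 j‖ := by
        refine (norm_add_le _ _).trans ?_
        rw [norm_mul, norm_mul]
    _ ≤ ‖M‖ * ‖N‖ + ‖M‖ * ‖N‖ := by gcongr
    _ = 2 * ‖M‖ * ‖N‖ := by ring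

lemma M2.norm_mulVec_le (M : M2) (v : V2) : ‖M.mulVec v‖ ≤ 2 * ‖M‖ * ‖v‖ := by
  rw [pi_norm_le_iff_of_nonneg (by positivity)]
  intro i
  rw [Matrix.mulVec, dotProduct, Fin.sum_univ_two]
  have h1 := Matrix.norm_entry_le_entrywise_sup_norm M (i := i) (j := 0)
  have h2 := Matrix.norm_entry_le_entrywise_sup_norm M (i := i) (j := 1)
  have h3 := norm_le_pi_norm v 0
  have h4 := norm_le_pi_norm v 1
  calc ‖M i 0 * v 0 + M i 1 * v 1‖ ≤ ‖M i 0‖ * ‖v 0‖ + ‖M i 1‖ * ‖v 1‖ := by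
        refine (norm_add_le _ _).trans ?_
        rw [norm_mul, norm_mul]
    _ ≤ ‖M‖ * ‖v‖ + ‖M‖ * ‖v‖ := by gcongr
    _ = 2 * ‖M‖ * ‖v‖ := by ring

lemma M2.norm_adjugate (M : M2) : ‖M.adjugate‖ = ‖M‖ := by
  have key : ∀ M : M2, ‖M.adjugate‖ ≤ ‖M‖ := by
    intro M
    rw [Matrix.norm_le_iff (norm_nonneg _)]
    intro i j
    rw [Matrix.adjugate_fin_two]
    fin_cases i <;> fin_cases j <;>
      simp [Matrix.norm_entry_le_entrywise_sup_norm M]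
  refine le_antisymm (key M) ?_
  have h := key M.adjugate
  have h2 : M.adjugate.adjugate = M := by
    simp [Matrix.adjugate_fin_two, Matrix.eta_fin_two M |>.symm]
  rwa [h2] at h

lemma M2.inv_eq_adjugate {M : M2} (h : M.det = 1) : M⁻¹ = M.adjugate := by
  rw [Matrix.inv_def, h]; simp

lemma M2.norm_inv {M : M2} (h : M.det = 1) : ‖M⁻¹‖ = ‖M‖ := by
  rw [M2.inv_eq_adjugate h, M2.norm_adjugate]

lemma M2.norm_one : ‖(1 : M2)‖ = 1 := by
  apply le_antisymm
  · rw [Matrix.norm_le_iff zero_le_one]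
    intro i j
    rw [Matrix.one_apply]
    split_ifs <;> simp
  · have := Matrix.norm_entry_le_entrywise_sup_norm (1 : M2) (i := 0) (j := 0)
    rwa [Matrix.one_apply_eq, NormOneClass.norm_one] at this

lemma M2.one_le_two_mul_norm {M : M2} (h : M.det = 1) : 1 ≤ 2 * ‖M‖ := by
  have h1 := M2.norm_mul_le M M⁻¹
  rw [Matrix.mul_nonsing_inv _ (by simp [h]), M2.norm_one, M2.norm_inv h] at h1
  nlinarith [norm_nonneg M]

lemma M2.exists_mulVec_norm_eq (M : M2) : ∃ e : V2, ‖e‖ = 1 ∧ ‖M.mulVec e‖ = ‖M‖ := by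
  by_contra hcon
  push Not at hcon
  have hs : ∀ j : Fin 2, ‖(Pi.single j 1 : V2)‖ = 1 := by
    intro j
    rw [Pi.norm_single, NormOneClass.norm_one]
  have hcol : ∀ j : Fin 2, M.mulVec (Pi.single j 1) = fun i => M i j := by
    intro j; ext i; simp
  have hle : ∀ j : Fin 2, ‖M.mulVec (Pi.single j 1)‖ ≤ ‖M‖ := by
    intro j
    rw [hcol, pi_norm_le_iff_of_nonneg (norm_nonneg _)]
    intro i
    exact Matrix.norm_entry_le_entrywise_sup_norm M
  have hlt : ∀ j : Fin 2, ‖M.mulVec (Pi.single j 1)‖ < ‖M‖ := fun j =>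
    lt_of_le_of_ne (hle j) (hcon _ (hs j))
  have : ‖M‖ < ‖M‖ := by
    conv_lhs => rw [Matrix.norm_def]
    have hpos : 0 < ‖M‖ := (norm_nonneg _).trans_lt (hlt 0)
    rw [pi_norm_lt_iff hpos]
    intro i
    rw [pi_norm_lt_iff hpos]
    intro j
    have := norm_le_pi_norm (M.mulVec (Pi.single j 1)) i
    rw [hcol] at this
    refine this.trans_lt ?_
    rw [← hcol]
    exact hlt j
  exact lt_irrefl _ this

/-- The determinant of a pair of vectors. -/
def wedge (v w : V2) : ℂ := v 0 * w 1 - v 1 * w 0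

lemma wedge_mulVec (M : M2) (v w : V2) :
    wedge (M.mulVec v) (M.mulVec w) = M.det * wedge v w := by
  simp only [wedge, Matrix.mulVec, dotProduct, Fin.sum_univ_two, Matrix.det_fin_two]
  ring

lemma norm_wedge_le (v w : V2) : ‖wedge v w‖ ≤ 2 * ‖v‖ * ‖w‖ := by
  have h1 := norm_le_pi_norm v 0
  have h2 := norm_le_pi_norm v 1
  have h3 := norm_le_pi_norm w 0
  have h4 := norm_le_pi_norm w 1
  calc ‖v 0 * w 1 - v 1 * w 0‖ ≤ ‖v 0‖ * ‖w 1‖ + ‖v 1‖ * ‖w 0‖ := by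
        refine (norm_sub_le _ _).trans ?_
        rw [norm_mul, norm_mul]
    _ ≤ ‖v‖ * ‖w‖ + ‖v‖ * ‖w‖ := by gcongr
    _ = 2 * ‖v‖ * ‖w‖ := by ring

lemma Strip.isOpen (r : ℝ) : IsOpen (Strip r) :=
  isOpen_lt (Complex.continuous_im.abs) continuous_const

lemma Strip.mono {r s : ℝ} (h : r ≤ s) : Strip r ⊆ Strip s := fun _ hz => lt_of_lt_of_le hz h

lemma Strip.add_real {r : ℝ} {z : ℂ} (x : ℝ) : z + (x : ℂ) ∈ Strip r ↔ z ∈ Strip r := by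
  simp [Strip]

lemma Strip.add_one {r : ℝ} {z : ℂ} : z + 1 ∈ Strip r ↔ z ∈ Strip r := by
  simp [Strip]

lemma Strip.add_nat_mul {r : ℝ} {z : ℂ} (k : ℕ) (x : ℝ) :
    z + (k : ℂ) * (x : ℂ) ∈ Strip r ↔ z ∈ Strip r := by
  simp [Strip]

lemma Strip.sub_nat_mul {r : ℝ} {z : ℂ} (k : ℕ) (x : ℝ) :
    z - (k : ℂ) * (x : ℂ) ∈ Strip r ↔ z ∈ Strip r := by
  simp [Strip]

/-- A 1-periodic holomorphic map to `SL(2,ℂ)` on a strip. -/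
def IsCSL (h : ℝ) (A : ℂ → M2) : Prop :=
  DifferentiableOn ℂ A (Strip h) ∧ (∀ z : ℂ, A (z + 1) = A z) ∧ ∀ z ∈ Strip h, (A z).det = 1

lemma IsSL2Strip.isCSL {h : ℝ} {A : ℂ → M2} (hA : IsSL2Strip h A) : IsCSL h A :=
  ⟨hA.1, hA.2.1, hA.2.2.2⟩

lemma IsCSL.mono {h h' : ℝ} {A : ℂ → M2} (hA : IsCSL h A) (hh : h' ≤ h) : IsCSL h' A :=
  ⟨hA.1.mono (Strip.mono hh), hA.2.1, fun z hz => hA.2.2 z (Strip.mono hh hz)⟩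

lemma IsSL2Strip.mono {h h' : ℝ} {A : ℂ → M2} (hA : IsSL2Strip h A) (hh : h' ≤ h) :
    IsSL2Strip h' A :=
  ⟨hA.1.mono (Strip.mono hh), hA.2.1, hA.2.2.1, fun z hz => hA.2.2.2 z (Strip.mono hh hz)⟩

lemma Strip.mem_shift {h y : ℝ} {z : ℂ} (hz : z ∈ Strip (h - |y|)) :
    z + (y : ℂ) * Complex.I ∈ Strip h := by
  simp only [Strip, Set.mem_ofPred_eq] at *
  have : (z + (y : ℂ) * Complex.I).im = z.im + y := by simp
  rw [this]
  have := abs_add_le z.im y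
  linarith

lemma IsCSL.shift {h : ℝ} {A : ℂ → M2} (hA : IsCSL h A) (y : ℝ) :
    IsCSL (h - |y|) (fun z => A (z + (y : ℂ) * Complex.I)) := by
  refine ⟨?_, ?_, fun z hz => hA.2.2 _ (Strip.mem_shift hz)⟩
  · exact hA.1.comp (by fun_prop) (fun z hz => Strip.mem_shift hz)
  · intro z
    have := hA.2.1 (z + (y : ℂ) * Complex.I)
    show A (z + 1 + (y : ℂ) * Complex.I) = A (z + (y : ℂ) * Complex.I)
    rw [← this]; congr 1; ring

lemma DifferentiableOn.matrix_mul {f g : ℂ → M2} {s : Set ℂ} (hf : DifferentiableOn ℂ f s)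
    (hg : DifferentiableOn ℂ g s) : DifferentiableOn ℂ (fun z => f z * g z) s := by
  have hf' : ∀ i j, DifferentiableOn ℂ (fun z => f z i j) s := fun i j =>
    differentiableOn_pi.1 (differentiableOn_pi.1 hf i) j
  have hg' : ∀ i j, DifferentiableOn ℂ (fun z => g z i j) s := fun i j =>
    differentiableOn_pi.1 (differentiableOn_pi.1 hg i) j
  refine differentiableOn_pi.2 fun i => differentiableOn_pi.2 fun j => ?_
  simp only [Matrix.mul_apply, Fin.sum_univ_two]
  exact ((hf' _ _).mul (hg' _ _)).add ((hf' _ _).mul (hg' _ _))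

lemma DifferentiableOn.matrix_entry {f : ℂ → M2} {s : Set ℂ} (hf : DifferentiableOn ℂ f s)
    (i j : Fin 2) : DifferentiableOn ℂ (fun z => f z i j) s :=
  differentiableOn_pi.1 (differentiableOn_pi.1 hf i) j

lemma differentiableOn_matrix {f : ℂ → M2} {s : Set ℂ}
    (hf : ∀ i j, DifferentiableOn ℂ (fun z => f z i j) s) : DifferentiableOn ℂ f s :=
  differentiableOn_pi.2 fun i => differentiableOn_pi.2 fun j => hf i j

lemma DifferentiableOn.matrix_mulVec {f : ℂ → M2} {g : ℂ → V2} {s : Set ℂ}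
    (hf : DifferentiableOn ℂ f s) (hg : DifferentiableOn ℂ g s) :
    DifferentiableOn ℂ (fun z => (f z).mulVec (g z)) s := by
  refine differentiableOn_pi.2 fun i => ?_
  simp only [Matrix.mulVec, dotProduct, Fin.sum_univ_two]
  exact ((hf.matrix_entry _ _).mul (differentiableOn_pi.1 hg _)).add
    ((hf.matrix_entry _ _).mul (differentiableOn_pi.1 hg _))

lemma DifferentiableOn.matrix_adjugate {f : ℂ → M2} {s : Set ℂ} (hf : DifferentiableOn ℂ f s) :
    DifferentiableOn ℂ (fun z => (f z).adjugate) s := by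
  refine differentiableOn_matrix fun i j => ?_
  simp only [Matrix.adjugate_fin_two]
  fin_cases i <;> fin_cases j <;> simp <;>
    exact hf.matrix_entry _ _

lemma DifferentiableOn.matrix_inv {f : ℂ → M2} {s : Set ℂ} (hf : DifferentiableOn ℂ f s)
    (hd : ∀ z ∈ s, (f z).det = 1) : DifferentiableOn ℂ (fun z => (f z)⁻¹) s :=
  hf.matrix_adjugate.congr fun z hz => M2.inv_eq_adjugate (hd z hz)

lemma DifferentiableOn.comp_add_real {E : Type*} [NormedAddCommGroup E] [NormedSpace ℂ E]
    {f : ℂ → E} {r : ℝ} (hf : DifferentiableOn ℂ f (Strip r)) (x : ℝ) :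
    DifferentiableOn ℂ (fun z => f (z + (x : ℂ))) (Strip r) :=
  hf.comp (by fun_prop) (fun _ hz => (Strip.add_real x).2 hz)

lemma cocycleIter_add (α : ℝ) (A : ℂ → M2) (m k : ℕ) (z : ℂ) :
    cocycleIter α A (m + k) z
      = cocycleIter α A m (z + (k : ℂ) * (α : ℂ)) * cocycleIter α A k z := by
  induction m with
  | zero => simp [cocycleIter]
  | succ m ih =>
    rw [show m + 1 + k = (m + k) + 1 by ring]
    simp only [cocycleIter]
    rw [ih, mul_assoc]
    congr 2
    push_cast; ring

lemma cocycleIter_one (α : ℝ) (A : ℂ → M2) (z : ℂ) : cocycleIter α A 1 z = A z := by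
  simp [cocycleIter]

lemma IsCSL.iter {h : ℝ} {A : ℂ → M2} (hA : IsCSL h A) (α : ℝ) (n : ℕ) :
    IsCSL h (cocycleIter α A n) := by
  induction n with
  | zero =>
      exact ⟨by simp only [cocycleIter]; fun_prop, by simp [cocycleIter], by simp [cocycleIter]⟩
  | succ n ih =>
    refine ⟨?_, ?_, ?_⟩
    · simp only [cocycleIter]
      refine DifferentiableOn.matrix_mul ?_ ih.1
      have := hA.1.comp_add_real (n * α)
      simp only [Complex.ofReal_mul, Complex.ofReal_natCast] at this
      exact this
    · intro z
      simp only [cocycleIter]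
      rw [ih.2.1, ← hA.2.1 (z + (n : ℂ) * (α : ℂ))]
      congr 2; ring
    · intro z hz
      simp only [cocycleIter]
      rw [Matrix.det_mul, ih.2.2 z hz, hA.2.2 _ ((Strip.add_nat_mul n α).2 hz), one_mul]

lemma cocycleIter_shift (α : ℝ) (A : ℂ → M2) (w : ℂ) (n : ℕ) (z : ℂ) :
    cocycleIter α (fun z => A (z + w)) n z = cocycleIter α A n (z + w) := by
  induction n with
  | zero => simp [cocycleIter]
  | succ n ih =>
    simp only [cocycleIter, ih]
    congr 2; ring

/-- `(α, A)` can be conjugated on the strip of half-width `ε` arbitrarily close to constants of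
bounded size. -/
def ApproxRed (α ε : ℝ) (A : ℂ → M2) : Prop :=
  ∃ K : ℝ, ∀ δ : ℝ, 0 < δ → ∃ B : ℂ → M2, IsPSL2Strip ε B ∧ ∃ c : M2, ‖c‖ ≤ K ∧
    ∀ z ∈ Strip ε, ‖B (z + (α : ℂ)) * A z * (B z)⁻¹ - c‖ ≤ δ

lemma ApproxRed.almostReducible {α ε εA : ℝ} {A : ℂ → M2} (h : ApproxRed α ε A) (hε : 0 < ε)
    (hεA : ε ≤ εA) : AlmostReducible α εA A := by
  obtain ⟨K, hK⟩ := h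
  have hpos : ∀ n : ℕ, (0 : ℝ) < 1 / ((n : ℝ) + 1) := fun n => by positivity
  choose B hB c hc hBc using fun n : ℕ => hK _ (hpos n)
  have : ProperSpace M2 := FiniteDimensional.proper ℂ M2
  have hcK : ∀ n, c n ∈ Metric.closedBall (0 : M2) K := fun n => by simpa using hc n
  obtain ⟨A₀, -, φ, hφ, hlim⟩ := (isCompact_closedBall (0 : M2) K).tendsto_subseq hcK
  refine ⟨ε, hε, hεA, fun n => B (φ n), fun n => hB _, A₀, fun δ hδ => ?_⟩
  have h1 : ∀ᶠ n : ℕ in atTop, (1 : ℝ) / ((n : ℝ) + 1) < δ / 2 :=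
    (tendsto_one_div_add_atTop_nhds_zero_nat).eventually (gt_mem_nhds (half_pos hδ))
  have h2 : ∀ᶠ n : ℕ in atTop, ‖c (φ n) - A₀‖ < δ / 2 := by
    have := (Metric.tendsto_nhds.1 hlim) (δ / 2) (half_pos hδ)
    simpa [dist_eq_norm] using this
  have h3 := hφ.tendsto_atTop.eventually h1
  obtain ⟨N, hN⟩ := eventually_atTop.1 (h2.and h3)
  refine ⟨N, fun n hn z hz => ?_⟩
  obtain ⟨h2', h3'⟩ := hN n hn
  have := hBc (φ n) z hz
  calc _ = ‖(B (φ n) (z + (α : ℂ)) * A z * (B (φ n) z)⁻¹ - c (φ n)) + (c (φ n) - A₀)‖ := by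
        congr 1; abel
    _ ≤ _ := norm_add_le _ _
    _ ≤ δ / 2 + δ / 2 := add_le_add (this.trans h3'.le) h2'.le
    _ = δ := by ring

lemma IsPSL2Strip.mul {ε : ℝ} {B C : ℂ → M2} (hB : IsPSL2Strip ε B) (hC : IsPSL2Strip ε C) :
    IsPSL2Strip ε (fun z => B z * C z) := by
  obtain ⟨hB1, ⟨s, hs, hBs⟩, hB3, hB4⟩ := hB
  obtain ⟨hC1, ⟨t, ht, hCt⟩, hC3, hC4⟩ := hC
  refine ⟨hB1.matrix_mul hC1, ⟨s * t, ?_, fun z => ?_⟩, fun x i j => ?_, fun z hz => ?_⟩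
  · rcases hs with rfl | rfl <;> rcases ht with rfl | rfl <;> simp
  · show B (z + 1) * C (z + 1) = _
    rw [hBs, hCt, Matrix.smul_mul, Matrix.mul_smul, smul_smul]
  · simp only [Matrix.mul_apply, Fin.sum_univ_two, Complex.add_im, Complex.mul_im, hB3, hC3]
    ring
  · rw [Matrix.det_mul, hB4 z hz, hC4 z hz, one_mul]

lemma ApproxRed.of_conj {α ε : ℝ} {A C B₀ : ℂ → M2} (hB₀ : IsPSL2Strip ε B₀)
    (hC : ∀ z ∈ Strip ε, B₀ (z + (α : ℂ)) * A z * (B₀ z)⁻¹ = C z) (h : ApproxRed α ε C) :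
    ApproxRed α ε A := by
  obtain ⟨K, hK⟩ := h
  refine ⟨K, fun δ hδ => ?_⟩
  obtain ⟨B, hB, c, hc, hBc⟩ := hK δ hδ
  refine ⟨_, hB.mul hB₀, c, hc, fun z hz => ?_⟩
  have := hBc z hz
  rw [← hC z hz] at this
  convert this using 3
  rw [Matrix.mul_inv_rev]
  simp only [mul_assoc]

lemma exists_isPSL2Strip_of_local {ε : ℝ} {B : ℂ → M2} (hd : DifferentiableOn ℂ B (Strip ε))
    (hper : ∃ s : ℂ, (s = 1 ∨ s = -1) ∧ ∀ z ∈ Strip ε, B (z + 1) = s • B z)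
    (hreal : ∀ x : ℝ, ∀ i j, (B (x : ℝ) i j).im = 0) (hdet : ∀ z ∈ Strip ε, (B z).det = 1) :
    ∃ B' : ℂ → M2, IsPSL2Strip ε B' ∧ ∀ z ∈ Strip ε, B' z = B z := by
  classical
  have heq : ∀ z ∈ Strip ε, (fun z => if z ∈ Strip ε then B z else 0) z = B z := fun z hz => by
    simp [hz]
  refine ⟨fun z => if z ∈ Strip ε then B z else 0, ⟨hd.congr heq, ?_, ?_, ?_⟩, heq⟩
  · obtain ⟨s, hs, hBs⟩ := hper
    refine ⟨s, hs, fun z => ?_⟩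
    by_cases hz : z ∈ Strip ε
    · simp only [Strip.add_one, hz, if_true, hBs z hz]
    · simp only [Strip.add_one, hz, if_false, smul_zero]
  · intro x i j
    by_cases hx : (x : ℂ) ∈ Strip ε
    · simpa only [hx, if_true] using hreal x i j
    · simp only [hx, if_false, Matrix.zero_apply, Complex.zero_im]
  · intro z hz
    simp only [hz, if_true, hdet z hz]

lemma ApproxRed.of_local {α ε : ℝ} {A : ℂ → M2} (K : ℝ)
    (h : ∀ δ : ℝ, 0 < δ → ∃ B : ℂ → M2, DifferentiableOn ℂ B (Strip ε) ∧
      (∃ s : ℂ, (s = 1 ∨ s = -1) ∧ ∀ z ∈ Strip ε, B (z + 1) = s • B z) ∧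
      (∀ x : ℝ, ∀ i j, (B (x : ℝ) i j).im = 0) ∧ (∀ z ∈ Strip ε, (B z).det = 1) ∧
      ∃ c : M2, ‖c‖ ≤ K ∧ ∀ z ∈ Strip ε, ‖B (z + (α : ℂ)) * A z * (B z)⁻¹ - c‖ ≤ δ) :
    ApproxRed α ε A := by
  refine ⟨K, fun δ hδ => ?_⟩
  obtain ⟨B, h1, h2, h3, h4, c, hc, hBc⟩ := h δ hδ
  obtain ⟨B', hB', heq⟩ := exists_isPSL2Strip_of_local h1 h2 h3 h4
  refine ⟨B', hB', c, hc, fun z hz => ?_⟩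
  rw [heq z hz, heq _ ((Strip.add_real α).2 hz)]
  exact hBc z hz

lemma exists_norm_eq_coord (v : V2) : ∃ i o : Fin 2, i ≠ o ∧ ‖v i‖ = ‖v‖ ∧ ‖v o‖ ≤ ‖v i‖ := by
  have key : ∀ i o : Fin 2, i ≠ o → ‖v o‖ ≤ ‖v i‖ → ‖v i‖ = ‖v‖ := by
    intro i o hio h
    refine le_antisymm (norm_le_pi_norm v i) ?_
    rw [pi_norm_le_iff_of_nonneg (norm_nonneg _)]
    intro j
    have : j = i ∨ j = o := by omega
    rcases this with rfl | rfl
    · exact le_rfl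
    · exact h
  rcases le_total ‖v 0‖ ‖v 1‖ with h | h
  · exact ⟨1, 0, by decide, key 1 0 (by decide) h, h⟩
  · exact ⟨0, 1, by decide, key 0 1 (by decide) h, h⟩

lemma norm_wedge_eq {i o : Fin 2} (hio : i ≠ o) (a b : V2) :
    ‖wedge a b‖ = ‖a i * b o - a o * b i‖ := by
  have : (i = 0 ∧ o = 1) ∨ (i = 1 ∧ o = 0) := by omega
  rcases this with ⟨rfl, rfl⟩ | ⟨rfl, rfl⟩
  · rfl
  · rw [wedge, norm_sub_rev]

lemma norm_le_of_coord {i o : Fin 2} (hio : i ≠ o) {a : V2} {C : ℝ} (hi : ‖a i‖ ≤ C)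
    (ho : ‖a o‖ ≤ C) : ‖a‖ ≤ C := by
  rw [pi_norm_le_iff_of_nonneg ((norm_nonneg _).trans hi)]
  intro j
  have : j = i ∨ j = o := by omega
  rcases this with rfl | rfl
  · exact hi
  · exact ho

/-- Cone invariance: expansion at one step forces expansion at the next step. -/
lemma cone_step {M N : M2} {θ : ℝ} (hθ : 0 < θ) (hM : M.det = 1)
    (hNM : θ * ‖N‖ * ‖M‖ ≤ ‖N * M‖) (hbig : 100 ≤ θ * ‖M‖) {v : V2}
    (hv : θ / 8 * ‖M‖ * ‖v‖ ≤ ‖M.mulVec v‖) :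
    θ / 4 * ‖N‖ * ‖M.mulVec v‖ ≤ ‖N.mulVec (M.mulVec v)‖ := by
  have hMpos : 0 < ‖M‖ := by
    by_contra h
    have : ‖M‖ = 0 := le_antisymm (not_lt.1 h) (norm_nonneg _)
    rw [this] at hbig; linarith
  set a := M.mulVec v with ha
  by_cases ha0 : ‖a‖ = 0
  · rw [ha0, mul_zero]; exact norm_nonneg _
  have hapos : 0 < ‖a‖ := lt_of_le_of_ne (norm_nonneg _) (Ne.symm ha0)
  obtain ⟨e, he1, he2⟩ := M2.exists_mulVec_norm_eq (N * M)
  set b := M.mulVec e with hb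
  have hbn : ‖b‖ ≤ 2 * ‖M‖ := by
    have := M2.norm_mulVec_le M e
    rwa [he1, mul_one] at this
  have hNb : θ * ‖N‖ * ‖M‖ ≤ ‖N.mulVec b‖ := by
    rw [hb, Matrix.mulVec_mulVec, he2]; exact hNM
  have hw : ‖wedge a b‖ ≤ 2 * ‖v‖ := by
    rw [ha, hb, wedge_mulVec, hM, one_mul]
    have := norm_wedge_le v e
    rwa [he1, mul_one] at this
  obtain ⟨i, o, hio, hai, -⟩ := exists_norm_eq_coord a
  have hai0 : a i ≠ 0 := by
    intro h; rw [h, norm_zero] at hai; exact ha0 hai.symm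
  set t : ℂ := b i / a i with ht
  set b' : V2 := b - t • a with hb'
  have hb'i : b' i = 0 := by
    simp only [hb', ht, Pi.sub_apply, Pi.smul_apply, smul_eq_mul]
    field_simp; ring
  have hb'o : ‖b' o‖ * ‖a‖ ≤ 2 * ‖v‖ := by
    rw [← hai, ← norm_mul]
    refine le_trans (le_of_eq ?_) hw
    rw [norm_wedge_eq hio]
    congr 1
    simp only [hb', ht, Pi.sub_apply, Pi.smul_apply, smul_eq_mul]
    field_simp
  have hb'n : ‖b'‖ ≤ ‖b' o‖ :=
      norm_le_of_coord hio (by rw [hb'i, norm_zero]; exact norm_nonneg _) le_rfl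
  have htn : ‖t‖ * ‖a‖ ≤ 2 * ‖M‖ := by
    rw [← hai, ← norm_mul, ht, div_mul_cancel₀ _ hai0]
    exact (norm_le_pi_norm b i).trans hbn
  have hsplit : N.mulVec b = t • N.mulVec a + N.mulVec b' := by
    rw [hb', Matrix.mulVec_sub, Matrix.mulVec_smul]; abel
  have h1 : ‖N.mulVec b‖ ≤ ‖t‖ * ‖N.mulVec a‖ + 2 * ‖N‖ * ‖b'‖ := by
    rw [hsplit]
    refine (norm_add_le _ _).trans ?_
    rw [norm_smul]
    gcongr
    exact M2.norm_mulVec_le _ _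
  set m := ‖M‖
  set p := ‖N.mulVec a‖
  have hp : 0 ≤ p := norm_nonneg _
  have hN : 0 ≤ ‖N‖ := norm_nonneg _
  have hb'1 : ‖b'‖ * ‖a‖ ≤ 2 * ‖v‖ := le_trans (by gcongr) hb'o
  have hb'2 : θ * m * ‖b'‖ ≤ 16 := by
    have h3 : θ * m * ‖b'‖ * ‖a‖ ≤ 16 * ‖a‖ := by
      calc θ * m * ‖b'‖ * ‖a‖ = θ * m * (‖b'‖ * ‖a‖) := by ring
        _ ≤ θ * m * (2 * ‖v‖) := by gcongr
        _ = 16 * (θ / 8 * m * ‖v‖) := by ring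
        _ ≤ 16 * ‖a‖ := by gcongr
    exact le_of_mul_le_mul_right h3 hapos
  have hb'3 : 2 * ‖b'‖ ≤ θ * m / 2 := by
    have h5 : 100 * ‖b'‖ ≤ θ * m * ‖b'‖ := by gcongr
    nlinarith
  have h6 : θ * ‖N‖ * m ≤ ‖t‖ * p + ‖N‖ * (θ * m / 2) := by
    refine hNb.trans (h1.trans ?_)
    have : 2 * ‖N‖ * ‖b'‖ = ‖N‖ * (2 * ‖b'‖) := by ring
    rw [this]
    gcongr
  have h7 : θ / 2 * ‖N‖ * m * ‖a‖ ≤ 2 * m * p := by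
    calc θ / 2 * ‖N‖ * m * ‖a‖ ≤ (‖t‖ * p) * ‖a‖ := by
          refine mul_le_mul_of_nonneg_right ?_ hapos.le
          linarith
      _ = (‖t‖ * ‖a‖) * p := by ring
      _ ≤ 2 * m * p := by gcongr
  have h8 : m * (θ / 4 * ‖N‖ * ‖a‖) ≤ m * p := by linarith
  exact le_of_mul_le_mul_left h8 hMpos

/-- The product `S 0 * S 1 * ⋯ * S (l - 1)`. -/
def lprod : ℕ → (ℕ → M2) → M2
  | 0, _ => 1
  | l + 1, S => S 0 * lprod l (fun j => S (j + 1))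

lemma lprod_add (k l : ℕ) (S : ℕ → M2) :
    lprod (k + l) S = lprod k S * lprod l (fun j => S (k + j)) := by
  induction k generalizing S with
  | zero => simp [lprod]
  | succ k ih =>
    rw [show k + 1 + l = (k + l) + 1 by ring]
    simp only [lprod]
    rw [ih, mul_assoc]
    congr 4
    ext1 j; congr 1; ring

lemma lprod_det (k : ℕ) (S : ℕ → M2) (hS : ∀ j, (S j).det = 1) : (lprod k S).det = 1 := by
  induction k generalizing S with
  | zero => simp [lprod]
  | succ k ih =>
    simp only [lprod]
    rw [Matrix.det_mul, hS, ih _ (fun _ => hS _), one_mul]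

/-- Avalanche-type hypotheses on a sequence of matrices. -/
structure Avalanche (θ : ℝ) (S : ℕ → M2) : Prop where
  pos : 0 < θ
  le_one : θ ≤ 1
  det : ∀ j, (S j).det = 1
  angle : ∀ j, θ * ‖S j‖ * ‖S (j + 1)‖ ≤ ‖S j * S (j + 1)‖
  big : ∀ j, 100 ≤ θ * ‖S j‖

lemma Avalanche.shift {θ : ℝ} {S : ℕ → M2} (h : Avalanche θ S) (m : ℕ) :
    Avalanche θ (fun j => S (m + j)) :=
  ⟨h.pos, h.le_one, fun _ => h.det _, fun j => h.angle (m + j), fun _ => h.big _⟩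

lemma Avalanche.cone {θ : ℝ} {S : ℕ → M2} (h : Avalanche θ S) (l : ℕ) {e : V2}
    (he : 1 / 2 * ‖S l‖ * ‖e‖ ≤ ‖(S l).mulVec e‖) :
    θ / 8 * ‖S 0‖ * ‖(lprod l (fun j => S (j + 1))).mulVec e‖
      ≤ ‖(lprod (l + 1) S).mulVec e‖ := by
  induction l generalizing S with
  | zero =>
    simp only [lprod, Matrix.one_mulVec, mul_one]
    refine le_trans ?_ he
    have := h.le_one
    gcongr
    linarith
  | succ l ih =>
    have h' : Avalanche θ (fun j => S (j + 1)) := by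
      simpa only [add_comm] using h.shift 1
    have h1 := ih h' he
    have h2 : lprod (l + 1 + 1) S = S 0 * lprod (l + 1) (fun j => S (j + 1)) := rfl
    have h3 : lprod (l + 1) (fun j => S (j + 1)) = S 1 * lprod l (fun j => S (j + 1 + 1)) := rfl
    rw [h2, ← Matrix.mulVec_mulVec]
    rw [h3, ← Matrix.mulVec_mulVec] at h1 ⊢
    refine le_trans ?_ (cone_step h.pos (h.det 1) (h.angle 0) (h.big 1) h1)
    have := h.pos
    gcongr
    linarith

lemma Avalanche.expand {θ : ℝ} {S : ℕ → M2} (h : Avalanche θ S) (m k : ℕ) {e : V2}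
    (he : 1 / 2 * ‖S (m + k)‖ * ‖e‖ ≤ ‖(S (m + k)).mulVec e‖) :
    12 ^ (m + 1) * ‖(lprod k (fun j => S (m + 1 + j))).mulVec e‖
      ≤ ‖(lprod (m + 1 + k) S).mulVec e‖ := by
  induction m generalizing k S with
  | zero =>
    have := h.cone k (e := e) (by simpa using he)
    have hb := h.big 0
    rw [show (0 + 1 + k : ℕ) = k + 1 by ring]
    refine le_trans ?_ this
    simp only [zero_add, pow_one, add_comm 1]
    gcongr
    linarith
  | succ m ih =>
    have h' : Avalanche θ (fun j => S (j + 1)) := by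
      simpa only [add_comm] using h.shift 1
    have h1 := ih h' k (by simpa only [show m + k + 1 = m + 1 + k by ring] using he)
    have h2 := h.cone (m + 1 + k) he
    have hb := h.big 0
    rw [show (m + 1 + 1 + k : ℕ) = m + 1 + k + 1 by ring]
    refine le_trans ?_ h2
    have e1 : (fun j => S (m + 1 + 1 + j)) = fun j => S (m + 1 + j + 1) := by
      ext1 j; congr 1; ring
    rw [e1, pow_succ, mul_comm _ (12 : ℝ), mul_assoc]
    have h12 : (12 : ℝ) ≤ θ / 8 * ‖S 0‖ := by linarith
    exact mul_le_mul h12 h1 (by positivity) (by linarith)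

section Limit

variable {θ : ℝ} {S : ℕ → M2} {e : ℕ → V2}

/-- The image of the `k`-th seed vector. -/
def imgSeed (S : ℕ → M2) (e : ℕ → V2) (k : ℕ) : V2 := (lprod (k + 1) S).mulVec (e k)

lemma lprod_succ_right (k : ℕ) (S : ℕ → M2) : lprod (k + 1) S = lprod k S * S k := by
  rw [lprod_add]; simp [lprod]

lemma Avalanche.norm_pos (h : Avalanche θ S) (j : ℕ) : 0 < ‖S j‖ := by
  have h1 := h.big j
  by_contra hc
  have : ‖S j‖ = 0 := le_antisymm (not_lt.1 hc) (norm_nonneg _)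
  rw [this] at h1
  linarith

lemma Avalanche.imgSeed_expand (h : Avalanche θ S)
    (he : ∀ k, ‖e k‖ = 1 ∧ 1 / 2 * ‖S k‖ ≤ ‖(S k).mulVec (e k)‖) (m k : ℕ) :
    12 ^ m * ‖(lprod (k + 1) (fun j => S (m + j))).mulVec (e (m + k))‖ ≤ ‖imgSeed S e (m + k)‖ := by
  cases m with
  | zero => simp [imgSeed]
  | succ m =>
    have := h.expand m (k + 1) (e := e (m + 1 + k)) (by
      have := (he (m + 1 + k)).2
      rw [(he _).1, mul_one, show m + (k + 1) = m + 1 + k by ring]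
      exact this)
    rw [imgSeed, show m + 1 + k + 1 = m + 1 + (k + 1) by ring]
    exact this

lemma Avalanche.imgSeed_ge (h : Avalanche θ S)
    (he : ∀ k, ‖e k‖ = 1 ∧ 1 / 2 * ‖S k‖ ≤ ‖(S k).mulVec (e k)‖) (k : ℕ) :
    12 ^ (k + 1) ≤ ‖imgSeed S e k‖ := by
  have h1 := h.imgSeed_expand he k 0
  simp only [lprod, mul_one, add_zero] at h1
  have h2 := (he k).2
  have h3 := h.big k
  have h4 := h.le_one
  have h5 := h.norm_pos k
  have : (12 : ℝ) ≤ ‖(S k).mulVec (e k)‖ := by nlinarith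
  rw [pow_succ]
  refine le_trans ?_ h1
  gcongr

lemma Avalanche.wedge_imgSeed (h : Avalanche θ S)
    (he : ∀ k, ‖e k‖ = 1 ∧ 1 / 2 * ‖S k‖ ≤ ‖(S k).mulVec (e k)‖) (k : ℕ) :
    ‖wedge (imgSeed S e k) (imgSeed S e (k + 1))‖
      ≤ (1 / 72) * (1 / 144) ^ k * (‖imgSeed S e k‖ * ‖imgSeed S e (k + 1)‖) := by
  have h1 := h.imgSeed_expand he (k + 1) 0
  simp only [lprod, mul_one, add_zero] at h1
  have h2 := h.imgSeed_ge he k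
  set u := (S (k + 1)).mulVec (e (k + 1)) with hu
  have h3 : ‖wedge (imgSeed S e k) (imgSeed S e (k + 1))‖ ≤ 2 * ‖u‖ := by
    have : imgSeed S e (k + 1) = (lprod (k + 1) S).mulVec u := by
      rw [imgSeed, lprod_succ_right, hu, Matrix.mulVec_mulVec]
    rw [this, imgSeed, wedge_mulVec, lprod_det _ _ h.det, one_mul]
    have := norm_wedge_le (e k) u
    rwa [(he k).1, mul_one] at this
  refine h3.trans ?_
  calc 2 * ‖u‖ = (1 / 72) * (1 / 144) ^ k * (12 ^ (k + 1) * (12 ^ (k + 1) * ‖u‖)) := by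
        have : (12 : ℝ) ^ (k + 1) * 12 ^ (k + 1) = 144 ^ k * 144 := by
          rw [← mul_pow, ← pow_succ]; norm_num
        rw [← mul_assoc _ _ ‖u‖, this, one_div_pow]
        field_simp; ring
    _ ≤ _ := by gcongr

lemma Avalanche.slope (h : Avalanche θ S)
    (he : ∀ k, ‖e k‖ = 1 ∧ 1 / 2 * ‖S k‖ ≤ ‖(S k).mulVec (e k)‖) {i o : Fin 2} (hio : i ≠ o)
    (h0 : ‖imgSeed S e 0 o‖ ≤ 3 / 2 * ‖imgSeed S e 0 i‖) (k : ℕ) :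
    ‖imgSeed S e k o‖ ≤ (2 - 1 / 2 * (1 / 4) ^ k) * ‖imgSeed S e k i‖ := by
  have hle : ∀ (v : V2) (t : ℝ), 0 ≤ t → t ≤ 2 → ‖v o‖ ≤ t * ‖v i‖ → ‖v‖ ≤ 2 * ‖v i‖ := by
    intro v t ht0 ht hv
    have := norm_nonneg (v i)
    exact norm_le_of_coord hio (by linarith) (hv.trans (by gcongr))
  induction k with
  | zero => norm_num; exact h0
  | succ k ih =>
    set a := imgSeed S e k with ha
    set b := imgSeed S e (k + 1) with hb
    have hw := h.wedge_imgSeed he k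
    rw [← ha, ← hb, norm_wedge_eq hio] at hw
    set x : ℝ := (1 / 4) ^ k with hx
    set y : ℝ := (1 / 144) ^ k with hy
    have hx0 : 0 < x := by positivity
    have hy0 : 0 < y := by positivity
    have hyx : y ≤ x := by rw [hx, hy]; gcongr; norm_num
    have hx1 : x ≤ 1 := by rw [hx]; exact pow_le_one₀ (by norm_num) (by norm_num)
    have han : ‖a‖ ≤ 2 * ‖a i‖ := hle a _ (by linarith) (by linarith) ih
    have hapos : 0 < ‖a i‖ := by
      have := h.imgSeed_ge he k
      have h12 : (0 : ℝ) < 12 ^ (k + 1) := by positivity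
      rw [← ha] at this
      linarith
    have hbn : ‖b‖ ≤ ‖b i‖ + ‖b o‖ := by
      refine norm_le_of_coord hio ?_ ?_ <;> linarith [norm_nonneg (b i), norm_nonneg (b o)]
    have h1 : ‖a i‖ * ‖b o‖ ≤ ‖a o‖ * ‖b i‖ + (1 / 72) * y * (‖a‖ * ‖b‖) := by
      rw [← norm_mul, ← norm_mul]
      have : a i * b o = a o * b i + (a i * b o - a o * b i) := by ring
      rw [this]
      exact (norm_add_le _ _).trans (by gcongr)
    have h2 : ‖a i‖ * ‖b o‖ ≤
        ‖a i‖ * ((2 - 1 / 2 * x) * ‖b i‖ + (1 / 36) * y * (‖b i‖ + ‖b o‖)) := by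
      refine h1.trans ?_
      calc ‖a o‖ * ‖b i‖ + (1 / 72) * y * (‖a‖ * ‖b‖)
          ≤ ((2 - 1 / 2 * x) * ‖a i‖) * ‖b i‖
              + (1 / 72) * y * (2 * ‖a i‖ * (‖b i‖ + ‖b o‖)) := by gcongr
        _ = _ := by ring
    have h3 := le_of_mul_le_mul_left h2 hapos
    have h4 : (1 / 4 : ℝ) ^ (k + 1) = x / 4 := by rw [pow_succ]; ring
    rw [h4]
    have hbi := norm_nonneg (b i)
    have hbo := norm_nonneg (b o)
    have h5 : (1 - x / 36) * ‖b o‖ ≤ (2 - x / 2 + x / 36) * ‖b i‖ := by nlinarith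
    have h6 : (2 - x / 2 + x / 36) ≤ (1 - x / 36) * (2 - 1 / 2 * (x / 4)) := by nlinarith
    have h7 : (1 - x / 36) * ‖b o‖ ≤ (1 - x / 36) * ((2 - 1 / 2 * (x / 4)) * ‖b i‖) := by
      refine h5.trans ?_
      rw [← mul_assoc]; gcongr
    exact le_of_mul_le_mul_left h7 (by linarith)

lemma Avalanche.imgSeed_coord (h : Avalanche θ S)
    (he : ∀ k, ‖e k‖ = 1 ∧ 1 / 2 * ‖S k‖ ≤ ‖(S k).mulVec (e k)‖) {i o : Fin 2} (hio : i ≠ o)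
    (h0 : ‖imgSeed S e 0 o‖ ≤ 3 / 2 * ‖imgSeed S e 0 i‖) (k : ℕ) :
    ‖imgSeed S e k‖ ≤ 2 * ‖imgSeed S e k i‖ ∧ imgSeed S e k i ≠ 0 := by
  have h1 := h.slope he hio h0 k
  have h2 := norm_nonneg (imgSeed S e k i)
  have h3 : (0 : ℝ) < (1 / 4) ^ k := by positivity
  have h4 : ‖imgSeed S e k‖ ≤ 2 * ‖imgSeed S e k i‖ :=
    norm_le_of_coord hio (by linarith) (h1.trans (by gcongr; linarith))
  refine ⟨h4, fun h5 => ?_⟩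
  rw [h5, norm_zero, mul_zero] at h4
  have := h.imgSeed_ge he k
  have h12 : (0 : ℝ) < 12 ^ (k + 1) := by positivity
  linarith

lemma Avalanche.normalized_sub (h : Avalanche θ S)
    (he : ∀ k, ‖e k‖ = 1 ∧ 1 / 2 * ‖S k‖ ≤ ‖(S k).mulVec (e k)‖) {i o : Fin 2} (hio : i ≠ o)
    (h0 : ‖imgSeed S e 0 o‖ ≤ 3 / 2 * ‖imgSeed S e 0 i‖) (k : ℕ) :
    ‖(imgSeed S e k i)⁻¹ • imgSeed S e k - (imgSeed S e (k + 1) i)⁻¹ • imgSeed S e (k + 1)‖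
      ≤ (1 / 2) ^ k := by
  obtain ⟨ha, ha0⟩ := h.imgSeed_coord he hio h0 k
  obtain ⟨hb, hb0⟩ := h.imgSeed_coord he hio h0 (k + 1)
  have hw := h.wedge_imgSeed he k
  rw [norm_wedge_eq hio] at hw
  set a := imgSeed S e k
  set b := imgSeed S e (k + 1)
  refine norm_le_of_coord hio ?_ ?_
  · simp [ha0, hb0]
  · have e1 : ((a i)⁻¹ • a - (b i)⁻¹ • b) o = -((a i * b o - a o * b i) / (a i * b i)) := by
      simp only [Pi.sub_apply, Pi.smul_apply, smul_eq_mul]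
      field_simp; ring
    have hai : 0 < ‖a i‖ := norm_pos_iff.2 ha0
    have hbi : 0 < ‖b i‖ := norm_pos_iff.2 hb0
    rw [e1, norm_neg, norm_div, norm_mul, div_le_iff₀ (by positivity)]
    refine hw.trans ?_
    calc (1 / 72) * (1 / 144) ^ k * (‖a‖ * ‖b‖)
        ≤ (1 / 72) * (1 / 2) ^ k * ((2 * ‖a i‖) * (2 * ‖b i‖)) := by
          gcongr; norm_num
      _ ≤ (1 / 2) ^ k * (‖a i‖ * ‖b i‖) := by
          have : 0 ≤ (1 / 2 : ℝ) ^ k * (‖a i‖ * ‖b i‖) := by positivity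
          linarith

lemma Avalanche.preimage (h : Avalanche θ S)
    (he : ∀ k, ‖e k‖ = 1 ∧ 1 / 2 * ‖S k‖ ≤ ‖(S k).mulVec (e k)‖) {i o : Fin 2} (hio : i ≠ o)
    (h0 : ‖imgSeed S e 0 o‖ ≤ 3 / 2 * ‖imgSeed S e 0 i‖) {v : V2}
    (hv : Tendsto (fun k => (imgSeed S e k i)⁻¹ • imgSeed S e k) atTop (nhds v)) (m : ℕ) :
    ∃ x : V2, (lprod m S).mulVec x = v ∧ ‖x‖ ≤ 2 * (1 / 12) ^ m := by
  have hdet := lprod_det m S h.det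
  have hu : IsUnit (lprod m S).det := by simp [hdet]
  refine ⟨(lprod m S)⁻¹.mulVec v, ?_, ?_⟩
  · rw [Matrix.mulVec_mulVec, Matrix.mul_nonsing_inv _ hu, Matrix.one_mulVec]
  · have hc : Continuous (fun v : V2 => (lprod m S)⁻¹.mulVec v) := by
      fun_prop
    have hlim := ((hc.tendsto v).comp hv).norm
    refine le_of_tendsto hlim (eventually_atTop.2 ⟨m, fun k hk => ?_⟩)
    obtain ⟨l, rfl⟩ := Nat.exists_eq_add_of_le hk
    have h1 := h.imgSeed_expand he m l
    obtain ⟨h2, h3⟩ := h.imgSeed_coord he hio h0 (m + l)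
    have e1 : imgSeed S e (m + l)
        = (lprod m S).mulVec ((lprod (l + 1) (fun j => S (m + j))).mulVec (e (m + l))) := by
      rw [imgSeed, add_assoc, lprod_add, Matrix.mulVec_mulVec]
    set q := (lprod (l + 1) (fun j => S (m + j))).mulVec (e (m + l))
    simp only [Function.comp]
    rw [Matrix.mulVec_smul, norm_smul, norm_inv]
    have e2 : (lprod m S)⁻¹.mulVec (imgSeed S e (m + l)) = q := by
      rw [e1, Matrix.mulVec_mulVec, Matrix.nonsing_inv_mul _ hu, Matrix.one_mulVec]
    rw [e2]
    have hpos : 0 < ‖imgSeed S e (m + l) i‖ := norm_pos_iff.2 h3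
    rw [inv_mul_le_iff₀ hpos, one_div_pow]
    have h12 : (0 : ℝ) < 12 ^ m := by positivity
    have : ‖q‖ = 12 ^ m * ‖q‖ * (1 / 12 ^ m) := by field_simp
    rw [this]
    calc 12 ^ m * ‖q‖ * (1 / 12 ^ m) ≤ (2 * ‖imgSeed S e (m + l) i‖) * (1 / 12 ^ m) := by
          exact mul_le_mul_of_nonneg_right (h1.trans h2) (by positivity)
      _ = _ := by ring

end Limit

section Periodic

variable {E : Type*} [NormedAddCommGroup E]

lemma Strip.exists_int_mem_rect {r : ℝ} {z : ℂ} (hz : |z.im| ≤ r) :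
    ∃ k : ℤ, z + (k : ℂ) ∈ Set.Icc (0 : ℝ) 1 ×ℂ Set.Icc (-r) r := by
  refine ⟨-⌊z.re⌋, ?_⟩
  rw [Complex.mem_reProdIm]
  have h1 := Int.floor_le z.re
  have h2 := Int.lt_floor_add_one z.re
  have h3 := abs_le.1 hz
  simp only [Int.cast_neg, Complex.add_re, Complex.neg_re, Complex.intCast_re, Complex.add_im,
    Complex.neg_im, Complex.intCast_im, Set.mem_Icc]
  refine ⟨⟨?_, ?_⟩, ?_, ?_⟩ <;> linarith [h3.1, h3.2]

lemma periodic_int {F : Type*} {f : ℂ → F} (hp : ∀ z, f (z + 1) = f z) (z : ℂ) (k : ℤ) :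
    f (z + (k : ℂ)) = f z := by
  have h : Function.Periodic f 1 := hp
  simpa using (h.int_mul k) z

lemma isCompact_rect (r : ℝ) : IsCompact (Set.Icc (0 : ℝ) 1 ×ℂ Set.Icc (-r) r) :=
  isCompact_Icc.reProdIm isCompact_Icc

lemma rect_subset_strip {r' r : ℝ} (h : r' < r) :
    Set.Icc (0 : ℝ) 1 ×ℂ Set.Icc (-r') r' ⊆ Strip r := by
  intro z hz
  rw [Complex.mem_reProdIm] at hz
  exact (abs_le.2 hz.2).trans_lt h

lemma exists_bound_strip {f : ℂ → E} {r r' : ℝ} (hf : ContinuousOn f (Strip r))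
    (hp : ∀ z, f (z + 1) = f z) (hr : r' < r) : ∃ C, ∀ z, |z.im| ≤ r' → ‖f z‖ ≤ C := by
  obtain ⟨C, hC⟩ := (isCompact_rect r').exists_bound_of_continuousOn
    (hf.mono (rect_subset_strip hr))
  refine ⟨C, fun z hz => ?_⟩
  obtain ⟨k, hk⟩ := Strip.exists_int_mem_rect hz
  rw [← periodic_int hp z k]
  exact hC _ hk

lemma exists_unifcont_strip {f : ℂ → E} {r r' : ℝ} (hf : ContinuousOn f (Strip r))
    (hp : ∀ z, f (z + 1) = f z) (hr : r' < r) {η : ℝ} (hη : 0 < η) :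
    ∃ ρ : ℝ, 0 < ρ ∧ ∀ z w, |z.im| ≤ r' → dist w z < ρ → ‖f w - f z‖ < η := by
  have h1 := (isCompact_rect r').uniformContinuousAt_of_continuousAt f
    (fun z hz => (hf.continuousAt ((Strip.isOpen r).mem_nhds (rect_subset_strip hr hz))))
    (Metric.dist_mem_uniformity hη)
  obtain ⟨ρ, hρ, h2⟩ := Metric.mem_uniformity_dist.1 h1
  refine ⟨ρ, hρ, fun z w hz hw => ?_⟩
  obtain ⟨k, hk⟩ := Strip.exists_int_mem_rect hz
  rw [← periodic_int hp z k, ← periodic_int hp w k, ← dist_eq_norm, dist_comm]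
  have := @h2 (z + k) (w + k) (by rw [dist_add_right, dist_comm]; exact hw) hk
  simpa using this

end Periodic

/-- Uniform avalanche hypotheses for the `n`-th iterate of a cocycle on a strip. -/
structure AP (α r : ℝ) (A : ℂ → M2) (n : ℕ) (θ : ℝ) : Prop where
  pos : 0 < θ
  le_one : θ ≤ 1
  angle : ∀ z ∈ Strip r, θ * ‖cocycleIter α A n (z + (n : ℂ) * (α : ℂ))‖ * ‖cocycleIter α A n z‖
    ≤ ‖cocycleIter α A (n + n) z‖
  big : ∀ z ∈ Strip r, 100 ≤ θ * ‖cocycleIter α A n z‖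

/-- The backward orbit of matrices. -/
def backSeq (α : ℝ) (A : ℂ → M2) (n : ℕ) (z : ℂ) (j : ℕ) : M2 :=
  cocycleIter α A n (z - (((j + 1) * n : ℕ) : ℂ) * (α : ℂ))

lemma lprod_backSeq (α : ℝ) (A : ℂ → M2) (n : ℕ) (z : ℂ) (m : ℕ) :
    lprod m (backSeq α A n z) = cocycleIter α A (m * n) (z - ((m * n : ℕ) : ℂ) * (α : ℂ)) := by
  induction m with
  | zero => simp [lprod, cocycleIter]
  | succ m ih =>
    have e1 : z - (((m + 1) * n : ℕ) : ℂ) * (α : ℂ) + (n : ℂ) * (α : ℂ)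
        = z - ((m * n : ℕ) : ℂ) * (α : ℂ) := by push_cast; ring
    have e2 := cocycleIter_add α A (m * n) n (z - (((m + 1) * n : ℕ) : ℂ) * (α : ℂ))
    rw [e1] at e2
    rw [lprod_succ_right, ih, backSeq, show (m + 1) * n = m * n + n by ring] at *
    exact e2.symm

lemma AP.avalanche {α r : ℝ} {A : ℂ → M2} {n : ℕ} {θ : ℝ} (h : AP α r A n θ) (hA : IsCSL r A)
    {z : ℂ} (hz : z ∈ Strip r) : Avalanche θ (backSeq α A n z) := by
  refine ⟨h.pos, h.le_one, fun j => ?_, fun j => ?_, fun j => ?_⟩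
  · exact (hA.iter α n).2.2 _ ((Strip.sub_nat_mul _ _).2 hz)
  · have h1 := h.angle (z - (((j + 1 + 1) * n : ℕ) : ℂ) * (α : ℂ)) ((Strip.sub_nat_mul _ _).2 hz)
    have e1 : z - (((j + 1 + 1) * n : ℕ) : ℂ) * (α : ℂ) + (n : ℂ) * (α : ℂ)
        = z - (((j + 1) * n : ℕ) : ℂ) * (α : ℂ) := by push_cast; ring
    rw [cocycleIter_add, e1] at h1
    exact h1
  · exact h.big _ ((Strip.sub_nat_mul _ _).2 hz)

/-- The most contracted (in the past) directions of a cocycle. -/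
def lineE (α : ℝ) (A : ℂ → M2) (n : ℕ) (z : ℂ) : Set V2 :=
  {v | ∃ x : ℕ → V2, (∀ k, (cocycleIter α A (k * n) (z - ((k * n : ℕ) : ℂ) * (α : ℂ))).mulVec (x k)
    = v) ∧ Tendsto x atTop (nhds 0)}

lemma lineE.smul {α : ℝ} {A : ℂ → M2} {n : ℕ} {z : ℂ} {v : V2} (hv : v ∈ lineE α A n z) (t : ℂ) :
    t • v ∈ lineE α A n z := by
  obtain ⟨x, hx, hl⟩ := hv
  refine ⟨fun k => t • x k, fun k => ?_, by simpa using hl.const_smul t⟩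
  rw [Matrix.mulVec_smul, hx]

lemma lineE.wedge_eq_zero {α r : ℝ} {A : ℂ → M2} {n : ℕ} {z : ℂ} {v w : V2} (hA : IsCSL r A)
    (hz : z ∈ Strip r) (hv : v ∈ lineE α A n z) (hw : w ∈ lineE α A n z) : wedge v w = 0 := by
  obtain ⟨x, hx, hlx⟩ := hv
  obtain ⟨y, hy, hly⟩ := hw
  have h1 : ∀ k, wedge v w = wedge (x k) (y k) := fun k => by
    have := wedge_mulVec (cocycleIter α A (k * n) (z - ((k * n : ℕ) : ℂ) * (α : ℂ))) (x k) (y k)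
    rwa [hx, hy, (hA.iter α (k * n)).2.2 _ ((Strip.sub_nat_mul _ _).2 hz), one_mul] at this
  have hx' := fun i => (tendsto_pi_nhds.1 hlx) i
  have hy' := fun i => (tendsto_pi_nhds.1 hly) i
  have h2 : Tendsto (fun k => wedge (x k) (y k)) atTop (nhds 0) := by
    have := ((hx' 0).mul (hy' 1)).sub ((hx' 1).mul (hy' 0))
    simpa [wedge] using this
  simp only [← h1] at h2
  exact tendsto_nhds_unique tendsto_const_nhds h2

lemma lineE.add_one {α r : ℝ} {A : ℂ → M2} {n : ℕ} {z : ℂ} (hA : IsCSL r A) :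
    lineE α A n (z + 1) = lineE α A n z := by
  ext v
  simp only [lineE, Set.mem_ofPred_eq]
  have : ∀ k : ℕ, cocycleIter α A (k * n) (z + 1 - ((k * n : ℕ) : ℂ) * (α : ℂ))
      = cocycleIter α A (k * n) (z - ((k * n : ℕ) : ℂ) * (α : ℂ)) := fun k => by
    rw [← (hA.iter α (k * n)).2.1 (z - ((k * n : ℕ) : ℂ) * (α : ℂ))]; congr 1; ring
  simp only [this]

lemma lineE.map {α r : ℝ} {A : ℂ → M2} {n : ℕ} {z : ℂ} {v : V2} (hA : IsCSL r A)
    (hz : z ∈ Strip r) (hv : v ∈ lineE α A n z) :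
    (A z).mulVec v ∈ lineE α A n (z + (α : ℂ)) := by
  obtain ⟨x, hx, hl⟩ := hv
  have hzr : |z.im| < r := hz
  obtain ⟨C, hC⟩ := exists_bound_strip (r' := |z.im|) hA.1.continuousOn hA.2.1 hzr
  refine ⟨fun k => (A (z - ((k * n : ℕ) : ℂ) * (α : ℂ))).mulVec (x k), fun k => ?_, ?_⟩
  · rw [← hx k, Matrix.mulVec_mulVec, Matrix.mulVec_mulVec]
    congr 1
    set w := z - ((k * n : ℕ) : ℂ) * (α : ℂ) with hw
    have h1 : cocycleIter α A (k * n + 1) w = cocycleIter α A (k * n) (w + α) * A w := by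
      have := cocycleIter_add α A (k * n) 1 w
      rw [cocycleIter_one] at this
      rw [this]; simp
    have h2 : cocycleIter α A (k * n + 1) w = A z * cocycleIter α A (k * n) w := by
      simp only [cocycleIter]
      congr 2
      rw [hw]; ring
    have h3 : z + (α : ℂ) - ((k * n : ℕ) : ℂ) * (α : ℂ) = w + α := by rw [hw]; ring
    rw [h3, ← h1, h2]
  · have h0 : Tendsto (fun k => 2 * C * ‖x k‖) atTop (nhds 0) := by
      simpa using hl.norm.const_mul (2 * C)
    refine squeeze_zero_norm (fun k => ?_) h0
    refine (M2.norm_mulVec_le _ _).trans ?_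
    gcongr
    apply hC
    simp

lemma AP.local_section {α r : ℝ} {A : ℂ → M2} {n : ℕ} {θ : ℝ} (h : AP α r A n θ) (hA : IsCSL r A)
    {zc : ℂ} (hzc : zc ∈ Strip r) : ∃ ρ : ℝ, 0 < ρ ∧ Metric.ball zc ρ ⊆ Strip r ∧ ∃ v : ℂ → V2,
      DifferentiableOn ℂ v (Metric.ball zc ρ) ∧
      ∀ z ∈ Metric.ball zc ρ, v z ≠ 0 ∧ v z ∈ lineE α A n z := by
  have hzr : |zc.im| < r := hzc
  have hT := hA.iter α n
  obtain ⟨ρ₁, hρ₁, hu⟩ := exists_unifcont_strip hT.1.continuousOn hT.2.1 hzr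
    (show (0 : ℝ) < 1 / 8 by norm_num)
  obtain ⟨ρ₂, hρ₂, hb⟩ := Metric.isOpen_iff.1 (Strip.isOpen r) zc hzc
  have hbig : ∀ z ∈ Strip r, ∀ j, 100 ≤ ‖backSeq α A n z j‖ := fun z hz j => by
    have h1 := (h.avalanche hA hz).big j
    have h2 := h.le_one
    have h3 := norm_nonneg (backSeq α A n z j)
    nlinarith
  choose e he1 he2 using fun j => M2.exists_mulVec_norm_eq (backSeq α A n zc j)
  have hsub : Metric.ball zc (min ρ₁ ρ₂) ⊆ Strip r :=
    (Metric.ball_subset_ball (min_le_right _ _)).trans hb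
  have hclose : ∀ z ∈ Metric.ball zc (min ρ₁ ρ₂), ∀ j,
      ‖backSeq α A n z j - backSeq α A n zc j‖ < 1 / 8 := fun z hz j => by
    refine hu _ _ (by simp) ?_
    rw [dist_sub_right]
    exact lt_of_lt_of_le hz (min_le_left _ _)
  have hev : ∀ z ∈ Metric.ball zc (min ρ₁ ρ₂), ∀ j,
      ‖(backSeq α A n z j).mulVec (e j) - (backSeq α A n zc j).mulVec (e j)‖ ≤ 1 / 4 := by
    intro z hz j
    rw [← Matrix.sub_mulVec]
    refine (M2.norm_mulVec_le _ _).trans ?_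
    rw [he1]
    linarith [hclose z hz j]
  have he : ∀ z ∈ Metric.ball zc (min ρ₁ ρ₂), ∀ j, ‖e j‖ = 1 ∧
      1 / 2 * ‖backSeq α A n z j‖ ≤ ‖(backSeq α A n z j).mulVec (e j)‖ := by
    intro z hz j
    refine ⟨he1 j, ?_⟩
    have h1 := hev z hz j
    have h2 :=
        norm_sub_norm_le ((backSeq α A n zc j).mulVec (e j)) ((backSeq α A n z j).mulVec (e j))
    rw [norm_sub_rev, he2] at h2
    have h3 := hclose z hz j
    have h4 := norm_sub_norm_le (backSeq α A n z j) (backSeq α A n zc j)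
    have h5 := hbig zc hzc j
    linarith
  obtain ⟨i, o, hio, hi1, hi2⟩ := exists_norm_eq_coord ((backSeq α A n zc 0).mulVec (e 0))
  have h0 : ∀ z ∈ Metric.ball zc (min ρ₁ ρ₂), ‖imgSeed (backSeq α A n z) e 0 o‖
      ≤ 3 / 2 * ‖imgSeed (backSeq α A n z) e 0 i‖ := by
    intro z hz
    simp only [imgSeed, lprod, mul_one]
    have h1 := hev z hz 0
    have h2 := fun j => (norm_le_pi_norm _ j).trans h1
    have h3 := norm_sub_norm_le ((backSeq α A n z 0).mulVec (e 0) o)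
      ((backSeq α A n zc 0).mulVec (e 0) o)
    have h4 := norm_sub_norm_le ((backSeq α A n zc 0).mulVec (e 0) i)
      ((backSeq α A n z 0).mulVec (e 0) i)
    rw [norm_sub_rev] at h4
    have h5 := h2 o
    have h6 := h2 i
    simp only [Pi.sub_apply] at h5 h6
    have h7 := hbig zc hzc 0
    rw [← he2 0, ← hi1] at h7
    linarith
  have hS : ∀ z ∈ Metric.ball zc (min ρ₁ ρ₂), Avalanche θ (backSeq α A n z) := fun z hz =>
    h.avalanche hA (hsub hz)
  set V : ℕ → ℂ → V2 := fun k z =>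
    (imgSeed (backSeq α A n z) e k i)⁻¹ • imgSeed (backSeq α A n z) e k with hV
  have hstep : ∀ z ∈ Metric.ball zc (min ρ₁ ρ₂), ∀ k, dist (V k z) (V (k + 1) z)
      ≤ 1 * (1 / 2) ^ k := by
    intro z hz k
    rw [dist_eq_norm, one_mul]
    exact (hS z hz).normalized_sub (he z hz) hio (h0 z hz) k
  have hex : ∀ z, ∃ l, z ∈ Metric.ball zc (min ρ₁ ρ₂) →
      Tendsto (fun k => V k z) atTop (nhds l) := by
    intro z
    by_cases hz : z ∈ Metric.ball zc (min ρ₁ ρ₂)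
    · obtain ⟨l, hl⟩ := cauchySeq_tendsto_of_complete
        (cauchySeq_of_le_geometric (1 / 2) 1 (by norm_num) (hstep z hz))
      exact ⟨l, fun _ => hl⟩
    · exact ⟨0, fun h => absurd h hz⟩
  choose v hv using hex
  have hcoord : ∀ z ∈ Metric.ball zc (min ρ₁ ρ₂), ∀ k, V k z i = 1 := by
    intro z hz k
    have := ((hS z hz).imgSeed_coord (he z hz) hio (h0 z hz) k).2
    simp [hV, this]
  refine ⟨min ρ₁ ρ₂, lt_min hρ₁ hρ₂, hsub, v, ?_, fun z hz => ⟨?_, ?_⟩⟩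
  · have hd : ∀ k, DifferentiableOn ℂ (V k) (Metric.ball zc (min ρ₁ ρ₂)) := by
      intro k
      have hd1 : DifferentiableOn ℂ (fun z => imgSeed (backSeq α A n z) e k)
          (Metric.ball zc (min ρ₁ ρ₂)) := by
        have h1 := ((hA.iter α ((k + 1) * n)).1.comp_add_real
          (-(((k + 1) * n : ℕ) * α))).mono hsub
        have h2 := h1.matrix_mulVec (g := fun _ => e k) (differentiableOn_const _)
        refine h2.congr fun z _ => ?_
        rw [imgSeed, lprod_backSeq]
        congr 2
        push_cast; ring
      have hd2 : DifferentiableOn ℂ (fun z => imgSeed (backSeq α A n z) e k i)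
          (Metric.ball zc (min ρ₁ ρ₂)) := differentiableOn_pi.1 hd1 i
      exact (hd2.inv fun z hz => ((hS z hz).imgSeed_coord (he z hz) hio (h0 z hz) k).2).smul hd1
    have hunif : TendstoUniformlyOn V v atTop (Metric.ball zc (min ρ₁ ρ₂)) := by
      rw [Metric.tendstoUniformlyOn_iff]
      intro ε hε
      have hlim : Tendsto (fun k : ℕ => (1 : ℝ) * (1 / 2) ^ k / (1 - 1 / 2)) atTop (nhds 0) := by
        have := tendsto_pow_atTop_nhds_zero_of_lt_one (r := (1 / 2 : ℝ)) (by norm_num) (by norm_num)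
        simpa using (this.const_mul 1).div_const (1 - 1 / 2)
      filter_upwards [hlim.eventually (gt_mem_nhds hε)] with k hk z hz
      rw [dist_comm]
      exact (dist_le_of_le_geometric_of_tendsto (1 / 2) 1 (by norm_num) (hstep z hz) (hv z hz)
          k).trans_lt hk
    exact hunif.tendstoLocallyUniformlyOn.differentiableOn (Eventually.of_forall hd)
      Metric.isOpen_ball
  · intro hz0
    have h1 : Tendsto (fun k => V k z i) atTop (nhds (v z i)) := (tendsto_pi_nhds.1 (hv z hz)) i
    simp only [hcoord z hz, hz0, Pi.zero_apply] at h1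
    exact one_ne_zero (tendsto_nhds_unique tendsto_const_nhds h1)
  · choose x hx1 hx2 using fun m => (hS z hz).preimage (he z hz) hio (h0 z hz) (hv z hz) m
    refine ⟨x, fun k => by rw [← lprod_backSeq, hx1], ?_⟩
    refine squeeze_zero_norm hx2 ?_
    have := tendsto_pow_atTop_nhds_zero_of_lt_one (r := (1 / 12 : ℝ)) (by norm_num) (by norm_num)
    simpa using this.const_mul 2

/-- The bilinear pairing of a covector with a vector. -/
def pair (c v : V2) : ℂ := c 0 * v 0 + c 1 * v 1

lemma pair_smul (c v : V2) (t : ℂ) : pair c (t • v) = t * pair c v := by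
  simp only [pair, Pi.smul_apply, smul_eq_mul]; ring

lemma eq_pair_smul_of_wedge {c v w : V2} (h : wedge v w = 0) (hv : pair c v = 1) :
    w = pair c w • v := by
  simp only [wedge, pair] at *
  ext i
  simp only [Pi.smul_apply, smul_eq_mul]
  fin_cases i
  · simp only [Fin.zero_eta, Fin.isValue]
    linear_combination (-w 0) * hv - c 1 * h
  · simp only [Fin.mk_one, Fin.isValue]
    linear_combination (-w 1) * hv + c 0 * h

/-- A normalised holomorphic invariant line field over a strip. -/
structure InvSection (α r : ℝ) (A : ℂ → M2) (c : V2) (u : ℂ → V2) (lam : ℂ → ℂ) : Prop where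
  diff : DifferentiableOn ℂ u (Strip r)
  diff' : DifferentiableOn ℂ lam (Strip r)
  per : ∀ z ∈ Strip r, u (z + 1) = u z
  per' : ∀ z ∈ Strip r, lam (z + 1) = lam z
  norm : ∀ z ∈ Strip r, pair c (u z) = 1
  inv : ∀ z ∈ Strip r, (A z).mulVec (u z) = lam z • u (z + (α : ℂ))
  ne : ∀ z ∈ Strip r, lam z ≠ 0

lemma AP.invSection {α r : ℝ} {A : ℂ → M2} {n : ℕ} {θ : ℝ} (h : AP α r A n θ) (hA : IsCSL r A)
    (hr : 0 < r) (c : V2) (hc : ∀ x : ℝ, ∀ v ∈ lineE α A n x, v ≠ 0 → pair c v ≠ 0) :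
    ∃ r' : ℝ, 0 < r' ∧ r' ≤ r ∧ ∃ u lam, InvSection α r' A c u lam ∧
      ∀ z ∈ Strip r', u z ∈ lineE α A n z := by
  have hreal : ∀ x : ℝ, (x : ℂ) ∈ Strip r := fun x => by simpa [Strip] using hr
  have hloc : ∀ x : ℝ, ∃ ρ : ℝ, 0 < ρ ∧ Metric.ball (x : ℂ) ρ ⊆ Strip r ∧ ∃ v : ℂ → V2,
      DifferentiableOn ℂ v (Metric.ball (x : ℂ) ρ) ∧
      ∀ z ∈ Metric.ball (x : ℂ) ρ, v z ∈ lineE α A n z ∧ pair c (v z) = 1 := by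
    intro x
    obtain ⟨ρ, hρ, hb, v, hv, hvE⟩ := h.local_section hA (hreal x)
    have hx : (x : ℂ) ∈ Metric.ball (x : ℂ) ρ := Metric.mem_ball_self hρ
    have hcv : DifferentiableOn ℂ (fun z => pair c (v z)) (Metric.ball (x : ℂ) ρ) := by
      have hv' := differentiableOn_pi.1 hv
      exact ((hv' 0).const_mul _).add ((hv' 1).const_mul _)
    have h0 : pair c (v x) ≠ 0 := hc x _ (hvE _ hx).2 (hvE _ hx).1
    have hcont : ContinuousAt (fun z => pair c (v z)) x :=
      (hcv.continuousOn).continuousAt (Metric.isOpen_ball.mem_nhds hx)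
    obtain ⟨ρ', hρ', hb'⟩ := Metric.eventually_nhds_iff_ball.1 (hcont.eventually_ne h0)
    have hs1 : Metric.ball (x : ℂ) (min ρ ρ') ⊆ Metric.ball (x : ℂ) ρ :=
      Metric.ball_subset_ball (min_le_left _ _)
    have hs2 : Metric.ball (x : ℂ) (min ρ ρ') ⊆ Metric.ball (x : ℂ) ρ' :=
      Metric.ball_subset_ball (min_le_right _ _)
    refine ⟨min ρ ρ', lt_min hρ hρ', hs1.trans hb, fun z => (pair c (v z))⁻¹ • v z, ?_, ?_⟩
    · exact ((hcv.mono hs1).inv fun z hz => hb' z (hs2 hz)).smul (hv.mono hs1)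
    · intro z hz
      refine ⟨lineE.smul (hvE z (hs1 hz)).2 _, ?_⟩
      rw [pair_smul, inv_mul_cancel₀ (hb' z (hs2 hz))]
  choose ρ hρ hball v hv hvE using hloc
  have hK : IsCompact ((fun x : ℝ => (x : ℂ)) '' Set.Icc 0 1) :=
    isCompact_Icc.image Complex.continuous_ofReal
  obtain ⟨δ, hδ, hleb⟩ :=
      lebesgue_number_lemma_of_metric (c := fun x : ℝ => Metric.ball (x : ℂ) (ρ x))
    hK (fun x => Metric.isOpen_ball) (by
      rintro _ ⟨x, -, rfl⟩
      exact Set.mem_iUnion.2 ⟨x, Metric.mem_ball_self (hρ x)⟩)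
  set r' := min δ r with hr'
  have hr'r : r' ≤ r := min_le_right _ _
  have hloc' : ∀ z ∈ Strip r', ∃ (x : ℝ) (k : ℤ), z + (k : ℂ) ∈ Metric.ball (x : ℂ) (ρ x) := by
    intro z hz
    obtain ⟨k, hk⟩ := Strip.exists_int_mem_rect (le_of_lt hz)
    rw [Complex.mem_reProdIm] at hk
    obtain ⟨x, hx⟩ := hleb _ ⟨(z + (k : ℂ)).re, hk.1, rfl⟩
    refine ⟨x, k, hx ?_⟩
    have e1 : z + (k : ℂ) - ((z + (k : ℂ)).re : ℂ) = (z.im : ℂ) * Complex.I := by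
      apply Complex.ext <;> simp
    rw [Metric.mem_ball, dist_eq_norm, e1]
    simp only [norm_mul, Complex.norm_I, mul_one, Complex.norm_real, Real.norm_eq_abs]
    exact lt_of_lt_of_le hz (min_le_left _ _)
  have hEper : ∀ (z : ℂ) (k : ℤ), lineE α A n (z + (k : ℂ)) = lineE α A n z :=
    periodic_int (fun z => lineE.add_one hA)
  have hex : ∀ z, ∃ w, z ∈ Strip r' → w ∈ lineE α A n z ∧ pair c w = 1 := by
    intro z
    by_cases hz : z ∈ Strip r'
    · obtain ⟨x, k, hx⟩ := hloc' z hz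
      refine ⟨v x (z + k), fun _ => ?_⟩
      have := hvE x _ hx
      rwa [hEper] at this
    · exact ⟨0, fun h => absurd h hz⟩
  choose u hu using hex
  have huniq : ∀ z ∈ Strip r', ∀ w ∈ lineE α A n z, w = pair c w • u z := fun z hz w hw =>
    eq_pair_smul_of_wedge (lineE.wedge_eq_zero hA (Strip.mono hr'r hz) (hu z hz).1 hw) (hu z hz).2
  have hudiff : DifferentiableOn ℂ u (Strip r') := by
    intro z hz
    obtain ⟨x, k, hx⟩ := hloc' z hz
    refine DifferentiableAt.differentiableWithinAt ?_
    have hd : DifferentiableAt ℂ (fun w => v x (w + k)) z :=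
      ((hv x).differentiableAt (Metric.isOpen_ball.mem_nhds hx)).comp z (by fun_prop)
    refine hd.congr_of_eventuallyEq ?_
    have hc1 : ContinuousAt (fun w : ℂ => w + (k : ℂ)) z := by fun_prop
    filter_upwards [(Strip.isOpen r').mem_nhds hz,
      hc1.preimage_mem_nhds (Metric.isOpen_ball.mem_nhds hx)] with w hw hw2
    have h1 := hvE x _ hw2
    rw [hEper] at h1
    have := huniq w hw _ h1.1
    rw [h1.2, one_smul] at this
    exact this.symm
  have hadd : ∀ z ∈ Strip r', z + (α : ℂ) ∈ Strip r' := fun z hz => (Strip.add_real α).2 hz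
  have hper : ∀ z ∈ Strip r', u (z + 1) = u z := by
    intro z hz
    have h1 := hu _ (Strip.add_one.2 hz)
    rw [lineE.add_one hA] at h1
    have := huniq z hz _ h1.1
    rwa [h1.2, one_smul] at this
  have hAu : ∀ z ∈ Strip r', (A z).mulVec (u z) = pair c ((A z).mulVec (u z)) • u (z + (α : ℂ)) :=
    fun z hz => huniq _ (hadd z hz) _ (lineE.map hA (Strip.mono hr'r hz) (hu z hz).1)
  refine ⟨r', lt_min hδ hr, hr'r, u, fun z => pair c ((A z).mulVec (u z)),
    ⟨hudiff, ?_, hper, ?_, fun z hz => (hu z hz).2, hAu, ?_⟩, fun z hz => (hu z hz).1⟩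
  · have h1 := differentiableOn_pi.1 ((hA.mono hr'r).1.matrix_mulVec hudiff)
    exact ((h1 0).const_mul _).add ((h1 1).const_mul _)
  · intro z hz
    simp only [hper z hz, hA.2.1]
  · intro z hz h0
    have h1 := hAu z hz
    rw [h0, zero_smul] at h1
    have hdet := (hA.mono hr'r).2.2 z hz
    have h2 : u z = 0 := by
      have : (A z)⁻¹.mulVec ((A z).mulVec (u z)) = u z := by
        rw [Matrix.mulVec_mulVec, Matrix.nonsing_inv_mul _ (by simp [hdet]), Matrix.one_mulVec]
      rw [← this, h1, Matrix.mulVec_zero]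
    have h3 := (hu z hz).2
    rw [h2] at h3
    simp [pair] at h3

lemma countable_zeros {f : ℂ → ℂ} {U : Set ℂ} (hf : DifferentiableOn ℂ f U) (hU : IsOpen U)
    (hc : IsConnected U) {x : ℂ} (hx : x ∈ U) (hfx : f x ≠ 0) : {z ∈ U | f z = 0}.Countable := by
  have h1 := (hf.analyticOnNhd hU).preimage_zero_mem_codiscreteWithin hfx hx hc
  have h2 : ((f ⁻¹' {0}) ∩ U).Countable := by
    apply (HereditarilyLindelofSpace.isLindelof _).countable_of_isDiscrete
      (isDiscrete_of_codiscreteWithin _)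
    simpa using h1
  refine h2.mono ?_
  rintro z ⟨hz, h0⟩
  exact ⟨h0, hz⟩

lemma AP.exists_good_line {α r : ℝ} {A : ℂ → M2} {n : ℕ} {θ : ℝ} (h : AP α r A n θ)
    (hA : IsCSL r A) {η : ℝ} (hη : 0 < η) (hηr : η ≤ r) :
    ∃ (t : ℂ) (y : ℝ), 0 < y ∧ y < η ∧ ∀ x : ℝ, ∀ v ∈ lineE α A n (x + y * Complex.I), v ≠ 0 →
      pair ![1, t] v ≠ 0 := by
  have hex : ∀ z, ∃ (ρ : ℝ) (v : ℂ → V2), z ∈ Strip r → 0 < ρ ∧ Metric.ball z ρ ⊆ Strip r ∧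
      DifferentiableOn ℂ v (Metric.ball z ρ) ∧
      ∀ w ∈ Metric.ball z ρ, v w ≠ 0 ∧ v w ∈ lineE α A n w := by
    intro z
    by_cases hz : z ∈ Strip r
    · obtain ⟨ρ, h1, h2, v, h3, h4⟩ := h.local_section hA hz
      exact ⟨ρ, v, fun _ => ⟨h1, h2, h3, h4⟩⟩
    · exact ⟨0, fun _ => 0, fun h => absurd h hz⟩
  choose ρ v hv using hex
  obtain ⟨s, hsub, hs, hcov⟩ := TopologicalSpace.countable_cover_nhdsWithin (s := Strip r)
    (f := fun z => Metric.ball z (ρ z))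
    (fun z hz => nhdsWithin_le_nhds (Metric.ball_mem_nhds z (hv z hz).1))
  have hbad : (⋃ z ∈ s, {t : ℂ | pair ![1, t] (v z z) = 0}).Countable := by
    refine hs.biUnion fun z hz => Set.Subsingleton.countable ?_
    have hz0 := ((hv z (hsub hz)).2.2.2 z (Metric.mem_ball_self (hv z (hsub hz)).1)).1
    intro t ht t' ht'
    simp only [pair, Set.mem_ofPred_eq, Matrix.cons_val_zero, Matrix.cons_val_one,
      one_mul] at ht ht'
    have h1 : (t - t') * v z z 1 = 0 := by linear_combination ht - ht'
    rcases mul_eq_zero.1 h1 with h2 | h2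
    · exact sub_eq_zero.1 h2
    · exfalso
      apply hz0
      rw [h2, mul_zero, add_zero] at ht
      ext i
      fin_cases i
      · exact ht
      · exact h2
  obtain ⟨t, ht⟩ := (hbad.dense_compl ℂ).nonempty
  simp only [Set.mem_compl_iff, Set.mem_iUnion, not_exists, Set.mem_ofPred_eq] at ht
  have hpd : ∀ z ∈ s, DifferentiableOn ℂ (fun w => pair ![1, t] (v z w)) (Metric.ball z (ρ z)) := by
    intro z hz
    have h1 := differentiableOn_pi.1 (hv z (hsub hz)).2.2.1
    exact ((h1 0).const_mul _).add ((h1 1).const_mul _)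
  have hzeros : (⋃ z ∈ s, {w ∈ Metric.ball z (ρ z) | pair ![1, t] (v z w) = 0}).Countable := by
    refine hs.biUnion fun z hz => ?_
    have h1 := (hv z (hsub hz)).1
    refine countable_zeros (hpd z hz) Metric.isOpen_ball ?_ (Metric.mem_ball_self h1) (ht z hz)
    exact ((convex_ball z (ρ z)).isConnected) ⟨z, Metric.mem_ball_self h1⟩
  have him := hzeros.image Complex.im
  obtain ⟨y, hy1, hy2⟩ := (him.dense_compl ℝ).exists_mem_open (isOpen_Ioo (a := 0) (b := η))
    (Set.nonempty_Ioo.2 hη)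
  refine ⟨t, y, hy2.1, hy2.2, fun x w hw hw0 => ?_⟩
  set p : ℂ := x + y * Complex.I with hp
  have hpim : p.im = y := by simp [hp]
  have hpr : p ∈ Strip r := by
    show |p.im| < r
    rw [hpim, abs_of_pos hy2.1]; linarith [hy2.2]
  obtain ⟨z, hz, hpz⟩ := Set.mem_iUnion₂.1 (hcov hpr)
  have h1 : pair ![1, t] (v z p) ≠ 0 := by
    intro h0
    exact hy1 ⟨p, Set.mem_iUnion₂.2 ⟨z, hz, hpz, h0⟩, hpim⟩
  obtain ⟨-, h2⟩ := (hv z (hsub hz)).2.2.2 p hpz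
  have h3 := eq_pair_smul_of_wedge (c := ![1, t])
    (lineE.wedge_eq_zero hA hpr (lineE.smul h2 (pair ![1, t] (v z p))⁻¹) hw)
    (by rw [pair_smul, inv_mul_cancel₀ h1])
  intro h0
  rw [h0, zero_smul] at h3
  exact hw0 h3

lemma exists_holo_log {U : Set ℂ} (hU : IsOpen U) (hc : Convex ℝ U) (hne : U.Nonempty) {f : ℂ → ℂ}
    (hf : DifferentiableOn ℂ f U) (hf0 : ∀ z ∈ U, f z ≠ 0) :
    ∃ G : ℂ → ℂ, DifferentiableOn ℂ G U ∧ ∀ z ∈ U, Complex.exp (G z) = f z := by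
  have hs : IsSimplyConnected U := by
    have := hc.contractibleSpace hne
    exact SimplyConnectedSpace.ofContractible _
  obtain ⟨G, hGc, hG⟩ := Complex.exists_continuousOn_eqOn_exp_comp hs hU hf.continuousOn
    (by rintro ⟨z, hz, h0⟩; exact hf0 z hz h0)
  have hG' : ∀ z ∈ U, Complex.exp (G z) = f z := fun z hz => hG hz
  refine ⟨G, fun z hz => DifferentiableAt.differentiableWithinAt ?_, hG'⟩
  have hUz := hU.mem_nhds hz
  have hd : DifferentiableAt ℂ (fun w => Complex.log (f w / f z) + G z) z := by
    refine DifferentiableAt.add (((hf.differentiableAt hUz).div_const (f z)).clog ?_)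
      (differentiableAt_const (G z))
    rw [div_self (hf0 z hz)]
    exact Complex.one_mem_slitPlane
  refine hd.congr_of_eventuallyEq ?_
  have hcont := (hGc.continuousAt hUz)
  filter_upwards [hUz, hcont (Metric.ball_mem_nhds _ Real.pi_pos)] with w hw hw2
  rw [← hG' w hw, ← hG' z hz, ← Complex.exp_sub, Complex.log_exp]
  · ring
  · have := (Complex.abs_im_le_norm (G w - G z)).trans_lt
      (by simpa [dist_eq_norm] using hw2)
    exact (abs_lt.1 this).1
  · have := (Complex.abs_im_le_norm (G w - G z)).trans_lt
      (by simpa [dist_eq_norm] using hw2)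
    exact (abs_lt.1 this).2.le

lemma exists_int_of_exp_eq_one {U : Set ℂ} (hU : IsOpen U) (hc : IsPreconnected U)
    {D : ℂ → ℂ} (hD : DifferentiableOn ℂ D U) (h1 : ∀ z ∈ U, Complex.exp (D z) = 1) :
    ∃ k : ℤ, ∀ z ∈ U, D z = k * (2 * π * Complex.I) := by
  have hder : Set.EqOn (deriv D) 0 U := by
    intro z hz
    have hz' := hU.mem_nhds hz
    have hd := (hD.differentiableAt hz').hasDerivAt
    have h2 : HasDerivAt (fun w => Complex.exp (D w)) (Complex.exp (D z) * deriv D z) z := hd.cexp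
    have h3 : HasDerivAt (fun w => Complex.exp (D w)) 0 z := by
      refine (hasDerivAt_const z (1 : ℂ)).congr_of_eventuallyEq ?_
      filter_upwards [hz'] with w hw using h1 w hw
    have h4 := h2.unique h3
    rw [h1 z hz, one_mul] at h4
    exact h4
  obtain ⟨a, ha⟩ := hU.exists_is_const_of_deriv_eq_zero hc hD hder
  by_cases hne : U.Nonempty
  · obtain ⟨z, hz⟩ := hne
    obtain ⟨k, hk⟩ := Complex.exp_eq_one_iff.1 (h1 z hz)
    exact ⟨k, fun w hw => by rw [ha w hw, ← ha z hz, hk]⟩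
  · exact ⟨0, fun z hz => absurd ⟨z, hz⟩ hne⟩

lemma Strip.convex (r : ℝ) : Convex ℝ (Strip r) := by
  have : Strip r = Complex.imLm ⁻¹' (Set.Ioo (-r) r) := by
    ext z
    simp [Strip, abs_lt]
  rw [this]
  exact (convex_Ioo _ _).linear_preimage _

lemma Strip.real_mem {r : ℝ} (hr : 0 < r) (x : ℝ) : (x : ℂ) ∈ Strip r := by simpa [Strip] using hr

lemma exists_dioph {α : ℝ} (hα : Irrational α) (N : ℕ) : ∃ (p : ℤ) (q : ℕ), N ≤ q ∧ 1 ≤ q ∧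
    IsCoprime p (q : ℤ) ∧ |α - p / q| < 1 / (q : ℝ) ^ 2 := by
  by_contra hcon
  push Not at hcon
  have hinf := Real.infinite_rat_abs_sub_lt_one_div_den_sq_of_irrational hα
  apply hinf
  set M : ℤ := ⌈(|α| + 1) * (N + 1)⌉ with hM
  have hfin : ((fun x : ℤ × ℕ => (x.1 / x.2 : ℚ)) ''
      (Set.Icc (-M) M ×ˢ Set.Icc 0 N)).Finite :=
    ((Set.finite_Icc _ _).prod (Set.finite_Icc _ _)).image _
  refine hfin.subset fun q hq => ⟨(q.num, q.den), ⟨?_, ?_⟩, q.num_div_den⟩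
  all_goals
    have hq' : |α - q| < 1 / (q.den : ℝ) ^ 2 := hq
    have hden : q.den < N := by
      by_contra h
      have h1 := hcon q.num q.den (not_lt.1 h) q.pos q.isCoprime_num_den
      rw [← Rat.cast_def] at h1
      exact absurd hq' (not_lt.2 h1)
  · have hd1 : (1 : ℝ) ≤ q.den := by exact_mod_cast q.pos
    have h2 : |(q : ℝ)| ≤ |α| + 1 := by
      have h3 : 1 / (q.den : ℝ) ^ 2 ≤ 1 := by
        rw [div_le_one (by positivity)]; exact one_le_pow₀ hd1
      have h4 := abs_sub_abs_le_abs_sub (q : ℝ) α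
      rw [abs_sub_comm] at h4
      linarith
    have h5 : |(q.num : ℝ)| ≤ (|α| + 1) * (N + 1) := by
      have : (q.num : ℝ) = q * q.den := by
        have := Rat.cast_def (K := ℝ) q
        rw [this]; field_simp
      rw [this, abs_mul, Nat.abs_cast]
      have : (q.den : ℝ) ≤ N + 1 := by
        have : (q.den : ℝ) < N := by exact_mod_cast hden
        linarith
      gcongr
    have h6 : |(q.num : ℝ)| ≤ M := h5.trans (Int.le_ceil _)
    have h7 : |q.num| ≤ M := by exact_mod_cast h6
    exact abs_le.1 h7
  · exact ⟨Nat.zero_le _, hden.le⟩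

lemma prod_range_coprime {M : Type*} [CommMonoid M] {p : ℤ} {q : ℕ} (hq : 1 ≤ q)
    (hpq : IsCoprime p (q : ℤ)) (φ : ℤ → M) (hφ : ∀ a : ℤ, φ (a + q) = φ a) :
    ∏ j ∈ Finset.range q, φ (j * p) = ∏ j ∈ Finset.range q, φ j := by
  have hq0 : (0 : ℤ) < q := by exact_mod_cast hq
  have hper : ∀ a : ℤ, φ (a % q) = φ a := by
    intro a
    have h : Function.Periodic φ (q : ℤ) := hφ
    have := (h.int_mul (a / q)) (a % q)
    rw [← this]
    congr 1
    rw [Int.cast_id, mul_comm]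
    exact Int.emod_add_mul_ediv a q
  set f : ℕ → ℕ := fun j => ((j * p : ℤ) % q).toNat with hf
  have hfc : ∀ j, ((f j : ℕ) : ℤ) = (j * p : ℤ) % q := fun j =>
    Int.toNat_of_nonneg (Int.emod_nonneg _ hq0.ne')
  have hmaps : ∀ j, f j ∈ Finset.range q := by
    intro j
    rw [Finset.mem_range]
    have : ((f j : ℕ) : ℤ) < q := by rw [hfc]; exact Int.emod_lt_of_pos _ hq0
    exact_mod_cast this
  have hinj : Set.InjOn f (Finset.range q : Set ℕ) := by
    intro a ha b hb hab
    have h1 : (a * p : ℤ) % q = (b * p : ℤ) % q := by rw [← hfc, ← hfc, hab]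
    have h2 : (q : ℤ) ∣ (b - a) * p := by
      have h3 : (a * p : ℤ) ≡ b * p [ZMOD q] := h1
      have := h3.dvd
      rwa [← sub_mul] at this
    have h4 : (q : ℤ) ∣ b - a := hpq.symm.dvd_of_dvd_mul_right h2
    simp only [Finset.coe_range, Set.mem_Iio] at ha hb
    have h5 : (b : ℤ) - a = 0 := by
      apply Int.eq_zero_of_abs_lt_dvd h4
      rw [abs_lt]
      omega
    omega
  have himg : (Finset.range q).image f = Finset.range q := by
    apply Finset.eq_of_subset_of_card_le
    · intro x hx
      obtain ⟨j, -, rfl⟩ := Finset.mem_image.1 hx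
      exact hmaps j
    · rw [Finset.card_image_of_injOn hinj]
  calc ∏ j ∈ Finset.range q, φ (j * p) = ∏ j ∈ Finset.range q, φ (f j) := by
        refine Finset.prod_congr rfl fun j _ => ?_
        rw [hfc, hper]
    _ = ∏ j ∈ (Finset.range q).image f, φ j := by
        rw [Finset.prod_image hinj]
    _ = _ := by rw [himg]

lemma sum_range_coprime {M : Type*} [AddCommMonoid M] {p : ℤ} {q : ℕ} (hq : 1 ≤ q)
    (hpq : IsCoprime p (q : ℤ)) (φ : ℤ → M) (hφ : ∀ a : ℤ, φ (a + q) = φ a) :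
    ∑ j ∈ Finset.range q, φ (j * p) = ∑ j ∈ Finset.range q, φ j :=
  prod_range_coprime (M := Multiplicative M) hq hpq φ hφ

lemma exists_periodic_eqOn {E : Type*} [Zero E] {r : ℝ} {f : ℂ → E}
    (hper : ∀ z ∈ Strip r, f (z + 1) = f z) :
    ∃ g : ℂ → E, Set.EqOn g f (Strip r) ∧ ∀ z, g (z + 1) = g z := by
  classical
  refine ⟨(Strip r).indicator f, fun z hz => Set.indicator_of_mem hz _, fun z => ?_⟩
  have hiff : z + 1 ∈ Strip r ↔ z ∈ Strip r := by simp [Strip]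
  by_cases hz : z ∈ Strip r
  · rw [Set.indicator_of_mem hz, Set.indicator_of_mem (hiff.2 hz), hper z hz]
  · rw [Set.indicator_of_notMem hz, Set.indicator_of_notMem (fun h => hz (hiff.1 h))]

lemma norm_sub_mul_deriv_le {r' r η ρ : ℝ} {g : ℂ → ℂ} (hg : DifferentiableOn ℂ g (Strip r))
    (hr : r' < r) (hη : ∀ z w : ℂ, |z.im| ≤ r' → dist w z < ρ → ‖deriv g w - deriv g z‖ < η)
    {z : ℂ} (hz : |z.im| ≤ r') {t : ℝ} (ht0 : 0 ≤ t) (ht : t < ρ) :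
    ‖g (z + t) - g z - t * deriv g z‖ ≤ η * t := by
  have hmem : ∀ s : ℝ, z + s ∈ Strip r := fun s => by
    simpa [Strip] using hz.trans_lt hr
  have hd : ∀ s ∈ Set.Icc (0 : ℝ) t, HasDerivWithinAt
      (fun s : ℝ => g (z + s) - s * deriv g z) (deriv g (z + s) - deriv g z) (Set.Icc 0 t) s := by
    intro s _
    have h1 : HasDerivAt g (deriv g (z + s)) (z + (s : ℂ)) :=
      (hg.differentiableAt ((Strip.isOpen r).mem_nhds (hmem s))).hasDerivAt
    have h2 : HasDerivAt (fun w : ℂ => g (z + w)) (deriv g (z + s)) (s : ℂ) :=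
      h1.comp_const_add z (s : ℂ)
    have h3 : HasDerivAt (fun w : ℂ => g (z + w) - w * deriv g z) (deriv g (z + s) - deriv g z)
        (s : ℂ) := by
      have h4 := h2.fun_sub ((hasDerivAt_id' (s : ℂ)).mul_const (deriv g z))
      rwa [one_mul] at h4
    exact h3.comp_ofReal.hasDerivWithinAt
  have hb : ∀ s ∈ Set.Icc (0 : ℝ) t, ‖deriv g (z + s) - deriv g z‖ ≤ η := by
    intro s hs
    refine (hη z (z + s) hz ?_).le
    simpa [dist_eq_norm, abs_of_nonneg hs.1] using hs.2.trans_lt ht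
  have := (convex_Icc (0 : ℝ) t).norm_image_sub_le_of_norm_hasDerivWithin_le hd hb
    (Set.left_mem_Icc.2 ht0) (Set.right_mem_Icc.2 ht0)
  simp only [ofReal_zero, add_zero, zero_mul, sub_zero, Real.norm_eq_abs, abs_of_nonneg ht0] at this
  rwa [sub_right_comm] at this

lemma birkhoff_deriv_small {r' r η α : ℝ} (hα : Irrational α) {g : ℂ → ℂ}
    (hg : DifferentiableOn ℂ g (Strip r)) (hper : ∀ z, g (z + 1) = g z) (hr : r' < r) (hη : 0 < η) :
    ∃ q : ℕ, 1 ≤ q ∧ ∀ z : ℂ, |z.im| ≤ r' →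
      ‖∑ j ∈ Finset.range q, deriv g (z + j * α)‖ ≤ q * η := by
  have hd : DifferentiableOn ℂ (deriv g) (Strip r) := hg.deriv (Strip.isOpen r)
  have hdper : ∀ z, deriv g (z + 1) = deriv g z := fun z => by
    rw [← deriv_comp_add_const g 1 z]
    exact congrArg (fun f => deriv f z) (funext hper)
  obtain ⟨ρ, hρ, hρ'⟩ := exists_unifcont_strip hd.continuousOn hdper hr (half_pos hη)
  obtain ⟨N, hN⟩ := exists_nat_gt (1 / ρ)
  obtain ⟨p, q, hNq, hq, hpq, hdio⟩ := exists_dioph hα N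
  have hq0 : (0 : ℝ) < q := by exact_mod_cast hq
  have hqC : (q : ℂ) ≠ 0 := by exact_mod_cast hq0.ne'
  have hqρ : 1 / (q : ℝ) < ρ := by
    rw [div_lt_iff₀ hq0, mul_comm, ← div_lt_iff₀ hρ]
    exact hN.trans_le (by exact_mod_cast hNq)
  refine ⟨q, hq, fun z hz => ?_⟩
  have e1 : ‖∑ j ∈ Finset.range q, deriv g (z + j * α) -
      ∑ j ∈ Finset.range q, deriv g (z + ((j * p : ℤ) : ℂ) / q)‖ ≤ q * (η / 2) := by
    rw [← Finset.sum_sub_distrib]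
    refine (norm_sum_le_of_le (n := fun _ => η / 2) _ fun j hj => ?_).trans (by simp)
    refine (hρ' _ _ ?_ ?_).le
    · have : (((j * p : ℤ) : ℂ) / q).im = 0 := by
        have : (((j * p : ℤ) : ℂ) / q) = (((j * p : ℤ) / q : ℝ) : ℂ) := by push_cast; rfl
        rw [this, ofReal_im]
      rw [add_im, this, add_zero]
      exact hz
    · have : z + j * (α : ℂ) - (z + ((j * p : ℤ) : ℂ) / q) = ((j * (α - p / q) : ℝ) : ℂ) := by
        push_cast; ring
      rw [dist_eq_norm, this, norm_real, Real.norm_eq_abs, abs_mul, Nat.abs_cast]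
      have hj' : (j : ℝ) ≤ q := by exact_mod_cast (Finset.mem_range.1 hj).le
      calc (j : ℝ) * |α - p / q| ≤ q * (1 / (q : ℝ) ^ 2) := by gcongr
        _ = 1 / q := by field_simp
        _ < ρ := hqρ
  have e2 : ∑ j ∈ Finset.range q, deriv g (z + ((j * p : ℤ) : ℂ) / q) =
      ∑ j ∈ Finset.range q, deriv g (z + j / q) := by
    have := sum_range_coprime hq hpq (fun a : ℤ => deriv g (z + (a : ℂ) / q)) (fun a => by
      have : z + ((a + q : ℤ) : ℂ) / q = z + (a : ℂ) / q + 1 := by push_cast; field_simp; ring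
      rw [this, hdper])
    simpa using this
  have e3 : ‖∑ j ∈ Finset.range q, deriv g (z + j / q)‖ ≤ q * (η / 2) := by
    have tel : ∑ j ∈ Finset.range q, (g (z + ((j + 1 : ℕ) : ℂ) / q) - g (z + j / q)) = 0 := by
      rw [Finset.sum_range_sub (fun j : ℕ => g (z + (j : ℂ) / q)), div_self hqC, hper]
      simp
    have : ∑ j ∈ Finset.range q, deriv g (z + j / q) = - ∑ j ∈ Finset.range q,
        q * (g (z + ((j + 1 : ℕ) : ℂ) / q) - g (z + j / q) - ((1 / q : ℝ) : ℂ) *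
            deriv g (z + j / q)) := by
      rw [← Finset.mul_sum, Finset.sum_sub_distrib, tel, ← Finset.mul_sum]
      push_cast
      field_simp
      ring
    rw [this, norm_neg]
    refine (norm_sum_le_of_le (n := fun _ => η / 2) _ fun j hj => ?_).trans (by simp)
    have hz' : |(z + (j : ℂ) / q).im| ≤ r' := by
      have : ((j : ℂ) / q).im = 0 := by
        have : ((j : ℂ) / q) = ((j / q : ℝ) : ℂ) := by push_cast; rfl
        rw [this, ofReal_im]
      rw [add_im, this, add_zero]
      exact hz
    have h := norm_sub_mul_deriv_le hg hr hρ' hz' (t := 1 / q) (by positivity) hqρ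
    have e : z + (j : ℂ) / q + ((1 / q : ℝ) : ℂ) = z + ((j + 1 : ℕ) : ℂ) / q := by
      push_cast; ring
    rw [e] at h
    rw [norm_mul, Complex.norm_natCast]
    calc (q : ℝ) * _ ≤ q * (η / 2 * (1 / q)) := by gcongr
      _ = η / 2 := by field_simp
  rw [e2] at e1
  calc _ ≤ _ := norm_le_norm_sub_add _ (∑ j ∈ Finset.range q, deriv g (z + j / q))
    _ ≤ q * (η / 2) + q * (η / 2) := add_le_add e1 e3
    _ = q * η := by ring

lemma birkhoff_near_const {r' r η α : ℝ} (hα : Irrational α) {g : ℂ → ℂ}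
    (hg : DifferentiableOn ℂ g (Strip r)) (hper : ∀ z, g (z + 1) = g z) (hr' : 0 < r') (hr : r' < r)
    (hη : 0 < η) : ∃ q : ℕ, 1 ≤ q ∧ ∀ z ∈ Strip r',
      ‖(∑ j ∈ Finset.range q, g (z + j * α)) / q - (∑ j ∈ Finset.range q, g (j * α)) / q‖ ≤ η := by
  obtain ⟨q, hq, hqb⟩ := birkhoff_deriv_small hα hg hper hr (η := η / (2 + r')) (by positivity)
  have hq0 : (0 : ℝ) < q := by exact_mod_cast hq
  refine ⟨q, hq, ?_⟩
  have hmem : ∀ z ∈ Strip r', ∀ j : ℕ, z + j * (α : ℂ) ∈ Strip r := fun z hz j => by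
    have h : |z.im| < r' := hz
    simpa [Strip] using h.trans hr
  have hd : ∀ z ∈ Strip r', HasDerivWithinAt (fun z => ∑ j ∈ Finset.range q, g (z + j * α))
      (∑ j ∈ Finset.range q, deriv g (z + j * α)) (Strip r') z := by
    intro z hz
    refine (HasDerivAt.fun_sum fun j _ => ?_).hasDerivWithinAt
    exact (hg.differentiableAt ((Strip.isOpen r).mem_nhds (hmem z hz j))).hasDerivAt.comp_add_const
        z _
  have key : ∀ z ∈ Strip r', ‖z‖ ≤ 2 + r' →
      ‖(∑ j ∈ Finset.range q, g (z + j * α)) / q - (∑ j ∈ Finset.range q, g (j * α)) / q‖ ≤ η := by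
    intro z hz hz2
    have h0 : (0 : ℂ) ∈ Strip r' := by simpa [Strip] using hr'
    have := (Strip.convex r').norm_image_sub_le_of_norm_hasDerivWithin_le hd
      (fun w hw => hqb w (le_of_lt hw)) h0 hz
    simp only [zero_add, sub_zero] at this
    rw [← sub_div, norm_div, Complex.norm_natCast, div_le_iff₀ hq0]
    refine this.trans ?_
    calc (q : ℝ) * (η / (2 + r')) * ‖z‖ ≤ q * (η / (2 + r')) * (2 + r') := by gcongr
      _ = η * q := by field_simp
  intro z hz
  have hz' : |z.im| < r' := hz
  have hfl : z = (z - ⌊z.re⌋) + ⌊z.re⌋ := by ring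
  have hperS : ∀ w, (∑ j ∈ Finset.range q, g (w + 1 + j * α)) =
      ∑ j ∈ Finset.range q, g (w + j * α) :=
    fun w => Finset.sum_congr rfl fun j _ => by rw [add_right_comm, hper]
  have hS := periodic_int (f := fun w => ∑ j ∈ Finset.range q, g (w + j * α)) hperS
    (z - ⌊z.re⌋) ⌊z.re⌋
  rw [sub_add_cancel] at hS
  rw [hS]
  refine key _ (by simpa [Strip] using hz') ?_
  refine (Complex.norm_le_abs_re_add_abs_im _).trans ?_
  have h1 : |(z - ⌊z.re⌋ : ℂ).re| ≤ 1 := by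
    simp only [sub_re, intCast_re]
    rw [abs_of_nonneg (sub_nonneg.2 (Int.floor_le _))]
    linarith [Int.lt_floor_add_one z.re]
  have h2 : |(z - ⌊z.re⌋ : ℂ).im| ≤ r' := by simpa using hz'.le
  linarith

lemma sum_im_zero {ι : Type*} {s : Finset ι} {f : ι → ℂ} (h : ∀ i ∈ s, (f i).im = 0) :
    (∑ i ∈ s, f i).im = 0 := by
  rw [Complex.im_sum]; exact Finset.sum_eq_zero h

lemma exists_cohomologous {r' r η α : ℝ} (hα : Irrational α) {g : ℂ → ℂ}
    (hg : DifferentiableOn ℂ g (Strip r)) (hper : ∀ z ∈ Strip r, g (z + 1) = g z) (hr' : 0 < r')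
    (hr : r' < r) (hη : 0 < η) : ∃ (ψ : ℂ → ℂ) (c : ℂ), DifferentiableOn ℂ ψ (Strip r) ∧
      (∀ z, ψ (z + 1) = ψ z) ∧
      ((∀ x : ℝ, (g x).im = 0) → (∀ x : ℝ, (ψ x).im = 0) ∧ c.im = 0) ∧
      (∀ K : ℝ, (∀ x : ℝ, ‖g x‖ ≤ K) → ‖c‖ ≤ K) ∧
      ∀ z ∈ Strip r', ‖g z + (ψ (z + α) - ψ z) - c‖ ≤ η := by
  obtain ⟨f, hfg, hfper⟩ := exists_periodic_eqOn hper
  have hf : DifferentiableOn ℂ f (Strip r) := hg.congr hfg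
  obtain ⟨q, hq, hb⟩ := birkhoff_near_const hα hf hfper hr' hr hη
  have hqC : (q : ℂ) ≠ 0 := by exact_mod_cast (Nat.one_le_iff_ne_zero.1 hq)
  refine ⟨fun z => (∑ j ∈ Finset.range q, ∑ i ∈ Finset.range j, f (z + i * α)) / q,
    (∑ j ∈ Finset.range q, f (j * α)) / q, ?_, ?_, ?_, ?_, ?_⟩
  · refine DifferentiableOn.div_const (DifferentiableOn.fun_sum fun j _ =>
      DifferentiableOn.fun_sum fun i _ => ?_) _
    refine hf.comp (differentiable_id.add_const _).differentiableOn fun z hz => ?_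
    have h : |z.im| < r := hz
    simpa [Strip] using h
  · intro z
    simp only [add_right_comm _ (1 : ℂ), hfper]
  · intro hre
    have hre' : ∀ x : ℝ, (f x).im = 0 := fun x => by
      rw [hfg (Strip.real_mem (hr'.trans hr) x)]; exact hre x
    have hdiv : ∀ w : ℂ, w.im = 0 → (w / q).im = 0 := fun w hw => by
      rw [Complex.div_natCast_im, hw, zero_div]
    refine ⟨fun x => hdiv _ (sum_im_zero fun j _ => sum_im_zero fun i _ => ?_),
      hdiv _ (sum_im_zero fun j _ => ?_)⟩
    · have := hre' (x + i * α)
      push_cast at this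
      exact this
    · have := hre' (j * α)
      push_cast at this
      exact this
  · intro K hK
    have hq0 : (0 : ℝ) < q := by exact_mod_cast hq
    rw [norm_div, Complex.norm_natCast, div_le_iff₀ hq0]
    refine (norm_sum_le_of_le (n := fun _ => K) _ fun j _ => ?_).trans (by simp [mul_comm])
    have e : (j : ℂ) * α = ((j * α : ℝ) : ℂ) := by push_cast; rfl
    rw [e, hfg (Strip.real_mem (hr'.trans hr) _)]
    exact hK _
  · intro z hz
    have hz' : z ∈ Strip r := lt_trans hz hr
    have key : f z + ((∑ j ∈ Finset.range q, ∑ i ∈ Finset.range j, f (z + α + i * α)) / q -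
        (∑ j ∈ Finset.range q, ∑ i ∈ Finset.range j, f (z + i * α)) / q) =
        (∑ j ∈ Finset.range q, f (z + j * α)) / q := by
      have h1 : ∀ j : ℕ, ∑ i ∈ Finset.range j, f (z + α + i * α) =
          ∑ i ∈ Finset.range j, f (z + i * α) + (f (z + j * α) - f z) := by
        intro j
        have := Finset.sum_range_succ_sub_sum (f := fun i : ℕ => f (z + i * α)) (n := j)
        have h2 := Finset.sum_range_succ' (fun i : ℕ => f (z + i * α)) j
        have h3 : ∀ i : ℕ, z + α + i * (α : ℂ) = z + ((i + 1 : ℕ) : ℂ) * α := fun i => by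
          push_cast; ring
        simp only [h3]
        simp only [Nat.cast_zero, zero_mul, add_zero] at h2
        rw [h2] at this
        linear_combination this
      simp only [h1, Finset.sum_add_distrib, Finset.sum_sub_distrib, Finset.sum_const,
        Finset.card_range, nsmul_eq_mul]
      rw [add_div, sub_div, mul_div_cancel_left₀ _ hqC]
      ring
    rw [← hfg hz', key]
    exact hb z hz

/-- Diagonal matrices of determinant one. -/
def dg (a : ℂ) : M2 := !![a, 0; 0, a⁻¹]

lemma dg_det {a : ℂ} (ha : a ≠ 0) : (dg a).det = 1 := by
  simp [dg, Matrix.det_fin_two_of, ha]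

lemma dg_conj {a b : ℂ} (hb : b ≠ 0) (T : M2) (h10 : T 1 0 = 0) :
    dg a * T * (dg b)⁻¹ = !![a * T 0 0 * b⁻¹, a * T 0 1 * b; 0, a⁻¹ * T 1 1 * b] := by
  rw [M2.inv_eq_adjugate (dg_det hb), Matrix.eta_fin_two T, h10]
  simp [dg, Matrix.adjugate_fin_two_of]

lemma differentiableOn_dg {f : ℂ → ℂ} {U : Set ℂ} (hf : DifferentiableOn ℂ f U)
    (h0 : ∀ z ∈ U, f z ≠ 0) : DifferentiableOn ℂ (fun z => dg (f z)) U := by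
  refine differentiableOn_matrix fun i j => ?_
  fin_cases i <;> fin_cases j
  · exact hf
  · exact differentiableOn_const 0
  · exact differentiableOn_const 0
  · exact hf.inv h0

lemma exists_periodic_log {r : ℝ} (hr : 0 < r) {f : ℂ → ℂ} (hf : DifferentiableOn ℂ f (Strip r))
    (hper : ∀ z ∈ Strip r, f (z + 1) = f z) (h0 : ∀ z ∈ Strip r, f z ≠ 0) :
    ∃ (G : ℂ → ℂ) (k : ℤ), DifferentiableOn ℂ G (Strip r) ∧
        (∀ z ∈ Strip r, Complex.exp (G z) = f z) ∧
      ∀ z ∈ Strip r, G (z + 1) = G z + k * (2 * π * Complex.I) := by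
  obtain ⟨G, hG, hexp⟩ := exists_holo_log (Strip.isOpen r) (Strip.convex r)
    ⟨0, by simpa [Strip] using hr⟩ hf h0
  obtain ⟨k, hk⟩ := exists_int_of_exp_eq_one (D := fun z => G (z + 1) - G z) (Strip.isOpen r)
    (Strip.convex r).isPreconnected
    ((by simpa using hG.comp_add_real 1 : DifferentiableOn ℂ (fun z => G (z + 1)) _).sub hG)
    (fun z hz => by
      rw [Complex.exp_sub, hexp z hz, hexp _ (Strip.add_one.2 hz), hper z hz, div_self (h0 z hz)])
  exact ⟨G, k, hG, hexp, fun z hz => by linear_combination hk z hz⟩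

lemma eq_of_sin_eq_zero {φ : ℝ → ℝ} (hφ : Continuous φ) (h : ∀ x, Real.sin (φ x) = 0) (x y : ℝ) :
    φ x = φ y := by
  by_contra hne
  wlog hlt : φ x < φ y generalizing x y
  · exact this y x (Ne.symm hne) (lt_of_le_of_ne (not_lt.1 hlt) (Ne.symm hne))
  obtain ⟨k, hk⟩ := Real.sin_eq_zero_iff.1 (h x)
  obtain ⟨m, hm⟩ := Real.sin_eq_zero_iff.1 (h y)
  have hkm : k + 1 ≤ m := by
    rw [← hk, ← hm] at hlt
    have := lt_of_mul_lt_mul_right hlt Real.pi_pos.le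
    exact_mod_cast this
  have hkm' : (k : ℝ) + 1 ≤ m := by exact_mod_cast hkm
  obtain ⟨w, hw⟩ := mem_range_of_exists_le_of_exists_ge hφ (c := (k + 1 / 2) * π)
    ⟨x, by rw [← hk]; nlinarith [Real.pi_pos]⟩ ⟨y, by rw [← hm]; nlinarith [Real.pi_pos]⟩
  obtain ⟨j, hj⟩ := Real.sin_eq_zero_iff.1 (h w)
  rw [hw] at hj
  have h1 := mul_right_cancel₀ Real.pi_ne_zero hj
  have h2 : (2 * j : ℤ) = 2 * k + 1 := by
    have : (2 * j : ℝ) = 2 * k + 1 := by linarith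
    exact_mod_cast this
  omega

/-- Nearly diagonalising the cocycle with entries `exp G`, `β`, up to the winding `k` of `exp G`. -/
lemma exists_triangular_conj {r' r η α : ℝ} {k : ℤ} (hα : Irrational α) {G β : ℂ → ℂ}
    (hG : DifferentiableOn ℂ G (Strip r))
    (hGper : ∀ z ∈ Strip r, G (z + 1) = G z + k * (2 * π * Complex.I))
    (hβ : DifferentiableOn ℂ β (Strip r)) (hβper : ∀ z ∈ Strip r, β (z + 1) = β z) (hr' : 0 < r')
    (hr : r' < r) (hη : 0 < η) : ∃ (ψ : ℂ → ℂ) (c : ℂ) (t : ℝ), 0 < t ∧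
      DifferentiableOn ℂ ψ (Strip r) ∧ (∀ z, ψ (z + 1) = ψ z) ∧
      ((∀ x : ℝ, (G x).im = 0) → k = 0 → (∀ x : ℝ, (ψ x).im = 0)) ∧
      (∀ K : ℝ, (∀ x : ℝ, ‖G x‖ ≤ K) → k = 0 → ‖c‖ ≤ K) ∧
      ∀ z ∈ Strip r', ‖G z - k * (2 * π * Complex.I) * z + (ψ (z + α) - ψ z) - c‖ ≤ η ∧
        ‖t * Complex.exp (ψ (z + α)) * β z * (t * Complex.exp (ψ z))‖ ≤ η := by
  obtain ⟨ψ, c, hψ, hψper, hreal, hbd, hmain⟩ := exists_cohomologous (r' := r') (η := η)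
    (g := fun z => G z - k * (2 * π * Complex.I) * z) hα
    (hG.sub (differentiableOn_id.const_mul _)) (fun z hz => by
      rw [hGper z hz]; ring) hr' hr hη
  obtain ⟨b, hb, hbper⟩ := exists_periodic_eqOn hβper
  obtain ⟨C₁, hC₁⟩ := exists_bound_strip (hβ.congr hb).continuousOn hbper hr
  obtain ⟨C₂, hC₂⟩ := exists_bound_strip hψ.continuousOn hψper hr
  set D : ℝ := (|C₁| + 1) * Real.exp (2 * C₂) with hD
  have hDpos : 0 < D := by positivity
  refine ⟨ψ, c, Real.sqrt (η / D), Real.sqrt_pos.2 (by positivity), hψ, hψper, ?_, ?_, ?_⟩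
  · intro h1 h2
    exact (hreal fun x => by simp [h2, h1 x]).1
  · intro K hK h2
    exact hbd K fun x => by simpa [h2] using hK x
  · intro z hz
    refine ⟨hmain z hz, ?_⟩
    have hz' : |z.im| < r' := hz
    have e1 : ‖Complex.exp (ψ (z + α))‖ ≤ Real.exp C₂ := by
      rw [Complex.norm_exp]
      exact Real.exp_le_exp.2 ((Complex.re_le_norm _).trans (hC₂ _ (by simpa using hz'.le)))
    have e2 : ‖Complex.exp (ψ z)‖ ≤ Real.exp C₂ := by
      rw [Complex.norm_exp]
      exact Real.exp_le_exp.2 ((Complex.re_le_norm _).trans (hC₂ _ hz'.le))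
    have e3 : ‖β z‖ ≤ |C₁| + 1 := by
      rw [← hb (lt_trans hz hr)]
      exact (hC₁ z hz'.le).trans (by linarith [le_abs_self C₁])
    rw [norm_mul, norm_mul, norm_mul, norm_mul, Complex.norm_real,
        Real.norm_of_nonneg (Real.sqrt_nonneg _)]
    calc √(η / D) * ‖Complex.exp (ψ (z + α))‖ * ‖β z‖ * (√(η / D) * ‖Complex.exp (ψ z)‖)
        ≤ √(η / D) * Real.exp C₂ * (|C₁| + 1) * (√(η / D) * Real.exp C₂) := by gcongr
      _ = (√(η / D) * √(η / D)) * ((|C₁| + 1) * (Real.exp C₂ * Real.exp C₂)) := by ring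
      _ = η / D * D := by
        rw [Real.mul_self_sqrt (by positivity), ← Real.exp_add, ← two_mul]
      _ = η := by field_simp

lemma norm_exp_sub_exp_le {w c : ℂ} {η K : ℝ} (h : ‖w - c‖ ≤ η) (hη : η ≤ 1) (hc : ‖c‖ ≤ K) :
    ‖Complex.exp w - Complex.exp c‖ ≤ Real.exp K * (2 * η) := by
  have e : Complex.exp w - Complex.exp c = Complex.exp c * (Complex.exp (w - c) - 1) := by
    rw [mul_sub, ← Complex.exp_add]; congr 2 <;> ring
  rw [e, norm_mul]
  have h1 := Complex.norm_exp_sub_one_le (h.trans hη)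
  have h2 : ‖Complex.exp c‖ ≤ Real.exp K := by
    rw [Complex.norm_exp]; exact Real.exp_le_exp.2 ((Complex.re_le_norm c).trans hc)
  gcongr
  linarith

lemma ApproxRed.of_triangular {r' r α : ℝ} (hα : Irrational α) {T : ℂ → M2}
    (hT : DifferentiableOn ℂ T (Strip r)) (hper : ∀ z ∈ Strip r, T (z + 1) = T z)
    (hreal : ∀ x : ℝ, ∀ i j, (T x i j).im = 0) (hdet : ∀ z ∈ Strip r, (T z).det = 1)
    (h10 : ∀ z ∈ Strip r, T z 1 0 = 0) (hr' : 0 < r') (hr : r' < r) : ApproxRed α r' T := by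
  have hr0 := hr'.trans hr
  have hdet' : ∀ z ∈ Strip r, T z 0 0 * T z 1 1 = 1 := fun z hz => by
    have := hdet z hz
    rwa [Matrix.det_fin_two, h10 z hz, mul_zero, sub_zero] at this
  have hne : ∀ z ∈ Strip r, T z 0 0 ≠ 0 := fun z hz => left_ne_zero_of_mul_eq_one (hdet' z hz)
  obtain ⟨G, k, hG, hexp, hGper⟩ := exists_periodic_log hr0 (hT.matrix_entry 0 0)
    (fun z hz => by rw [hper z hz]) hne
  have hGc : Continuous fun x : ℝ => (G x).im := Complex.continuous_im.comp
    (continuous_iff_continuousAt.2 fun x => ((hG.continuousOn.continuousAt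
      ((Strip.isOpen r).mem_nhds (Strip.real_mem hr0 x))).comp
      Complex.continuous_ofReal.continuousAt))
  have hGim : ∀ x : ℝ, (G x).im = (G 0).im := by
    have := fun x => eq_of_sin_eq_zero hGc (fun x => by
      have h1 := hreal x 0 0
      rw [← hexp _ (Strip.real_mem hr0 x), Complex.exp_im] at h1
      exact (mul_eq_zero.1 h1).resolve_left (Real.exp_pos _).ne') x 0
    simpa using this
  have hk : k = 0 := by
    have h1 := congrArg Complex.im (hGper 0 (by simpa [Strip] using hr0))
    have h2 := hGim 1
    have h3 : ((k : ℂ) * (2 * π * Complex.I)).im = k * (2 * π) := by simp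
    rw [zero_add, add_im, h3] at h1
    rw [ofReal_one] at h2
    have : (k : ℝ) * (2 * π) = 0 := by linarith
    have := (mul_eq_zero.1 this).resolve_right (by positivity)
    exact_mod_cast this
  set s : ℂ := ((G 0).im : ℂ) * Complex.I with hs
  set H : ℂ → ℂ := fun z => G z - s with hH
  have hHd : DifferentiableOn ℂ H (Strip r) := hG.sub_const _
  have hHper : ∀ z ∈ Strip r, H (z + 1) = H z + (0 : ℤ) * (2 * π * Complex.I) := fun z hz => by
    simp only [hH, hGper z hz, hk]; push_cast; ring
  have hHim : ∀ x : ℝ, (H x).im = 0 := fun x => by simp [hH, hs, hGim x]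
  obtain ⟨f, hf, hfper⟩ := exists_periodic_eqOn (f := H) (r := r) (fun z hz => by
    simpa using hHper z hz)
  obtain ⟨K, hK⟩ := exists_bound_strip (hHd.congr hf).continuousOn hfper hr
  have hK' : ∀ x : ℝ, ‖H x‖ ≤ K := fun x => by
    rw [← hf (Strip.real_mem hr0 x)]; exact hK _ (by simpa using hr'.le)
  have hsn : ‖Complex.exp s‖ = 1 := by rw [hs, Complex.norm_exp_ofReal_mul_I]
  have hsn' : ‖(Complex.exp s)⁻¹‖ = 1 := by rw [norm_inv, hsn, inv_one]
  have hT00 : ∀ z ∈ Strip r, T z 0 0 = Complex.exp s * Complex.exp (H z) := fun z hz => by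
    rw [← Complex.exp_add, ← hexp z hz]; congr 1; simp [hH]
  refine ApproxRed.of_local (Real.exp K) fun δ hδ => ?_
  set η : ℝ := min (min 1 δ) (δ / (2 * Real.exp K)) with hη
  have hη0 : 0 < η := by positivity
  have hη1 : η ≤ 1 := (min_le_left _ _).trans (min_le_left _ _)
  have hη2 : η ≤ δ := (min_le_left _ _).trans (min_le_right _ _)
  have hη3 : Real.exp K * (2 * η) ≤ δ := by
    have : η ≤ δ / (2 * Real.exp K) := min_le_right _ _
    rw [le_div_iff₀ (by positivity)] at this
    linarith
  obtain ⟨ψ, c, t, ht, hψ, hψper, hψre, hcK, hmain⟩ := exists_triangular_conj hα hHd hHper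
    (hT.matrix_entry 0 1) (fun z hz => by rw [hper z hz]) hr' hr hη0
  have hψre := hψre hHim rfl
  have hcK := hcK K hK' rfl
  have htC : (t : ℂ) ≠ 0 := by exact_mod_cast ht.ne'
  have hQne : ∀ z, (t : ℂ) * Complex.exp (ψ z) ≠ 0 := fun z =>
      mul_ne_zero htC (Complex.exp_ne_zero _)
  refine ⟨fun z => dg (t * Complex.exp (ψ z)), ?_, ⟨1, Or.inl rfl, fun z _ => by simp [hψper]⟩, ?_,
    fun z _ => dg_det (hQne z), dg (Complex.exp s * Complex.exp c), ?_, ?_⟩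
  · exact differentiableOn_dg (((hψ.mono (Strip.mono hr.le)).cexp).const_mul _) fun z _ => hQne z
  · intro x i j
    have : (t : ℂ) * Complex.exp (ψ x) = ((t * Real.exp (ψ x).re : ℝ) : ℂ) := by
      rw [← Complex.re_add_im (ψ x), hψre x]; simp
    show (dg (t * Complex.exp (ψ x)) i j).im = 0
    rw [this]
    fin_cases i <;> fin_cases j <;>
      simp only [dg, Matrix.of_apply, Matrix.cons_val', Matrix.cons_val_zero, Matrix.cons_val_one,
        Matrix.cons_val_fin_one, Fin.zero_eta, Fin.mk_one, Complex.ofReal_im, Complex.zero_im,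
        ← Complex.ofReal_inv]
  · have h1 : ‖Complex.exp c‖ ≤ Real.exp K := by
      rw [Complex.norm_exp]; exact Real.exp_le_exp.2 ((Complex.re_le_norm c).trans hcK)
    have h2 : ‖(Complex.exp c)⁻¹‖ ≤ Real.exp K := by
      rw [← Complex.exp_neg, Complex.norm_exp]
      exact Real.exp_le_exp.2 ((Complex.re_le_norm _).trans (by rwa [norm_neg]))
    rw [Matrix.norm_le_iff (Real.exp_pos _).le]
    intro i j
    fin_cases i <;> fin_cases j
    · simpa [dg, hsn] using h1
    · simpa [dg] using (Real.exp_pos K).le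
    · simpa [dg] using (Real.exp_pos K).le
    · simpa [dg, hsn, -norm_inv, mul_inv, norm_mul, hsn'] using h2
  · intro z hz
    have hz' : z ∈ Strip r := lt_trans hz hr
    obtain ⟨m1, m2⟩ := hmain z hz
    simp only [Int.cast_zero, zero_mul, sub_zero] at m1
    rw [dg_conj (hQne z) _ (h10 z hz'), Matrix.norm_le_iff hδ.le]
    have d1 := (norm_exp_sub_exp_le m1 hη1 hcK).trans hη3
    have d2 : ‖Complex.exp (-(H z + (ψ (z + α) - ψ z))) - Complex.exp (-c)‖ ≤ δ :=
      (norm_exp_sub_exp_le (by rwa [neg_sub_neg, norm_sub_rev]) hη1 (by rwa [norm_neg])).trans hη3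
    have hT11 : T z 1 1 = (Complex.exp s)⁻¹ * Complex.exp (-H z) := by
      rw [Complex.exp_neg, ← mul_inv, ← hT00 z hz']
      exact eq_inv_of_mul_eq_one_right (hdet' z hz')
    intro i j
    fin_cases i <;> fin_cases j
    · have e : t * Complex.exp (ψ (z + α)) * T z 0 0 * (t * Complex.exp (ψ z))⁻¹ -
          Complex.exp s * Complex.exp c =
          Complex.exp s * (Complex.exp (H z + (ψ (z + α) - ψ z)) - Complex.exp c) := by
        rw [hT00 z hz', Complex.exp_add, Complex.exp_sub (ψ (z + α))]
        field_simp
      have : ‖t * Complex.exp (ψ (z + α)) * T z 0 0 * (t * Complex.exp (ψ z))⁻¹ -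
          Complex.exp s * Complex.exp c‖ ≤ δ := by
        rw [e, norm_mul, hsn, one_mul]; exact d1
      simpa [dg, -mul_inv_rev] using this
    · simpa [dg] using m2.trans hη2
    · simpa [dg] using hδ.le
    · have e : (t * Complex.exp (ψ (z + α)))⁻¹ * T z 1 1 * (t * Complex.exp (ψ z)) -
          (Complex.exp s * Complex.exp c)⁻¹ =
          (Complex.exp s)⁻¹ * (Complex.exp (-(H z + (ψ (z + α) - ψ z))) - Complex.exp (-c)) := by
        rw [hT11, neg_add, neg_sub (ψ (z + α)), Complex.exp_add, Complex.exp_sub (ψ z),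
            Complex.exp_neg c]
        field_simp
      have : ‖(t * Complex.exp (ψ (z + α)))⁻¹ * T z 1 1 * (t * Complex.exp (ψ z)) -
          (Complex.exp s * Complex.exp c)⁻¹‖ ≤ δ := by
        rw [e, norm_mul, hsn', one_mul]; exact d2
      simpa [dg, -mul_inv_rev, -norm_inv] using this

lemma IsSL2Strip.cocycleIter_im {h α : ℝ} {A : ℂ → M2} (hA : IsSL2Strip h A) (n : ℕ) (x : ℝ)
    (i j : Fin 2) : (cocycleIter α A n x i j).im = 0 := by
  induction n generalizing i j with
  | zero => fin_cases i <;> fin_cases j <;> simp [cocycleIter]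
  | succ n ih =>
    have h1 := hA.2.2.1 (x + n * α)
    push_cast at h1
    simp [cocycleIter, Matrix.mul_apply, Complex.mul_im, h1, ih]

/-- Entrywise complex conjugation of vectors. -/
def conjV (v : V2) : V2 := fun i => (starRingEnd ℂ) (v i)

lemma conjV_mulVec {M : M2} (hM : ∀ i j, (M i j).im = 0) (v : V2) :
    M.mulVec (conjV v) = conjV (M.mulVec v) := by
  have h : ∀ i j, (starRingEnd ℂ) (M i j) = M i j := fun i j => Complex.conj_eq_iff_im.2 (hM i j)
  ext i
  simp [conjV, Matrix.mulVec, dotProduct, h]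

lemma IsSL2Strip.conjV_mem_lineE {h α : ℝ} {A : ℂ → M2} (hA : IsSL2Strip h A) {n : ℕ} {x : ℝ}
    {v : V2} (hv : v ∈ lineE α A n x) : conjV v ∈ lineE α A n x := by
  obtain ⟨y, hy, hl⟩ := hv
  refine ⟨fun k => conjV (y k), fun k => ?_, ?_⟩
  · rw [← hy k]
    have e : (x : ℂ) - ((k * n : ℕ) : ℂ) * (α : ℂ) = ((x - (k * n : ℕ) * α : ℝ) : ℂ) := by
      push_cast; rfl
    rw [e]
    exact conjV_mulVec (hA.cocycleIter_im _ _) _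
  · rw [tendsto_pi_nhds] at hl ⊢
    intro i
    have := (Complex.continuous_conj.tendsto _).comp (hl i)
    simpa [conjV, Function.comp_def] using this

lemma normSq_sub_I {v : V2} (h : wedge v (conjV v) = 0) :
    Complex.normSq (v 0 - Complex.I * v 1) = Complex.normSq (v 0 + Complex.I * v 1) := by
  have := congrArg Complex.im h
  simp [wedge, conjV] at this
  simp [Complex.normSq_apply]
  nlinarith

lemma exists_ne_zero_strip {r : ℝ} (hr : 0 < r) {g : ℂ → ℂ} (hg : ContinuousOn g (Strip r))
    (hper : ∀ z, g (z + 1) = g z) {m : ℝ} (hm : 0 < m) (h : ∀ x : ℝ, m ≤ ‖g x‖) :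
    ∃ r' : ℝ, 0 < r' ∧ r' ≤ r ∧ ∀ z ∈ Strip r', g z ≠ 0 := by
  obtain ⟨ρ, hρ, hρ'⟩ := exists_unifcont_strip hg hper hr hm
  refine ⟨min ρ r, lt_min hρ hr, min_le_right _ _, fun z hz h0 => ?_⟩
  have hz' : |z.im| < min ρ r := hz
  have h1 := hρ' (z.re : ℂ) z (by simp) (by
    have e : z - (z.re : ℂ) = z.im * Complex.I := by
      linear_combination -Complex.re_add_im z
    rw [dist_eq_norm, e, norm_mul, Complex.norm_I, mul_one, Complex.norm_real]
    exact hz'.trans_le (min_le_left _ _))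
  rw [h0, zero_sub, norm_neg] at h1
  exact absurd (h z.re) (not_le.2 h1)

lemma AP.approxRed {h r α θ : ℝ} {A : ℂ → M2} {n : ℕ} (hα : Irrational α) (hA : IsSL2Strip h A)
    (hr : 0 < r) (hrh : r ≤ h) (hAP : AP α r A n θ) :
    ∃ ε : ℝ, 0 < ε ∧ ε ≤ r ∧ ApproxRed α ε A := by
  have hAr : IsCSL r A := hA.isCSL.mono hrh
  obtain ⟨r₁, hr₁, hr₁r, u, lam, hu, huE⟩ := hAP.invSection hAr hr ![1, Complex.I] (by
    intro x v hv hv0 hp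
    have hw := lineE.wedge_eq_zero hAr (Strip.real_mem hr x) hv (hA.conjV_mem_lineE hv)
    have hp' : v 0 + Complex.I * v 1 = 0 := by simpa [pair] using hp
    have h1 := normSq_sub_I hw
    rw [hp', map_zero, Complex.normSq_eq_zero] at h1
    apply hv0
    have h2 : v 0 = 0 := by linear_combination (hp' + h1) / 2
    have h3 : v 1 = 0 := by
      rw [h2, zero_add] at hp'
      exact (mul_eq_zero.1 hp').resolve_left Complex.I_ne_zero
    ext i; fin_cases i
    · exact h2
    · exact h3)
  have hnorm : ∀ z ∈ Strip r₁, u z 0 + Complex.I * u z 1 = 1 := fun z hz => by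
    simpa [pair] using hu.norm z hz
  have hu' := differentiableOn_pi.1 hu.diff
  set g : ℂ → ℂ := fun z => u z 0 - Complex.I * u z 1 with hg
  have hgd : DifferentiableOn ℂ g (Strip r₁) := (hu' 0).sub ((hu' 1).const_mul _)
  have hgre : ∀ x : ℝ, ‖g x‖ = 1 := by
    intro x
    have hx := Strip.real_mem hr₁ x
    have hw := lineE.wedge_eq_zero hAr (Strip.real_mem hr x) (huE x hx)
      (hA.conjV_mem_lineE (huE x hx))
    have h1 := normSq_sub_I hw
    rw [hnorm x hx, map_one, Complex.normSq_eq_norm_sq] at h1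
    exact (pow_eq_one_iff_of_nonneg (norm_nonneg _) two_ne_zero).1 h1
  have hgper : ∀ z ∈ Strip r₁, g (z + 1) = g z := fun z hz => by simp only [hg, hu.per z hz]
  obtain ⟨f, hf, hfper⟩ := exists_periodic_eqOn hgper
  obtain ⟨r₂, hr₂, hr₂₁, hfne⟩ := exists_ne_zero_strip hr₁ (hgd.congr hf).continuousOn hfper one_pos
    (fun x => by rw [hf (Strip.real_mem hr₁ x), hgre])
  have hsub : Strip r₂ ⊆ Strip r₁ := Strip.mono hr₂₁
  obtain ⟨G, k, hG, hGexp, hGper⟩ := exists_periodic_log hr₂ (hgd.mono hsub)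
    (fun z hz => hgper z (hsub hz)) (fun z hz => by rw [← hf (hsub hz)]; exact hfne z hz)
  set t : ℂ → ℂ := fun z => Complex.I * G z / 2 with ht
  have htd : DifferentiableOn ℂ t (Strip r₂) := (hG.const_mul _).div_const _
  have htre : ∀ x : ℝ, (t x).im = 0 := fun x => by
    have h1 := hgre x
    rw [← hGexp _ (Strip.real_mem hr₂ x), Complex.norm_exp, Real.exp_eq_one_iff] at h1
    simp [ht, h1]
  have htper : ∀ z ∈ Strip r₂, t (z + 1) = t z - k * π := fun z hz => by
    simp only [ht, hGper z hz]
    linear_combination (k * π) * Complex.I_mul_I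
  have hexp2 : ∀ z ∈ Strip r₂, Complex.exp (-(t z * Complex.I)) =
      Complex.exp (t z * Complex.I) * g z := fun z hz => by
    rw [← hGexp z hz, ← Complex.exp_add]
    congr 1
    simp only [ht]
    linear_combination (-G z) * Complex.I_mul_I
  have hcos : ∀ z ∈ Strip r₂, Complex.cos (t z) = Complex.exp (t z * Complex.I) * u z 0 := by
    intro z hz
    rw [Complex.cos, neg_mul, hexp2 z hz]
    have := hnorm z (hsub hz)
    simp only [hg]
    linear_combination (-Complex.exp (t z * Complex.I) / 2) * this
  have hsin : ∀ z ∈ Strip r₂, Complex.sin (t z) = Complex.exp (t z * Complex.I) * u z 1 := by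
    intro z hz
    rw [Complex.sin, neg_mul, hexp2 z hz]
    have := hnorm z (hsub hz)
    simp only [hg]
    linear_combination (Complex.I * Complex.exp (t z * Complex.I) / 2) * this -
      Complex.exp (t z * Complex.I) * u z 1 * Complex.I_mul_I
  set R : ℂ → M2 := fun z =>
      !![Complex.cos (t z), Complex.sin (t z); -Complex.sin (t z), Complex.cos (t z)]
    with hR
  have hRdet : ∀ z, (R z).det = 1 := fun z => by
    simp only [hR, Matrix.det_fin_two_of]
    linear_combination Complex.cos_sq_add_sin_sq (t z)
  obtain ⟨B, hB, hBR⟩ := exists_isPSL2Strip_of_local (ε := r₂) (B := R) (by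
      refine differentiableOn_matrix fun i j => ?_
      fin_cases i <;> fin_cases j
      · exact htd.ccos
      · exact htd.csin
      · exact htd.csin.neg
      · exact htd.ccos) (by
      refine ⟨((k.negOnePow : ℤ) : ℂ), ?_, fun z hz => ?_⟩
      · rcases Int.even_or_odd k with h | h
        · exact Or.inl (by simp [Int.negOnePow_even k h])
        · exact Or.inr (by simp [Int.negOnePow_odd k h])
      · have hc := Complex.cos_antiperiodic.sub_int_mul_eq k (x := t z)
        have hs := Complex.sin_antiperiodic.sub_int_mul_eq k (x := t z)
        simp only [hR, htper z hz, hc, hs]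
        ext i j
        fin_cases i <;> fin_cases j <;> simp) (by
      intro x i j
      have : (t x) = ((t x).re : ℂ) := (Complex.ext rfl (by simp [htre x]))
      fin_cases i <;> fin_cases j <;>
        simp only [hR, Matrix.of_apply, Matrix.cons_val', Matrix.cons_val_zero, Matrix.cons_val_one,
          Matrix.cons_val_fin_one, Fin.zero_eta, Fin.mk_one]
        <;> rw [this] <;> simp only [← Complex.ofReal_cos, ← Complex.ofReal_sin,
            ← Complex.ofReal_neg, Complex.ofReal_im])
      (fun z _ => hRdet z)
  set T : ℂ → M2 := fun z => B (z + α) * A z * (B z)⁻¹ with hT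
  have hBα : DifferentiableOn ℂ (fun z => B (z + α)) (Strip r₂) := hB.1.comp_add_real α
  have hinv : ∀ z ∈ Strip r₂, (B z)⁻¹ = (B z).adjugate := fun z hz =>
      M2.inv_eq_adjugate (hB.2.2.2 z hz)
  have hsub' : r₂ ≤ h := (hr₂₁.trans hr₁r).trans hrh
  have hTred : ApproxRed α (r₂ / 2) T := by
    refine ApproxRed.of_triangular hα (r := r₂) ?_ ?_ ?_ ?_ ?_ (half_pos hr₂) (half_lt_self hr₂)
    · exact (hBα.matrix_mul (hA.1.mono (Strip.mono hsub'))).matrix_mul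
        (hB.1.matrix_inv hB.2.2.2)
    · intro z hz
      obtain ⟨s, hs, hBs⟩ := hB.2.1
      have hs2 : s * s = 1 := by rcases hs with rfl | rfl <;> norm_num
      have e : z + 1 + α = z + α + 1 := by ring
      simp only [hT]
      rw [hinv _ (Strip.add_one.2 hz), hinv z hz, e, hBs, hBs, hA.2.1 z, Matrix.adjugate_smul]
      simp [smul_smul, hs2]
    · intro x i j
      have h1 := hB.2.2.1 (x + α)
      push_cast at h1
      have h2 := hB.2.2.1 x
      have h3 := hA.2.2.1 x
      simp only [hT]
      rw [hinv _ (Strip.real_mem hr₂ x), Matrix.adjugate_fin_two]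
      fin_cases i <;> fin_cases j <;>
        simp [Matrix.mul_apply, Complex.mul_im, h1, h2, h3]
    · intro z hz
      simp only [hT]
      rw [Matrix.det_mul, Matrix.det_mul, hB.2.2.2 _ ((Strip.add_real α).2 hz),
        hA.2.2.2 z (Strip.mono hsub' hz), hinv z hz, Matrix.det_adjugate, hB.2.2.2 z hz]
      simp
    · intro z hz
      have hzα := (Strip.add_real α).2 hz
      have h1 := hu.inv z (hsub hz)
      have h10 := congrFun h1 0
      have h11 := congrFun h1 1
      simp only [Matrix.mulVec, dotProduct, Fin.sum_univ_two, Pi.smul_apply, smul_eq_mul] at h10 h11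
      simp only [hT]
      rw [hinv z hz, hBR z hz, hBR _ hzα]
      simp only [hR, Matrix.adjugate_fin_two_of, Matrix.mul_apply, Fin.sum_univ_two,
          Matrix.of_apply,
        Matrix.cons_val', Matrix.cons_val_zero, Matrix.cons_val_one, Matrix.cons_val_fin_one,
        hcos z hz, hsin z hz, hcos _ hzα, hsin _ hzα]
      linear_combination (-Complex.exp (t (z + α) * Complex.I) * u (z + α) 1 *
        Complex.exp (t z * Complex.I)) * h10 + (Complex.exp (t (z + α) * Complex.I) * u (z + α) 0 *
        Complex.exp (t z * Complex.I)) * h11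
  refine ⟨r₂ / 2, half_pos hr₂, (half_le_self hr₂.le).trans (hr₂₁.trans hr₁r), ?_⟩
  have hm : Strip (r₂ / 2) ⊆ Strip r₂ := Strip.mono (half_le_self hr₂.le)
  exact ApproxRed.of_conj (B₀ := B) ⟨hB.1.mono hm, hB.2.1, hB.2.2.1, fun z hz => hB.2.2.2 z (hm hz)⟩
    (fun z _ => rfl) hTred

/-- Maximal logarithmic size of the `n`-th iterate on the line `Im z = y`. -/
def maxLog (α : ℝ) (A : ℂ → M2) (n : ℕ) (y : ℝ) : ℝ :=
  ⨆ x : ℝ, Real.log (2 * ‖cocycleIter α A n (x + y * Complex.I)‖)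

/-- Exponential growth rate of the cocycle on the line `Im z = y`. -/
def growth (α : ℝ) (A : ℂ → M2) (y : ℝ) : ℝ :=
  sInf ((fun n : ℕ => maxLog α A n y / n) '' Set.Ici 1)

lemma Strip.line_mem {h y : ℝ} (hy : |y| < h) (x : ℝ) : (x + y * Complex.I : ℂ) ∈ Strip h := by
  simpa [Strip] using hy

section Growth

variable {α h : ℝ} {A : ℂ → M2}

lemma IsCSL.one_le (hA : IsCSL h A) (n : ℕ) {z : ℂ} (hz : z ∈ Strip h) :
    1 ≤ 2 * ‖cocycleIter α A n z‖ :=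
  M2.one_le_two_mul_norm ((hA.iter α n).2.2 z hz)

lemma IsCSL.log_le_maxLog (hA : IsCSL h A) (n : ℕ) {y : ℝ} (hy : |y| < h) (x : ℝ) :
    Real.log (2 * ‖cocycleIter α A n (x + y * Complex.I)‖) ≤ maxLog α A n y := by
  obtain ⟨C, hC⟩ := exists_bound_strip (hA.iter α n).1.continuousOn (hA.iter α n).2.1 hy
  refine le_ciSup (f := fun x : ℝ => Real.log (2 * ‖cocycleIter α A n (x + y * Complex.I)‖))
    ⟨Real.log (2 * C), ?_⟩ x
  rintro _ ⟨x, rfl⟩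
  have h1 := hA.one_le (α := α) n (Strip.line_mem hy x)
  refine Real.log_le_log (by linarith) ?_
  have := hC (x + y * Complex.I) (by simp)
  linarith

lemma IsCSL.norm_le_exp_maxLog (hA : IsCSL h A) (n : ℕ) {z : ℂ} (hz : z ∈ Strip h) :
    2 * ‖cocycleIter α A n z‖ ≤ Real.exp (maxLog α A n z.im) := by
  have h1 := hA.one_le (α := α) n hz
  have h2 := hA.log_le_maxLog (α := α) n (y := z.im) hz z.re
  rw [Complex.re_add_im] at h2
  exact (Real.log_le_iff_le_exp (by linarith)).1 h2

lemma IsCSL.maxLog_le (hA : IsCSL h A) {n : ℕ} {y b : ℝ} (hy : |y| < h)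
    (hb : ∀ x : ℝ, 2 * ‖cocycleIter α A n (x + y * Complex.I)‖ ≤ Real.exp b) :
    maxLog α A n y ≤ b := by
  refine ciSup_le fun x => ?_
  have h1 := hA.one_le (α := α) n (Strip.line_mem hy x)
  exact (Real.log_le_iff_le_exp (by linarith)).2 (hb x)

lemma IsCSL.maxLog_nonneg (hA : IsCSL h A) (n : ℕ) {y : ℝ} (hy : |y| < h) :
    0 ≤ maxLog α A n y :=
  (Real.log_nonneg (hA.one_le n (Strip.line_mem hy 0))).trans (hA.log_le_maxLog n hy 0)

lemma IsCSL.maxLog_subadditive (hA : IsCSL h A) {y : ℝ} (hy : |y| < h) :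
    Subadditive fun n => maxLog α A n y := by
  intro m n
  refine hA.maxLog_le hy fun x => ?_
  rw [cocycleIter_add, Real.exp_add]
  have h1 := hA.norm_le_exp_maxLog (α := α) n (Strip.line_mem hy x)
  have h2 := hA.norm_le_exp_maxLog (α := α) m (Strip.line_mem hy (x + n * α))
  have e1 : ((x + y * Complex.I : ℂ)).im = y := by simp
  have e2 : (((x + n * α : ℝ) + y * Complex.I : ℂ)).im = y := by simp
  have e3 : ((x + n * α : ℝ) + y * Complex.I : ℂ) = x + y * Complex.I + n * α := by push_cast; ring
  rw [e1] at h1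
  rw [e2, e3] at h2
  calc 2 * ‖_ * _‖ ≤ 2 * (2 * ‖cocycleIter α A m (x + y * Complex.I + n * α)‖ *
        ‖cocycleIter α A n (x + y * Complex.I)‖) := by gcongr; exact M2.norm_mul_le _ _
    _ = (2 * ‖cocycleIter α A m (x + y * Complex.I + n * α)‖) *
        (2 * ‖cocycleIter α A n (x + y * Complex.I)‖) := by ring
    _ ≤ _ := by gcongr

lemma IsCSL.bddBelow (hA : IsCSL h A) {y : ℝ} (hy : |y| < h) :
    BddBelow (Set.range fun n : ℕ => maxLog α A n y / n) := by
  refine ⟨0, ?_⟩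
  rintro _ ⟨n, rfl⟩
  exact div_nonneg (hA.maxLog_nonneg n hy) (Nat.cast_nonneg n)

lemma IsCSL.tendsto_growth (hA : IsCSL h A) {y : ℝ} (hy : |y| < h) :
    Tendsto (fun n : ℕ => maxLog α A n y / n) atTop (nhds (growth α A y)) := by
  simpa only [Subadditive.lim, growth] using (hA.maxLog_subadditive (α := α) hy).tendsto_lim
      (hA.bddBelow hy)

lemma IsCSL.growth_le (hA : IsCSL h A) {y : ℝ} (hy : |y| < h) {n : ℕ} (hn : n ≠ 0) :
    growth α A y ≤ maxLog α A n y / n := by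
  simpa only [Subadditive.lim, growth] using (hA.maxLog_subadditive (α := α) hy).lim_le_div
      (hA.bddBelow hy) hn

lemma IsCSL.growth_nonneg (hA : IsCSL h A) {y : ℝ} (hy : |y| < h) : 0 ≤ growth α A y :=
  ge_of_tendsto' (hA.tendsto_growth hy) fun n =>
    div_nonneg (hA.maxLog_nonneg n hy) (Nat.cast_nonneg n)

lemma IsCSL.maxLog_eventually_le (hA : IsCSL h A) {y ε : ℝ} (hy : |y| < h) (hε : 0 < ε) :
    ∀ᶠ n : ℕ in atTop, maxLog α A n y ≤ n * (growth α A y + ε) := by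
  filter_upwards [(hA.tendsto_growth (α := α) hy).eventually
    (gt_mem_nhds (lt_add_of_pos_right _ hε)), eventually_gt_atTop 0] with n hn hn0
  have : (0 : ℝ) < n := by exact_mod_cast hn0
  rw [div_lt_iff₀ this] at hn
  linarith

lemma IsCSL.convexOn_maxLog (hA : IsCSL h A) (n : ℕ) :
    ConvexOn ℝ (Set.Ioo (-h) h) (maxLog α A n) := by
  refine LinearOrder.convexOn_of_lt (convex_Ioo _ _) ?_
  intro y₁ hy₁ y₂ hy₂ hlt a b ha hb hab
  have hy₁' : |y₁| < h := abs_lt.2 hy₁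
  have hy₂' : |y₂| < h := abs_lt.2 hy₂
  have hmid : |a * y₁ + b * y₂| < h := abs_lt.2 ((convex_Ioo (-h) h) hy₁ hy₂ ha.le hb.le hab)
  simp only [smul_eq_mul]
  refine hA.maxLog_le hmid fun x => ?_
  have hIoo : Set.Icc y₁ y₂ ⊆ Set.Ioo (-h) h := fun t ht =>
      ⟨hy₁.1.trans_le ht.1, ht.2.trans_lt hy₂.2⟩
  have hmem : ∀ w : ℂ, w ∈ Complex.HadamardThreeLines.verticalClosedStrip y₁ y₂ →
      x + Complex.I * w ∈ Strip h := by
    intro w hw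
    have := hIoo hw
    simpa [Strip, abs_lt] using this
  set f : ℂ → M2 := fun w => (2 : ℂ) • cocycleIter α A n (x + Complex.I * w) with hf
  have hnf : ∀ w, ‖f w‖ = 2 * ‖cocycleIter α A n (x + Complex.I * w)‖ := fun w => by
    simp [hf, norm_smul]
  have hd : ∀ w ∈ Complex.HadamardThreeLines.verticalClosedStrip y₁ y₂, DifferentiableAt ℂ f w := by
    intro w hw
    have h1 := (hA.iter α n).1.differentiableAt ((Strip.isOpen h).mem_nhds (hmem w hw))
    exact (h1.comp w (f := fun w => (x : ℂ) + Complex.I * w) (by fun_prop)).const_smul (2 : ℂ)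
  have hbound : ∀ w ∈ Complex.HadamardThreeLines.verticalClosedStrip y₁ y₂,
      ‖f w‖ ≤ Real.exp (maxLog α A n w.re) := fun w hw => by
    have := hA.norm_le_exp_maxLog (α := α) n (hmem w hw)
    simpa [hnf] using this
  have hsub : closure (Complex.HadamardThreeLines.verticalStrip y₁ y₂) ⊆
      Complex.HadamardThreeLines.verticalClosedStrip y₁ y₂ :=
    closure_minimal (Set.preimage_mono Set.Ioo_subset_Icc_self)
      (isClosed_Icc.preimage Complex.continuous_re)
  have hdc : DiffContOnCl ℂ f (Complex.HadamardThreeLines.verticalStrip y₁ y₂) :=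
    ⟨fun w hw => (hd w (hsub (subset_closure hw))).differentiableWithinAt,
      fun w hw => (hd w (hsub hw)).continuousAt.continuousWithinAt⟩
  have hbdd : BddAbove ((norm ∘ f) '' Complex.HadamardThreeLines.verticalClosedStrip y₁ y₂) := by
    obtain ⟨C, hC⟩ := exists_bound_strip (r' := max |y₁| |y₂|) (hA.iter α n).1.continuousOn
      (hA.iter α n).2.1 (max_lt hy₁' hy₂')
    refine ⟨2 * C, ?_⟩
    rintro _ ⟨w, hw, rfl⟩
    have hw' : w.re ∈ Set.Icc y₁ y₂ := hw
    have := hC (x + Complex.I * w) (by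
      simpa using abs_le_max_abs_abs hw'.1 hw'.2)
    simp only [Function.comp_apply, hnf]
    linarith
  have hw₀m : ((a * y₁ + b * y₂ : ℝ) : ℂ) ∈ Complex.HadamardThreeLines.verticalClosedStrip y₁ y₂ :=
    (convex_Icc y₁ y₂) (Set.left_mem_Icc.2 hlt.le) (Set.right_mem_Icc.2 hlt.le) ha.le hb.le hab
  have key :=
      Complex.HadamardThreeLines.norm_le_interp_of_mem_verticalClosedStrip' hlt hw₀m hdc hbdd
    (a := Real.exp (maxLog α A n y₁)) (b := Real.exp (maxLog α A n y₂))
    (fun w hw => by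
      have hw' : w.re = y₁ := hw
      have := hbound w (by
        show w.re ∈ Set.Icc y₁ y₂
        rw [hw']; exact Set.left_mem_Icc.2 hlt.le)
      rwa [hw'] at this)
    (fun w hw => by
      have hw' : w.re = y₂ := hw
      have := hbound w (by
        show w.re ∈ Set.Icc y₁ y₂
        rw [hw']; exact Set.right_mem_Icc.2 hlt.le)
      rwa [hw'] at this)
  have ht : (((a * y₁ + b * y₂ : ℝ) : ℂ).re - y₁) / (y₂ - y₁) = b := by
    rw [Complex.ofReal_re, div_eq_iff (sub_pos.2 hlt).ne']
    linear_combination y₁ * hab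
  rw [ht, hnf, ← Real.exp_mul, ← Real.exp_mul, ← Real.exp_add] at key
  have e : (x : ℂ) + ((a * y₁ + b * y₂ : ℝ) : ℂ) * Complex.I =
      x + Complex.I * ((a * y₁ + b * y₂ : ℝ) : ℂ) := by ring
  rw [e]
  refine key.trans (le_of_eq ?_)
  congr 1
  linear_combination (-maxLog α A n y₁) * hab

lemma IsCSL.convexOn_growth (hA : IsCSL h A) : ConvexOn ℝ (Set.Ioo (-h) h) (growth α A) := by
  refine ⟨convex_Ioo _ _, fun y₁ hy₁ y₂ hy₂ a b ha hb hab => ?_⟩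
  have hmid := (convex_Ioo (-h) h) hy₁ hy₂ ha hb hab
  refine le_of_tendsto_of_tendsto' (hA.tendsto_growth (abs_lt.2 hmid))
    (((hA.tendsto_growth (abs_lt.2 hy₁)).const_mul a).add
      ((hA.tendsto_growth (abs_lt.2 hy₂)).const_mul b)) fun n => ?_
  have := (hA.convexOn_maxLog (α := α) n).2 hy₁ hy₂ ha hb hab
  simp only [smul_eq_mul] at this ⊢
  rw [mul_div_assoc', mul_div_assoc', ← add_div]
  gcongr

lemma IsCSL.growth_lipschitz (hA : IsCSL h A) (hh : 0 < h) {s : ℝ}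
    (hs : ∀ y, |y| < h → growth α A y ≤ s)
    {y y' : ℝ} (hy : |y| ≤ h / 2) (hy' : |y'| ≤ h / 2) :
    growth α A y' - growth α A y ≤ 4 * s / h * |y' - y| := by
  have hs0 : 0 ≤ s := (hA.growth_nonneg (α := α) (y := 0) (by simpa)).trans (hs 0 (by simpa))
  have h1 := abs_le.1 hy
  have h2 := abs_le.1 hy'
  have mem : ∀ t : ℝ, |t| ≤ 3 * h / 4 → t ∈ Set.Ioo (-h) h := fun t ht => by
    have := abs_le.1 ht
    constructor <;> linarith [this.1, this.2]
  have key : ∀ b : ℝ, |b| = 3 * h / 4 → h / 4 ≤ |b - y'| →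
      (growth α A y' - growth α A y) * |b - y'| ≤ s * |y' - y| →
      growth α A y' - growth α A y ≤ 4 * s / h * |y' - y| := by
    intro b _ hb2 hb3
    by_cases hle : growth α A y' - growth α A y ≤ 0
    · exact hle.trans (by positivity)
    · push Not at hle
      have : (growth α A y' - growth α A y) * (h / 4) ≤ s * |y' - y| :=
        (mul_le_mul_of_nonneg_left hb2 hle.le).trans hb3
      have e : 4 * s / h * |y' - y| = (s * |y' - y|) / (h / 4) := by field_simp
      rw [e, le_div_iff₀ (by positivity)]
      exact this
  have upper : ∀ b : ℝ, |b| = 3 * h / 4 → growth α A b - growth α A y' ≤ s := fun b hb => by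
    have h1 := hs b (by linarith)
    have h2 := hA.growth_nonneg (α := α) (y := y') (by linarith)
    linarith
  rcases lt_trichotomy y y' with hlt | heq | hlt
  · have hb : |3 * h / 4| = 3 * h / 4 := abs_of_pos (by positivity)
    have hb' : 0 < 3 * h / 4 - y' := by linarith [h2.2]
    refine key (3 * h / 4) hb (by rw [abs_of_pos hb']; linarith [h2.2]) ?_
    have := (hA.convexOn_growth (α := α)).slope_mono_adjacent (mem y (by linarith))
      (mem _ hb.le) hlt (sub_pos.1 hb')
    rw [div_le_div_iff₀ (sub_pos.2 hlt) hb'] at this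
    rw [abs_of_pos hb', abs_of_pos (sub_pos.2 hlt)]
    exact this.trans (mul_le_mul_of_nonneg_right (upper _ hb) (sub_pos.2 hlt).le)
  · simp [heq]
  · have hb : |-(3 * h / 4)| = 3 * h / 4 := by rw [abs_neg, abs_of_pos (by positivity)]
    have hb' : -(3 * h / 4) - y' < 0 := by linarith [h2.1]
    refine key (-(3 * h / 4)) hb (by rw [abs_of_neg hb']; linarith [h2.1]) ?_
    have := (hA.convexOn_growth (α := α)).slope_mono_adjacent (mem _ hb.le) (mem y (by linarith))
      (sub_neg.1 hb') hlt
    rw [div_le_div_iff₀ (by linarith) (sub_pos.2 hlt)] at this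
    rw [abs_of_neg hb', abs_of_neg (sub_neg.2 hlt)]
    have := mul_le_mul_of_nonneg_right (upper _ hb) (sub_pos.2 hlt).le
    nlinarith

end Growth

lemma cocycleIter_conj {α y : ℝ} {A R C : ℂ → M2}
    (hC : ∀ z : ℂ, z.im = y → R (z + α) * A z = C z * R z) (n : ℕ) :
    ∀ z : ℂ, z.im = y → R (z + n * α) * cocycleIter α A n z = cocycleIter α C n z * R z := by
  induction n with
  | zero => intro z _; simp [cocycleIter]
  | succ n ih =>
    intro z hz
    have h1 := hC (z + n * α) (by simpa using hz)
    have e : z + ((n + 1 : ℕ) : ℂ) * α = z + n * α + α := by push_cast; ring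
    simp only [cocycleIter]
    rw [e, ← mul_assoc, h1, mul_assoc, ih z hz, mul_assoc]

lemma triangular_iter_bounds {α y b δ : ℝ} {C : ℂ → M2} (hδ : 0 ≤ δ)
    (h10 : ∀ z : ℂ, z.im = y → C z 1 0 = 0) (h01 : ∀ z : ℂ, z.im = y → ‖C z 0 1‖ ≤ δ)
    (h00 : ∀ z : ℂ, z.im = y → Real.exp (b - δ) ≤ ‖C z 0 0‖ ∧ ‖C z 0 0‖ ≤ Real.exp (b + δ))
    (h11 : ∀ z : ℂ, z.im = y → Real.exp (-b - δ) ≤ ‖C z 1 1‖ ∧ ‖C z 1 1‖ ≤ Real.exp (-b + δ))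
    (n : ℕ) {z : ℂ} (hz : z.im = y) :
    Real.exp (n * (|b| - 2 * δ)) ≤ ‖cocycleIter α C n z‖ ∧
      ‖cocycleIter α C n z‖ ≤ Real.exp (n * (|b| + 2 * δ)) := by
  have hiter : ∀ n : ℕ, cocycleIter α C n z 1 0 = 0 ∧
      Real.exp (n * (b - δ)) ≤ ‖cocycleIter α C n z 0 0‖ ∧
      Real.exp (n * (-b - δ)) ≤ ‖cocycleIter α C n z 1 1‖ ∧
      ∀ i j, ‖cocycleIter α C n z i j‖ ≤ Real.exp (n * (|b| + 2 * δ)) := by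
    intro n
    induction n with
    | zero =>
      refine ⟨by simp [cocycleIter], by simp [cocycleIter], by simp [cocycleIter], fun i j => ?_⟩
      fin_cases i <;> fin_cases j <;> simp [cocycleIter]
    | succ n ih =>
      obtain ⟨i1, i2, i3, i4⟩ := ih
      have hz' : (z + (n : ℂ) * α).im = y := by simpa using hz
      have g10 := h10 _ hz'
      have g01 := h01 _ hz'
      have g00 := h00 _ hz'
      have g11 := h11 _ hz'
      have hsucc : ∀ x : ℝ, Real.exp (((n + 1 : ℕ) : ℝ) * x) = Real.exp x * Real.exp (n * x) := by
        intro x; rw [← Real.exp_add]; congr 1; push_cast; ring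
      have hb := neg_le_abs b
      have hb' := le_abs_self b
      have hb0 := abs_nonneg b
      have hrow : Real.exp (|b| + δ) + δ ≤ Real.exp (|b| + 2 * δ) := by
        have e : |b| + 2 * δ = δ + (|b| + δ) := by ring
        rw [e, Real.exp_add δ]
        have h1 := Real.add_one_le_exp δ
        have h2 : 1 ≤ Real.exp (|b| + δ) := Real.one_le_exp (by positivity)
        nlinarith
      have k00 : ‖C (z + (n : ℂ) * α) 0 0‖ ≤ Real.exp (|b| + δ) :=
        g00.2.trans (Real.exp_le_exp.2 (by linarith))
      have k11 : ‖C (z + (n : ℂ) * α) 1 1‖ ≤ Real.exp (|b| + δ) :=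
        g11.2.trans (Real.exp_le_exp.2 (by linarith))
      refine ⟨?_, ?_, ?_, ?_⟩
      · simp [cocycleIter, Matrix.mul_apply, Fin.sum_univ_two, g10, i1]
      · simp only [cocycleIter, Matrix.mul_apply, Fin.sum_univ_two, i1, mul_zero, add_zero,
          norm_mul]
        rw [hsucc]
        exact mul_le_mul g00.1 i2 (Real.exp_pos _).le (norm_nonneg _)
      · simp only [cocycleIter, Matrix.mul_apply, Fin.sum_univ_two, g10, zero_mul, zero_add,
          norm_mul]
        rw [hsucc]
        exact mul_le_mul g11.1 i3 (Real.exp_pos _).le (norm_nonneg _)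
      · intro i j
        simp only [cocycleIter, Matrix.mul_apply, Fin.sum_univ_two]
        rw [hsucc]
        have hi : ‖C (z + (n : ℂ) * α) i 0‖ + ‖C (z + (n : ℂ) * α) i 1‖ ≤
            Real.exp (|b| + 2 * δ) := by
          fin_cases i
          · simp only [Fin.zero_eta]; linarith
          · simp only [Fin.mk_one, g10, norm_zero]; linarith
        calc _ ≤ ‖C (z + (n : ℂ) * α) i 0‖ * ‖cocycleIter α C n z 0 j‖ +
              ‖C (z + (n : ℂ) * α) i 1‖ * ‖cocycleIter α C n z 1 j‖ := by
              rw [← norm_mul, ← norm_mul]; exact norm_add_le _ _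
          _ ≤ ‖C (z + (n : ℂ) * α) i 0‖ * Real.exp (n * (|b| + 2 * δ)) +
              ‖C (z + (n : ℂ) * α) i 1‖ * Real.exp (n * (|b| + 2 * δ)) := by
              gcongr <;> exact i4 _ _
          _ ≤ _ := by rw [← add_mul]; gcongr
  obtain ⟨_, i2, i3, i4⟩ := hiter n
  refine ⟨?_, (Matrix.norm_le_iff (Real.exp_pos _).le).2 i4⟩
  have hn : (0 : ℝ) ≤ n := Nat.cast_nonneg n
  rcases abs_cases b with ⟨hb, _⟩ | ⟨hb, _⟩
  · exact (Real.exp_le_exp.2 (mul_le_mul_of_nonneg_left (by linarith) hn)).trans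
      (i2.trans (Matrix.norm_entry_le_entrywise_sup_norm _))
  · exact (Real.exp_le_exp.2 (mul_le_mul_of_nonneg_left (by linarith) hn)).trans
      (i3.trans (Matrix.norm_entry_le_entrywise_sup_norm _))

lemma IsCSL.growth_near {α h y L δ K : ℝ} {A : ℂ → M2} (hA : IsCSL h A) (hy : |y| < h)
    (hK : ∀ n : ℕ, |maxLog α A n y - n * L| ≤ K + n * δ) : |growth α A y - L| ≤ δ := by
  have h1 : Tendsto (fun n : ℕ => |maxLog α A n y / n - L|) atTop (nhds |growth α A y - L|) :=
    ((hA.tendsto_growth hy).sub_const L).abs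
  have h2 : Tendsto (fun n : ℕ => K / (n : ℝ) + δ) atTop (nhds (0 + δ)) :=
    (tendsto_const_div_atTop_nhds_zero_nat K).add_const δ
  rw [zero_add] at h2
  refine le_of_tendsto_of_tendsto h1 h2 ?_
  filter_upwards [eventually_gt_atTop 0] with n hn
  have hn' : (0 : ℝ) < n := by exact_mod_cast hn
  have e : maxLog α A n y / n - L = (maxLog α A n y - n * L) / n := by field_simp
  rw [e, abs_div, abs_of_pos hn', div_le_iff₀ hn']
  refine (hK n).trans (le_of_eq ?_)
  field_simp

lemma IsCSL.growth_near_of_conj {α h y b δ K : ℝ} {A R C : ℂ → M2} (hA : IsCSL h A) (hy : |y| < h)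
    (hδ : 0 ≤ δ) (hR : ∀ z : ℂ, z.im = y → ‖R z‖ ≤ K ∧ (R z).det = 1)
    (hC : ∀ z : ℂ, z.im = y → R (z + α) * A z = C z * R z)
    (h10 : ∀ z : ℂ, z.im = y → C z 1 0 = 0) (h01 : ∀ z : ℂ, z.im = y → ‖C z 0 1‖ ≤ δ)
    (h00 : ∀ z : ℂ, z.im = y → Real.exp (b - δ) ≤ ‖C z 0 0‖ ∧ ‖C z 0 0‖ ≤ Real.exp (b + δ))
    (h11 : ∀ z : ℂ, z.im = y → Real.exp (-b - δ) ≤ ‖C z 1 1‖ ∧ ‖C z 1 1‖ ≤ Real.exp (-b + δ)) :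
    abs (growth α A y - |b|) ≤ 2 * δ := by
  have hy0 : ((y : ℂ) * Complex.I).im = y := by simp
  have hK1 : 1 ≤ 2 * K := (M2.one_le_two_mul_norm (hR _ hy0).2).trans
    (by linarith [(hR _ hy0).1])
  have hK0 : 0 ≤ K := by linarith
  have hcomm := cocycleIter_conj hC
  refine hA.growth_near (K := Real.log (8 * K ^ 2)) hy fun n => ?_
  have hpos : 0 < 8 * K ^ 2 := by nlinarith
  have hup : maxLog α A n y ≤ Real.log (8 * K ^ 2) + n * (|b| + 2 * δ) := by
    refine hA.maxLog_le hy fun x => ?_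
    have hz : (x + y * Complex.I : ℂ).im = y := by simp
    have hz' : (x + y * Complex.I + n * α : ℂ).im = y := by simp
    generalize (x + y * Complex.I : ℂ) = z at *
    have h1 := hcomm n z hz
    have h2 := (hR _ hz').2
    have e : cocycleIter α A n z = (R (z + n * α))⁻¹ * (cocycleIter α C n z * R z) := by
      rw [← h1, ← mul_assoc, Matrix.nonsing_inv_mul _ (by simp [h2]), one_mul]
    rw [Real.exp_add, Real.exp_log hpos, e]
    have hb := (triangular_iter_bounds (α := α) hδ h10 h01 h00 h11 n hz).2
    calc 2 * ‖_ * _‖ ≤ 2 * (2 * K * (2 * Real.exp (n * (|b| + 2 * δ)) * K)) := by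
          gcongr
          refine (M2.norm_mul_le _ _).trans ?_
          rw [M2.norm_inv h2]
          gcongr
          · exact (hR _ hz').1
          · refine (M2.norm_mul_le _ _).trans ?_
            gcongr
            exact (hR _ hz).1
      _ = _ := by ring
  have hlow : n * (|b| - 2 * δ) ≤ Real.log (8 * K ^ 2) + maxLog α A n y := by
    have h1 := hcomm n _ hy0
    have hz' : (y * Complex.I + n * α : ℂ).im = y := by simp
    have hs : ((y : ℂ) * Complex.I) ∈ Strip h := by simpa [Strip] using hy
    have hA' := hA.norm_le_exp_maxLog (α := α) n hs
    have hb := (triangular_iter_bounds (α := α) hδ h10 h01 h00 h11 n hy0).1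
    rw [hy0] at hA'
    generalize ((y : ℂ) * Complex.I) = z at *
    have e : cocycleIter α C n z = R (z + n * α) * cocycleIter α A n z * (R z)⁻¹ := by
      rw [h1, mul_assoc, Matrix.mul_nonsing_inv _ (by simp [(hR _ hy0).2]), mul_one]
    rw [← Real.exp_le_exp, Real.exp_add, Real.exp_log hpos]
    refine hb.trans ?_
    rw [e]
    calc ‖R (z + n * α) * cocycleIter α A n z * (R z)⁻¹‖ ≤ 2 * (2 * K * ‖cocycleIter α A n z‖) *
        K := by
          refine (M2.norm_mul_le _ _).trans ?_
          rw [M2.norm_inv (hR _ hy0).2]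
          gcongr
          · refine (M2.norm_mul_le _ _).trans ?_
            gcongr
            exact (hR _ hz').1
          · exact (hR _ hy0).1
      _ = 2 * K ^ 2 * (2 * ‖cocycleIter α A n z‖) := by ring
      _ ≤ 8 * K ^ 2 * Real.exp (maxLog α A n y) := by
        refine mul_le_mul ?_ hA' (by positivity) hpos.le
        nlinarith
  rw [abs_le]
  constructor <;> linarith

/-- A unimodular frame whose first column is a given vector. -/
def frame (t : ℂ) (v : V2) : M2 := !![v 0, -t; v 1, 1]

lemma frame_det {t : ℂ} {v : V2} (hv : pair ![1, t] v = 1) : (frame t v).det = 1 := by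
  simp only [frame, Matrix.det_fin_two_of]
  simp [pair] at hv
  linear_combination hv

/-- A cocycle in the frame of an invariant section is triangular. -/
lemma frame_conj {t l : ℂ} {v w : V2} {M : M2} (hv : pair ![1, t] v = 1) (hw : pair ![1, t] w = 1)
    (hM : M.det = 1) (h : M.mulVec v = l • w) :
    ((frame t w)⁻¹ * M * frame t v) 0 0 = l ∧ ((frame t w)⁻¹ * M * frame t v) 1 0 = 0 ∧
      ((frame t w)⁻¹ * M * frame t v) 1 1 = l⁻¹ := by
  have h0 := congrFun h 0
  have h1 := congrFun h 1
  simp only [Matrix.mulVec, dotProduct, Fin.sum_univ_two, Pi.smul_apply, smul_eq_mul] at h0 h1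
  have hw' : w 0 + t * w 1 = 1 := by simpa [pair] using hw
  have a1 : ((frame t w)⁻¹ * M * frame t v) 0 0 = l := by
    rw [M2.inv_eq_adjugate (frame_det hw)]
    simp only [frame, Matrix.adjugate_fin_two_of, Matrix.mul_apply, Fin.sum_univ_two]
    simp
    linear_combination h0 + t * h1 + l * hw'
  have a2 : ((frame t w)⁻¹ * M * frame t v) 1 0 = 0 := by
    rw [M2.inv_eq_adjugate (frame_det hw)]
    simp only [frame, Matrix.adjugate_fin_two_of, Matrix.mul_apply, Fin.sum_univ_two]
    simp
    linear_combination (-w 1) * h0 + w 0 * h1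
  refine ⟨a1, a2, ?_⟩
  have hdet : ((frame t w)⁻¹ * M * frame t v).det = 1 := by
    simp [Matrix.det_mul, Matrix.det_nonsing_inv, frame_det hw, frame_det hv, hM]
  rw [Matrix.det_fin_two, a1, a2, mul_zero, sub_zero] at hdet
  exact eq_inv_of_mul_eq_one_right hdet

lemma InvSection.growth_affine {α r : ℝ} {A : ℂ → M2} {t : ℂ} {u : ℂ → V2} {lam : ℂ → ℂ}
    (hα : Irrational α) (hA : IsCSL r A) (hr : 0 < r) (h : InvSection α r A ![1, t] u lam) :
    ∃ k : ℤ, ∀ δ : ℝ, 0 < δ → ∃ a : ℝ, ∀ y : ℝ, |y| < r / 2 →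
      abs (growth α A y - |a - 2 * π * k * y|) ≤ 2 * δ := by
  set P : ℂ → M2 := fun z => frame t (u z) with hP
  have hadd : ∀ z ∈ Strip r, z + (α : ℂ) ∈ Strip r := fun z hz => (Strip.add_real α).2 hz
  have hPdet : ∀ z ∈ Strip r, (P z).det = 1 := fun z hz => frame_det (h.norm z hz)
  have hPd : DifferentiableOn ℂ P (Strip r) := by
    have hu := differentiableOn_pi.1 h.diff
    refine differentiableOn_matrix fun i j => ?_
    fin_cases i <;> fin_cases j
    · exact hu 0
    · exact differentiableOn_const _
    · exact hu 1
    · exact differentiableOn_const _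
  have hPper : ∀ z ∈ Strip r, P (z + 1) = P z := fun z hz => by simp only [hP, h.per z hz]
  set T : ℂ → M2 := fun z => (P (z + α))⁻¹ * A z * P z with hT
  have hTd : DifferentiableOn ℂ T (Strip r) :=
    (((hPd.comp_add_real α).matrix_inv fun z hz => hPdet _ (hadd z hz)).matrix_mul hA.1).matrix_mul
        hPd
  have hTper : ∀ z ∈ Strip r, T (z + 1) = T z := fun z hz => by
    simp only [hT, hPper z hz, hA.2.1]
    rw [add_right_comm, hPper _ (hadd z hz)]
  have hTe : ∀ z ∈ Strip r, T z 0 0 = lam z ∧ T z 1 0 = 0 ∧ T z 1 1 = (lam z)⁻¹ := fun z hz =>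
    frame_conj (h.norm z hz) (h.norm _ (hadd z hz)) (hA.2.2 z hz) (h.inv z hz)
  obtain ⟨G, k, hG, hexp, hGper⟩ := exists_periodic_log hr h.diff' h.per' h.ne
  refine ⟨k, fun δ hδ => ?_⟩
  obtain ⟨ψ, c, τ, hτ, hψ, hψper, -, -, hmain⟩ := exists_triangular_conj (r' := r / 2) hα hG hGper
    (hTd.matrix_entry 0 1) (fun z hz => by rw [hTper z hz]) (by linarith) (by linarith) hδ
  refine ⟨c.re, fun y hy => ?_⟩
  set q : ℂ → ℂ := fun z => τ * Complex.exp (ψ z) with hq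
  have hqne : ∀ z, q z ≠ 0 := fun z =>
    mul_ne_zero (by exact_mod_cast hτ.ne') (Complex.exp_ne_zero _)
  have hqd : DifferentiableOn ℂ q (Strip r) := hψ.cexp.const_mul _
  set R : ℂ → M2 := fun z => dg (q z) * (P z)⁻¹ with hR
  have hRd : DifferentiableOn ℂ R (Strip r) :=
    (differentiableOn_dg hqd fun z _ => hqne z).matrix_mul (hPd.matrix_inv hPdet)
  have hRper : ∀ z ∈ Strip r, R (z + 1) = R z := fun z hz => by
    simp only [hR, hq, hPper z hz, hψper]
  obtain ⟨R', hR', hR'per⟩ := exists_periodic_eqOn hRper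
  obtain ⟨K, hK⟩ := exists_bound_strip (r' := r / 2) (hRd.congr hR').continuousOn hR'per
    (by linarith)
  have hmem : ∀ z : ℂ, z.im = y → z ∈ Strip (r / 2) := fun z hz => by
    show |z.im| < _
    rwa [hz]
  have hmem' : ∀ z : ℂ, z.im = y → z ∈ Strip r := fun z hz =>
    Strip.mono (by linarith) (hmem z hz)
  have hCe : ∀ z : ℂ, z.im = y → dg (q (z + α)) * T z * (dg (q z))⁻¹ =
      !![q (z + α) * lam z * (q z)⁻¹, q (z + α) * T z 0 1 * q z; 0,
        (q (z + α))⁻¹ * (lam z)⁻¹ * q z] := fun z hz => by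
    obtain ⟨h00, h10, h11⟩ := hTe z (hmem' z hz)
    rw [dg_conj (hqne z) _ h10, h00, h11]
  have hquot : ∀ z : ℂ, z.im = y →
      abs (Real.log ‖q (z + α) * lam z * (q z)⁻¹‖ - (c.re - 2 * π * k * y)) ≤ δ := fun z hz => by
    have e : q (z + α) * lam z * (q z)⁻¹ = Complex.exp (G z + (ψ (z + α) - ψ z)) := by
      have hτ' : (τ : ℂ) ≠ 0 := by exact_mod_cast hτ.ne'
      rw [Complex.exp_add, Complex.exp_sub, hexp z (hmem' z hz)]
      simp only [hq]
      field_simp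
    rw [e, Complex.norm_exp, Real.log_exp]
    have h1 := (hmain z (hmem z hz)).1
    have h2 := (Complex.abs_re_le_norm _).trans h1
    have h3 : (k * (2 * π * Complex.I) * z).re = -(2 * π * k * y) := by
      have e : (k * (2 * π * Complex.I) * z : ℂ) = ((2 * π * k : ℝ) : ℂ) * (Complex.I * z) := by
        push_cast; ring
      rw [e, Complex.re_ofReal_mul, ← hz]
      simp
    rw [Complex.sub_re, Complex.add_re, Complex.sub_re, h3] at h2
    rw [Complex.add_re]
    refine le_of_eq_of_le ?_ h2
    congr 1; ring
  have hlamne : ∀ z : ℂ, z.im = y → 0 < ‖q (z + α) * lam z * (q z)⁻¹‖ := fun z hz =>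
    norm_pos_iff.2 (mul_ne_zero (mul_ne_zero (hqne _) (h.ne z (hmem' z hz))) (inv_ne_zero (hqne _)))
  refine hA.growth_near_of_conj (R := R) (C := fun z => dg (q (z + α)) * T z * (dg (q z))⁻¹)
    (K := K) (by linarith) hδ.le ?_ ?_ ?_ ?_ ?_ ?_
  · intro z hz
    have hz' := hmem' z hz
    refine ⟨?_, ?_⟩
    · rw [← hR' hz']
      exact hK z (by rw [hz]; exact hy.le)
    · simp only [hR]
      simp [Matrix.det_mul, Matrix.det_nonsing_inv, dg_det (hqne z), hPdet z hz']
  · intro z hz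
    have hz' := hmem' z hz
    have d1 : IsUnit (P z).det := by simp [hPdet z hz']
    have d2 : IsUnit (dg (q z)).det := by simp [dg_det (hqne z)]
    simp only [hR, hT]
    simp only [mul_assoc]
    rw [← mul_assoc (dg (q z))⁻¹, Matrix.nonsing_inv_mul _ d2, one_mul, Matrix.mul_nonsing_inv _ d1,
      mul_one]
  · intro z hz
    simp [hCe z hz]
  · intro z hz
    rw [hCe z hz]
    simpa [hq, mul_assoc] using (hmain z (hmem z hz)).2
  · intro z hz
    have := abs_le.1 (hquot z hz)
    have hent : (dg (q (z + α)) * T z * (dg (q z))⁻¹) 0 0 = q (z + α) * lam z * (q z)⁻¹ := by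
      rw [hCe z hz]; rfl
    rw [hent, ← Real.le_log_iff_exp_le (hlamne z hz), ← Real.log_le_iff_le_exp (hlamne z hz)]
    constructor <;> linarith
  · intro z hz
    have := abs_le.1 (hquot z hz)
    have e : (q (z + α))⁻¹ * (lam z)⁻¹ * q z = (q (z + α) * lam z * (q z)⁻¹)⁻¹ := by
      rw [mul_inv _ (q z)⁻¹, mul_inv _ (lam z), inv_inv]
    have hent : (dg (q (z + α)) * T z * (dg (q z))⁻¹) 1 1 = (q (z + α))⁻¹ * (lam z)⁻¹ * q z := by
      rw [hCe z hz]; rfl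
    have hl : 0 < ‖(q (z + α) * lam z * (q z)⁻¹)⁻¹‖ := by
      rw [norm_inv]; exact inv_pos.2 (hlamne z hz)
    have hlog : Real.log ‖(q (z + α) * lam z * (q z)⁻¹)⁻¹‖ =
      -Real.log ‖q (z + α) * lam z * (q z)⁻¹‖ := by rw [norm_inv, Real.log_inv]
    rw [hent, e, ← Real.le_log_iff_exp_le hl, ← Real.log_le_iff_le_exp hl, hlog]
    constructor <;> linarith

section Shift

variable {α r θ y : ℝ} {A : ℂ → M2} {n : ℕ}

lemma AP.shift (h : AP α r A n θ) (y : ℝ) :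
    AP α (r - |y|) (fun z => A (z + (y : ℂ) * Complex.I)) n θ where
  pos := h.pos
  le_one := h.le_one
  angle z hz := by
    simp only [cocycleIter_shift]
    have := h.angle _ (Strip.mem_shift hz)
    rwa [add_right_comm] at this
  big z hz := by
    simp only [cocycleIter_shift]
    exact h.big _ (Strip.mem_shift hz)

lemma lineE_shift (w z : ℂ) : lineE α (fun z => A (z + w)) n z = lineE α A n (z + w) := by
  ext v
  simp only [lineE, cocycleIter_shift, sub_add_eq_add_sub]

lemma maxLog_shift (y y' : ℝ) :
    maxLog α (fun z => A (z + (y : ℂ) * Complex.I)) n y' = maxLog α A n (y + y') := by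
  simp only [maxLog, cocycleIter_shift]
  congr 1
  ext x
  congr 4
  push_cast; ring

lemma growth_shift (y y' : ℝ) :
    growth α (fun z => A (z + (y : ℂ) * Complex.I)) y' = growth α A (y + y') := by
  simp only [growth, maxLog_shift]

end Shift

/-- Near a dominated line, the growth rate is locally constant as soon as it is a contraction. -/
lemma AP.growth_const {α r θ η : ℝ} {A : ℂ → M2} {n : ℕ} (h : AP α r A n θ) (hα : Irrational α)
    (hA : IsCSL r A) (hη : 0 < η) (hηr : η ≤ r)
    (hLip : ∀ y y' : ℝ, |y| < r → |y'| < r → growth α A y' - growth α A y ≤ |y' - y|) :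
    ∃ y₁ : ℝ, 0 < y₁ ∧ y₁ < η ∧ ∃ ρ : ℝ, 0 < ρ ∧ ∀ y : ℝ, |y - y₁| < ρ →
      growth α A y = growth α A y₁ := by
  obtain ⟨t, y₁, hy0, hyη, hline⟩ := h.exists_good_line hA hη hηr
  refine ⟨y₁, hy0, hyη, ?_⟩
  have hy1 : |y₁| = y₁ := abs_of_pos hy0
  have hA' := hA.shift y₁
  have h' := h.shift y₁
  have hr1 : 0 < r - |y₁| := by rw [hy1]; linarith
  obtain ⟨r', hr', hr'r, u, lam, hinv, -⟩ := h'.invSection hA' hr1 ![1, t] (by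
    intro x v hv
    rw [lineE_shift] at hv
    exact hline x v hv)
  obtain ⟨k, hk⟩ := hinv.growth_affine hα (hA'.mono hr'r) hr'
  simp only [growth_shift] at hk
  have hk0 : k = 0 := by
    by_contra hne
    obtain ⟨a, ha⟩ := hk (r' / 4) (by positivity)
    have hw : |r' / 4| < r' / 2 := by rw [abs_of_pos (by positivity)]; linarith
    have e0 := ha 0 (by rw [abs_zero]; linarith)
    have e1 := ha (r' / 4) hw
    have e2 := ha (-(r' / 4)) (by rwa [abs_neg])
    have l1 := hLip y₁ (y₁ + r' / 4) (by rw [hy1]; linarith)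
      (by rw [abs_of_pos (by positivity)]; rw [hy1] at hr'r; linarith)
    have l2 := hLip y₁ (y₁ + -(r' / 4)) (by rw [hy1]; linarith)
      (by rw [hy1] at hr'r; rw [abs_lt]; constructor <;> linarith)
    rw [add_sub_cancel_left, abs_of_pos (by positivity)] at l1
    rw [add_sub_cancel_left, abs_neg, abs_of_pos (by positivity)] at l2
    rw [mul_zero, sub_zero, add_zero] at e0
    have hk1 : (1 : ℝ) ≤ |(k : ℝ)| := by exact_mod_cast Int.one_le_abs hne
    have hx : 6 * (r' / 4) ≤ |2 * π * k * (r' / 4)| := by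
      rw [abs_mul, abs_mul, abs_of_pos (by positivity : 0 < 2 * π),
          abs_of_pos (by positivity : 0 < r' / 4)]
      have := Real.pi_gt_three
      have : 6 ≤ 2 * π * |(k : ℝ)| := by nlinarith
      gcongr
    have e3 : 2 * π * k * -(r' / 4) = -(2 * π * k * (r' / 4)) := by ring
    rw [e3] at e2
    generalize 2 * π * k * (r' / 4) = x at *
    have e0 := abs_le.1 e0
    have e1 := abs_le.1 e1
    have e2 := abs_le.1 e2
    rcases abs_cases a with ⟨ha1, _⟩ | ⟨ha1, _⟩ <;> rcases abs_cases x with ⟨hx1, _⟩ | ⟨hx1, _⟩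
    · linarith [le_abs_self (a - -x)]
    · linarith [le_abs_self (a - x)]
    · linarith [neg_le_abs (a - x)]
    · linarith [neg_le_abs (a - -x)]
  refine ⟨r' / 2, by positivity, fun y hy => ?_⟩
  have key : ∀ δ : ℝ, 0 < δ → |growth α A y - growth α A y₁| ≤ 4 * δ := by
    intro δ hδ
    obtain ⟨a, ha⟩ := hk δ hδ
    have e0 := ha 0 (by rw [abs_zero]; linarith)
    have e1 := ha (y - y₁) hy
    rw [hk0] at e0 e1
    simp only [Int.cast_zero, mul_zero, zero_mul, sub_zero, add_zero, add_sub_cancel] at e0 e1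
    have e0 := abs_le.1 e0
    have e1 := abs_le.1 e1
    rw [abs_le]
    constructor <;> linarith
  have : |growth α A y - growth α A y₁| ≤ 0 := by
    refine le_of_forall_pos_le_add fun ε hε => ?_
    have := key (ε / 4) (by positivity)
    linarith
  exact sub_eq_zero.1 (abs_nonpos_iff.1 this)

lemma exists_orbit_near {α : ℝ} {p : ℤ} {q : ℕ} (hq : 1 ≤ q) (hpq : IsCoprime p (q : ℤ))
    (hα : |α - p / q| < 1 / (q : ℝ) ^ 2) (x : ℝ) :
    ∃ j : ℕ, j < q ∧ ∃ k : ℤ, |x - (j * α + k)| ≤ 2 / q := by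
  have hq0 : (0 : ℝ) < q := by exact_mod_cast hq
  have hqz : (q : ℤ) ≠ 0 := by omega
  obtain ⟨u, v, huv⟩ := hpq
  set a : ℤ := round (q * x) with ha
  set w : ℤ := (a * u) / q with hw
  have hj0 : 0 ≤ (a * u) % q := Int.emod_nonneg _ hqz
  have hj1 : (a * u) % q < q := Int.emod_lt_of_pos _ (by omega)
  obtain ⟨j, hj⟩ := Int.eq_ofNat_of_zero_le hj0
  have hjq : j < q := by omega
  refine ⟨j, hjq, a * v + w * p, ?_⟩
  have hdiv := Int.emod_add_mul_ediv (a * u) q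
  rw [hj, ← hw] at hdiv
  have hzz : (a : ℤ) = j * p + q * (a * v + w * p) := by
    linear_combination (-a) * huv - p * hdiv
  have hR : (a : ℝ) = j * p + q * ((a * v + w * p : ℤ) : ℝ) := by exact_mod_cast hzz
  have h1 : |q * x - a| ≤ 1 / 2 := abs_sub_round _
  have hjR : (j : ℝ) ≤ q := by exact_mod_cast hjq.le
  have h2 : (j : ℝ) * |α - p / q| ≤ 1 / q := by
    calc (j : ℝ) * |α - p / q| ≤ q * (1 / (q : ℝ) ^ 2) := by gcongr
      _ = 1 / q := by field_simp
  have e : x - (j * α + ((a * v + w * p : ℤ) : ℝ)) = (q * x - a) / q - j * (α - p / q) := by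
    field_simp
    linear_combination hR
  rw [e]
  calc |(q * x - a) / q - j * (α - p / q)| ≤ |(q * x - a) / q| + |j * (α - p / q)| := abs_sub _ _
    _ = |q * x - a| / q + j * |α - p / q| := by
      rw [abs_div, abs_mul, Nat.abs_cast, Nat.abs_cast]
    _ ≤ (1 / 2) / q + 1 / q := by gcongr
    _ ≤ 2 / q := by rw [← add_div]; gcongr; norm_num

section Lower

variable {α h r : ℝ} {A : ℂ → M2}

lemma IsCSL.exists_maxLog_le (hA : IsCSL h A) {y ε : ℝ} (hy : |y| < h) (hε : 0 < ε) :
    ∃ K : ℝ, 0 ≤ K ∧ ∀ n : ℕ, maxLog α A n y ≤ K + n * (growth α A y + ε) := by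
  obtain ⟨N, hN⟩ := eventually_atTop.1 (hA.maxLog_eventually_le (α := α) hy hε)
  have hg := hA.growth_nonneg (α := α) hy
  refine ⟨∑ n ∈ Finset.range N, maxLog α A n y,
    Finset.sum_nonneg fun n _ => hA.maxLog_nonneg n hy, fun n => ?_⟩
  have h0 : 0 ≤ n * (growth α A y + ε) := by positivity
  by_cases hn : n < N
  · have := Finset.single_le_sum (f := fun n => maxLog α A n y)
      (fun n _ => hA.maxLog_nonneg (α := α) n hy) (Finset.mem_range.2 hn)
    linarith
  · have h1 := hN n (not_lt.1 hn)
    have := Finset.sum_nonneg (s := Finset.range N) fun n _ => hA.maxLog_nonneg (α := α) n hy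
    linarith

lemma IsCSL.maxLog_le_add (hA : IsCSL h A) (hr : 0 < r) (hrh : r < h) {m : ℕ} {σ y : ℝ}
    (hup : ∀ s : ℝ, |s| = r → maxLog α A m s ≤ maxLog α A m 0 + σ * r) (hy : |y| ≤ r) :
    maxLog α A m y ≤ maxLog α A m 0 + σ * |y| := by
  have hmem : ∀ s : ℝ, |s| ≤ r → s ∈ Set.Ioo (-h) h := fun s hs => abs_lt.1 (hs.trans_lt hrh)
  obtain ⟨s, hs, hys⟩ : ∃ s : ℝ, |s| = r ∧ y = (|y| / r) * s := by
    rcases abs_cases y with ⟨h1, _⟩ | ⟨h1, _⟩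
    · exact ⟨r, abs_of_pos hr, by rw [h1]; field_simp⟩
    · exact ⟨-r, by rw [abs_neg, abs_of_pos hr], by rw [h1]; field_simp⟩
  have ht : |y| / r ≤ 1 := (div_le_one hr).2 hy
  have ht0 : 0 ≤ |y| / r := by positivity
  have := (hA.convexOn_maxLog (α := α) m).2 (hmem 0 (by simpa using hr.le)) (hmem s hs.le)
    (sub_nonneg.2 ht) ht0 (by ring)
  simp only [smul_eq_mul, mul_zero, zero_add] at this
  rw [← hys] at this
  have h2 := mul_le_mul_of_nonneg_left (hup s hs) ht0
  have e : |y| / r * (σ * r) = σ * |y| := by field_simp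
  rw [mul_add, e] at h2
  linarith

/-- If an iterate is small at one point, it is small along a `2 / q`-dense orbit, which is
incompatible with slow variation of the growth rate. -/
lemma IsCSL.le_norm_iter (hA : IsCSL h A) (hr : 0 < r) (hrh : r < h) {p : ℤ} {q m : ℕ} (hq : 1 ≤ q)
    (hpq : IsCoprime p (q : ℤ)) (hα : |α - p / q| < 1 / (q : ℝ) ^ 2) (hqr : 40 / q ≤ r) {σ τ D : ℝ}
    (hup : ∀ s : ℝ, |s| = r → maxLog α A m s ≤ maxLog α A m 0 + σ * r) (hσ0 : 0 ≤ σ)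
    (hσ : σ * (40 / q) ≤ 1) (hD : ∀ j < q, maxLog α A j 0 ≤ D)
    (hτ : 20 * (Real.exp (2 * D) * τ) ≤ Real.exp (maxLog α A m 0)) (x₀ : ℝ) :
    τ ≤ ‖cocycleIter α A m x₀‖ := by
  by_contra hlt
  push Not at hlt
  have hq0 : (0 : ℝ) < q := by exact_mod_cast hq
  have h0 : |(0 : ℝ)| < h := by rw [abs_zero]; linarith
  set M := maxLog α A m 0 with hM
  have hreal : ∀ x : ℝ, (x : ℂ) ∈ Strip h := fun x => Strip.real_mem (hr.trans hrh) x
  have hbd : ∀ (j : ℕ) (x : ℝ), 2 * ‖cocycleIter α A j x‖ ≤ Real.exp (maxLog α A j 0) := by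
    intro j x
    simpa using hA.norm_le_exp_maxLog (α := α) j (hreal x)
  have horb : ∀ j < q, ‖cocycleIter α A m (x₀ + j * α : ℝ)‖ ≤ Real.exp (2 * D) * τ := by
    intro j hj
    have hdet := (hA.iter α j).2.2 _ (hreal x₀)
    have e : cocycleIter α A m (x₀ + j * α : ℝ) =
        cocycleIter α A j (x₀ + m * α : ℝ) * cocycleIter α A m x₀ * (cocycleIter α A j x₀)⁻¹ := by
      have e1 := cocycleIter_add α A m j x₀
      have e2 := cocycleIter_add α A j m x₀
      rw [add_comm, e2] at e1
      push_cast
      rw [e1, mul_assoc, Matrix.mul_nonsing_inv _ (by simp [hdet]), mul_one]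
    have hj' : ∀ x : ℝ, 2 * ‖cocycleIter α A j x‖ ≤ Real.exp D := fun x =>
      (hbd j x).trans (Real.exp_le_exp.2 (hD j hj))
    rw [e]
    calc _ ≤ 2 * (2 * ‖cocycleIter α A j (x₀ + m * α : ℝ)‖ * ‖cocycleIter α A m x₀‖) *
          ‖cocycleIter α A j x₀‖ := by
          refine (M2.norm_mul_le _ _).trans ?_
          rw [M2.norm_inv hdet]
          gcongr
          exact M2.norm_mul_le _ _
      _ = (2 * ‖cocycleIter α A j (x₀ + m * α : ℝ)‖) * (2 * ‖cocycleIter α A j x₀‖) *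
          ‖cocycleIter α A m x₀‖ := by ring
      _ ≤ Real.exp D * Real.exp D * τ := by
          gcongr
          · exact hj' _
          · exact hj' _
      _ = _ := by rw [← Real.exp_add]; congr 2; ring
  have hall : ∀ x : ℝ, 2 * ‖cocycleIter α A m x‖ ≤ Real.exp (M - Real.log 2) := by
    intro x
    obtain ⟨j, hj, k, hk⟩ := exists_orbit_near hq hpq hα (x - x₀)
    set w : ℝ := x₀ + j * α + k with hw
    have hxw : |x - w| ≤ 2 / q := by
      refine le_of_eq_of_le ?_ hk
      congr 1; rw [hw]; ring
    have hAw : ‖cocycleIter α A m w‖ ≤ Real.exp (2 * D) * τ := by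
      have := periodic_int (hA.iter α m).2.1 (x₀ + j * α : ℝ) k
      rw [hw, Complex.ofReal_add, Complex.ofReal_intCast, this]
      exact horb j hj
    set ρ : ℝ := 40 / q with hρ
    have hρ0 : 0 < ρ := by positivity
    have hball : ∀ z ∈ Metric.ball (w : ℂ) ρ, |z.im| ≤ ρ := by
      intro z hz
      have h1 := Complex.abs_im_le_norm (z - w)
      rw [Complex.sub_im, Complex.ofReal_im, sub_zero] at h1
      exact h1.trans (by rw [← dist_eq_norm]; exact (Metric.mem_ball.1 hz).le)
    have hC : ∀ z ∈ Metric.ball (w : ℂ) ρ, 2 * ‖cocycleIter α A m z‖ ≤ 3 * Real.exp M := by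
      intro z hz
      have hz' := hball z hz
      refine (hA.norm_le_exp_maxLog (α := α) m (z := z) (by
        show |z.im| < h
        linarith)).trans ?_
      have h1 := hA.maxLog_le_add hr hrh hup (hz'.trans hqr)
      have h2 : σ * |z.im| ≤ 1 := (mul_le_mul_of_nonneg_left hz' hσ0).trans hσ
      calc Real.exp (maxLog α A m z.im) ≤ Real.exp (1 + M) := Real.exp_le_exp.2 (by linarith)
        _ = Real.exp 1 * Real.exp M := Real.exp_add _ _
        _ ≤ 3 * Real.exp M := by
          gcongr
          linarith [Real.exp_one_lt_d9]
    have hcen : (w : ℂ) ∈ Metric.ball (w : ℂ) ρ := Metric.mem_ball_self hρ0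
    have hdist : dist (x : ℂ) w ≤ 2 / q := by
      rw [dist_eq_norm, ← Complex.ofReal_sub, Complex.norm_real]
      exact hxw
    have hS := Complex.dist_le_div_mul_dist_of_mapsTo_ball (f := cocycleIter α A m) (c := (w : ℂ))
      (z := (x : ℂ)) (R₁ := ρ) (R₂ := 4 * Real.exp M)
      ((hA.iter α m).1.mono fun z hz => by
        show |z.im| < h
        linarith [hball z hz])
      (fun z hz => by
        rw [Metric.mem_closedBall, dist_eq_norm]
        have h1 := hC z hz
        have h2 := hC _ hcen
        have h3 := norm_sub_le (cocycleIter α A m z) (cocycleIter α A m w)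
        have h4 := Real.exp_pos M
        linarith)
      (by
        rw [Metric.mem_ball]
        refine hdist.trans_lt ?_
        rw [hρ]
        gcongr
        norm_num)
    have h5 : 4 * Real.exp M / ρ * dist (x : ℂ) w ≤ Real.exp M / 5 := by
      calc _ ≤ 4 * Real.exp M / ρ * (2 / q) := by gcongr
        _ = Real.exp M / 5 := by rw [hρ]; field_simp; norm_num
    rw [dist_eq_norm] at hS
    have h6 := norm_sub_norm_le (cocycleIter α A m x) (cocycleIter α A m w)
    rw [Real.exp_sub, Real.exp_log two_pos]
    linarith [Real.exp_pos M]
  have hfin : M ≤ M - Real.log 2 := by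
    rw [hM]
    refine hA.maxLog_le h0 fun x => ?_
    simpa using hall x
  linarith [Real.log_pos one_lt_two]

end Lower

/-- Positive growth with small slope forces the cocycle to be dominated near the real line. -/
lemma IsCSL.exists_AP {α h r : ℝ} {A : ℂ → M2} (hα : Irrational α) (hA : IsCSL h A) (hr : 0 < r)
    (hrh : r < h) (hL : 0 < growth α A 0)
    (hup : ∀ s : ℝ, |s| = r → growth α A s ≤ growth α A 0 + r / 40000) :
    ∃ (n : ℕ) (θ ρ : ℝ), 0 < ρ ∧ ρ ≤ h ∧ AP α ρ A n θ := by
  have hh : 0 < h := hr.trans hrh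
  have h0 : |(0 : ℝ)| < h := by rw [abs_zero]; exact hh
  set L := growth α A 0 with hLdef
  have hupm : ∀ᶠ m : ℕ in atTop, ∀ s : ℝ, |s| = r →
      maxLog α A m s ≤ maxLog α A m 0 + (m / 20000) * r := by
    have hr4 : 0 < r / 40000 := by positivity
    filter_upwards [hA.maxLog_eventually_le (α := α) (y := r) (by rwa [abs_of_pos hr]) hr4,
      hA.maxLog_eventually_le (α := α) (y := -r) (by rwa [abs_neg, abs_of_pos hr]) hr4,
      eventually_gt_atTop 0] with m h1 h2 hm s hs
    have hm0 : (0 : ℝ) < m := by exact_mod_cast hm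
    have h3 := hA.growth_le (α := α) h0 hm.ne'
    rw [← hLdef, le_div_iff₀ hm0] at h3
    have h4 : maxLog α A m s ≤ m * (growth α A s + r / 40000) := by
      rcases (abs_eq hr.le).1 hs with rfl | rfl
      · exact h1
      · exact h2
    have h5 := mul_le_mul_of_nonneg_left (hup s hs) hm0.le
    linarith
  obtain ⟨n₁, hn₁⟩ := eventually_atTop.1 hupm
  obtain ⟨n₂, hn₂⟩ := eventually_atTop.1
    (hA.maxLog_eventually_le (α := α) (y := 0) (ε := L / 20) h0 (by positivity))
  obtain ⟨K, hK0, hK⟩ := hA.exists_maxLog_le (α := α) (y := 0) (ε := L) h0 hL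
  obtain ⟨n₃, hn₃⟩ := exists_nat_ge (40 / r)
  obtain ⟨n₄, hn₄⟩ := exists_nat_ge ((3 + 2 * K) / (16 * L) + 12 / L)
  obtain ⟨p, q, hqN, hq1, hpq, happ⟩ := exists_dioph hα (n₁ + n₂ + n₃ + n₄)
  have hq0 : (0 : ℝ) < q := by exact_mod_cast hq1
  have c3 : (n₃ : ℝ) ≤ q := by exact_mod_cast (by omega : n₃ ≤ q)
  have c4 : (n₄ : ℝ) ≤ q := by exact_mod_cast (by omega : n₄ ≤ q)
  have hqr : 40 / (q : ℝ) ≤ r := by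
    rw [div_le_iff₀ hq0]
    have := hn₃.trans c3
    rw [div_le_iff₀ hr] at this
    linarith
  have hqK : 3 + 2 * K ≤ 16 * L * q := by
    have h1 : (3 + 2 * K) / (16 * L) ≤ q := by
      have : 0 ≤ 12 / L := by positivity
      linarith
    rw [div_le_iff₀ (by positivity)] at h1
    linarith
  have hqL : 12 ≤ L * q := by
    have h1 : 12 / L ≤ q := by
      have : 0 ≤ (3 + 2 * K) / (16 * L) := by positivity
      linarith
    rw [div_le_iff₀ hL] at h1
    linarith
  have hlow : ∀ N : ℕ, 200 ≤ N → N ≤ 400 → ∀ x : ℝ,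
      Real.exp ((N * q : ℕ) * (9 / 10 * L)) ≤ ‖cocycleIter α A (N * q) x‖ := by
    intro N hN1 hN2 x
    have hN1' : (200 : ℝ) ≤ N := by exact_mod_cast hN1
    have hN2' : (N : ℝ) ≤ 400 := by exact_mod_cast hN2
    have hqm : q ≤ N * q := Nat.le_mul_of_pos_left _ (by omega)
    have hm0 : 0 < N * q := lt_of_lt_of_le hq1 hqm
    refine hA.le_norm_iter hr hrh hq1 hpq happ hqr (σ := ((N * q : ℕ) : ℝ) / 20000)
      (D := K + 2 * L * q) (hn₁ _ (by omega)) (by positivity) ?_ ?_ ?_ x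
    · push_cast
      have e : (N * q : ℝ) / 20000 * (40 / q) = N / 500 := by field_simp; norm_num
      rw [e]; linarith
    · intro j hj
      have hjq : (j : ℝ) ≤ q := by exact_mod_cast hj.le
      have h1 := hK j
      have h2 : (j : ℝ) * (L + L) ≤ q * (L + L) := by gcongr
      linarith
    · have h3 := hA.growth_le (α := α) h0 hm0.ne'
      rw [← hLdef, le_div_iff₀ (by exact_mod_cast hm0)] at h3
      have h20 : (20 : ℝ) ≤ Real.exp 3 := by
        have h1 : Real.exp 3 = Real.exp 1 ^ 3 := by rw [← Real.exp_nat_mul]; norm_num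
        have h2 : (2.718 : ℝ) ^ 3 ≤ Real.exp 1 ^ 3 := by
          gcongr; linarith [Real.exp_one_gt_d9]
        rw [h1]; refine le_trans ?_ h2; norm_num
      calc _ ≤ Real.exp 3 *
          (Real.exp (2 * (K + 2 * L * q)) * Real.exp ((N * q : ℕ) * (9 / 10 * L))) := by
            gcongr
        _ = Real.exp (3 + (2 * (K + 2 * L * q) + (N * q : ℕ) * (9 / 10 * L))) := by
            rw [← Real.exp_add, ← Real.exp_add]
        _ ≤ _ := by
            refine Real.exp_le_exp.2 (le_trans ?_ h3)
            push_cast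
            have : 200 * (q * L) ≤ N * (q * L) := by gcongr
            linarith
  set n : ℕ := 200 * q with hn
  have hnR : (n : ℝ) = 200 * q := by rw [hn]; push_cast; ring
  have hl1 : ∀ x : ℝ, Real.exp (n * (9 / 10 * L)) ≤ ‖cocycleIter α A n x‖ :=
    hlow 200 le_rfl (by norm_num)
  have hl2 : ∀ x : ℝ, Real.exp ((n + n : ℕ) * (9 / 10 * L)) ≤ ‖cocycleIter α A (n + n) x‖ := by
    have : n + n = 400 * q := by omega
    rw [this]
    exact hlow 400 (by norm_num) le_rfl
  have hu : ∀ x : ℝ, 2 * ‖cocycleIter α A n x‖ ≤ Real.exp (n * (L + L / 20)) := fun x => by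
    have := hA.norm_le_exp_maxLog (α := α) n (Strip.real_mem hh x)
    rw [Complex.ofReal_im] at this
    exact this.trans (Real.exp_le_exp.2 (hn₂ n (by omega)))
  obtain ⟨ρ₁, hρ₁, hρ₁'⟩ := exists_unifcont_strip (r' := h / 2) (η := 1 / 10)
    (hA.iter α n).1.continuousOn (hA.iter α n).2.1 (by linarith) (by norm_num)
  obtain ⟨ρ₂, hρ₂, hρ₂'⟩ := exists_unifcont_strip (r' := h / 2) (η := 1 / 10)
    (hA.iter α (n + n)).1.continuousOn (hA.iter α (n + n)).2.1 (by linarith) (by norm_num)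
  have hcl : ∀ z ∈ Strip (min h (min ρ₁ ρ₂)),
      ‖cocycleIter α A n z - cocycleIter α A n z.re‖ < 1 / 10 ∧
      ‖cocycleIter α A (n + n) z - cocycleIter α A (n + n) z.re‖ < 1 / 10 := by
    intro z hz
    have hz' : |z.im| < min h (min ρ₁ ρ₂) := hz
    have hd : dist z (z.re : ℂ) = |z.im| := by
      have e : z - z.re = z.im * Complex.I := by
        apply Complex.ext <;> simp
      rw [dist_eq_norm, e, norm_mul, Complex.norm_I, mul_one, Complex.norm_real, Real.norm_eq_abs]
    have him : |((z.re : ℂ)).im| ≤ h / 2 := by simp; linarith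
    refine ⟨hρ₁' _ _ him ?_, hρ₂' _ _ him ?_⟩
    · rw [hd]; exact hz'.trans_le ((min_le_right _ _).trans (min_le_left _ _))
    · rw [hd]; exact hz'.trans_le ((min_le_right _ _).trans (min_le_right _ _))
  have hexp1 : ∀ x : ℝ, 0 ≤ x → 1 ≤ Real.exp x := fun x hx => Real.one_le_exp hx
  have hlo : ∀ z ∈ Strip (min h (min ρ₁ ρ₂)), 1 / 2 * Real.exp (n * (9 / 10 * L)) ≤
      ‖cocycleIter α A n z‖ := by
    intro z hz
    have h1 := (hcl z hz).1
    have h2 := hl1 z.re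
    have h3 := norm_sub_norm_le (cocycleIter α A n z.re) (cocycleIter α A n z)
    rw [norm_sub_rev] at h3
    linarith [hexp1 (n * (9 / 10 * L)) (by positivity)]
  have hlo2 : ∀ z ∈ Strip (min h (min ρ₁ ρ₂)), 1 / 2 * Real.exp ((n + n : ℕ) * (9 / 10 * L)) ≤
      ‖cocycleIter α A (n + n) z‖ := by
    intro z hz
    have h1 := (hcl z hz).2
    have h2 := hl2 z.re
    have h3 := norm_sub_norm_le (cocycleIter α A (n + n) z.re) (cocycleIter α A (n + n) z)
    rw [norm_sub_rev] at h3
    linarith [hexp1 ((n + n : ℕ) * (9 / 10 * L)) (by positivity)]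
  have hhi : ∀ z ∈ Strip (min h (min ρ₁ ρ₂)), ‖cocycleIter α A n z‖ ≤
      Real.exp (n * (L + L / 20)) := by
    intro z hz
    have h1 := (hcl z hz).1
    have h2 := hu z.re
    have h3 := norm_sub_norm_le (cocycleIter α A n z) (cocycleIter α A n z.re)
    linarith [hexp1 (n * (L + L / 20)) (by positivity)]
  refine ⟨n, 1 / 2 * Real.exp (-(6 * n * (L / 20))), min h (min ρ₁ ρ₂),
    lt_min hh (lt_min hρ₁ hρ₂), min_le_left _ _, by positivity, ?_, fun z hz => ?_, fun z hz => ?_⟩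
  · have : Real.exp (-(6 * n * (L / 20))) ≤ 1 := Real.exp_le_one_iff.2 (by
      have : 0 ≤ 6 * n * (L / 20) := by positivity
      linarith)
    linarith
  · have hz2 : z + (n : ℂ) * α ∈ Strip (min h (min ρ₁ ρ₂)) := by
      have := (Strip.add_real (z := z) (r := min h (min ρ₁ ρ₂)) (n * α)).2 hz
      simpa using this
    refine le_trans ?_ (hlo2 z hz)
    calc _ ≤ 1 / 2 * Real.exp (-(6 * n * (L / 20))) * Real.exp (n * (L + L / 20)) *
          Real.exp (n * (L + L / 20)) := by
          gcongr
          · exact hhi _ hz2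
          · exact hhi _ hz
      _ = 1 / 2 * Real.exp ((n + n : ℕ) * (9 / 10 * L)) := by
          rw [mul_assoc, mul_assoc, ← Real.exp_add, ← Real.exp_add]
          congr 2
          push_cast; ring
  · calc (100 : ℝ) ≤ 1 / 4 * Real.exp 7 := by
          have h1 : Real.exp 7 = Real.exp 1 ^ 7 := by rw [← Real.exp_nat_mul]; norm_num
          have h2 : (2.7 : ℝ) ^ 7 ≤ Real.exp 1 ^ 7 := by
            gcongr; linarith [Real.exp_one_gt_d9]
          have h3 : (400 : ℝ) ≤ 2.7 ^ 7 := by norm_num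
          rw [h1]; linarith
      _ ≤ 1 / 4 * Real.exp (n * (6 / 10 * L)) := by
          gcongr
          rw [hnR]; nlinarith
      _ = 1 / 2 * Real.exp (-(6 * n * (L / 20))) * (1 / 2 * Real.exp (n * (9 / 10 * L))) := by
          rw [mul_mul_mul_comm, ← Real.exp_add]
          congr 1
          · norm_num
          · congr 1; ring
      _ ≤ _ := by gcongr; exact hlo z hz

lemma AP.mono {α r r' : ℝ} {A : ℂ → M2} {n : ℕ} {θ : ℝ} (h : AP α r A n θ) (hr : r' ≤ r) :
    AP α r' A n θ :=
  ⟨h.pos, h.le_one, fun z hz => h.angle z (Strip.mono hr hz), fun z hz =>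
      h.big z (Strip.mono hr hz)⟩

/-- A slowly growing cocycle is either almost reducible or has zero growth near the real line. -/
lemma IsSL2Strip.approxRed_or_growth_eq_zero {α h s : ℝ} {A : ℂ → M2} (hα : Irrational α)
    (hA : IsSL2Strip h A) (hh : 0 < h) (hsh : s ≤ h / 160000)
    (hs : ∀ y, |y| < h → growth α A y ≤ s) :
    (∃ ε : ℝ, 0 < ε ∧ ε ≤ h ∧ ApproxRed α ε A) ∨ ∀ y, |y| < h / 4 → growth α A y = 0 := by
  have hC := hA.isCSL
  have h00 : |(0 : ℝ)| < h := by simpa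
  have hLip : ∀ y y' : ℝ, |y| ≤ h / 2 → |y'| ≤ h / 2 →
      growth α A y' - growth α A y ≤ |y' - y| / 40000 := fun y y' hy hy' => by
    have h1 := hC.growth_lipschitz (α := α) hh hs hy hy'
    have h2 : 4 * s / h ≤ 1 / 40000 := by rw [div_le_iff₀ hh]; linarith
    have := mul_le_mul_of_nonneg_right h2 (abs_nonneg (y' - y))
    linarith
  rcases (hC.growth_nonneg (α := α) h00).lt_or_eq with hpos | hzero
  · left
    obtain ⟨n, θ, ρ, hρ, hρh, hAP⟩ := hC.exists_AP hα (r := h / 4) (by linarith) (by linarith) hpos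
      fun t ht => by
        have := hLip 0 t (by rw [abs_zero]; linarith) (by rw [ht]; linarith)
        rw [sub_zero, ht] at this
        linarith
    obtain ⟨ε, h1, h2, h3⟩ := hAP.approxRed hα hA hρ hρh
    exact ⟨ε, h1, h2.trans hρh, h3⟩
  · right
    intro y₀ hy₀
    by_contra hne
    have hF : 0 < growth α A y₀ :=
      lt_of_le_of_ne (hC.growth_nonneg (by linarith)) (Ne.symm hne)
    have habs := abs_lt.1 hy₀
    have hC' := (hC.shift y₀).mono (h' := 3 * h / 4) (by linarith)
    have hnear : ∀ y, |y| < h / 4 → |y₀ + y| ≤ h / 2 := fun y hy => by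
      have := abs_lt.1 hy
      rw [abs_le]; constructor <;> linarith
    obtain ⟨n, θ, ρ, hρ, hρh, hAP⟩ := hC'.exists_AP hα (r := h / 8) (by linarith) (by linarith)
      (by rw [growth_shift, add_zero]; exact hF)
      fun t ht => by
        rw [growth_shift, growth_shift, add_zero]
        have := hLip y₀ (y₀ + t) (by linarith) (hnear t (by linarith))
        rw [add_sub_cancel_left, ht] at this
        linarith
    have hr : min ρ (h / 4) ≤ h / 4 := min_le_right _ _
    have hr0 : 0 < min ρ (h / 4) := lt_min hρ (by linarith)
    obtain ⟨y₁, hy₁, hy₁', ρ', hρ', hconst⟩ := (hAP.mono (min_le_left ρ (h / 4))).growth_const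
      (η := min (min ρ (h / 4)) (growth α A y₀)) hα
      (hC'.mono (by linarith)) (lt_min hr0 hF) (min_le_left _ _) fun y y' hy hy' => by
        rw [growth_shift, growth_shift]
        have := hLip (y₀ + y) (y₀ + y') (hnear y (by linarith)) (hnear y' (by linarith))
        rw [add_sub_add_left_eq_sub] at this
        linarith [abs_nonneg (y' - y)]
    simp only [growth_shift] at hconst
    have hy₁1 := hy₁'.trans_le (min_le_left _ _)
    have hy₁2 := hy₁'.trans_le (min_le_right _ _)
    have hy₁a : |y₁| = y₁ := abs_of_pos hy₁
    have hmem : y₀ + y₁ ∈ Set.Ioo (-h) h := ⟨by linarith, by linarith⟩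
    have hmin := IsMinOn.of_isLocalMinOn_of_convexOn hmem (f := growth α A) (by
      refine Filter.Eventually.filter_mono nhdsWithin_le_nhds ?_
      filter_upwards [Metric.ball_mem_nhds (y₀ + y₁) hρ'] with y hy
      rw [Metric.mem_ball, Real.dist_eq] at hy
      have := hconst (y - y₀) (by convert hy using 2; ring)
      rw [add_sub_cancel] at this
      exact this.ge) hC.convexOn_growth
    have h1 : growth α A (y₀ + y₁) ≤ growth α A 0 := hmin (show (0 : ℝ) ∈ Set.Ioo (-h) h from
      ⟨by linarith, hh⟩)
    have h2 := hLip (y₀ + y₁) y₀ (hnear y₁ (by linarith)) (by linarith)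
    rw [show y₀ - (y₀ + y₁) = -y₁ by ring, abs_neg, hy₁a] at h2
    linarith

open ComplexConjugate in
/-- A family of positive sesquilinear forms on a space of holomorphic vector functions, related to
each other as the forms `∫ f^* W g dσ_ω` for the harmonic measures `σ_ω` of a domain. -/
structure HermFam (S : Set ℂ) (E : Type) [AddCommGroup E] [Module ℂ E] where
  a : ℂ → E →ₗ⋆[ℂ] E →ₗ[ℂ] ℂ
  ev : E →ₗ[ℂ] ℂ → V2
  cst : V2 →ₗ[ℂ] E
  symm : ∀ ω f g, a ω g f = conj (a ω f g)
  nonneg : ∀ ω ∈ S, ∀ f, 0 ≤ (a ω f f).re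
  ev_cst : ∀ v, ∀ ω ∈ S, ev (cst v) ω = v
  holo : ∀ f, DifferentiableOn ℂ (ev f) S
  eval : ∃ K : ℂ → ℝ, ContinuousOn K S ∧ ∀ ω ∈ S, ∀ f, ‖ev f ω‖ ^ 2 ≤ K ω ^ 2 * (a 0 f f).re
  cbound : ∀ ω ∈ S, ∃ C : ℝ, ∀ v, (a ω (cst v) (cst v)).re ≤ C ^ 2 * ‖v‖ ^ 2
  mul_vanish : ∀ ω ∈ S, ∃ K : ℝ, ∀ g, ev g ω = 0 → ∃ g', ev g' 0 = 0 ∧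
    (a 0 g' g').re ≤ K ^ 2 * (a 0 g g).re ∧ ∀ f, a ω f g = a 0 f g'
  poisson : ∀ ω ∈ S, ∃ (K : ℝ) (T : E → E), (∀ f, ev (T f) 0 = 0) ∧
    (∀ f, (a 0 (T f) (T f)).re ≤ K ^ 2 * (a 0 f f).re) ∧
    ∀ f g, a ω f g = a 0 f g + a 0 f (T g) + conj (a 0 g (T f))

lemma sq_norm_le_of_forall {z : ℂ} {M A : ℝ} (hA : 0 ≤ A)
    (h : ∀ t : ℂ, 0 ≤ M + 2 * (t * z).re + ‖t‖ ^ 2 * A) : ‖z‖ ^ 2 ≤ M * A := by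
  have key : ∀ s : ℝ, 0 ≤ M - 2 * s * ‖z‖ ^ 2 + s ^ 2 * ‖z‖ ^ 2 * A := fun s => by
    have := h (-(s : ℂ) * (starRingEnd ℂ) z)
    rw [mul_assoc, Complex.conj_mul', norm_mul, norm_neg, RCLike.norm_conj, mul_pow,
      Complex.norm_real, Real.norm_eq_abs, sq_abs] at this
    have e : (-(s : ℂ) * ((‖z‖ : ℂ)) ^ 2).re = -s * ‖z‖ ^ 2 := by
      rw [← Complex.ofReal_pow, ← Complex.ofReal_neg, ← Complex.ofReal_mul, Complex.ofReal_re]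
    rw [e] at this
    linarith
  rcases hA.eq_or_lt with h0 | h0
  · subst h0
    by_contra hc
    simp only [mul_zero, not_le] at hc
    have := key ((|M| + 1) / ‖z‖ ^ 2)
    rw [mul_div_assoc', div_mul_cancel₀ _ hc.ne'] at this
    nlinarith [neg_abs_le M, le_abs_self M, abs_nonneg M]
  · have := key (1 / A)
    have e : (1 / A) ^ 2 * ‖z‖ ^ 2 * A = ‖z‖ ^ 2 / A := by field_simp
    rw [e, show 2 * (1 / A) * ‖z‖ ^ 2 = 2 * (‖z‖ ^ 2 / A) by ring] at this
    rw [← div_le_iff₀ h0]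
    linarith

namespace HermFam

variable {S : Set ℂ} {E : Type} [AddCommGroup E] [Module ℂ E] (H : HermFam S E) {ω : ℂ}

/-- The seminorm of the form at `ω`. -/
def nm (ω : ℂ) (f : E) : ℝ := √(H.a ω f f).re

lemma nm_nonneg (ω : ℂ) (f : E) : 0 ≤ H.nm ω f := Real.sqrt_nonneg _

lemma nm_sq (hω : ω ∈ S) (f : E) : H.nm ω f ^ 2 = (H.a ω f f).re := Real.sq_sqrt (H.nonneg ω hω f)

lemma re_add (f g : E) : (H.a ω (f + g) (f + g)).re =
    (H.a ω f f).re + 2 * (H.a ω f g).re + (H.a ω g g).re := by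
  simp only [map_add, LinearMap.add_apply, Complex.add_re, H.symm ω f g, Complex.conj_re]
  ring

lemma re_add_smul (f g : E) (t : ℂ) : (H.a ω (f + t • g) (f + t • g)).re =
    (H.a ω f f).re + 2 * (t * H.a ω f g).re + ‖t‖ ^ 2 * (H.a ω g g).re := by
  rw [H.re_add]
  simp only [map_smul, LinearMap.map_smulₛₗ, LinearMap.smul_apply, smul_eq_mul]
  rw [← mul_assoc, Complex.mul_conj', ← Complex.ofReal_pow,
    Complex.re_ofReal_mul]

lemma norm_le (hω : ω ∈ S) (f g : E) : ‖H.a ω f g‖ ≤ H.nm ω f * H.nm ω g := by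
  refine abs_le_of_sq_le_sq' ?_ (mul_nonneg (H.nm_nonneg _ _) (H.nm_nonneg _ _)) |>.2
  rw [mul_pow, H.nm_sq hω, H.nm_sq hω]
  refine sq_norm_le_of_forall (H.nonneg ω hω g) fun t => ?_
  rw [← H.re_add_smul]
  exact H.nonneg ω hω _

lemma nm_add_le (hω : ω ∈ S) (f g : E) : H.nm ω (f + g) ≤ H.nm ω f + H.nm ω g := by
  refine abs_le_of_sq_le_sq' ?_ (add_nonneg (H.nm_nonneg _ _) (H.nm_nonneg _ _)) |>.2
  rw [H.nm_sq hω, H.re_add, add_sq, H.nm_sq hω, H.nm_sq hω]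
  have := (Complex.re_le_norm _).trans (H.norm_le hω f g)
  linarith

lemma nm_neg (f : E) : H.nm ω (-f) = H.nm ω f := by
  simp [nm]

lemma nm_le_of_re_le {f g : E} {ω' : ℂ} {K : ℝ} (h0 : ω ∈ S)
    (h : (H.a ω' f f).re ≤ K ^ 2 * (H.a ω g g).re) : H.nm ω' f ≤ |K| * H.nm ω g := by
  rw [nm, Real.sqrt_le_left (mul_nonneg (abs_nonneg _) (H.nm_nonneg _ _)), mul_pow, sq_abs,
    H.nm_sq h0]
  exact h

lemma exists_near_min (h0 : (0 : ℂ) ∈ S) (v : V2) {η : ℝ} (hη : 0 < η) :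
    ∃ f, H.ev f 0 = v ∧ ∀ g, H.ev g 0 = 0 → ‖H.a 0 f g‖ ≤ η * H.nm 0 g := by
  set T : Set ℝ := (fun f => (H.a 0 f f).re) '' {f | H.ev f 0 = v} with hT
  have hne : T.Nonempty := ⟨_, H.cst v, H.ev_cst v 0 h0, rfl⟩
  have hbdd : BddBelow T := ⟨0, by rintro _ ⟨f, -, rfl⟩; exact H.nonneg 0 h0 f⟩
  obtain ⟨_, ⟨f, hf, rfl⟩, hlt⟩ := exists_lt_of_csInf_lt hne
    (lt_add_of_pos_right (sInf T) (pow_pos hη 2))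
  refine ⟨f, hf, fun g hg => ?_⟩
  refine abs_le_of_sq_le_sq' ?_ (mul_nonneg hη.le (H.nm_nonneg _ _)) |>.2
  rw [mul_pow, H.nm_sq h0]
  refine sq_norm_le_of_forall (H.nonneg 0 h0 g) fun t => ?_
  have h1 : sInf T ≤ (H.a 0 (f + t • g) (f + t • g)).re := csInf_le hbdd
    ⟨f + t • g, by
      have hf' : H.ev f 0 = v := hf
      simp [hf', hg], rfl⟩
  rw [H.re_add_smul] at h1
  have hlt' : (H.a 0 f f).re < sInf T + η ^ 2 := hlt
  linarith

lemma exists_seq (h0 : (0 : ℂ) ∈ S) : ∃ f : ℕ → V2 →ₗ[ℂ] E, (∀ n u, H.ev (f n u) 0 = u) ∧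
    ∀ n u g, H.ev g 0 = 0 → ‖H.a 0 (f n u) g‖ ≤ 1 / ((n : ℝ) + 1) * ‖u‖ * H.nm 0 g := by
  have hη : ∀ n : ℕ, (0 : ℝ) < 1 / (2 * ((n : ℝ) + 1)) := fun n => by positivity
  choose F hF1 hF2 using fun (n : ℕ) (j : Fin 2) =>
    H.exists_near_min h0 (Pi.single j 1) (hη n)
  refine ⟨fun n => (LinearMap.proj 0).smulRight (F n 0) + (LinearMap.proj 1).smulRight (F n 1),
    fun n u => ?_, fun n u g hg => ?_⟩
  · have e0 := hF1 n 0
    have e1 := hF1 n 1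
    ext i
    simp only [LinearMap.add_apply, LinearMap.smulRight_apply, LinearMap.proj_apply, map_add,
      map_smul, Pi.add_apply, Pi.smul_apply, e0, e1]
    fin_cases i <;> simp
  · simp only [LinearMap.add_apply, LinearMap.smulRight_apply, LinearMap.proj_apply, map_add,
      LinearMap.map_smulₛₗ, LinearMap.smul_apply, smul_eq_mul]
    have h1 := hF2 n 0 g hg
    have h2 := hF2 n 1 g hg
    have hu0 := norm_le_pi_norm u 0
    have hu1 := norm_le_pi_norm u 1
    have hg0 := H.nm_nonneg 0 g
    calc _ ≤ ‖u 0‖ * ‖H.a 0 (F n 0) g‖ + ‖u 1‖ * ‖H.a 0 (F n 1) g‖ := by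
          refine (norm_add_le _ _).trans ?_
          simp only [norm_mul, RCLike.norm_conj, le_refl]
      _ ≤ ‖u‖ * (1 / (2 * ((n : ℝ) + 1)) * H.nm 0 g) +
          ‖u‖ * (1 / (2 * ((n : ℝ) + 1)) * H.nm 0 g) := by gcongr
      _ = _ := by field_simp; ring

end HermFam

namespace HermFam

variable {S : Set ℂ} {E : Type} [AddCommGroup E] [Module ℂ E] (H : HermFam S E) {ω : ℂ}

/-- A sequence of asymptotically minimal extensions of the vectors at the base point. -/
structure MinSeq (f : ℕ → V2 →ₗ[ℂ] E) : Prop where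
  ev_zero : ∀ n u, H.ev (f n u) 0 = u
  near : ∀ n u g, H.ev g 0 = 0 → ‖H.a 0 (f n u) g‖ ≤ 1 / ((n : ℝ) + 1) * ‖u‖ * H.nm 0 g

variable {H} {f : ℕ → V2 →ₗ[ℂ] E}

lemma MinSeq.nm_sub_le (hf : H.MinSeq f) (h0 : (0 : ℂ) ∈ S) (n m : ℕ) (u : V2) :
    H.nm 0 (f n u - f m u) ≤ (1 / ((n : ℝ) + 1) + 1 / ((m : ℝ) + 1)) * ‖u‖ := by
  set D := f n u - f m u with hD
  have hev : H.ev D 0 = 0 := by rw [hD, map_sub, Pi.sub_apply, hf.ev_zero, hf.ev_zero, sub_self]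
  have h1 := hf.near n u D hev
  have h2 := hf.near m u D hev
  have h3 : H.nm 0 D ^ 2 ≤ (1 / ((n : ℝ) + 1) + 1 / ((m : ℝ) + 1)) * ‖u‖ * H.nm 0 D := by
    rw [H.nm_sq h0]
    calc (H.a 0 D D).re = (H.a 0 (f n u) D - H.a 0 (f m u) D).re := by
          conv_lhs => rw [show H.a 0 D = H.a 0 (f n u) - H.a 0 (f m u) by rw [hD, map_sub]]
          rfl
      _ ≤ ‖H.a 0 (f n u) D‖ + ‖H.a 0 (f m u) D‖ := (Complex.re_le_norm _).trans (norm_sub_le _ _)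
      _ ≤ _ := by linarith
  rcases (H.nm_nonneg 0 D).eq_or_lt with h | h
  · rw [← h]; positivity
  · exact le_of_mul_le_mul_right (by linarith [sq (H.nm 0 D)]) h

lemma one_div_le_one (n : ℕ) : 1 / ((n : ℝ) + 1) ≤ 1 :=
  div_le_one_of_le₀ (by linarith [(Nat.cast_nonneg n : (0 : ℝ) ≤ n)]) (by positivity)

lemma MinSeq.nm_le (hf : H.MinSeq f) (h0 : (0 : ℂ) ∈ S) (u : V2) :
    ∃ C : ℝ, ∀ n, H.nm 0 (f n u) ≤ C := by
  refine ⟨H.nm 0 (f 0 u) + 2 * ‖u‖, fun n => ?_⟩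
  have h1 := H.nm_add_le h0 (f 0 u) (f n u - f 0 u)
  rw [add_sub_cancel] at h1
  have h2 := hf.nm_sub_le h0 n 0 u
  have h3 : (1 / ((n : ℝ) + 1) + 1 / (((0 : ℕ) : ℝ) + 1)) * ‖u‖ ≤ 2 * ‖u‖ :=
    mul_le_mul_of_nonneg_right (by linarith [one_div_le_one n, one_div_le_one 0]) (norm_nonneg u)
  linarith

lemma norm_symm (x y : E) : ‖H.a ω x y‖ = ‖H.a ω y x‖ := by
  rw [H.symm ω y x, RCLike.norm_conj]

lemma MinSeq.exists_gram (hf : H.MinSeq f) (h0 : (0 : ℂ) ∈ S) : ∃ G : V2 → V2 → ℂ,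
    ∀ u v, ∀ ω ∈ S, Tendsto (fun n => H.a ω (f n u) (f n v)) atTop (nhds (G u v)) := by
  have hlim0 := tendsto_one_div_add_atTop_nhds_zero_nat (𝕜 := ℝ)
  have hc : ∀ u v, ∃ l, Tendsto (fun n => H.a 0 (f n u) (f n v)) atTop (nhds l) := fun u v => by
    refine cauchySeq_tendsto_of_complete (cauchySeq_of_le_tendsto_0
      (fun N : ℕ => 1 / ((N : ℝ) + 1) * (4 * (‖u‖ * ‖v‖))) ?_ ?_)
    · intro n m N hn hm
      have hnN : 1 / ((n : ℝ) + 1) ≤ 1 / ((N : ℝ) + 1) := Nat.one_div_le_one_div hn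
      have hmN : 1 / ((m : ℝ) + 1) ≤ 1 / ((N : ℝ) + 1) := Nat.one_div_le_one_div hm
      have hev : ∀ w : V2, H.ev (f n w - f m w) 0 = 0 := fun w => by
        rw [map_sub, Pi.sub_apply, hf.ev_zero, hf.ev_zero, sub_self]
      have e : H.a 0 (f n u) (f n v) - H.a 0 (f m u) (f m v) =
          H.a 0 (f n u) (f n v - f m v) + H.a 0 (f n u - f m u) (f m v) := by
        simp only [map_sub, LinearMap.sub_apply]; ring
      have h1 := (hf.near n u _ (hev v)).trans (mul_le_mul_of_nonneg_left
        (hf.nm_sub_le h0 n m v) (by positivity))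
      have h2 := (hf.near m v _ (hev u)).trans (mul_le_mul_of_nonneg_left
        (hf.nm_sub_le h0 n m u) (by positivity))
      rw [norm_symm] at h2
      rw [dist_eq_norm, e]
      refine (norm_add_le _ _).trans ((add_le_add h1 h2).trans ?_)
      set x := 1 / ((n : ℝ) + 1)
      set y := 1 / ((m : ℝ) + 1)
      set t := 1 / ((N : ℝ) + 1)
      have hx : 0 ≤ x := by positivity
      have hy : 0 ≤ y := by positivity
      have hx1 : x ≤ 1 := one_div_le_one n
      have hy1 : y ≤ 1 := one_div_le_one m
      have hxy : (x + y) * (x + y) ≤ 4 * t := by nlinarith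
      have := mul_le_mul_of_nonneg_right hxy (mul_nonneg (norm_nonneg u) (norm_nonneg v))
      nlinarith
    · simpa using hlim0.mul_const (4 * (‖u‖ * ‖v‖))
  choose G hG using hc
  refine ⟨G, fun u v ω hω => ?_⟩
  obtain ⟨K, T, hT0, hTK, hT⟩ := H.poisson ω hω
  have hsmall : ∀ u v : V2, Tendsto (fun n => H.a 0 (f n u) (T (f n v))) atTop (nhds 0) := by
    intro u v
    obtain ⟨C, hC⟩ := hf.nm_le h0 v
    refine squeeze_zero_norm (fun n => (hf.near n u _ (hT0 _)).trans
      (mul_le_mul_of_nonneg_left ((H.nm_le_of_re_le h0 (hTK _)).trans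
        (mul_le_mul_of_nonneg_left (hC n) (abs_nonneg K))) (by positivity))) ?_
    simpa [mul_assoc] using hlim0.mul_const (‖u‖ * (|K| * C))
  have h3 := ((hG u v).add (hsmall u v)).add
    ((Complex.continuous_conj.tendsto 0).comp (hsmall v u))
  simp only [map_zero, add_zero] at h3
  exact h3.congr fun n => (hT _ _).symm

lemma MinSeq.near_vanish (hf : H.MinSeq f) (h0 : (0 : ℂ) ∈ S) (hω : ω ∈ S) : ∃ K : ℝ, 0 ≤ K ∧
    ∀ n u g, H.ev g ω = 0 → ‖H.a ω (f n u) g‖ ≤ 1 / ((n : ℝ) + 1) * ‖u‖ * (K * H.nm 0 g) := by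
  obtain ⟨K, hK⟩ := H.mul_vanish ω hω
  refine ⟨|K|, abs_nonneg K, fun n u g hg => ?_⟩
  obtain ⟨g', hg0, hgK, hgf⟩ := hK g hg
  rw [hgf]
  exact (hf.near n u g' hg0).trans (mul_le_mul_of_nonneg_left (H.nm_le_of_re_le h0 hgK)
    (by positivity))

lemma nm_cst_le (hω : ω ∈ S) : ∃ C : ℝ, 0 ≤ C ∧ ∀ v, H.nm ω (H.cst v) ≤ C * ‖v‖ := by
  obtain ⟨C, hC⟩ := H.cbound ω hω
  refine ⟨|C|, abs_nonneg C, fun v => ?_⟩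
  rw [nm, Real.sqrt_le_left (by positivity), mul_pow, sq_abs]
  exact hC v

lemma tendsto_nm_cst (hω : ω ∈ S) {c : ℕ → V2} (hc : Tendsto c atTop (nhds 0)) :
    Tendsto (fun n => H.nm ω (H.cst (c n))) atTop (nhds 0) := by
  obtain ⟨C, -, hC⟩ := H.nm_cst_le hω
  refine squeeze_zero (fun n => H.nm_nonneg _ _) (fun n => hC _) ?_
  simpa using hc.norm.const_mul C

lemma MinSeq.lower_bound (hf : H.MinSeq f) (h0 : (0 : ℂ) ∈ S) (hω : ω ∈ S) {u : V2} {l : ℂ}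
    (hl : Tendsto (fun n => H.a ω (f n u) (f n u)) atTop (nhds l)) {F : E}
    (hF : Tendsto (fun n => H.ev (f n u) ω) atTop (nhds (H.ev F ω))) :
    l.re ≤ (H.a ω F F).re := by
  obtain ⟨K, hK0, hK⟩ := hf.near_vanish h0 hω
  obtain ⟨C, hC⟩ := hf.nm_le h0 u
  obtain ⟨C', hC'0, hC'⟩ := H.nm_cst_le h0
  set c : ℕ → V2 := fun n => H.ev F ω - H.ev (f n u) ω with hcdef
  have hc : Tendsto c atTop (nhds 0) := by simpa using hF.const_sub (H.ev F ω)
  have hlim0 := tendsto_one_div_add_atTop_nhds_zero_nat (𝕜 := ℝ)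
  have hb : ∀ n, (H.a ω (f n u) (f n u)).re ≤ (H.nm ω F + H.nm ω (H.cst (c n))) ^ 2 +
      2 * (1 / ((n : ℝ) + 1) * ‖u‖ * (K * (H.nm 0 F + C' * ‖c n‖ + C))) := fun n => by
    set g := F + -H.cst (c n) + -f n u with hg
    have hev : H.ev g ω = 0 := by
      simp only [hg, map_add, map_neg, Pi.add_apply, Pi.neg_apply, H.ev_cst _ ω hω, hcdef]
      abel
    have h1 := H.re_add (ω := ω) (f n u) g
    have h2 := hK n u g hev
    have h3 : H.nm 0 g ≤ H.nm 0 F + C' * ‖c n‖ + C := by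
      refine (H.nm_add_le h0 _ _).trans (add_le_add ((H.nm_add_le h0 _ _).trans
        (add_le_add le_rfl ?_)) ?_)
      · rw [nm_neg]; exact hC' _
      · rw [nm_neg]; exact hC n
    have h4 : f n u + g = F + -H.cst (c n) := by rw [hg]; abel
    have h5 := H.nm_add_le hω F (-H.cst (c n))
    rw [nm_neg] at h5
    have h6 := pow_le_pow_left₀ (H.nm_nonneg _ _) h5 2
    rw [H.nm_sq hω, ← h4, h1] at h6
    have h7 := (abs_le.1 (Complex.abs_re_le_norm (H.a ω (f n u) g))).1
    have h8 := H.nonneg ω hω g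
    have h9 : 1 / ((n : ℝ) + 1) * ‖u‖ * (K * H.nm 0 g) ≤
        1 / ((n : ℝ) + 1) * ‖u‖ * (K * (H.nm 0 F + C' * ‖c n‖ + C)) := by gcongr
    linarith
  have hlim : Tendsto (fun n : ℕ => (H.nm ω F + H.nm ω (H.cst (c n))) ^ 2 +
      2 * (1 / ((n : ℝ) + 1) * ‖u‖ * (K * (H.nm 0 F + C' * ‖c n‖ + C)))) atTop
      (nhds ((H.nm ω F + 0) ^ 2 + 2 * (0 * ‖u‖ * (K * (H.nm 0 F + C' * 0 + C))))) := by
    have hcn : Tendsto (fun n => ‖c n‖) atTop (nhds 0) := by simpa using hc.norm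
    exact ((tendsto_const_nhds.add (tendsto_nm_cst hω hc)).pow 2).add (((hlim0.mul_const _).mul
      (((tendsto_const_nhds.add (hcn.const_mul _)).add_const _).const_mul _)).const_mul _)
  have := le_of_tendsto_of_tendsto' ((Complex.continuous_re.tendsto _).comp hl) hlim hb
  rw [add_zero, H.nm_sq hω] at this
  simpa using this

lemma MinSeq.exists_extension (hω : ω ∈ S) {u p : V2} {l : ℂ}
    (hl : Tendsto (fun n => H.a ω (f n u) (f n u)) atTop (nhds l))
    (hp : Tendsto (fun n => H.ev (f n u) ω) atTop (nhds p)) {η : ℝ} (hη : 0 < η) :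
    ∃ F, H.ev F ω = p ∧ (H.a ω F F).re ≤ l.re + η := by
  set c : ℕ → V2 := fun n => p - H.ev (f n u) ω with hcdef
  have hc : Tendsto c atTop (nhds 0) := by simpa using hp.const_sub p
  have hre := (Complex.continuous_re.tendsto _).comp hl
  have hl0 : 0 ≤ l.re := ge_of_tendsto' hre fun n => H.nonneg ω hω _
  have hlim : Tendsto (fun n => (H.nm ω (f n u) + H.nm ω (H.cst (c n))) ^ 2) atTop
      (nhds ((√l.re + 0) ^ 2)) :=
    (hre.sqrt.add (tendsto_nm_cst hω hc)).pow 2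
  rw [add_zero, Real.sq_sqrt hl0] at hlim
  obtain ⟨n, hn⟩ := (hlim.eventually (gt_mem_nhds (lt_add_of_pos_right _ hη))).exists
  refine ⟨f n u + H.cst (c n), ?_, ?_⟩
  · simp [H.ev_cst _ ω hω, hcdef]
  · rw [← H.nm_sq hω]
    exact (pow_le_pow_left₀ (H.nm_nonneg _ _) (H.nm_add_le hω _ _) 2).trans hn.le

end HermFam

/-- The squared Euclidean norm. -/
def eN (v : V2) : ℝ := Complex.normSq (v 0) + Complex.normSq (v 1)

lemma exists_cholesky {p r : ℝ} {z : ℂ} (h : ∀ u : V2, u ≠ 0 → 0 < p * Complex.normSq (u 0) +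
      2 * ((starRingEnd ℂ) (u 0) * z * u 1).re + r * Complex.normSq (u 1)) :
    ∃ s t : ℝ, 0 < s ∧ 0 < t ∧ ∀ u : V2, eN ((!![(s : ℂ), z / s; 0, t] : M2).mulVec u) =
      p * Complex.normSq (u 0) +
      2 * ((starRingEnd ℂ) (u 0) * z * u 1).re + r * Complex.normSq (u 1) := by
  have hp : 0 < p := by
    have := h ![1, 0] (fun h => by simpa using congrFun h 0)
    simpa using this
  have hd : 0 < r - Complex.normSq z / p := by
    have := h ![-z / p, 1] (fun h => by simpa using congrFun h 1)
    simp only [Matrix.cons_val_zero, Matrix.cons_val_one, map_div₀, map_neg, Complex.conj_ofReal,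
      map_one, mul_one, Complex.normSq_neg, Complex.normSq_ofReal] at this
    have e : -(starRingEnd ℂ) z / (p : ℂ) * z = ((-Complex.normSq z / p : ℝ) : ℂ) := by
      rw [Complex.ofReal_div, Complex.ofReal_neg, ← Complex.mul_conj]; ring
    rw [e, Complex.ofReal_re] at this
    have e2 : p * (Complex.normSq z / (p * p)) = Complex.normSq z / p := by
      field_simp
    rw [e2] at this
    have e3 : -Complex.normSq z / p = -(Complex.normSq z / p) := by ring
    rw [e3] at this
    linarith
  have hsp := Real.sqrt_pos.2 hp
  have hss : √p * √p = p := Real.mul_self_sqrt hp.le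
  have htt : √(r - Complex.normSq z / p) * √(r - Complex.normSq z / p) = _ :=
    Real.mul_self_sqrt hd.le
  refine ⟨√p, √(r - Complex.normSq z / p), hsp, Real.sqrt_pos.2 hd, fun u => ?_⟩
  have e0 : ((!![((√p : ℝ) : ℂ), z / ((√p : ℝ) : ℂ); 0, ((√(r - Complex.normSq z / p) : ℝ) : ℂ)] :
      M2).mulVec u) =
    ![((√p : ℝ) : ℂ) * u 0 + z / ((√p : ℝ) : ℂ) * u 1, ((√(r - Complex.normSq z / p) : ℝ) : ℂ) *
        u 1] := by
    ext i; fin_cases i <;> simp [Matrix.mulVec, dotProduct, Fin.sum_univ_two]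
  rw [eN, e0]
  simp only [Matrix.cons_val_zero, Matrix.cons_val_one, Complex.normSq_add, Complex.normSq_mul,
    Complex.normSq_ofReal, Complex.normSq_div, hss, htt]
  have e1 : ((√p : ℝ) : ℂ) * u 0 * (starRingEnd ℂ) (z / ((√p : ℝ) : ℂ) * u 1) =
      u 0 * (starRingEnd ℂ) z * (starRingEnd ℂ) (u 1) := by
    have : ((√p : ℝ) : ℂ) ≠ 0 := by exact_mod_cast hsp.ne'
    simp only [map_mul, map_div₀, Complex.conj_ofReal]
    field_simp
  have e2 : ((starRingEnd ℂ) (u 0) * z * u 1).re =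
      (u 0 * (starRingEnd ℂ) z * (starRingEnd ℂ) (u 1)).re := by
    rw [← Complex.conj_re]; simp
  rw [e1, e2]
  ring

namespace HermFam

variable {S : Set ℂ} {E : Type} [AddCommGroup E] [Module ℂ E] {H : HermFam S E} {ω : ℂ}
  {f : ℕ → V2 →ₗ[ℂ] E}

lemma V2.eq_single (u : V2) : u = u 0 • Pi.single 0 1 + u 1 • Pi.single 1 1 := by
  ext i; fin_cases i <;> simp

lemma MinSeq.exists_limit (hf : H.MinSeq f) (hS : IsOpen S) (h0 : (0 : ℂ) ∈ S) :
    ∃ Φ : ℂ → M2, DifferentiableOn ℂ Φ S ∧ ∀ ω ∈ S, ∀ u,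
      Tendsto (fun n => H.ev (f n u) ω) atTop (nhds ((Φ ω).mulVec u)) := by
  obtain ⟨K, hKc, hK⟩ := H.eval
  have hlim0 := tendsto_one_div_add_atTop_nhds_zero_nat (𝕜 := ℝ)
  have hsub : ∀ ω ∈ S, ∀ u (n m : ℕ), ‖H.ev (f n u) ω - H.ev (f m u) ω‖ ≤
      |K ω| * ((1 / ((n : ℝ) + 1) + 1 / ((m : ℝ) + 1)) * ‖u‖) := fun ω hω u n m => by
    have h1 := hK ω hω (f n u - f m u)
    rw [← H.nm_sq h0, ← mul_pow, map_sub, Pi.sub_apply] at h1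
    have h2 : ‖H.ev (f n u) ω - H.ev (f m u) ω‖ ≤ |K ω * H.nm 0 (f n u - f m u)| :=
      (le_abs_self _).trans (sq_le_sq.1 h1)
    rw [abs_mul, abs_of_nonneg (H.nm_nonneg _ _)] at h2
    exact h2.trans (mul_le_mul_of_nonneg_left (hf.nm_sub_le h0 n m u) (abs_nonneg _))
  have hex : ∀ ω (j : Fin 2), ∃ l, ω ∈ S →
      Tendsto (fun n => H.ev (f n (Pi.single j 1)) ω) atTop (nhds l) := fun ω j => by
    by_cases hω : ω ∈ S
    · obtain ⟨l, hl⟩ := cauchySeq_tendsto_of_complete (cauchySeq_of_le_tendsto_0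
        (s := fun n => H.ev (f n (Pi.single j 1)) ω)
        (fun N : ℕ => |K ω| * ((1 / ((N : ℝ) + 1) + 1 / ((N : ℝ) + 1)) *
          ‖(Pi.single j 1 : V2)‖)) (fun n m N hn hm => by
            rw [dist_eq_norm]
            refine (hsub ω hω _ n m).trans ?_
            have hnN : 1 / ((n : ℝ) + 1) ≤ 1 / ((N : ℝ) + 1) := Nat.one_div_le_one_div hn
            have hmN : 1 / ((m : ℝ) + 1) ≤ 1 / ((N : ℝ) + 1) := Nat.one_div_le_one_div hm
            gcongr) (by
          simpa using ((hlim0.add hlim0).mul_const ‖(Pi.single j 1 : V2)‖).const_mul |K ω|))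
      exact ⟨l, fun _ => hl⟩
    · exact ⟨0, fun h => absurd h hω⟩
  choose L hL using hex
  have hdist : ∀ ω ∈ S, ∀ (j : Fin 2) (n : ℕ),
      ‖L ω j - H.ev (f n (Pi.single j 1)) ω‖ ≤ |K ω| * (1 / ((n : ℝ) + 1)) := fun ω hω j n => by
    have h1 : Tendsto (fun m => ‖H.ev (f n (Pi.single j 1)) ω - H.ev (f m (Pi.single j 1)) ω‖) atTop
        (nhds ‖H.ev (f n (Pi.single j 1)) ω - L ω j‖) := ((hL ω j hω).const_sub _).norm
    have h2 : Tendsto (fun m : ℕ => |K ω| * ((1 / ((n : ℝ) + 1) + 1 / ((m : ℝ) + 1)) *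
        ‖(Pi.single j 1 : V2)‖)) atTop
        (nhds (|K ω| * ((1 / ((n : ℝ) + 1) + 0) * ‖(Pi.single j 1 : V2)‖))) :=
      ((hlim0.const_add _).mul_const _).const_mul _
    have h3 := le_of_tendsto_of_tendsto' h1 h2 fun m => hsub ω hω _ n m
    rw [norm_sub_rev] at h3
    have hn1 : ‖(Pi.single j 1 : V2)‖ = 1 := by rw [Pi.norm_single, norm_one]
    simpa [hn1] using h3
  refine ⟨fun ω => Matrix.of fun i j => L ω j i, ?_, fun ω hω u => ?_⟩
  · refine TendstoLocallyUniformlyOn.differentiableOn (φ := atTop)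
      (F := fun n ω => (Matrix.of fun i j => H.ev (f n (Pi.single j 1)) ω i : M2)) ?_
      (Eventually.of_forall fun n => ?_) hS
    · rw [tendstoLocallyUniformlyOn_iff_forall_isCompact hS]
      intro C hCS hC
      obtain ⟨B, hB⟩ := hC.exists_bound_of_continuousOn (hKc.mono hCS)
      rw [Metric.tendstoUniformlyOn_iff]
      intro ε hε
      have hB0 : Tendsto (fun n : ℕ => B * (1 / ((n : ℝ) + 1))) atTop (nhds 0) := by
        simpa using hlim0.const_mul B
      filter_upwards [hB0.eventually (gt_mem_nhds hε)] with n hn ω hω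
      refine lt_of_le_of_lt ?_ hn
      have hBn : 0 ≤ B * (1 / ((n : ℝ) + 1)) :=
        mul_nonneg ((norm_nonneg _).trans (hB ω hω)) (by positivity)
      rw [dist_eq_norm, Matrix.norm_le_iff hBn]
      intro i j
      refine (norm_le_pi_norm (L ω j - H.ev (f n (Pi.single j 1)) ω) i).trans
        ((hdist ω (hCS hω) j n).trans ?_)
      exact mul_le_mul_of_nonneg_right (hB ω hω) (by positivity)
    · exact differentiableOn_matrix fun i j =>
        (differentiableOn_pi.1 (H.holo (f n (Pi.single j 1)))) i
  · have e1 : ∀ n, H.ev (f n u) ω = u 0 • H.ev (f n (Pi.single 0 1)) ω +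
        u 1 • H.ev (f n (Pi.single 1 1)) ω := fun n => by
      conv_lhs => rw [V2.eq_single u, map_add, map_smul, map_smul, map_add, map_smul, map_smul]
      rfl
    have e2 : (Matrix.of fun i j => L ω j i : M2).mulVec u = u 0 • L ω 0 + u 1 • L ω 1 := by
      ext i
      simp [Matrix.mulVec, dotProduct, Fin.sum_univ_two, mul_comm]
    simp only [e1]
    rw [e2]
    exact ((hL ω 0 hω).const_smul _).add ((hL ω 1 hω).const_smul _)

lemma gram_formula (h0 : (0 : ℂ) ∈ S) {G : V2 → V2 → ℂ}
    (hG : ∀ u v, ∀ ω ∈ S, Tendsto (fun n => H.a ω (f n u) (f n v)) atTop (nhds (G u v))) (u : V2) :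
    (G u u).re = (G (Pi.single 0 1) (Pi.single 0 1)).re * Complex.normSq (u 0) +
      2 * ((starRingEnd ℂ) (u 0) * G (Pi.single 0 1) (Pi.single 1 1) * u 1).re +
      (G (Pi.single 1 1) (Pi.single 1 1)).re * Complex.normSq (u 1) := by
  have hre := fun u v => (Complex.continuous_re.tendsto _).comp (hG u v 0 h0)
  have h1 : ∀ n, (H.a 0 (f n u) (f n u)).re =
      (H.a 0 (f n (Pi.single 0 1)) (f n (Pi.single 0 1))).re * Complex.normSq (u 0) +
      2 * ((starRingEnd ℂ) (u 0) * H.a 0 (f n (Pi.single 0 1)) (f n (Pi.single 1 1)) * u 1).re +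
      (H.a 0 (f n (Pi.single 1 1)) (f n (Pi.single 1 1))).re * Complex.normSq (u 1) := fun n => by
    have hsm : ∀ (t : ℂ) (g : E), (H.a 0 (t • g) (t • g)).re =
        (H.a 0 g g).re * Complex.normSq t := fun t g => by
      have := H.re_add_smul (ω := 0) 0 g t
      rw [Complex.normSq_eq_norm_sq]
      simpa [mul_comm] using this
    conv_lhs => rw [V2.eq_single u, map_add, map_smul, map_smul, H.re_add, hsm, hsm]
    simp only [map_smul, LinearMap.map_smulₛₗ, LinearMap.smul_apply, smul_eq_mul]
    congr 4
    ring
  refine tendsto_nhds_unique (hre u u) ?_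
  refine Tendsto.congr (fun n => (h1 n).symm) ?_
  exact (((hre _ _).mul_const _).add (((Complex.continuous_re.tendsto _).comp
    (((hG _ _ 0 h0).const_mul _).mul_const _)).const_mul 2)).add ((hre _ _).mul_const _)

/-- The minimal norm of an extension of a vector at `ω` is the norm of its image under a matrix
depending holomorphically on `ω`. -/
theorem exists_factor (H : HermFam S E) (hS : IsOpen S) (h0 : (0 : ℂ) ∈ S) :
    ∃ B : ℂ → M2, DifferentiableOn ℂ B S ∧ (∀ ω ∈ S, (B ω).det ≠ 0) ∧
      (∃ (s t : ℝ) (z : ℂ), 0 < s ∧ 0 < t ∧ B 0 = !![(s : ℂ), z; 0, t]) ∧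
      (∀ ω ∈ S, ∀ F, eN ((B ω).mulVec (H.ev F ω)) ≤ (H.a ω F F).re) ∧
      ∀ ω ∈ S, ∀ v, ∀ η > 0, ∃ F, H.ev F ω = v ∧ (H.a ω F F).re ≤ eN ((B ω).mulVec v) + η := by
  obtain ⟨f, hf1, hf2⟩ := H.exists_seq h0
  have hf : H.MinSeq f := ⟨hf1, hf2⟩
  obtain ⟨G, hG⟩ := hf.exists_gram h0
  obtain ⟨Φ, hΦ, hlim⟩ := hf.exists_limit hS h0
  obtain ⟨K, -, hK⟩ := H.eval
  have hpos : ∀ u : V2, u ≠ 0 → 0 < (G u u).re := fun u hu => by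
    have h1 : ∀ n, ‖u‖ ^ 2 ≤ K 0 ^ 2 * (H.a 0 (f n u) (f n u)).re := fun n => by
      have := hK 0 h0 (f n u)
      rwa [hf.ev_zero] at this
    have h2 : ‖u‖ ^ 2 ≤ K 0 ^ 2 * (G u u).re :=
      ge_of_tendsto' (((Complex.continuous_re.tendsto _).comp (hG u u 0 h0)).const_mul _) h1
    have h3 : 0 < ‖u‖ ^ 2 := pow_pos (norm_pos_iff.2 hu) 2
    exact pos_of_mul_pos_right (h3.trans_le h2) (sq_nonneg _)
  have hform := H.gram_formula h0 hG
  obtain ⟨s, t, hs, ht, hR⟩ := exists_cholesky (fun u hu => (hform u) ▸ hpos u hu)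
  simp only [← hform] at hR
  set R : M2 := !![(s : ℂ), G (Pi.single 0 1) (Pi.single 1 1) / s; 0, t] with hRdef
  have hlow : ∀ ω ∈ S, ∀ u F, H.ev F ω = (Φ ω).mulVec u → (G u u).re ≤ (H.a ω F F).re :=
    fun ω hω u F hF => hf.lower_bound h0 hω (hG u u ω hω) (hF ▸ hlim ω hω u)
  have hdet : ∀ ω ∈ S, (Φ ω).det ≠ 0 := fun ω hω hd => by
    obtain ⟨u, hu, hu0⟩ := Matrix.exists_mulVec_eq_zero_iff.2 hd
    have := hlow ω hω u 0 (by rw [hu0, map_zero]; rfl)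
    simp only [map_zero, Complex.zero_re] at this
    linarith [hpos u hu]
  have hΦ0 : Φ 0 = 1 := by
    have h1 : ∀ u, (Φ 0).mulVec u = u := fun u =>
      tendsto_nhds_unique (hlim 0 h0 u) (by simp only [hf.ev_zero]; exact tendsto_const_nhds)
    exact Matrix.ext_of_mulVec_single fun j => by rw [h1, Matrix.one_mulVec]
  have hRdet : R.det ≠ 0 := by
    simp [hRdef, Matrix.det_fin_two, hs.ne', ht.ne']
  have hcancel : ∀ ω ∈ S, ∀ v, (Φ ω).mulVec ((Φ ω)⁻¹.mulVec v) = v := fun ω hω v => by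
    rw [Matrix.mulVec_mulVec, Matrix.mul_nonsing_inv _ (isUnit_iff_ne_zero.2 (hdet ω hω)),
      Matrix.one_mulVec]
  refine ⟨fun ω => R * (Φ ω)⁻¹, ?_, fun ω hω => ?_,
    ⟨s, t, G (Pi.single 0 1) (Pi.single 1 1) / s, hs, ht, ?_⟩, fun ω hω F => ?_,
    fun ω hω v η hη => ?_⟩
  · have hd : DifferentiableOn ℂ (fun ω => (Φ ω)⁻¹) S := by
      have : ∀ ω ∈ S, (Φ ω)⁻¹ = ((Φ ω).det)⁻¹ • (Φ ω).adjugate := fun ω _ => by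
        rw [Matrix.inv_def, Ring.inverse_eq_inv']
      refine DifferentiableOn.congr ?_ this
      refine DifferentiableOn.smul (DifferentiableOn.inv ?_ hdet) hΦ.matrix_adjugate
      simp only [Matrix.det_fin_two]
      exact ((hΦ.matrix_entry 0 0).mul (hΦ.matrix_entry 1 1)).sub
        ((hΦ.matrix_entry 0 1).mul (hΦ.matrix_entry 1 0))
    exact (differentiableOn_const R).matrix_mul hd
  · rw [Matrix.det_mul, Matrix.det_nonsing_inv, Ring.inverse_eq_inv']
    exact mul_ne_zero hRdet (inv_ne_zero (hdet ω hω))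
  · simp only [hΦ0, inv_one, mul_one, hRdef]
  · rw [← Matrix.mulVec_mulVec, hR]
    exact hlow ω hω _ F (hcancel ω hω _).symm
  · rw [← Matrix.mulVec_mulVec, hR]
    exact MinSeq.exists_extension hω (hG _ _ ω hω) (by
      have := hlim ω hω ((Φ ω)⁻¹.mulVec v)
      rwa [hcancel ω hω v] at this) hη

end HermFam

/-- The exponential map from the strip of half-width `h` onto the right half-plane. -/
def sexp (h : ℝ) (z : ℂ) : ℂ := Complex.exp ((π / (2 * h) : ℝ) * z)

/-- The closed strip of half-width `h`. -/
def CStrip (h : ℝ) : Set ℂ := {z : ℂ | |z.im| ≤ h}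

variable {h : ℝ} {z ω : ℂ}

lemma Strip.subset_cstrip (h : ℝ) : Strip h ⊆ CStrip h := fun z hz =>
    le_of_lt (show |z.im| < h from hz)

lemma CStrip.isClosed (h : ℝ) : IsClosed (CStrip h) :=
  isClosed_le (continuous_abs.comp Complex.continuous_im) continuous_const

lemma Strip.mem_nhds (hz : z ∈ Strip h) : Strip h ∈ nhds z := (Strip.isOpen h).mem_nhds hz

lemma CStrip.mem_nhds (hz : z ∈ Strip h) : CStrip h ∈ nhds z :=
  mem_of_superset (Strip.mem_nhds hz) (Strip.subset_cstrip h)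

lemma sexp_differentiable (h : ℝ) : Differentiable ℂ (sexp h) := by unfold sexp; fun_prop

lemma sexp_continuous (h : ℝ) : Continuous (sexp h) := (sexp_differentiable h).continuous

lemma sexp_zero (h : ℝ) : sexp h 0 = 1 := by simp [sexp]

lemma sexp_add (h : ℝ) (z ω : ℂ) : sexp h (z + ω) = sexp h z * sexp h ω := by
  rw [sexp, mul_add, Complex.exp_add]; rfl

lemma sexp_ne_zero (h : ℝ) (z : ℂ) : sexp h z ≠ 0 := Complex.exp_ne_zero _

lemma deriv_sexp_ne_zero (hh : 0 < h) (z : ℂ) : deriv (sexp h) z ≠ 0 := by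
  have h1 : HasDerivAt (sexp h) (Complex.exp ((π / (2 * h) : ℝ) * z) * ((π / (2 * h) : ℝ) * 1)) z :=
    ((hasDerivAt_id z).const_mul _).cexp
  rw [h1.deriv]
  have : (π / (2 * h) : ℝ) ≠ 0 := by positivity
  exact mul_ne_zero (Complex.exp_ne_zero _) (mul_ne_zero (by exact_mod_cast this) one_ne_zero)

lemma norm_sexp (h : ℝ) (z : ℂ) : ‖sexp h z‖ = Real.exp (π / (2 * h) * z.re) := by
  rw [sexp, Complex.norm_exp, Complex.re_ofReal_mul]

lemma sexp_re (h : ℝ) (z : ℂ) :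
    (sexp h z).re = Real.exp (π / (2 * h) * z.re) * Real.cos (π / (2 * h) * z.im) := by
  rw [sexp, Complex.exp_re, Complex.re_ofReal_mul, Complex.im_ofReal_mul]

lemma sexp_conj (h : ℝ) (z : ℂ) : sexp h ((starRingEnd ℂ) z) = (starRingEnd ℂ) (sexp h z) := by
  rw [sexp, sexp, ← Complex.exp_conj, map_mul, Complex.conj_ofReal]

lemma sexp_re_pos (hh : 0 < h) (hz : z ∈ Strip h) : 0 < (sexp h z).re := by
  rw [sexp_re]
  have hz' := abs_lt.1 (show |z.im| < h from hz)
  refine mul_pos (Real.exp_pos _) (Real.cos_pos_of_mem_Ioo ⟨?_, ?_⟩)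
  · rw [neg_lt, ← mul_neg, div_mul_eq_mul_div, div_lt_div_iff₀ (by positivity) two_pos]
    nlinarith [Real.pi_pos, mul_lt_mul_of_pos_left hz'.1 Real.pi_pos]
  · rw [div_mul_eq_mul_div, div_lt_div_iff₀ (by positivity) two_pos]
    nlinarith [Real.pi_pos, mul_lt_mul_of_pos_left hz'.2 Real.pi_pos]

lemma sexp_re_nonneg (hh : 0 < h) (hz : z ∈ CStrip h) : 0 ≤ (sexp h z).re := by
  rw [sexp_re]
  have hz' := abs_le.1 (show |z.im| ≤ h from hz)
  refine mul_nonneg (Real.exp_pos _).le (Real.cos_nonneg_of_mem_Icc ⟨?_, ?_⟩)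
  · rw [neg_le, ← mul_neg, div_mul_eq_mul_div, div_le_div_iff₀ (by positivity) two_pos]
    nlinarith [Real.pi_pos, mul_le_mul_of_nonneg_left hz'.1 Real.pi_pos.le]
  · rw [div_mul_eq_mul_div, div_le_div_iff₀ (by positivity) two_pos]
    nlinarith [Real.pi_pos, mul_le_mul_of_nonneg_left hz'.2 Real.pi_pos.le]

lemma sexp_add_mul_I (hh : 0 < h) (x : ℝ) :
    sexp h (x + h * Complex.I) = Real.exp (π / (2 * h) * x) * Complex.I := by
  have e : ((π / (2 * h) : ℝ) : ℂ) * (h * Complex.I) = (π / 2 : ℂ) * Complex.I := by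
    have : (h : ℂ) ≠ 0 := by exact_mod_cast hh.ne'
    push_cast; field_simp
  rw [sexp, mul_add, e, Complex.exp_add, Complex.exp_pi_div_two_mul_I]
  push_cast
  rfl

lemma sexp_add_neg_mul_I (hh : 0 < h) (x : ℝ) :
    sexp h (x + (-h : ℝ) * Complex.I) = -(Real.exp (π / (2 * h) * x) * Complex.I) := by
  have : (x : ℂ) + (-h : ℝ) * Complex.I = (starRingEnd ℂ) (x + h * Complex.I) := by
    simp [Complex.conj_ofReal]
  rw [this, sexp_conj, sexp_add_mul_I hh, map_mul, Complex.conj_ofReal, Complex.conj_I, mul_neg]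

lemma conj_sexp_of_abs_im_eq (hh : 0 < h) (hz : |z.im| = h) :
    (starRingEnd ℂ) (sexp h z) = -sexp h z := by
  rcases abs_eq hh.le |>.1 hz with e | e
  · rw [← Complex.re_add_im z, e, sexp_add_mul_I hh, map_mul, Complex.conj_ofReal, Complex.conj_I,
      mul_neg]
  · rw [← Complex.re_add_im z, e, sexp_add_neg_mul_I hh, map_neg, map_mul, Complex.conj_ofReal,
      Complex.conj_I, mul_neg]

lemma sexp_re_of_abs_im_eq (hh : 0 < h) (hz : |z.im| = h) : (sexp h z).re = 0 := by
  have := congr_arg Complex.re (conj_sexp_of_abs_im_eq hh hz)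
  rw [Complex.conj_re, Complex.neg_re] at this
  linarith

lemma sexp_injOn (hh : 0 < h) : Set.InjOn (sexp h) (CStrip h) := by
  intro z hz ω hω e
  obtain ⟨n, hn⟩ := Complex.exp_eq_exp_iff_exists_int.1 e
  have hz' := abs_le.1 (show |z.im| ≤ h from hz)
  have hω' := abs_le.1 (show |ω.im| ≤ h from hω)
  have hp : 0 < π / (2 * h) := by positivity
  have him := congr_arg Complex.im hn
  have e2 : (n : ℂ) * (2 * (π : ℂ) * Complex.I) = ((n * (2 * π) : ℝ) : ℂ) * Complex.I := by
    push_cast; ring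
  rw [e2, Complex.im_ofReal_mul, Complex.add_im, Complex.im_ofReal_mul, Complex.im_ofReal_mul,
    Complex.I_im, mul_one] at him
  have h1 : |(n : ℝ) * (2 * π)| ≤ π := by
    have : (n : ℝ) * (2 * π) = π / (2 * h) * (z.im - ω.im) := by linarith
    rw [this, abs_mul, abs_of_pos hp, div_mul_eq_mul_div, div_le_iff₀ (by positivity)]
    exact mul_le_mul_of_nonneg_left (abs_le.2 ⟨by linarith, by linarith⟩) Real.pi_pos.le
  have hn0 : n = 0 := by
    by_contra hne
    have : (1 : ℝ) ≤ |(n : ℝ)| := by exact_mod_cast Int.one_le_abs hne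
    rw [abs_mul, abs_of_pos (by positivity : 0 < 2 * π)] at h1
    nlinarith [Real.pi_pos]
  rw [hn0, Int.cast_zero, zero_mul, add_zero] at hn
  exact mul_left_cancel₀ (by exact_mod_cast hp.ne') hn

/-- The density of the harmonic measure of the strip at the origin, up to normalisation. -/
def kap (h x : ℝ) : ℝ := Real.exp (π / (2 * h) * x) / (1 + Real.exp (π / (2 * h) * x) ^ 2)

lemma kap_pos (h x : ℝ) : 0 < kap h x := by unfold kap; positivity

lemma kap_continuous (h : ℝ) : Continuous (kap h) := by
  unfold kap
  exact Continuous.div (by fun_prop) (by fun_prop) fun x => by positivity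

lemma kap_integrable (hh : 0 < h) : MeasureTheory.Integrable (kap h) := by
  have hp : 0 < π / (2 * h) := by positivity
  rw [← MeasureTheory.integrableOn_univ, ← Set.Iic_union_Ioi (a := (0 : ℝ)),
    MeasureTheory.integrableOn_union]
  refine ⟨(integrableOn_exp_mul_Iic hp 0).mono' (kap_continuous h).aestronglyMeasurable
      (MeasureTheory.ae_of_all _ fun x => ?_),
    (integrableOn_exp_mul_Ioi (neg_lt_zero.2 hp) 0).mono' (kap_continuous h).aestronglyMeasurable
      (MeasureTheory.ae_of_all _ fun x => ?_)⟩
  · rw [Real.norm_eq_abs, abs_of_pos (kap_pos h x), kap, div_le_iff₀ (by positivity)]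
    nlinarith [Real.exp_pos (π / (2 * h) * x), sq_nonneg (Real.exp (π / (2 * h) * x))]
  · rw [Real.norm_eq_abs, abs_of_pos (kap_pos h x), kap, div_le_iff₀ (by positivity), neg_mul,
      Real.exp_neg]
    have := Real.exp_pos (π / (2 * h) * x)
    field_simp
    linarith

/-- The boundary line of the strip at height `y`. -/
def bline (y x : ℝ) : ℂ := x + (y : ℝ) * Complex.I

lemma bline_re (y x : ℝ) : (bline y x).re = x := by simp [bline]

lemma bline_im (y x : ℝ) : (bline y x).im = y := by simp [bline]

lemma bline_continuous (y : ℝ) : Continuous (bline y) := by unfold bline; fun_prop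

lemma bline_measurableEmbedding (y : ℝ) : MeasurableEmbedding (bline y) :=
  (bline_continuous y).measurableEmbedding fun a b e => by
    rw [← bline_re y a, e, bline_re]

open MeasureTheory in
/-- Harmonic measure of the strip at the origin, up to normalisation. -/
def bdM (h : ℝ) : Measure ℂ :=
  Measure.map (bline h) (volume.withDensity fun x => ENNReal.ofReal (kap h x)) +
  Measure.map (bline (-h)) (volume.withDensity fun x => ENNReal.ofReal (kap h x))

open MeasureTheory

lemma kap_isFinite (hh : 0 < h) :
    IsFiniteMeasure (volume.withDensity fun x => ENNReal.ofReal (kap h x)) :=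
  isFiniteMeasure_withDensity_ofReal (kap_integrable hh).2

lemma bdM_isFinite (hh : 0 < h) : IsFiniteMeasure (bdM h) := by
  have := kap_isFinite hh
  unfold bdM
  infer_instance

lemma ae_bdM (hh : 0 < h) : ∀ᵐ z ∂(bdM h), |z.im| = h := by
  have hm : MeasurableSet {z : ℂ | |z.im| = h} :=
    (isClosed_eq (continuous_abs.comp Complex.continuous_im) continuous_const).measurableSet
  rw [bdM, ae_add_measure_iff]
  constructor
  · rw [ae_map_iff (bline_continuous _).measurable.aemeasurable hm]
    exact ae_of_all _ fun x => by rw [bline_im, abs_of_pos hh]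
  · rw [ae_map_iff (bline_continuous _).measurable.aemeasurable hm]
    exact ae_of_all _ fun x => by rw [bline_im, abs_neg, abs_of_pos hh]

lemma bdM_restrict (hh : 0 < h) : (bdM h).restrict (CStrip h) = bdM h :=
  Measure.restrict_eq_self_of_ae_mem ((ae_bdM hh).mono fun _ hz => hz.le)

lemma bdM_aesm {E : Type} [NormedAddCommGroup E] [SecondCountableTopology E] (hh : 0 < h)
    {f : ℂ → E} (hf : ContinuousOn f (CStrip h)) : AEStronglyMeasurable f (bdM h) := by
  rw [← bdM_restrict hh]
  exact hf.aestronglyMeasurable (CStrip.isClosed h).measurableSet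

lemma bdM_integrable {E : Type} [NormedAddCommGroup E] (hh : 0 < h)
    {f : ℂ → E} (hf : AEStronglyMeasurable f (bdM h)) {C : ℝ} (hC : ∀ z, |z.im| = h → ‖f z‖ ≤ C) :
    Integrable f (bdM h) := by
  have := bdM_isFinite hh
  exact Integrable.of_bound hf C ((ae_bdM hh).mono hC)

lemma integral_kap (g : ℝ → ℂ) :
    ∫ x, g x ∂(volume.withDensity fun x => ENNReal.ofReal (kap h x)) = ∫ x, kap h x • g x := by
  rw [integral_withDensity_eq_integral_toReal_smul
    (kap_continuous h).measurable.ennreal_ofReal (ae_of_all _ fun x => ENNReal.ofReal_lt_top)]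
  simp only [ENNReal.toReal_ofReal (kap_pos h _).le]

lemma integral_bdM {f : ℂ → ℂ} (hf : Integrable f (bdM h)) :
    ∫ z, f z ∂(bdM h) =
      (∫ x, kap h x • f (bline h x)) + ∫ x, kap h x • f (bline (-h) x) := by
  rw [bdM] at hf ⊢
  rw [integral_add_measure hf.left_of_add_measure hf.right_of_add_measure,
    (bline_measurableEmbedding h).integral_map, (bline_measurableEmbedding (-h)).integral_map,
    integral_kap, integral_kap]

lemma integrable_kap_smul {f : ℂ → ℂ} (hf : Integrable f (bdM h)) :
    Integrable (fun x => kap h x • f (bline h x)) ∧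
      Integrable (fun x => kap h x • f (bline (-h) x)) := by
  rw [bdM, integrable_add_measure, (bline_measurableEmbedding h).integrable_map_iff,
    (bline_measurableEmbedding (-h)).integrable_map_iff,
    integrable_withDensity_iff_integrable_smul'
      (kap_continuous h).measurable.ennreal_ofReal (ae_of_all _ fun x => ENNReal.ofReal_lt_top),
    integrable_withDensity_iff_integrable_smul'
      (kap_continuous h).measurable.ennreal_ofReal
        (ae_of_all _ fun x => ENNReal.ofReal_lt_top)] at hf
  simpa only [Function.comp_apply, ENNReal.toReal_ofReal (kap_pos h _).le] using hf

lemma dslope_sexp_ne_zero (hh : 0 < h) (hω : ω ∈ CStrip h) (hz : z ∈ CStrip h) :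
    dslope (sexp h) ω z ≠ 0 := by
  rcases eq_or_ne z ω with rfl | hne
  · rw [dslope_same]; exact deriv_sexp_ne_zero hh z
  · rw [dslope_of_ne _ hne, slope_def_module]
    exact smul_ne_zero (inv_ne_zero (sub_ne_zero.2 hne))
      (sub_ne_zero.2 fun e => hne (sexp_injOn hh hz hω e))

lemma continuousOn_dslope_cstrip {E : Type} [NormedAddCommGroup E] [NormedSpace ℂ E] {g : ℂ → E}
    (hω : ω ∈ Strip h) (hg : ContinuousOn g (CStrip h)) (hg' : DifferentiableOn ℂ g (Strip h)) :
    ContinuousOn (dslope g ω) (CStrip h) :=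
  (continuousOn_dslope (CStrip.mem_nhds hω)).2 ⟨hg, hg'.differentiableAt (Strip.mem_nhds hω)⟩

lemma differentiableOn_dslope_strip {E : Type} [NormedAddCommGroup E] [NormedSpace ℂ E]
    [CompleteSpace E] {g : ℂ → E} (hω : ω ∈ Strip h) (hg' : DifferentiableOn ℂ g (Strip h)) :
    DifferentiableOn ℂ (dslope g ω) (Strip h) :=
  (Complex.differentiableOn_dslope (Strip.mem_nhds hω)).2 hg'

lemma sexp_add_one_ne_zero (hh : 0 < h) (hz : z ∈ CStrip h) : sexp h z + 1 ≠ 0 := fun e => by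
  have := congr_arg Complex.re e
  have h2 := sexp_re_nonneg hh hz
  simp only [Complex.add_re, Complex.one_re, Complex.zero_re] at this
  linarith

/-- Mean value property of holomorphic functions with respect to harmonic measure. -/
theorem integral_bdM_eq_zero (hh : 0 < h) {g : ℂ → ℂ} (hg : ContinuousOn g (CStrip h))
    (hg' : DifferentiableOn ℂ g (Strip h)) {C : ℝ} (hC : ∀ z ∈ CStrip h, ‖g z‖ ≤ C)
    (hg0 : g 0 = 0) : ∫ z, g z ∂(bdM h) = 0 := by
  have h0 : (0 : ℂ) ∈ Strip h := by simpa [Strip] using hh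
  have h0' := Strip.subset_cstrip h h0
  have hC0 : 0 ≤ C := (norm_nonneg _).trans (hC 0 h0')
  have h_int : Integrable g (bdM h) := bdM_integrable hh (bdM_aesm hh hg) fun z hz => hC z hz.le
  obtain ⟨i1, i2⟩ := integrable_kap_smul h_int
  set F : ℂ → ℂ := fun z =>
    dslope g 0 z * (sexp h z / ((sexp h z + 1) * dslope (sexp h) 0 z)) with hF
  have hFc : ContinuousOn F (CStrip h) :=
    (continuousOn_dslope_cstrip h0 hg hg').mul ((sexp_continuous h).continuousOn.div
      (((sexp_continuous h).continuousOn.add continuousOn_const).mul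
        (continuousOn_dslope_cstrip h0 (sexp_continuous h).continuousOn
          (sexp_differentiable h).differentiableOn))
      fun z hz => mul_ne_zero (sexp_add_one_ne_zero hh hz) (dslope_sexp_ne_zero hh h0' hz))
  have hFd : DifferentiableOn ℂ F (Strip h) :=
    (differentiableOn_dslope_strip h0 hg').mul ((sexp_differentiable h).differentiableOn.div
      (((sexp_differentiable h).differentiableOn.add (differentiableOn_const _)).mul
        (differentiableOn_dslope_strip h0 (sexp_differentiable h).differentiableOn))
      fun z hz => mul_ne_zero (sexp_add_one_ne_zero hh (Strip.subset_cstrip h hz))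
        (dslope_sexp_ne_zero hh h0' (Strip.subset_cstrip h hz)))
  have hFeq : ∀ z ∈ CStrip h, z ≠ 0 → F z = g z * (sexp h z / (sexp h z ^ 2 - 1)) := by
    intro z hz hz0
    have h1 := sexp_add_one_ne_zero hh hz
    have h2 : sexp h z - 1 ≠ 0 := sub_ne_zero.2 fun e => hz0
      (sexp_injOn hh hz h0' (by rw [e, sexp_zero]))
    have h3 : sexp h z ^ 2 - 1 ≠ 0 := by
      have : sexp h z ^ 2 - 1 = (sexp h z - 1) * (sexp h z + 1) := by ring
      rw [this]; exact mul_ne_zero h2 h1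
    simp only [hF, dslope_of_ne _ hz0, slope_def_field, sub_zero, hg0, sexp_zero]
    field_simp
    ring
  have htop : ∀ x, F (bline h x) = -Complex.I * (kap h x • g (bline h x)) := fun x => by
    have hm : bline h x ∈ CStrip h := by simp [CStrip, bline_im, abs_of_pos hh]
    have hne : bline h x ≠ 0 := fun e => hh.ne' (by simpa [bline_im] using congr_arg Complex.im e)
    rw [hFeq _ hm hne, bline, sexp_add_mul_I hh, kap, Complex.real_smul, mul_pow, Complex.I_sq]
    push_cast [-Complex.ofReal_exp]
    generalize (Real.exp (π / (2 * h) * x) : ℂ) = e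
    rw [show e ^ 2 * -1 - 1 = -(1 + e ^ 2) by ring, div_neg]
    ring
  have hbot : ∀ x, F (bline (-h) x) = Complex.I * (kap h x • g (bline (-h) x)) := fun x => by
    have hm : bline (-h) x ∈ CStrip h := by simp [CStrip, bline_im, abs_of_pos hh]
    have hne : bline (-h) x ≠ 0 := fun e =>
      hh.ne' (by simpa [bline_im] using congr_arg Complex.im e)
    rw [hFeq _ hm hne, bline, sexp_add_neg_mul_I hh, kap, Complex.real_smul, neg_sq, mul_pow,
      Complex.I_sq]
    push_cast [-Complex.ofReal_exp]
    generalize (Real.exp (π / (2 * h) * x) : ℂ) = e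
    rw [show e ^ 2 * -1 - 1 = -(1 + e ^ 2) by ring, div_neg]
    ring
  have it : Integrable (fun x => F (bline h x)) := by
    simp only [htop]; exact i1.const_mul _
  have ib : Integrable (fun x => F (bline (-h) x)) := by
    simp only [hbot]; exact i2.const_mul _
  set τ : ℝ := π / (2 * h) with hτ
  have hτ0 : 0 < τ := by positivity
  have hexp : Tendsto (fun R : ℝ => Real.exp (τ * R)) atTop atTop :=
    Real.tendsto_exp_atTop.comp (tendsto_id.const_mul_atTop hτ0)
  have hside : ∀ᶠ R : ℝ in atTop, ∀ z ∈ CStrip h, (z.re = R ∨ z.re = -R) →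
      ‖F z‖ ≤ 2 * C / Real.exp (τ * R) := by
    filter_upwards [hexp.eventually_ge_atTop 2, eventually_gt_atTop 0] with R hR hR0 z hz hzR
    have hz0 : z ≠ 0 := by
      rintro rfl
      rcases hzR with e | e <;> simp at e <;> linarith
    set X := Real.exp (τ * R)
    rw [hFeq z hz hz0, norm_mul, norm_div, mul_comm 2 C, mul_div_assoc]
    refine mul_le_mul (hC z hz) ?_ (by positivity) hC0
    rcases hzR with e | e
    · have hw : ‖sexp h z‖ = X := by rw [norm_sexp, e]
      have h1 : X ^ 2 - 1 ≤ ‖sexp h z ^ 2 - 1‖ := by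
        have := norm_sub_norm_le (sexp h z ^ 2) 1
        rwa [norm_pow, hw, norm_one] at this
      rw [hw, div_le_div_iff₀ (by nlinarith) (by linarith)]
      nlinarith
    · have hw : ‖sexp h z‖ = X⁻¹ := by rw [norm_sexp, e, mul_neg, Real.exp_neg]
      have h1 : 1 - (X ^ 2)⁻¹ ≤ ‖sexp h z ^ 2 - 1‖ := by
        have := norm_sub_norm_le 1 (sexp h z ^ 2)
        rwa [norm_pow, hw, norm_one, norm_sub_rev, inv_pow] at this
      have h2 : (X ^ 2)⁻¹ ≤ 1 / 2 := by
        rw [inv_eq_one_div]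
        exact one_div_le_one_div_of_le two_pos (by nlinarith)
      rw [hw, div_le_iff₀ (by linarith), div_mul_eq_mul_div, ← one_div]
      exact div_le_div_of_nonneg_right (by linarith) (by positivity)
  have hrect : ∀ᶠ R : ℝ in atTop,
      ‖(∫ x in (-R)..R, F (bline (-h) x)) - ∫ x in (-R)..R, F (bline h x)‖ ≤
        2 * (2 * C / Real.exp (τ * R) * (2 * h)) := by
    filter_upwards [hside, eventually_gt_atTop 0] with R hR hR0
    have hsub : (Set.uIcc (-R) R ×ℂ Set.uIcc (-h) h) ⊆ CStrip h := by
      rintro z ⟨-, hz⟩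
      rw [Set.mem_preimage, Set.uIcc_of_le (by linarith)] at hz
      exact abs_le.2 hz
    have key := Complex.integral_boundary_rect_eq_zero_of_continuousOn_of_differentiableOn F
      ⟨-R, -h⟩ ⟨R, h⟩ (hFc.mono hsub) (hFd.mono (by
        rintro z ⟨-, hz⟩
        rw [Set.mem_preimage] at hz
        simp only [min_eq_left (by linarith : -h ≤ h), max_eq_right (by linarith : -h ≤ h)] at hz
        exact abs_lt.2 hz))
    have hv : ∀ s : ℝ, (s = R ∨ s = -R) →
        ‖∫ y : ℝ in (-h)..h, F (s + y * Complex.I)‖ ≤ 2 * C / Real.exp (τ * R) * (2 * h) :=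
      fun s hs => by
        have := intervalIntegral.norm_integral_le_of_norm_le_const (a := -h) (b := h)
          (f := fun y : ℝ => F (s + y * Complex.I)) (C := 2 * C / Real.exp (τ * R)) fun y hy => by
            rw [Set.uIoc_of_le (by linarith)] at hy
            refine hR _ ?_ ?_
            · simpa [CStrip] using abs_le.2 ⟨hy.1.le, hy.2⟩
            · simpa using hs
        rwa [sub_neg_eq_add, ← two_mul, abs_of_pos (by linarith)] at this
    simp only [smul_eq_mul] at key
    have e : (∫ x in (-R)..R, F (bline (-h) x)) - ∫ x in (-R)..R, F (bline h x) =
        Complex.I * (∫ y : ℝ in (-h)..h, F ((-R : ℝ) + y * Complex.I)) -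
          Complex.I * ∫ y : ℝ in (-h)..h, F (R + y * Complex.I) := by
      simp only [bline]
      linear_combination key
    rw [e]
    refine (norm_sub_le _ _).trans ?_
    rw [norm_mul, norm_mul, Complex.norm_I, one_mul, one_mul, two_mul]
    exact add_le_add (hv _ (Or.inr rfl)) (hv _ (Or.inl rfl))
  have hlim0 : Tendsto (fun R : ℝ => 2 * (2 * C / Real.exp (τ * R) * (2 * h))) atTop (nhds 0) := by
    simpa using ((tendsto_const_nhds.div_atTop hexp).mul_const (2 * h)).const_mul 2
  have hlim := (intervalIntegral_tendsto_integral ib tendsto_neg_atTop_atBot tendsto_id).sub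
    (intervalIntegral_tendsto_integral it tendsto_neg_atTop_atBot tendsto_id)
  have hz := tendsto_nhds_unique hlim (squeeze_zero_norm' hrect hlim0)
  simp only [htop, hbot] at hz
  rw [integral_const_mul, integral_const_mul] at hz
  rw [integral_bdM h_int]
  have : Complex.I * ((∫ x, kap h x • g (bline h x)) + ∫ x, kap h x • g (bline (-h) x)) = 0 := by
    linear_combination hz
  exact (mul_eq_zero.1 this).resolve_left Complex.I_ne_zero

/-- The Poisson kernel of the strip, relative to harmonic measure at the origin. -/
def pker (h : ℝ) (ω z : ℂ) : ℝ :=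
  (sexp h ω).re * ‖sexp h z - 1‖ ^ 2 / ‖sexp h z - sexp h ω‖ ^ 2

/-- The Poisson kernel divided by a function vanishing at `ω` (as a divided difference). -/
def pmul (h : ℝ) (ω z : ℂ) : ℂ :=
  (sexp h ω).re * (sexp h z ^ 2 - 1) /
    (dslope (sexp h) ω z * (sexp h z + (starRingEnd ℂ) (sexp h ω)))

lemma pker_measurable (h : ℝ) (ω : ℂ) : Measurable (pker h ω) := by
  have := (sexp_continuous h).measurable
  unfold pker
  fun_prop

lemma pker_nonneg (hh : 0 < h) (hω : ω ∈ Strip h) (z : ℂ) : 0 ≤ pker h ω z := by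
  have := sexp_re_pos hh hω
  unfold pker; positivity

lemma re_le_norm_sexp_add_conj (hh : 0 < h) (hz : z ∈ CStrip h) :
    (sexp h ω).re ≤ ‖sexp h z + (starRingEnd ℂ) (sexp h ω)‖ := by
  refine le_trans ?_ (Complex.re_le_norm _)
  rw [Complex.add_re, Complex.conj_re]
  linarith [sexp_re_nonneg hh hz]

lemma sexp_add_conj_ne_zero (hh : 0 < h) (hω : ω ∈ Strip h) (hz : z ∈ CStrip h) :
    sexp h z + (starRingEnd ℂ) (sexp h ω) ≠ 0 :=
  norm_pos_iff.1 ((sexp_re_pos hh hω).trans_le (re_le_norm_sexp_add_conj hh hz))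

lemma re_le_norm_sexp_sub (hh : 0 < h) (hz : |z.im| = h) :
    (sexp h ω).re ≤ ‖sexp h z - sexp h ω‖ := by
  rw [norm_sub_rev]
  refine le_trans ?_ (Complex.re_le_norm _)
  rw [Complex.sub_re, sexp_re_of_abs_im_eq hh hz, sub_zero]

/-- Supremum of the Poisson kernel. -/
def pbd (h : ℝ) (ω : ℂ) : ℝ := (sexp h ω).re * (1 + ‖sexp h ω - 1‖ / (sexp h ω).re) ^ 2

lemma pker_le (hh : 0 < h) (hω : ω ∈ Strip h) (hz : |z.im| = h) : pker h ω z ≤ pbd h ω := by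
  have h1 := sexp_re_pos hh hω
  have h2 := re_le_norm_sexp_sub (ω := ω) hh hz
  have h3 : 0 < ‖sexp h z - sexp h ω‖ := h1.trans_le h2
  rw [pker, pbd, mul_div_assoc, ← div_pow]
  refine mul_le_mul_of_nonneg_left (pow_le_pow_left₀ (by positivity) ?_ 2) h1.le
  rw [div_le_iff₀ h3, add_mul, one_mul]
  have h4 : ‖sexp h z - 1‖ ≤ ‖sexp h z - sexp h ω‖ + ‖sexp h ω - 1‖ :=
    norm_sub_le_norm_sub_add_norm_sub _ _ _
  have h5 : ‖sexp h ω - 1‖ ≤ ‖sexp h ω - 1‖ / (sexp h ω).re * ‖sexp h z - sexp h ω‖ := by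
    rw [div_mul_eq_mul_div, le_div_iff₀ h1]
    exact mul_le_mul_of_nonneg_left h2 (norm_nonneg _)
  linarith

lemma pbd_continuousOn (hh : 0 < h) : ContinuousOn (pbd h) (Strip h) := by
  have hc := (sexp_continuous h).continuousOn (s := Strip h)
  have hr := Complex.continuous_re.comp_continuousOn hc
  exact hr.mul ((continuousOn_const.add ((hc.sub continuousOn_const).norm.div hr
    fun ω hω => (sexp_re_pos hh hω).ne')).pow 2)

lemma pker_eq (hh : 0 < h) (hz : |z.im| = h) :
    (pker h ω z : ℂ) = (sexp h ω).re * (sexp h z ^ 2 - 1) /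
      ((sexp h z - sexp h ω) * (sexp h z + (starRingEnd ℂ) (sexp h ω))) := by
  have hc := conj_sexp_of_abs_im_eq hh hz
  have h1 : ((‖sexp h z - 1‖ : ℝ) : ℂ) ^ 2 = -(sexp h z ^ 2 - 1) := by
    rw [← Complex.conj_mul', map_sub, map_one, hc]; ring
  have h2 : ((‖sexp h z - sexp h ω‖ : ℝ) : ℂ) ^ 2 =
      -((sexp h z - sexp h ω) * (sexp h z + (starRingEnd ℂ) (sexp h ω))) := by
    rw [← Complex.conj_mul', map_sub, hc]; ring
  rw [pker]
  push_cast
  rw [h1, h2, mul_neg, neg_div_neg_eq]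

section

variable {E : Type} [NormedAddCommGroup E] [NormedSpace ℂ E] {g : ℂ → E}

lemma pmul_smul_dslope_of_ne (hne : z ≠ ω) (hgω : g ω = 0) :
    pmul h ω z • dslope g ω z = ((sexp h ω).re * (sexp h z ^ 2 - 1) /
      ((sexp h z - sexp h ω) * (sexp h z + (starRingEnd ℂ) (sexp h ω))) : ℂ) • g z := by
  have : z - ω ≠ 0 := sub_ne_zero.2 hne
  rw [pmul, dslope_of_ne _ hne, dslope_of_ne _ hne, slope_def_module, slope_def_module, hgω,
    sub_zero, smul_smul, smul_eq_mul]
  congr 1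
  field_simp

lemma pmul_smul_dslope_boundary (hh : 0 < h) (hω : ω ∈ Strip h) (hz : |z.im| = h) (hgω : g ω = 0) :
    pmul h ω z • dslope g ω z = (pker h ω z : ℂ) • g z := by
  rw [pmul_smul_dslope_of_ne _ hgω, pker_eq hh hz]
  rintro rfl
  exact (lt_irrefl h (hz ▸ hω : h < h))

lemma pmul_smul_dslope_zero : pmul h ω 0 • dslope g ω 0 = 0 := by
  rw [pmul, sexp_zero]; simp

lemma pmul_continuousOn (hh : 0 < h) (hω : ω ∈ Strip h) :
    ContinuousOn (pmul h ω) (CStrip h) := by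
  have hc := (sexp_continuous h).continuousOn (s := CStrip h)
  exact ((continuousOn_const.mul ((hc.pow 2).sub continuousOn_const)).div
    ((continuousOn_dslope_cstrip hω hc (sexp_differentiable h).differentiableOn).mul
      (hc.add continuousOn_const)) fun z hz => mul_ne_zero
        (dslope_sexp_ne_zero hh (Strip.subset_cstrip h hω) hz) (sexp_add_conj_ne_zero hh hω hz))

lemma pmul_differentiableOn (hh : 0 < h) (hω : ω ∈ Strip h) :
    DifferentiableOn ℂ (pmul h ω) (Strip h) := by
  have hc := (sexp_differentiable h).differentiableOn (s := Strip h)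
  exact (((differentiableOn_const _).mul ((hc.pow 2).sub (differentiableOn_const _))).div
    ((differentiableOn_dslope_strip hω hc).mul
      (hc.add (differentiableOn_const _))) fun z hz => mul_ne_zero
        (dslope_sexp_ne_zero hh (Strip.subset_cstrip h hω) (Strip.subset_cstrip h hz))
        (sexp_add_conj_ne_zero hh hω (Strip.subset_cstrip h hz)))

lemma exists_bound_pmul_smul_dslope (hh : 0 < h) (hω : ω ∈ Strip h)
    (hg : ContinuousOn g (CStrip h)) (hg' : DifferentiableOn ℂ g (Strip h))
    {C : ℝ} (hC : ∀ z ∈ CStrip h, ‖g z‖ ≤ C) (hgω : g ω = 0) :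
    ∃ C', ∀ z ∈ CStrip h, ‖pmul h ω z • dslope g ω z‖ ≤ C' := by
  have hρ := sexp_re_pos hh hω
  have hτ : 0 < π / (2 * h) := by positivity
  set ρ := (sexp h ω).re with hρdef
  set r := ‖sexp h ω‖ with hr
  have hρr : ρ ≤ r := Complex.re_le_norm _
  have hr0 : 0 < r := hρ.trans_le hρr
  set d := ‖sexp h ω - 1‖
  obtain ⟨C₁, hC₁⟩ := (((isCompact_Icc (a := Real.log (r / 2) / (π / (2 * h)))
    (b := Real.log (2 * r) / (π / (2 * h)))).reProdIm
      (isCompact_Icc (a := -h) (b := h))).exists_bound_of_continuousOn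
    (((pmul_continuousOn hh hω).smul (continuousOn_dslope_cstrip hω hg hg')).mono fun z hz =>
      abs_le.2 hz.2))
  refine ⟨max C₁ (ρ * ((1 + 2 * d / ρ) * (1 + d / ρ)) * C), fun z hz => ?_⟩
  by_cases hcase : r / 2 ≤ ‖sexp h z‖ ∧ ‖sexp h z‖ ≤ 2 * r
  · refine le_max_of_le_left (hC₁ z ⟨?_, abs_le.1 hz⟩)
    rw [norm_sexp] at hcase
    refine ⟨?_, ?_⟩
    · rw [div_le_iff₀ hτ, mul_comm]
      exact (Real.log_le_iff_le_exp (by positivity)).2 hcase.1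
    · rw [le_div_iff₀ hτ, mul_comm]
      exact (Real.le_log_iff_exp_le (by positivity)).2 hcase.2
  · refine le_max_of_le_right ?_
    have hfar : r / 2 ≤ ‖sexp h z - sexp h ω‖ := by
      by_contra hlt
      push Not at hlt
      refine hcase ⟨?_, ?_⟩
      · linarith [norm_sub_norm_le (sexp h ω) (sexp h z), norm_sub_rev (sexp h ω) (sexp h z)]
      · linarith [norm_sub_norm_le (sexp h z) (sexp h ω)]
    have hne : z ≠ ω := by
      rintro rfl
      rw [sub_self, norm_zero] at hfar
      linarith
    have h1 : 0 < ‖sexp h z - sexp h ω‖ := by linarith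
    have h2 := re_le_norm_sexp_add_conj (ω := ω) hh hz
    rw [← hρdef] at h2
    have h3 : 0 < ‖sexp h z + (starRingEnd ℂ) (sexp h ω)‖ := hρ.trans_le h2
    have e1 : ‖sexp h z - 1‖ / ‖sexp h z - sexp h ω‖ ≤ 1 + 2 * d / ρ := by
      rw [div_le_iff₀ h1, add_mul, one_mul]
      have h4 : ‖sexp h z - 1‖ ≤ ‖sexp h z - sexp h ω‖ + d :=
        norm_sub_le_norm_sub_add_norm_sub _ _ _
      have h5 : d ≤ 2 * d / ρ * ‖sexp h z - sexp h ω‖ := by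
        rw [div_mul_eq_mul_div, le_div_iff₀ hρ]
        nlinarith [norm_nonneg (sexp h ω - 1)]
      linarith
    have e2 : ‖sexp h z + 1‖ / ‖sexp h z + (starRingEnd ℂ) (sexp h ω)‖ ≤ 1 + d / ρ := by
      rw [div_le_iff₀ h3, add_mul, one_mul]
      have h4 : ‖sexp h z + 1‖ ≤ ‖sexp h z + (starRingEnd ℂ) (sexp h ω)‖ + d := by
        have e : sexp h z + 1 = (sexp h z + (starRingEnd ℂ) (sexp h ω)) -
          (starRingEnd ℂ) (sexp h ω - 1) := by rw [map_sub, map_one]; ring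
        rw [e]
        refine (norm_sub_le _ _).trans (le_of_eq ?_)
        rw [RCLike.norm_conj (sexp h ω - 1)]
      have h5 : d ≤ d / ρ * ‖sexp h z + (starRingEnd ℂ) (sexp h ω)‖ := by
        rw [div_mul_eq_mul_div, le_div_iff₀ hρ]
        exact mul_le_mul_of_nonneg_left h2 (norm_nonneg _)
      linarith
    rw [pmul_smul_dslope_of_ne hne hgω, norm_smul, norm_div, norm_mul, norm_mul,
      Complex.norm_real, Real.norm_eq_abs, abs_of_pos hρ,
      show sexp h z ^ 2 - 1 = (sexp h z - 1) * (sexp h z + 1) by ring, norm_mul, mul_div_assoc,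
      mul_div_mul_comm]
    refine mul_le_mul (mul_le_mul_of_nonneg_left (mul_le_mul e1 e2 (by positivity) ?_) hρ.le)
      (hC z hz) (norm_nonneg _) ?_
    · positivity
    · positivity

end

/-- Mean value property with respect to harmonic measure at `ω`. -/
lemma integral_pker_mul_eq_zero (hh : 0 < h) (hω : ω ∈ Strip h) {g : ℂ → ℂ}
    (hg : ContinuousOn g (CStrip h)) (hg' : DifferentiableOn ℂ g (Strip h)) {C : ℝ}
    (hC : ∀ z ∈ CStrip h, ‖g z‖ ≤ C) (hgω : g ω = 0) :
    ∫ z, (pker h ω z : ℂ) * g z ∂(bdM h) = 0 := by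
  obtain ⟨C', hC'⟩ := exists_bound_pmul_smul_dslope hh hω hg hg' hC hgω
  rw [← integral_bdM_eq_zero hh
      ((pmul_continuousOn hh hω).smul (continuousOn_dslope_cstrip hω hg hg'))
    ((pmul_differentiableOn hh hω).smul (differentiableOn_dslope_strip hω hg')) hC'
    pmul_smul_dslope_zero]
  refine integral_congr_ae ((ae_bdM hh).mono fun z hz => ?_)
  exact (pmul_smul_dslope_boundary hh hω hz hgω).symm

/-- The analytic part of the Poisson kernel. -/
def pan (h : ℝ) (ω z : ℂ) : ℂ :=
  ((starRingEnd ℂ) (sexp h ω) - 1) * (sexp h z - 1) /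
    (2 * (sexp h z + (starRingEnd ℂ) (sexp h ω)))

lemma pan_zero : pan h ω 0 = 0 := by simp [pan, sexp_zero]

lemma pan_continuousOn (hh : 0 < h) (hω : ω ∈ Strip h) : ContinuousOn (pan h ω) (CStrip h) := by
  have hc := (sexp_continuous h).continuousOn (s := CStrip h)
  exact (continuousOn_const.mul (hc.sub continuousOn_const)).div
    (continuousOn_const.mul (hc.add continuousOn_const)) fun z hz =>
      mul_ne_zero two_ne_zero (sexp_add_conj_ne_zero hh hω hz)

lemma pan_differentiableOn (hh : 0 < h) (hω : ω ∈ Strip h) :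
    DifferentiableOn ℂ (pan h ω) (Strip h) := by
  have hc := (sexp_differentiable h).differentiableOn (s := Strip h)
  exact ((differentiableOn_const _).mul (hc.sub (differentiableOn_const _))).div
    ((differentiableOn_const _).mul (hc.add (differentiableOn_const _))) fun z hz =>
      mul_ne_zero two_ne_zero (sexp_add_conj_ne_zero hh hω (Strip.subset_cstrip h hz))

lemma exists_bound_pan (hh : 0 < h) (hω : ω ∈ Strip h) :
    ∃ C, ∀ z ∈ CStrip h, ‖pan h ω z‖ ≤ C := by
  have hρ := sexp_re_pos hh hω
  set c := (starRingEnd ℂ) (sexp h ω) with hc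
  refine ⟨‖c - 1‖ * (1 + ‖c + 1‖ / (sexp h ω).re), fun z hz => ?_⟩
  have h2 := re_le_norm_sexp_add_conj (ω := ω) hh hz
  rw [← hc] at h2
  have h3 : 0 < ‖sexp h z + c‖ := hρ.trans_le h2
  rw [pan, ← hc, norm_div, norm_mul, norm_mul, mul_div_assoc, Complex.norm_ofNat]
  refine mul_le_mul_of_nonneg_left ?_ (norm_nonneg _)
  rw [div_le_iff₀ (by positivity)]
  have h4 : ‖sexp h z - 1‖ ≤ ‖sexp h z + c‖ + ‖c + 1‖ := by
    have e : sexp h z - 1 = (sexp h z + c) - (c + 1) := by ring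
    rw [e]
    exact norm_sub_le _ _
  have h5 : ‖c + 1‖ ≤ ‖c + 1‖ / (sexp h ω).re * ‖sexp h z + c‖ := by
    rw [div_mul_eq_mul_div, le_div_iff₀ hρ]
    exact mul_le_mul_of_nonneg_left h2 (norm_nonneg _)
  rw [mul_left_comm, add_mul, one_mul]
  linarith [norm_nonneg (c + 1)]

lemma pker_eq_pan (hh : 0 < h) (hω : ω ∈ Strip h) (hz : |z.im| = h) :
    (pker h ω z : ℂ) = 1 + pan h ω z + (starRingEnd ℂ) (pan h ω z) := by
  have h1 := sexp_add_conj_ne_zero hh hω hz.le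
  have h2 : sexp h z - sexp h ω ≠ 0 :=
    norm_pos_iff.1 ((sexp_re_pos hh hω).trans_le (re_le_norm_sexp_sub hh hz))
  have hre : ((sexp h ω).re : ℂ) = (sexp h ω + (starRingEnd ℂ) (sexp h ω)) / 2 := by
    rw [Complex.add_conj]; push_cast; ring
  have h3 : -sexp h z + sexp h ω ≠ 0 := fun e => h2 (by linear_combination -e)
  rw [pker_eq hh hz, pan, hre]
  simp only [map_div₀, map_mul, map_sub, map_add, map_one, map_ofNat, Complex.conj_conj,
    conj_sexp_of_abs_im_eq hh hz]
  field_simp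
  ring

lemma pker_zero (hh : 0 < h) (hz : |z.im| = h) : pker h 0 z = 1 := by
  have h0 : (0 : ℂ) ∈ Strip h := by simpa [Strip] using hh
  have h2 : 0 < ‖sexp h z - sexp h 0‖ := (sexp_re_pos hh h0).trans_le (re_le_norm_sexp_sub hh hz)
  rw [sexp_zero] at h2
  rw [pker, sexp_zero, Complex.one_re, one_mul, div_self (by positivity)]

/-- Translation invariance of harmonic measure. -/
lemma kap_mul_pker (hh : 0 < h) (hy : |z.im| = h) :
    kap h z.re * pker h ω z = (sexp h ω).re * ‖sexp h z‖ / ‖sexp h z - sexp h ω‖ ^ 2 := by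
  have e : ‖sexp h z - 1‖ ^ 2 = 1 + ‖sexp h z‖ ^ 2 := by
    rw [← Complex.normSq_eq_norm_sq, ← Complex.normSq_eq_norm_sq, Complex.normSq_apply,
      Complex.normSq_apply, Complex.sub_re, Complex.sub_im, sexp_re_of_abs_im_eq hh hy]
    simp
  rw [pker, e, kap, ← norm_sexp]
  have : 1 + ‖sexp h z‖ ^ 2 ≠ 0 := by positivity
  field_simp

lemma kap_mul_pker_add (hh : 0 < h) (hy : |z.im| = h) (t : ℝ) :
    kap h (z + t).re * pker h (ω + t) (z + t) = kap h z.re * pker h ω z := by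
  have hre : ∀ u : ℂ, (sexp h (u + t)).re = (sexp h u).re * ‖sexp h t‖ := fun u => by
    rw [sexp_re, sexp_re, norm_sexp, Complex.add_re, Complex.ofReal_re, mul_add, Real.exp_add,
      Complex.add_im, Complex.ofReal_im, add_zero]
    ring
  rw [kap_mul_pker hh hy, kap_mul_pker hh (by simpa using hy), hre, sexp_add, sexp_add, ← sub_mul,
    norm_mul, norm_mul]
  have : ‖sexp h t‖ ≠ 0 := norm_ne_zero_iff.2 (sexp_ne_zero h _)
  field_simp

/-- Bounded continuous vector functions on the closed strip which are holomorphic inside. -/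
def HSp (h : ℝ) : Submodule ℂ (ℂ → V2) where
  carrier := {f | ContinuousOn f (CStrip h) ∧ DifferentiableOn ℂ f (Strip h) ∧
    ∃ C, ∀ z ∈ CStrip h, ‖f z‖ ≤ C}
  add_mem' := by
    rintro f g ⟨hf, hf', C, hC⟩ ⟨hg, hg', D, hD⟩
    exact ⟨hf.add hg, hf'.add hg', C + D, fun z hz =>
      (norm_add_le _ _).trans (add_le_add (hC z hz) (hD z hz))⟩
  zero_mem' := ⟨continuousOn_const, differentiableOn_const _, 0, fun z _ => by simp⟩
  smul_mem' := by
    rintro a f ⟨hf, hf', C, hC⟩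
    exact ⟨hf.const_smul a, hf'.const_smul a, ‖a‖ * C, fun z hz => by
      rw [Pi.smul_apply, norm_smul]
      exact mul_le_mul_of_nonneg_left (hC z hz) (norm_nonneg _)⟩

/-- The sesquilinear pairing of two vectors through a matrix. -/
def hpair (M : M2) (u v : V2) : ℂ := dotProduct (star u) (M.mulVec v)

lemma hpair_add_left (M : M2) (u u' v : V2) : hpair M (u + u') v = hpair M u v + hpair M u' v := by
  simp [hpair, add_dotProduct]

lemma hpair_add_right (M : M2) (u v v' : V2) : hpair M u (v + v') = hpair M u v + hpair M u v' := by
  simp only [hpair, dotProduct, Matrix.mulVec, Fin.sum_univ_two, Pi.add_apply]; ring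

lemma hpair_smul_left (M : M2) (a : ℂ) (u v : V2) :
    hpair M (a • u) v = (starRingEnd ℂ) a * hpair M u v := by
  simp [hpair]

lemma hpair_smul_right (M : M2) (a : ℂ) (u v : V2) : hpair M u (a • v) = a * hpair M u v := by
  simp only [hpair, dotProduct, Matrix.mulVec, Fin.sum_univ_two, Pi.smul_apply, smul_eq_mul]; ring

lemma hpair_smul_smul (M : M2) (a : ℂ) (u : V2) :
    hpair M (a • u) (a • u) = (‖a‖ ^ 2 : ℝ) * hpair M u u := by
  rw [hpair_smul_left, hpair_smul_right, ← mul_assoc, Complex.conj_mul']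
  push_cast; rfl

lemma hpair_conj {M : M2} (hM : M.IsHermitian) (u v : V2) :
    hpair M v u = (starRingEnd ℂ) (hpair M u v) := by
  have h01 := hM.apply 0 1
  have h10 := hM.apply 1 0
  have h00 := hM.apply 0 0
  have h11 := hM.apply 1 1
  simp only [hpair, dotProduct, Matrix.mulVec, Fin.sum_univ_two, Pi.star_apply, map_add, map_mul,
    starRingEnd_apply, star_star, h01, h10, h00, h11]
  ring

lemma norm_hpair_le (M : M2) (u v : V2) : ‖hpair M u v‖ ≤ 4 * ‖M‖ * ‖u‖ * ‖v‖ := by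
  have h1 : ∀ i, ‖star u i * M.mulVec v i‖ ≤ ‖u‖ * (2 * ‖M‖ * ‖v‖) := fun i => by
    rw [norm_mul, Pi.star_apply, norm_star]
    exact mul_le_mul (norm_le_pi_norm u i) ((norm_le_pi_norm _ i).trans (M2.norm_mulVec_le M v))
      (norm_nonneg _) (norm_nonneg _)
  rw [hpair, dotProduct, Fin.sum_univ_two]
  exact (norm_add_le _ _).trans (by linarith [h1 0, h1 1])

/-- A continuous uniformly bounded and uniformly positive Hermitian weight on the closed strip. -/
structure IsWeight (h : ℝ) (W : ℂ → M2) (c C : ℝ) : Prop where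
  cont : ContinuousOn W (CStrip h)
  herm : ∀ z ∈ CStrip h, (W z).IsHermitian
  pos : 0 < c
  low : ∀ z ∈ CStrip h, ∀ v, c * ‖v‖ ^ 2 ≤ (hpair (W z) v v).re
  up : ∀ z ∈ CStrip h, ‖W z‖ ≤ C

lemma continuousOn_hpair {W : ℂ → M2} {f g : ℂ → V2} {s : Set ℂ} (hW : ContinuousOn W s)
    (hf : ContinuousOn f s) (hg : ContinuousOn g s) :
    ContinuousOn (fun z => hpair (W z) (f z) (g z)) s := by
  have hW' : ∀ i j, ContinuousOn (fun z => W z i j) s := fun i j =>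
    continuousOn_pi.1 (continuousOn_pi.1 hW i) j
  have hf' := continuousOn_pi.1 hf
  have hg' := continuousOn_pi.1 hg
  simp only [hpair, dotProduct, Matrix.mulVec, Fin.sum_univ_two, Pi.star_apply]
  exact ((hf' 0).star.mul (((hW' 0 0).mul (hg' 0)).add ((hW' 0 1).mul (hg' 1)))).add
    ((hf' 1).star.mul (((hW' 1 0).mul (hg' 0)).add ((hW' 1 1).mul (hg' 1))))

/-- The integral of a weighted pairing against a density. -/
def wform (h : ℝ) (W : ℂ → M2) (P : ℂ → ℂ) (f g : ℂ → V2) : ℂ :=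
  ∫ z, P z * hpair (W z) (f z) (g z) ∂(bdM h)

lemma IsWeight.integrable {W : ℂ → M2} {c C : ℝ} (hW : IsWeight h W c C) (hh : 0 < h)
    {P : ℂ → ℂ} (hP : AEStronglyMeasurable P (bdM h)) {K : ℝ} (hK : ∀ z, |z.im| = h → ‖P z‖ ≤ K)
    {f g : ℂ → V2} (hf : f ∈ HSp h) (hg : g ∈ HSp h) :
    Integrable (fun z => P z * hpair (W z) (f z) (g z)) (bdM h) := by
  obtain ⟨hf, -, Cf, hCf⟩ := hf
  obtain ⟨hg, -, Cg, hCg⟩ := hg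
  refine bdM_integrable hh (hP.mul (bdM_aesm hh (continuousOn_hpair hW.cont hf hg)))
    (C := K * (4 * C * Cf * Cg)) fun z hz => ?_
  have hz' : z ∈ CStrip h := hz.le
  rw [norm_mul]
  refine mul_le_mul (hK z hz) ((norm_hpair_le _ _ _).trans ?_) (norm_nonneg _)
    ((norm_nonneg _).trans (hK z hz))
  have h1 := hW.up z hz'
  have h2 := hCf z hz'
  have h3 := hCg z hz'
  have h4 := (norm_nonneg _).trans h1
  have h5 := (norm_nonneg _).trans h2
  gcongr

lemma IsWeight.hpair_nonneg {W : ℂ → M2} {c C : ℝ} (hW : IsWeight h W c C) (hz : |z.im| = h)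
    (v : V2) : 0 ≤ (hpair (W z) v v).re :=
  (mul_nonneg hW.pos.le (sq_nonneg _)).trans (hW.low z hz.le v)

lemma integral_bdM_re_le {f g : ℂ → ℂ} (hh : 0 < h) (hf : Integrable f (bdM h))
    (hg : Integrable g (bdM h)) {K : ℝ} (hfg : ∀ z, |z.im| = h → (f z).re ≤ K * (g z).re) :
    (∫ z, f z ∂(bdM h)).re ≤ K * (∫ z, g z ∂(bdM h)).re := by
  have e : ∀ {f : ℂ → ℂ}, Integrable f (bdM h) →
      (∫ z, f z ∂(bdM h)).re = ∫ z, (f z).re ∂(bdM h) := fun hf =>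
    (Complex.reCLM.integral_comp_comm hf).symm
  rw [e hf, e hg, ← integral_const_mul]
  exact integral_mono_ae (Complex.reCLM.integrable_comp hf)
    ((Complex.reCLM.integrable_comp hg).const_mul K) ((ae_bdM hh).mono hfg)

open Classical in
/-- The density of harmonic measure at `ω`, extended by zero for points outside of the strip. -/
def pwt (h : ℝ) (ω z : ℂ) : ℝ := if ω ∈ Strip h then pker h ω z else 0

lemma pwt_of_mem (hω : ω ∈ Strip h) : pwt h ω = pker h ω := by
  ext z; simp [pwt, hω]

lemma pwt_aesm (h : ℝ) (ω : ℂ) : AEStronglyMeasurable (fun z => (pwt h ω z : ℂ)) (bdM h) := by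
  by_cases hω : ω ∈ Strip h
  · rw [pwt_of_mem hω]
    exact (Complex.measurable_ofReal.comp (pker_measurable h ω)).aestronglyMeasurable
  · simp only [pwt, hω, if_false]
    exact aestronglyMeasurable_const

lemma pwt_le (hh : 0 < h) (hz : |z.im| = h) : ‖(pwt h ω z : ℂ)‖ ≤ |pbd h ω| := by
  rw [Complex.norm_real, Real.norm_eq_abs]
  by_cases hω : ω ∈ Strip h
  · rw [pwt_of_mem hω, abs_of_nonneg (pker_nonneg hh hω z)]
    exact (pker_le hh hω hz).trans (le_abs_self _)
  · simp [pwt, hω]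

lemma pwt_zero (hh : 0 < h) (hz : |z.im| = h) : pwt h 0 z = 1 := by
  rw [pwt_of_mem (by simpa [Strip] using hh), pker_zero hh hz]

lemma integral_bdM_congr {f g : ℂ → ℂ} (hh : 0 < h) (hfg : ∀ z, |z.im| = h → f z = g z) :
    ∫ z, f z ∂(bdM h) = ∫ z, g z ∂(bdM h) :=
  integral_congr_ae ((ae_bdM hh).mono hfg)

lemma bdM_mass_pos (hh : 0 < h) : 0 < (bdM h).real Set.univ := by
  have := bdM_isFinite hh
  have h1 := integral_bdM (h := h) (f := fun _ => 1) (integrable_const 1)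
  have h2 : 0 < ∫ x, kap h x := by
    rw [integral_pos_iff_support_of_nonneg (fun x => (kap_pos h x).le) (kap_integrable hh)]
    have : Function.support (kap h) = Set.univ := Set.eq_univ_of_forall fun x => (kap_pos h x).ne'
    rw [this]; simp
  simp only [integral_const, Complex.real_smul, mul_one] at h1
  rw [integral_complex_ofReal] at h1
  have h3 : (bdM h).real Set.univ = (∫ x, kap h x) + ∫ x, kap h x := by exact_mod_cast h1
  linarith

lemma integral_pker (hh : 0 < h) (hω : ω ∈ Strip h) :
    ∫ z, (pker h ω z : ℂ) ∂(bdM h) = (bdM h).real Set.univ := by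
  have := bdM_isFinite hh
  obtain ⟨C, hC⟩ := exists_bound_pan hh hω
  have hi : Integrable (pan h ω) (bdM h) :=
    bdM_integrable hh (bdM_aesm hh (pan_continuousOn hh hω)) fun z hz => hC z hz.le
  have h0 := integral_bdM_eq_zero hh (pan_continuousOn hh hω) (pan_differentiableOn hh hω) hC
    pan_zero
  rw [integral_bdM_congr hh fun z hz => pker_eq_pan hh hω hz, integral_add, integral_add,
    integral_conj, h0, map_zero, add_zero, add_zero, integral_const, Complex.real_smul, mul_one]
  · exact integrable_const _
  · exact hi
  · exact (integrable_const _).add hi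
  · exact Complex.conjCLE.toContinuousLinearMap.integrable_comp hi

/-- Holomorphic functions are reproduced by the Poisson kernel. -/
lemma integral_pker_mul (hh : 0 < h) (hω : ω ∈ Strip h) {g : ℂ → ℂ}
    (hg : ContinuousOn g (CStrip h)) (hg' : DifferentiableOn ℂ g (Strip h)) {C : ℝ}
    (hC : ∀ z ∈ CStrip h, ‖g z‖ ≤ C) :
    ∫ z, (pker h ω z : ℂ) * g z ∂(bdM h) = g ω * (bdM h).real Set.univ := by
  have hm : AEStronglyMeasurable (fun z => (pker h ω z : ℂ)) (bdM h) := pwt_of_mem hω ▸ pwt_aesm h ω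
  have hb : ∀ z : ℂ, |z.im| = h → ‖(pker h ω z : ℂ)‖ ≤ |pbd h ω| :=
    fun z hz => pwt_of_mem hω ▸ pwt_le hh hz
  have h0 := integral_pker_mul_eq_zero hh hω (hg.sub continuousOn_const)
    (hg'.sub (differentiableOn_const (g ω))) (C := C + C) (fun z hz =>
      (norm_sub_le _ _).trans (add_le_add (hC z hz) (hC ω (Strip.subset_cstrip h hω)))) (sub_self _)
  have hi : Integrable (fun z => (pker h ω z : ℂ)) (bdM h) := bdM_integrable hh hm hb
  have hi2 : Integrable (fun z => (pker h ω z : ℂ) * g z) (bdM h) :=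
    bdM_integrable hh (hm.mul (bdM_aesm hh hg)) (C := |pbd h ω| * C) fun z hz => by
      rw [norm_mul]
      exact mul_le_mul (hb z hz) (hC z hz.le) (norm_nonneg _) (abs_nonneg _)
  simp only [Pi.sub_apply, mul_sub] at h0
  rw [integral_sub hi2 (hi.mul_const _), integral_mul_const, integral_pker hh hω] at h0
  linear_combination h0

section WeightForms

variable {W : ℂ → M2} {c C : ℝ}

lemma IsWeight.pwt_integrable (hW : IsWeight h W c C) (hh : 0 < h) (ω : ℂ) (f g : HSp h) :
    Integrable (fun z => (pwt h ω z : ℂ) * hpair (W z) (f.1 z) (g.1 z)) (bdM h) :=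
  hW.integrable hh (pwt_aesm h ω) (fun _ hz => pwt_le hh hz) f.2 g.2

/-- The sesquilinear form of a weight with respect to harmonic measure at `ω`. -/
def IsWeight.form (hW : IsWeight h W c C) (hh : 0 < h) (ω : ℂ) : HSp h →ₗ⋆[ℂ] HSp h →ₗ[ℂ] ℂ :=
  LinearMap.mk₂'ₛₗ (starRingEnd ℂ) (RingHom.id ℂ)
    (fun f g => wform h W (fun z => (pwt h ω z : ℂ)) f.1 g.1)
    (fun f f' g => by
      rw [wform, wform, wform, ← integral_add (hW.pwt_integrable hh ω f g)
        (hW.pwt_integrable hh ω f' g)]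
      exact integral_congr_ae (ae_of_all _ fun z => by
        simp only [Submodule.coe_add, Pi.add_apply, hpair_add_left, mul_add]))
    (fun a f g => by
      rw [wform, wform, smul_eq_mul, ← integral_const_mul]
      exact integral_congr_ae (ae_of_all _ fun z => by
        simp only [Submodule.coe_smul, Pi.smul_apply, hpair_smul_left]; ring))
    (fun f g g' => by
      rw [wform, wform, wform, ← integral_add (hW.pwt_integrable hh ω f g)
        (hW.pwt_integrable hh ω f g')]
      exact integral_congr_ae (ae_of_all _ fun z => by
        simp only [Submodule.coe_add, Pi.add_apply, hpair_add_right, mul_add]))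
    (fun a f g => by
      rw [wform, wform, RingHom.id_apply, smul_eq_mul, ← integral_const_mul]
      exact integral_congr_ae (ae_of_all _ fun z => by
        simp only [Submodule.coe_smul, Pi.smul_apply, hpair_smul_right]; ring))

lemma IsWeight.form_apply (hW : IsWeight h W c C) (hh : 0 < h) (ω : ℂ) (f g : HSp h) :
    hW.form hh ω f g = ∫ z, (pwt h ω z : ℂ) * hpair (W z) (f.1 z) (g.1 z) ∂(bdM h) := rfl

lemma IsWeight.form_zero (hW : IsWeight h W c C) (hh : 0 < h) (f g : HSp h) :
    hW.form hh 0 f g = ∫ z, hpair (W z) (f.1 z) (g.1 z) ∂(bdM h) := by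
  rw [hW.form_apply]
  exact integral_bdM_congr hh fun z hz => by rw [pwt_zero hh hz]; simp

lemma IsWeight.pair_integrable (hW : IsWeight h W c C) (hh : 0 < h) (f g : HSp h) :
    Integrable (fun z => hpair (W z) (f.1 z) (g.1 z)) (bdM h) := by
  simpa using hW.integrable hh (P := fun _ => 1) aestronglyMeasurable_const (K := 1)
    (fun _ _ => by simp) f.2 g.2

lemma IsWeight.form_zero_re_le (hW : IsWeight h W c C) (hh : 0 < h) {f g : HSp h} {K : ℝ}
    {m : ℂ → ℂ} (hm : ∀ z, |z.im| = h → ‖m z‖ ≤ K) (hfg : ∀ z, |z.im| = h → f.1 z = m z • g.1 z) :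
    (hW.form hh 0 f f).re ≤ K ^ 2 * (hW.form hh 0 g g).re := by
  rw [hW.form_zero, hW.form_zero]
  refine integral_bdM_re_le hh (hW.pair_integrable hh f f) (hW.pair_integrable hh g g)
    fun z hz => ?_
  rw [hfg z hz, hpair_smul_smul, Complex.re_ofReal_mul]
  exact mul_le_mul_of_nonneg_right (pow_le_pow_left₀ (norm_nonneg _) (hm z hz) 2)
    (hW.hpair_nonneg hz _)

lemma HSp.smul_mem {m : ℂ → ℂ} (hm : ContinuousOn m (CStrip h))
    (hm' : DifferentiableOn ℂ m (Strip h))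
    {K : ℝ} (hK : ∀ z ∈ CStrip h, ‖m z‖ ≤ K) {f : ℂ → V2} (hf : f ∈ HSp h) :
    (fun z => m z • f z) ∈ HSp h := by
  obtain ⟨hf, hf', C, hC⟩ := hf
  refine ⟨hm.smul hf, hm'.smul hf', K * C, fun z hz => ?_⟩
  rw [norm_smul]
  exact mul_le_mul (hK z hz) (hC z hz) (norm_nonneg _) ((norm_nonneg _).trans (hK z hz))

lemma IsWeight.form_eval (hW : IsWeight h W c C) (hh : 0 < h) (hω : ω ∈ Strip h) (f : HSp h) :
    ‖f.1 ω‖ ^ 2 ≤ √(pbd h ω / (c * (bdM h).real Set.univ)) ^ 2 * (hW.form hh 0 f f).re := by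
  have hm := bdM_mass_pos hh
  have hmul := mul_pos hW.pos hm
  have hb0 : 0 ≤ pbd h ω :=
    (pker_nonneg hh hω ((0 : ℝ) + h * Complex.I)).trans (pker_le hh hω (by simp [abs_of_pos hh]))
  rw [Real.sq_sqrt (div_nonneg hb0 hmul.le), div_mul_eq_mul_div, le_div_iff₀ hmul]
  obtain ⟨i, o, -, hi, -⟩ := exists_norm_eq_coord (f.1 ω)
  obtain ⟨hf, hf', Cf, hCf⟩ := f.2
  have hfi : ContinuousOn (fun z => f.1 z i) (CStrip h) := continuousOn_pi.1 hf i
  have hfi' : DifferentiableOn ℂ (fun z => f.1 z i) (Strip h) := differentiableOn_pi.1 hf' i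
  have h_int := integral_pker_mul hh hω (hfi.pow 2) (hfi'.pow 2) (C := Cf ^ 2) fun z hz => by
    simp only [Pi.pow_apply, norm_pow]
    exact pow_le_pow_left₀ (norm_nonneg _) ((norm_le_pi_norm _ i).trans (hCf z hz)) 2
  have hre : (hW.form hh 0 f f).re = ∫ z, (hpair (W z) (f.1 z) (f.1 z)).re ∂(bdM h) := by
    rw [hW.form_zero]
    exact (Complex.reCLM.integral_comp_comm (hW.pair_integrable hh f f)).symm
  have hle : ‖∫ z, (pker h ω z : ℂ) * (f.1 z i) ^ 2 ∂(bdM h)‖ ≤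
      ∫ z, pbd h ω / c * (hpair (W z) (f.1 z) (f.1 z)).re ∂(bdM h) := by
    refine norm_integral_le_of_norm_le
      ((Complex.reCLM.integrable_comp (hW.pair_integrable hh f f)).const_mul _)
      ((ae_bdM hh).mono fun z hz => ?_)
    rw [norm_mul, norm_pow, Complex.norm_real, Real.norm_eq_abs,
        abs_of_nonneg (pker_nonneg hh hω z),
      div_mul_eq_mul_div, mul_div_assoc]
    refine mul_le_mul (pker_le hh hω hz) ?_ (by positivity) hb0
    rw [le_div_iff₀ hW.pos, mul_comm]
    exact (mul_le_mul_of_nonneg_left (pow_le_pow_left₀ (norm_nonneg _) (norm_le_pi_norm _ i) 2)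
      hW.pos.le).trans (hW.low z hz.le _)
  have h_int' : ∫ z, (pker h ω z : ℂ) * (f.1 z i) ^ 2 ∂(bdM h) =
      (f.1 ω i) ^ 2 * (bdM h).real Set.univ := h_int
  rw [h_int', integral_const_mul, ← hre, norm_mul, norm_pow, hi, Complex.norm_real,
    Real.norm_eq_abs, abs_of_pos hm, div_mul_eq_mul_div, le_div_iff₀ hW.pos] at hle
  linarith

/-- The family of sesquilinear forms attached to a weight. -/
def IsWeight.hermFam (hW : IsWeight h W c C) (hh : 0 < h) : HermFam (Strip h) (HSp h) where
  a := hW.form hh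
  ev := (HSp h).subtype
  cst :=
    { toFun := fun v => ⟨fun _ => v, continuousOn_const, differentiableOn_const _, ‖v‖,
        fun _ _ => le_rfl⟩
      map_add' := fun _ _ => rfl
      map_smul' := fun _ _ => rfl }
  symm := fun ω f g => by
    rw [hW.form_apply, hW.form_apply, ← integral_conj]
    exact integral_bdM_congr hh fun z hz => by
      rw [map_mul, Complex.conj_ofReal, hpair_conj (hW.herm z hz.le)]
  nonneg := fun ω hω f => by
    have := integral_bdM_re_le hh (integrable_zero ℂ ℂ (bdM h)) (hW.pwt_integrable hh ω f f)
      (K := 1) fun z hz => by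
        rw [one_mul, Complex.re_ofReal_mul, pwt_of_mem hω]
        exact mul_nonneg (pker_nonneg hh hω z) (hW.hpair_nonneg hz _)
    simpa [hW.form_apply] using this
  ev_cst := fun v ω _ => rfl
  holo := fun f => f.2.2.1
  eval := ⟨fun ω => √(pbd h ω / (c * (bdM h).real Set.univ)),
    ((pbd_continuousOn hh).div_const _).sqrt, fun ω hω f => hW.form_eval hh hω f⟩
  cbound := fun ω hω => by
    have := bdM_isFinite hh
    refine ⟨√(|pbd h ω| * (4 * |C|) * (bdM h).real Set.univ), fun v => ?_⟩
    rw [Real.sq_sqrt (by positivity), hW.form_apply]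
    refine (Complex.re_le_norm _).trans ?_
    have := norm_integral_le_of_norm_le_const (μ := bdM h) (C := |pbd h ω| * (4 * |C|) * ‖v‖ ^ 2)
      (f := fun z => (pwt h ω z : ℂ) * hpair (W z) v v) ((ae_bdM hh).mono fun z hz => by
        rw [norm_mul, mul_assoc (|pbd h ω|)]
        refine mul_le_mul (pwt_le hh hz) ((norm_hpair_le _ _ _).trans ?_) (norm_nonneg _)
          (abs_nonneg _)
        have := (hW.up z hz.le).trans (le_abs_self C)
        rw [sq, ← mul_assoc]
        gcongr)
    refine this.trans (le_of_eq ?_)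
    ring
  mul_vanish := fun ω hω => by
    refine ⟨pbd h ω, fun g hg => ?_⟩
    have hg : g.1 ω = 0 := hg
    obtain ⟨hc, hd, Cg, hCg⟩ := g.2
    refine ⟨⟨fun z => pmul h ω z • dslope g.1 ω z,
      (pmul_continuousOn hh hω).smul (continuousOn_dslope_cstrip hω hc hd),
      (pmul_differentiableOn hh hω).smul (differentiableOn_dslope_strip hω hd),
      exists_bound_pmul_smul_dslope hh hω hc hd hCg hg⟩, pmul_smul_dslope_zero, ?_, fun f => ?_⟩
    · refine hW.form_zero_re_le hh (m := fun z => (pker h ω z : ℂ)) (fun z hz => ?_) fun z hz =>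
        pmul_smul_dslope_boundary hh hω hz hg
      rw [Complex.norm_real, Real.norm_eq_abs, abs_of_nonneg (pker_nonneg hh hω z)]
      exact pker_le hh hω hz
    · rw [hW.form_apply, hW.form_zero]
      refine integral_bdM_congr hh fun z hz => ?_
      simp only [pmul_smul_dslope_boundary hh hω hz hg, hpair_smul_right, pwt_of_mem hω]
  poisson := fun ω hω => by
    obtain ⟨K, hK⟩ := exists_bound_pan hh hω
    refine ⟨K, fun f => ⟨fun z => pan h ω z • f.1 z, HSp.smul_mem (pan_continuousOn hh hω)
      (pan_differentiableOn hh hω) hK f.2⟩, fun f => ?_, fun f => ?_, fun f g => ?_⟩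
    · change pan h ω 0 • f.1 0 = 0
      rw [pan_zero, zero_smul]
    · exact hW.form_zero_re_le hh (fun z hz => hK z hz.le) fun z hz => rfl
    · rw [hW.form_apply, hW.form_zero, hW.form_zero, hW.form_zero, ← integral_conj, ← integral_add,
        ← integral_add]
      · refine integral_bdM_congr hh fun z hz => ?_
        simp only [hpair_smul_right, map_mul, ← hpair_conj (hW.herm z hz.le), pwt_of_mem hω,
          pker_eq_pan hh hω hz]
        ring
      · exact (hW.pair_integrable hh f g).add (hW.pair_integrable hh f _)
      · exact Complex.conjCLE.toContinuousLinearMap.integrable_comp (hW.pair_integrable hh g _)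
      · exact hW.pair_integrable hh f g
      · exact hW.pair_integrable hh f _

end WeightForms

section Extremal

variable {W : ℂ → M2} {c C : ℝ}

/-- The energy of a vector function for the weight `W` and harmonic measure at `ω`. -/
def energy (h : ℝ) (W : ℂ → M2) (ω : ℂ) (f : ℂ → V2) : ℝ :=
  (∫ z, (pker h ω z : ℂ) * hpair (W z) (f z) (f z) ∂(bdM h)).re

/-- The matrix function `B` computes the minimal energy of an extension of a vector. -/
structure IsExtremal (h : ℝ) (W B : ℂ → M2) : Prop where
  diff : DifferentiableOn ℂ B (Strip h)
  det : ∀ ω ∈ Strip h, (B ω).det ≠ 0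
  base : ∃ (s t : ℝ) (z : ℂ), 0 < s ∧ 0 < t ∧ B 0 = !![(s : ℂ), z; 0, t]
  le : ∀ ω ∈ Strip h, ∀ f ∈ HSp h, eN ((B ω).mulVec (f ω)) ≤ energy h W ω f
  approx : ∀ ω ∈ Strip h, ∀ v, ∀ η > 0, ∃ f ∈ HSp h, f ω = v ∧
    energy h W ω f ≤ eN ((B ω).mulVec v) + η

lemma IsWeight.exists_extremal (hW : IsWeight h W c C) (hh : 0 < h) : ∃ B, IsExtremal h W B := by
  obtain ⟨B, h1, h2, h3, h4, h5⟩ :=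
    (hW.hermFam hh).exists_factor (Strip.isOpen h) (by simpa [Strip] using hh)
  have key : ∀ ω ∈ Strip h, ∀ F : HSp h, ((hW.hermFam hh).a ω F F).re = energy h W ω F.1 :=
    fun ω hω F => by
      change (hW.form hh ω F F).re = _
      rw [hW.form_apply, pwt_of_mem hω, energy]
  refine ⟨B, h1, h2, h3, fun ω hω f hf => ?_, fun ω hω v η hη => ?_⟩
  · rw [← key ω hω ⟨f, hf⟩]; exact h4 ω hω ⟨f, hf⟩
  · obtain ⟨F, hF, hF'⟩ := h5 ω hω v η hη
    exact ⟨F.1, F.2, hF, key ω hω F ▸ hF'⟩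

lemma integral_pker_shift (hh : 0 < h) (t : ℝ) {F : ℂ → ℂ}
    (h1 : Integrable (fun z => (pker h (ω + t) z : ℂ) * F z) (bdM h))
    (h2 : Integrable (fun z => (pker h ω z : ℂ) * F (z + t)) (bdM h)) :
    ∫ z, (pker h (ω + t) z : ℂ) * F z ∂(bdM h) = ∫ z, (pker h ω z : ℂ) * F (z + t) ∂(bdM h) := by
  rw [integral_bdM h1, integral_bdM h2]
  have key : ∀ y : ℝ, |y| = h → ∫ x, kap h x • ((pker h (ω + t) (bline y x) : ℂ) * F (bline y x)) =
      ∫ x, kap h x • ((pker h ω (bline y x) : ℂ) * F (bline y x + t)) := fun y hy => by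
    rw [← integral_add_right_eq_self
      (fun x => kap h x • ((pker h (ω + t) (bline y x) : ℂ) * F (bline y x))) t]
    refine integral_congr_ae (ae_of_all _ fun x => ?_)
    have e : bline y (x + t) = bline y x + t := by simp [bline]; ring
    have := kap_mul_pker_add (z := bline y x) (ω := ω) hh (by rwa [bline_im]) t
    rw [Complex.add_re, Complex.ofReal_re, bline_re] at this
    simp only [e, Complex.real_smul, ← mul_assoc]
    rw [← Complex.ofReal_mul, ← Complex.ofReal_mul, this]
  rw [key h (abs_of_pos hh), key (-h) (by rw [abs_neg, abs_of_pos hh])]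

lemma IsWeight.pker_integrable (hW : IsWeight h W c C) (hh : 0 < h) (hω : ω ∈ Strip h) {f : ℂ → V2}
    (hf : f ∈ HSp h) :
    Integrable (fun z => (pker h ω z : ℂ) * hpair (W z) (f z) (f z)) (bdM h) := by
  rw [← pwt_of_mem hω]
  exact hW.pwt_integrable hh ω ⟨f, hf⟩ ⟨f, hf⟩

lemma HSp.comp_add {f : ℂ → V2} (hf : f ∈ HSp h) (t : ℝ) : (fun z => f (z + t)) ∈ HSp h := by
  obtain ⟨hf, hf', K, hK⟩ := hf
  have hm : ∀ z ∈ CStrip h, z + (t : ℂ) ∈ CStrip h := fun z hz => by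
    simpa [CStrip] using hz
  exact ⟨hf.comp (by fun_prop) hm, hf'.comp_add_real t, K, fun z hz => hK _ (hm z hz)⟩

lemma IsWeight.comp_add (hW : IsWeight h W c C) (t : ℝ) : IsWeight h (fun z => W (z + t)) c C := by
  have hm : ∀ z ∈ CStrip h, z + (t : ℂ) ∈ CStrip h := fun z hz => by
    simpa [CStrip] using hz
  exact ⟨hW.cont.comp (by fun_prop) hm, fun z hz => hW.herm _ (hm z hz), hW.pos,
    fun z hz => hW.low _ (hm z hz), fun z hz => hW.up _ (hm z hz)⟩

lemma IsWeight.energy_add (hW : IsWeight h W c C) (hh : 0 < h) (hω : ω ∈ Strip h) {f : ℂ → V2}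
    (hf : f ∈ HSp h) (t : ℝ) :
    energy h W (ω + t) f = energy h (fun z => W (z + t)) ω fun z => f (z + t) := by
  rw [energy, energy, integral_pker_shift hh t (F := fun z => hpair (W z) (f z) (f z))
    (hW.pker_integrable hh ((Strip.add_real t).2 hω) hf)
    ((hW.comp_add t).pker_integrable hh hω (HSp.comp_add hf t))]

lemma HSp.mulVec {X : ℂ → M2} (hX : ContinuousOn X (CStrip h))
    (hX' : DifferentiableOn ℂ X (Strip h))
    {K : ℝ} (hK : ∀ z ∈ CStrip h, ‖X z‖ ≤ K) {f : ℂ → V2} (hf : f ∈ HSp h) :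
    (fun z => (X z).mulVec (f z)) ∈ HSp h := by
  obtain ⟨hf, hf', L, hL⟩ := hf
  refine ⟨?_, hX'.matrix_mulVec hf', 2 * K * L, fun z hz => (M2.norm_mulVec_le _ _).trans ?_⟩
  · refine continuousOn_pi.2 fun i => ?_
    simp only [Matrix.mulVec, dotProduct, Fin.sum_univ_two]
    have h1 : ∀ j, ContinuousOn (fun z => X z i j) (CStrip h) := fun j =>
      continuousOn_pi.1 (continuousOn_pi.1 hX i) j
    have h2 := continuousOn_pi.1 hf
    exact ((h1 0).mul (h2 0)).add ((h1 1).mul (h2 1))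
  · have h1 := hK z hz
    have h2 := hL z hz
    have h3 := (norm_nonneg _).trans h1
    gcongr

/-- Intertwining maps distort the minimal energies at most as much as they distort the weight. -/
lemma IsExtremal.transport {B X : ℂ → M2} (hB : IsExtremal h W B) (hW : IsWeight h W c C)
    (hh : 0 < h) (hX : ContinuousOn X (CStrip h)) (hX' : DifferentiableOn ℂ X (Strip h))
    {K : ℝ} (hK : ∀ z ∈ CStrip h, ‖X z‖ ≤ K) {t κ : ℝ} (hκ : 0 ≤ κ)
    (hXW : ∀ z, |z.im| = h → ∀ v, (hpair (W (z + t)) ((X z).mulVec v) ((X z).mulVec v)).re ≤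
      κ * (hpair (W z) v v).re) (hω : ω ∈ Strip h) (v : V2) :
    eN ((B (ω + t)).mulVec ((X ω).mulVec v)) ≤ κ * eN ((B ω).mulVec v) := by
  refine le_of_forall_pos_le_add fun η hη => ?_
  obtain ⟨f, hf, rfl, hfη⟩ := hB.approx ω hω v (η / (κ + 1)) (by positivity)
  have hXf := HSp.mulVec hX hX' hK hf
  have hg := HSp.comp_add hXf (-t)
  have h1 := hB.le (ω + t) ((Strip.add_real t).2 hω) _ hg
  have e : ∀ z : ℂ, z + (t : ℂ) + ((-t : ℝ) : ℂ) = z := fun z => by push_cast; ring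
  rw [hW.energy_add hh hω hg] at h1
  simp only [e] at h1
  have h2 : energy h (fun z => W (z + t)) ω (fun z => (X z).mulVec (f z)) ≤
      κ * energy h W ω f := by
    refine integral_bdM_re_le hh ((hW.comp_add t).pker_integrable hh hω hXf)
      (hW.pker_integrable hh hω hf) fun z hz => ?_
    rw [Complex.re_ofReal_mul, Complex.re_ofReal_mul, mul_left_comm]
    exact mul_le_mul_of_nonneg_left (hXW z hz _) (pker_nonneg hh hω z)
  have h3 : κ * (η / (κ + 1)) ≤ η := by
    rw [mul_div_assoc', div_le_iff₀ (by positivity)]; nlinarith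
  nlinarith [mul_le_mul_of_nonneg_left hfη hκ]

end Extremal

section ConjugationSymmetry

lemma Strip.conj_mem : (starRingEnd ℂ) z ∈ Strip h ↔ z ∈ Strip h := by
  simp [Strip]

lemma CStrip.conj_mem : (starRingEnd ℂ) z ∈ CStrip h ↔ z ∈ CStrip h := by
  simp [CStrip]

lemma differentiableOn_strip_conj {f : ℂ → ℂ} (hf : DifferentiableOn ℂ f (Strip h)) :
    DifferentiableOn ℂ (fun z => (starRingEnd ℂ) (f ((starRingEnd ℂ) z))) (Strip h) := by
  intro z hz
  have h1 := hf.differentiableAt (Strip.mem_nhds (Strip.conj_mem.2 hz))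
  have h2 := h1.conj_conj
  rw [Complex.conj_conj] at h2
  exact h2.differentiableWithinAt

/-- Entrywise complex conjugation of matrices. -/
def conjM (M : M2) : M2 := fun i j => (starRingEnd ℂ) (M i j)

lemma conjM_mulVec_conjV (M : M2) (v : V2) : (conjM M).mulVec (conjV v) = conjV (M.mulVec v) := by
  ext i
  simp [conjM, conjV, Matrix.mulVec, dotProduct]

lemma conjV_conjV (v : V2) : conjV (conjV v) = v := by
  ext i; simp [conjV]

lemma eN_conjV (v : V2) : eN (conjV v) = eN v := by
  simp [eN, conjV, Complex.normSq_conj]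

lemma hpair_conjM (M : M2) (u v : V2) :
    hpair (conjM M) (conjV u) (conjV v) = (starRingEnd ℂ) (hpair M u v) := by
  simp [hpair, conjM, conjV, Matrix.mulVec, dotProduct]

lemma norm_conjV (v : V2) : ‖conjV v‖ = ‖v‖ := by
  simp only [conjV, Pi.norm_def]
  congr 1
  refine Finset.sup_congr rfl fun i _ => ?_
  ext; simp

lemma HSp.conj {f : ℂ → V2} (hf : f ∈ HSp h) :
    (fun z => conjV (f ((starRingEnd ℂ) z))) ∈ HSp h := by
  obtain ⟨hf, hf', K, hK⟩ := hf
  refine ⟨?_, ?_, K, fun z hz => by rw [norm_conjV]; exact hK _ (CStrip.conj_mem.2 hz)⟩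
  · refine continuousOn_pi.2 fun i => ?_
    exact Complex.continuous_conj.comp_continuousOn ((continuousOn_pi.1 hf i).comp
      Complex.continuous_conj.continuousOn fun z hz => CStrip.conj_mem.2 hz)
  · exact differentiableOn_pi.2 fun i => differentiableOn_strip_conj (differentiableOn_pi.1 hf' i)

lemma integral_bdM_conj {f : ℂ → ℂ} (h1 : Integrable f (bdM h))
    (h2 : Integrable (fun z => f ((starRingEnd ℂ) z)) (bdM h)) :
    ∫ z, f ((starRingEnd ℂ) z) ∂(bdM h) = ∫ z, f z ∂(bdM h) := by
  rw [integral_bdM h1, integral_bdM h2, add_comm]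
  have e : ∀ y x, (starRingEnd ℂ) (bline y x) = bline (-y) x := fun y x => by simp [bline]
  simp only [e, neg_neg]

lemma pker_conj (h : ℝ) (ω z : ℂ) :
    pker h ((starRingEnd ℂ) ω) ((starRingEnd ℂ) z) = pker h ω z := by
  have e1 : (starRingEnd ℂ) (sexp h z) - 1 = (starRingEnd ℂ) (sexp h z - 1) := by simp
  rw [pker, pker, sexp_conj, sexp_conj, e1, ← map_sub, RCLike.norm_conj, RCLike.norm_conj,
    Complex.conj_re]

lemma IsWeight.energy_conj {W : ℂ → M2} {c C : ℝ} (hW : IsWeight h W c C) (hh : 0 < h)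
    (hWc : ∀ z, |z.im| = h → W ((starRingEnd ℂ) z) = conjM (W z)) (hω : ω ∈ Strip h) {f : ℂ → V2}
    (hf : f ∈ HSp h) :
    energy h W ((starRingEnd ℂ) ω) (fun z => conjV (f ((starRingEnd ℂ) z))) = energy h W ω f := by
  have h1 := hW.pker_integrable hh (Strip.conj_mem.2 hω) (HSp.conj hf)
  have h2 := hW.pker_integrable hh hω hf
  have key : ∀ z : ℂ, |z.im| = h → (pker h ((starRingEnd ℂ) ω) ((starRingEnd ℂ) z) : ℂ) *
      hpair (W ((starRingEnd ℂ) z)) (conjV (f ((starRingEnd ℂ) ((starRingEnd ℂ) z))))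
        (conjV (f ((starRingEnd ℂ) ((starRingEnd ℂ) z)))) =
      (starRingEnd ℂ) ((pker h ω z : ℂ) * hpair (W z) (f z) (f z)) := fun z hz => by
    rw [pker_conj, Complex.conj_conj, hWc z hz, hpair_conjM, map_mul, Complex.conj_ofReal]
  have h3 : Integrable (fun z => (starRingEnd ℂ) ((pker h ω z : ℂ) * hpair (W z) (f z) (f z)))
    (bdM h) := Complex.conjCLE.toContinuousLinearMap.integrable_comp h2
  rw [energy, energy,
      ← integral_bdM_conj h1 (h3.congr ((ae_bdM hh).mono fun z hz => (key z hz).symm)),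
    integral_bdM_congr hh key, integral_conj, Complex.conj_re]

lemma IsExtremal.eN_conj {W B : ℂ → M2} {c C : ℝ} (hB : IsExtremal h W B) (hW : IsWeight h W c C)
    (hh : 0 < h) (hWc : ∀ z, |z.im| = h → W ((starRingEnd ℂ) z) = conjM (W z)) (hω : ω ∈ Strip h)
    (v : V2) : eN ((conjM (B ((starRingEnd ℂ) ω))).mulVec v) = eN ((B ω).mulVec v) := by
  have key : ∀ ω ∈ Strip h, ∀ v, eN ((B ((starRingEnd ℂ) ω)).mulVec (conjV v)) ≤
      eN ((B ω).mulVec v) := fun ω hω v => le_of_forall_pos_le_add fun η hη => by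
    obtain ⟨f, hf, rfl, hfη⟩ := hB.approx ω hω v η hη
    rw [← hW.energy_conj hh hWc hω hf] at hfη
    have := hB.le _ (Strip.conj_mem.2 hω) _ (HSp.conj hf)
    simp only [Complex.conj_conj] at this
    exact this.trans hfη
  have e : eN ((conjM (B ((starRingEnd ℂ) ω))).mulVec v) =
      eN ((B ((starRingEnd ℂ) ω)).mulVec (conjV v)) := by
    rw [← eN_conjV ((B _).mulVec _), ← conjM_mulVec_conjV, conjV_conjV]
  rw [e]
  refine le_antisymm (key ω hω v) ?_
  have := key _ (Strip.conj_mem.2 hω) (conjV v)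
  rwa [Complex.conj_conj, conjV_conjV] at this

end ConjugationSymmetry

section NearUnitary

lemma eN_eq (v : V2) : eN v = ‖v 0‖ ^ 2 + ‖v 1‖ ^ 2 := by
  rw [eN, Complex.normSq_eq_norm_sq, Complex.normSq_eq_norm_sq]

lemma eN_nonneg (v : V2) : 0 ≤ eN v := by rw [eN_eq]; positivity

lemma sq_norm_le_eN (v : V2) : ‖v‖ ^ 2 ≤ eN v := by
  obtain ⟨i, o, -, hi, -⟩ := exists_norm_eq_coord v
  rw [← hi, eN_eq]
  fin_cases i <;> simp

lemma eN_neg (v : V2) : eN (-v) = eN v := by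
  simp only [eN, Pi.neg_apply, Complex.normSq_neg]

/-- The standard Hermitian product on the plane. -/
def hdot (u v : V2) : ℂ := (starRingEnd ℂ) (u 0) * v 0 + (starRingEnd ℂ) (u 1) * v 1

lemma hdot_self (u : V2) : hdot u u = (eN u : ℂ) := by
  rw [hdot, Complex.conj_mul', Complex.conj_mul', eN_eq]; push_cast; rfl

lemma eN_sub (u v : V2) : eN (u - v) = eN u + eN v - 2 * (hdot u v).re := by
  simp only [eN, hdot, Pi.sub_apply, Complex.normSq_apply, Complex.sub_re, Complex.sub_im,
    Complex.add_re, Complex.mul_re, Complex.conj_re, Complex.conj_im]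
  ring

/-- A holomorphic matrix function which is nearly isometric is nearly constant. -/
lemma eN_sub_le_of_near_isometric {Cf : ℂ → M2} {κ R : ℝ} {z₀ : ℂ} (hR : 0 < R)
    (hd : DifferentiableOn ℂ Cf (Metric.ball z₀ R)) {v : V2}
    (hlow : eN v ≤ κ * eN ((Cf z₀).mulVec v))
    (hκ : 0 < κ) (hup : ∀ z ∈ Metric.ball z₀ R, eN ((Cf z).mulVec v) ≤ κ * eN v)
    (hz : ‖z - z₀‖ ≤ R / 2) :
    eN ((Cf z).mulVec v - (Cf z₀).mulVec v) ≤ 6 * (κ - κ⁻¹) * eN v := by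
  set u := (Cf z₀).mulVec v with hu
  have hlow' : κ⁻¹ * eN v ≤ eN u := by
    rw [inv_mul_le_iff₀ hκ]; exact hlow
  set φ : ℂ → ℂ := fun w => hdot u ((Cf w).mulVec v) - (κ * eN v : ℝ) with hφ
  have hdφ : DifferentiableOn ℂ φ (Metric.ball z₀ R) := by
    have h1 := differentiableOn_pi.1 (hd.matrix_mulVec (differentiableOn_const v))
    exact (((differentiableOn_const _).mul (h1 0)).add ((differentiableOn_const _).mul (h1 1))).sub
      (differentiableOn_const _)
  have hzR : z ∈ Metric.ball z₀ R := by
    rw [mem_ball_iff_norm]; linarith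
  have hz0 : z₀ ∈ Metric.ball z₀ R := Metric.mem_ball_self hR
  have hre : ∀ w ∈ Metric.ball z₀ R, (φ w).re ≤ 0 := fun w hw => by
    have h1 := eN_nonneg (u - (Cf w).mulVec v)
    rw [eN_sub] at h1
    have h2 := hup w hw
    have h3 := hup z₀ hz0
    rw [← hu] at h3
    simp only [hφ, Complex.sub_re, Complex.ofReal_re]
    linarith
  have hφ0 : ‖φ z₀‖ ≤ (κ - κ⁻¹) * eN v := by
    simp only [hφ]
    rw [← hu, hdot_self, ← Complex.ofReal_sub, Complex.norm_real, Real.norm_eq_abs, abs_sub_comm,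
      abs_of_nonneg (sub_nonneg.2 (hup z₀ hz0)), sub_mul]
    linarith
  have hφz : ‖φ z‖ ≤ 3 * ‖φ z₀‖ := by
    refine le_of_forall_pos_le_add fun η hη => ?_
    have hmap : Set.MapsTo (fun w => φ (z₀ + w)) (Metric.ball 0 R) {w | w.re ≤ η / 2} := by
      intro w hw
      have : z₀ + w ∈ Metric.ball z₀ R := by
        rw [mem_ball_iff_norm, add_sub_cancel_left]; simpa using hw
      exact (hre _ this).trans (by positivity)
    have hd' : DifferentiableOn ℂ (fun w => φ (z₀ + w)) (Metric.ball 0 R) :=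
      hdφ.comp (by fun_prop) fun w hw => by
        rw [mem_ball_iff_norm, add_sub_cancel_left]; simpa using hw
    have hz' : z - z₀ ∈ Metric.ball (0 : ℂ) R := by
      rw [mem_ball_zero_iff]; linarith
    have := Complex.borelCaratheodory (half_pos hη) hd' hmap hR hz'
    simp only [add_sub_cancel, add_zero] at this
    have hpos : 0 < R - ‖z - z₀‖ := by linarith
    have b1 : 2 * (η / 2) * ‖z - z₀‖ / (R - ‖z - z₀‖) ≤ η := by
      rw [div_le_iff₀ hpos]; nlinarith
    have b2 : ‖φ z₀‖ * (R + ‖z - z₀‖) / (R - ‖z - z₀‖) ≤ 3 * ‖φ z₀‖ := by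
      rw [div_le_iff₀ hpos]; nlinarith [norm_nonneg (φ z₀)]
    linarith
  have h1 := hup z hzR
  have h2 := hup z₀ hz0
  rw [← hu] at h2
  have h3 : -‖φ z‖ ≤ (φ z).re := (abs_le.1 (Complex.abs_re_le_norm _)).1
  rw [← eN_neg, neg_sub, eN_sub]
  simp only [hφ, Complex.sub_re, Complex.ofReal_re] at h3
  linarith

end NearUnitary

section NearConstant

lemma norm_sub_le_of_chain {E : Type*} [NormedAddCommGroup E] {f : ℂ → E} {s : Set ℂ}
    (hs : Convex ℝ s) {r δ : ℝ} (H : ∀ z ∈ s, ∀ w ∈ s, ‖z - w‖ ≤ r → ‖f z - f w‖ ≤ δ) (n : ℕ) :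
    ∀ z ∈ s, ∀ w ∈ s, ‖z - w‖ ≤ n * r → ‖f z - f w‖ ≤ n * δ := by
  induction n with
  | zero =>
    intro z _ w _ hzw
    have : z = w := sub_eq_zero.1 (norm_le_zero_iff.1 (by simpa using hzw))
    simp [this]
  | succ n ih =>
    intro z hz w hw hzw
    have hn : (0 : ℝ) < n + 1 := by positivity
    set u : ℂ := w + (1 / (n + 1) : ℝ) • (z - w) with hu
    have hus : u ∈ s := hs.add_smul_sub_mem hw hz ⟨by positivity, by
      rw [div_le_one hn]; linarith [Nat.cast_nonneg (α := ℝ) n]⟩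
    push_cast at hzw ⊢
    have h1 : ‖u - w‖ ≤ r := by
      rw [hu, add_sub_cancel_left, norm_smul, Real.norm_eq_abs, abs_of_pos (by positivity),
        div_mul_eq_mul_div, one_mul, div_le_iff₀ hn]
      linarith
    have h2 : ‖z - u‖ ≤ n * r := by
      have : z - u = (n / (n + 1) : ℝ) • (z - w) := by
        have e : (n / (n + 1) : ℝ) = 1 - 1 / (n + 1) := by field_simp; ring
        rw [hu, e, sub_smul, one_smul]; ring
      rw [this, norm_smul, Real.norm_eq_abs, abs_of_nonneg (by positivity), div_mul_eq_mul_div,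
        div_le_iff₀ hn]
      nlinarith [Nat.cast_nonneg (α := ℝ) n]
    have h3 := ih z hz u hus h2
    have h4 := H u hus w hw h1
    have := norm_add_le (f z - f u) (f u - f w)
    rw [sub_add_sub_cancel] at this
    linarith

lemma norm_sub_le_of_near_isometric {Cf : ℂ → M2} {κ : ℝ} (hh : 0 < h)
    (hd : DifferentiableOn ℂ Cf (Strip h)) (hκ : 0 < κ)
    (hlow : ∀ z ∈ Strip h, ∀ v, eN v ≤ κ * eN ((Cf z).mulVec v))
    (hup : ∀ z ∈ Strip h, ∀ v, eN ((Cf z).mulVec v) ≤ κ * eN v) (n : ℕ) :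
    ∀ z ∈ Strip (h / 2), ∀ w ∈ Strip (h / 2), ‖z - w‖ ≤ n * (h / 4) →
      ‖Cf z - Cf w‖ ≤ n * √(6 * (κ - κ⁻¹)) := by
  refine norm_sub_le_of_chain (Strip.convex _) (fun z _ w hw hzw => ?_) n
  have hball : Metric.ball w (h / 2) ⊆ Strip h := fun u hu => by
    have h1 : |(u - w).im| ≤ ‖u - w‖ := Complex.abs_im_le_norm _
    rw [mem_ball_iff_norm] at hu
    have h2 : |w.im| < h / 2 := hw
    have h3 := abs_add_le (u - w).im w.im
    rw [Complex.sub_im, sub_add_cancel] at h3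
    rw [Complex.sub_im] at h1
    change |u.im| < h
    linarith
  refine (Matrix.norm_le_iff (Real.sqrt_nonneg _)).2 fun i j => Real.le_sqrt_of_sq_le ?_
  have hwh : w ∈ Strip h := Strip.mono (by linarith) hw
  have h1 := eN_sub_le_of_near_isometric (z := z) (half_pos hh) (hd.mono hball)
    (v := Pi.single j 1) (hlow w hwh _) hκ (fun u hu => hup u (hball hu) _) (by linarith)
  have h2 := (pow_le_pow_left₀ (norm_nonneg _) (norm_le_pi_norm ((Cf z).mulVec (Pi.single j 1) -
    (Cf w).mulVec (Pi.single j 1)) i) 2).trans ((sq_norm_le_eN _).trans h1)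
  have h3 : eN (Pi.single j 1) = 1 := by
    rw [eN_eq]; fin_cases j <;> simp
  rw [h3, mul_one] at h2
  simpa [Matrix.mulVec_single] using h2

/-- Holomorphic matrix functions inducing the same Hermitian norms differ by a constant isometry. -/
lemma exists_isometry_of_eN_eq {B D : ℂ → M2} (hh : 0 < h) (hB : DifferentiableOn ℂ B (Strip h))
    (hD : DifferentiableOn ℂ D (Strip h)) (hdet : ∀ z ∈ Strip h, (B z).det ≠ 0)
    (hBD : ∀ z ∈ Strip h, ∀ v, eN ((D z).mulVec v) = eN ((B z).mulVec v)) :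
    ∃ U : M2, (∀ v, eN (U.mulVec v) = eN v) ∧ ∀ z ∈ Strip (h / 2), D z = U * B z := by
  set Cf : ℂ → M2 := fun z => D z * (B z)⁻¹ with hCf
  have hinv : DifferentiableOn ℂ (fun z => (B z)⁻¹) (Strip h) := by
    have h1 : DifferentiableOn ℂ (fun z => (B z).det) (Strip h) := by
      simp only [Matrix.det_fin_two]
      exact ((hB.matrix_entry 0 0).mul (hB.matrix_entry 1 1)).sub
        ((hB.matrix_entry 0 1).mul (hB.matrix_entry 1 0))
    have h2 := (h1.inv hdet).smul hB.matrix_adjugate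
    exact h2.congr fun z hz => by rw [Matrix.inv_def, Ring.inverse_eq_inv']; rfl
  have hiso : ∀ z ∈ Strip h, ∀ v, eN ((Cf z).mulVec v) = eN v := fun z hz v => by
    rw [hCf, ← Matrix.mulVec_mulVec, hBD z hz, Matrix.mulVec_mulVec,
      Matrix.mul_nonsing_inv _ (hdet z hz).isUnit, Matrix.one_mulVec]
  have h0 : (0 : ℂ) ∈ Strip (h / 2) := by simpa [Strip] using hh
  refine ⟨Cf 0, hiso 0 (Strip.mono (by linarith) h0), fun z hz => ?_⟩
  obtain ⟨n, hn⟩ := exists_nat_ge (‖z - 0‖ / (h / 4))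
  rw [div_le_iff₀ (by positivity)] at hn
  have := norm_sub_le_of_near_isometric hh (hD.matrix_mul hinv) one_pos
    (fun z hz v => by rw [hiso z hz, one_mul]) (fun z hz v => by rw [hiso z hz, one_mul]) n
    z hz 0 h0 hn
  have e : Cf z = Cf 0 := by
    have : ‖Cf z - Cf 0‖ ≤ 0 := by simpa using this
    exact sub_eq_zero.1 (norm_le_zero_iff.1 this)
  rw [← e, hCf, Matrix.mul_assoc, Matrix.nonsing_inv_mul _
    (hdet z (Strip.mono (by linarith) hz)).isUnit, Matrix.mul_one]

end NearConstant

lemma norm_det_le_of_eN_le {M : M2} {κ : ℝ} (hM : ∀ v, eN (M.mulVec v) ≤ κ * eN v) :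
    ‖M.det‖ ≤ κ := by
  have h0 := hM (Pi.single 0 1)
  have h1 := hM (Pi.single 1 1)
  rw [eN_eq, eN_eq] at h0 h1
  simp only [Matrix.mulVec_single, Pi.single_apply] at h0 h1
  simp at h0 h1
  have h2 : ‖M.det‖ ≤ ‖M 0 0‖ * ‖M 1 1‖ + ‖M 0 1‖ * ‖M 1 0‖ := by
    rw [Matrix.det_fin_two, ← norm_mul, ← norm_mul]; exact norm_sub_le _ _
  nlinarith [sq_nonneg (‖M 0 0‖ - ‖M 1 1‖), sq_nonneg (‖M 0 1‖ - ‖M 1 0‖)]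

section NormalForm

variable {W B : ℂ → M2} {c C : ℝ}

lemma IsExtremal.exists_period (hB : IsExtremal h W B) (hW : IsWeight h W c C) (hh : 0 < h)
    (hper : ∀ z, W (z + 1) = W z) :
    ∃ U : M2, (∀ v, eN (U.mulVec v) = eN v) ∧ ∀ z ∈ Strip (h / 2), B (z + 1) = U * B z := by
  have key : ∀ t : ℝ, (∀ z, W (z + t) = W z) → ∀ ω ∈ Strip h, ∀ v,
      eN ((B (ω + t)).mulVec v) ≤ eN ((B ω).mulVec v) := fun t ht ω hω v => by
    have := hB.transport (X := fun _ => 1) hW hh continuousOn_const (differentiableOn_const _)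
      (K := ‖(1 : M2)‖) (fun _ _ => le_rfl) (t := t) zero_le_one (fun z _ v => by
        rw [ht, Matrix.one_mulVec, one_mul]) hω v
    simpa using this
  have h1 := hB.diff.comp_add_real 1
  simp only [Complex.ofReal_one] at h1
  refine exists_isometry_of_eN_eq hh hB.diff h1 hB.det fun z hz v =>
    le_antisymm (by simpa using key 1 (by simpa using hper) z hz v) ?_
  have := key (-1) (fun z => by
    have := hper (z + ((-1 : ℝ) : ℂ)); simpa using this.symm) (z + 1) (Strip.add_one.2 hz) v
  simpa using this

lemma IsExtremal.conj_eq (hB : IsExtremal h W B) (hW : IsWeight h W c C) (hh : 0 < h)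
    (hWc : ∀ z, |z.im| = h → W ((starRingEnd ℂ) z) = conjM (W z)) :
    ∀ z ∈ Strip (h / 2), conjM (B ((starRingEnd ℂ) z)) = B z := by
  have hd : DifferentiableOn ℂ (fun z => conjM (B ((starRingEnd ℂ) z))) (Strip h) :=
    differentiableOn_matrix fun i j => differentiableOn_strip_conj (hB.diff.matrix_entry i j)
  obtain ⟨U, hU, hUB⟩ := exists_isometry_of_eN_eq hh hB.diff hd hB.det
    fun z hz v => hB.eN_conj hW hh hWc hz v
  obtain ⟨s, t, x, hs, ht, h0⟩ := hB.base
  have e := hUB 0 (by simpa [Strip] using hh)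
  rw [map_zero, h0] at e
  have hs' : (s : ℂ) ≠ 0 := by exact_mod_cast hs.ne'
  have ht' : (t : ℂ) ≠ 0 := by exact_mod_cast ht.ne'
  have e00 := congr_fun (congr_fun e 0) 0
  have e10 := congr_fun (congr_fun e 1) 0
  have e11 := congr_fun (congr_fun e 1) 1
  simp [conjM, Matrix.mul_apply, Fin.sum_univ_two, hs'] at e00 e10 e11
  rw [e10, zero_mul, zero_add] at e11
  have u11 : U 1 1 = 1 := mul_right_cancel₀ ht' (by rw [← e11, one_mul])
  have h1 := hU (Pi.single 1 1)
  rw [eN_eq, eN_eq] at h1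
  simp [Matrix.mulVec_single, u11] at h1
  have hU1 : U = 1 := by
    ext i j
    fin_cases i <;> fin_cases j <;> simp [*]
  intro z hz
  rw [hUB z hz, hU1, Matrix.one_mul]

end NormalForm

lemma exists_real_log {r : ℝ} (hr : 0 < r) {f : ℂ → ℂ} (hf : DifferentiableOn ℂ f (Strip r))
    (hf0 : ∀ z ∈ Strip r, f z ≠ 0)
    (hc : ∀ z ∈ Strip r, (starRingEnd ℂ) (f ((starRingEnd ℂ) z)) = f z)
    {d : ℝ} (hd : 0 < d) (h0 : f 0 = d) :
    ∃ L : ℂ → ℂ, DifferentiableOn ℂ L (Strip r) ∧ (∀ z ∈ Strip r, Complex.exp (L z) = f z) ∧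
      ∀ z ∈ Strip r, (starRingEnd ℂ) (L ((starRingEnd ℂ) z)) = L z := by
  have hz0 : (0 : ℂ) ∈ Strip r := by simpa [Strip] using hr
  obtain ⟨G, hG, hGe⟩ := exists_holo_log (Strip.isOpen r) (Strip.convex r) ⟨0, hz0⟩ hf hf0
  have hd' : Complex.exp ((Real.log d : ℝ) : ℂ) = d := by
    rw [← Complex.ofReal_exp, Real.exp_log hd]
  have hdne : (d : ℂ) ≠ 0 := by exact_mod_cast hd.ne'
  set L : ℂ → ℂ := fun z => G z - (G 0 - (Real.log d : ℝ)) with hL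
  have hLd : DifferentiableOn ℂ L (Strip r) := hG.sub (differentiableOn_const _)
  have hLe : ∀ z ∈ Strip r, Complex.exp (L z) = f z := fun z hz => by
    rw [hL]; simp only
    rw [Complex.exp_sub, Complex.exp_sub, hGe z hz, hGe 0 hz0, hd', h0, div_self hdne, div_one]
  have hL0 : L 0 = (Real.log d : ℝ) := by simp [hL]
  refine ⟨L, hLd, hLe, ?_⟩
  obtain ⟨k, hk⟩ := exists_int_of_exp_eq_one (Strip.isOpen r) (Strip.convex r).isPreconnected
    (D := fun z => (starRingEnd ℂ) (L ((starRingEnd ℂ) z)) - L z)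
    ((differentiableOn_strip_conj hLd).sub hLd) fun z hz => by
      rw [Complex.exp_sub, Complex.exp_conj, hLe _ (Strip.conj_mem.2 hz), hc z hz, hLe z hz,
        div_self (hf0 z hz)]
  intro z hz
  have e0 := hk 0 hz0
  rw [map_zero, hL0, Complex.conj_ofReal, sub_self] at e0
  have := hk z hz
  rw [← e0] at this
  exact sub_eq_zero.1 this

/-- Normalisation of the determinant of a real family with isometric monodromy. -/
lemma exists_normalized {r : ℝ} (hr : 0 < r) {B : ℂ → M2} {U : M2}
    (hB : DifferentiableOn ℂ B (Strip r)) (hdet : ∀ z ∈ Strip r, (B z).det ≠ 0)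
    (hc : ∀ z ∈ Strip r, conjM (B ((starRingEnd ℂ) z)) = B z) {d : ℝ} (hd : 0 < d)
    (h0 : (B 0).det = d) (hU : ∀ v, eN (U.mulVec v) = eN v)
    (hper : ∀ z ∈ Strip r, B (z + 1) = U * B z) :
    ∃ (D : ℂ → M2) (m : ℂ → ℂ), DifferentiableOn ℂ D (Strip r) ∧
      (∀ z ∈ Strip r, (D z).det = 1) ∧ (∀ x : ℝ, ∀ i j, (D x i j).im = 0) ∧
      (∀ z ∈ Strip r, D (z + 1) = U * D z) ∧ (∀ i j, (U i j).im = 0) ∧ U.det = 1 ∧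
      ∀ z ∈ Strip r, D z = m z • B z ∧ m z ^ 2 * (B z).det = 1 := by
  have hfd : DifferentiableOn ℂ (fun z => (B z).det) (Strip r) := by
    simp only [Matrix.det_fin_two]
    exact ((hB.matrix_entry 0 0).mul (hB.matrix_entry 1 1)).sub
      ((hB.matrix_entry 0 1).mul (hB.matrix_entry 1 0))
  have hfc : ∀ z ∈ Strip r, (starRingEnd ℂ) ((B ((starRingEnd ℂ) z)).det) = (B z).det :=
    fun z hz => by
      rw [← hc z hz]
      simp [Matrix.det_fin_two, conjM]
  obtain ⟨L, hLd, hLe, hLc⟩ := exists_real_log hr hfd hdet hfc hd h0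
  have hreal : ∀ x : ℝ, (L x).im = 0 := fun x => by
    have := hLc x (Strip.real_mem hr x)
    rw [Complex.conj_ofReal] at this
    exact Complex.conj_eq_iff_im.1 this
  have hBreal : ∀ x : ℝ, ∀ i j, (B x i j).im = 0 := fun x i j => by
    have := hc x (Strip.real_mem hr x)
    rw [Complex.conj_ofReal] at this
    have h2 := congrFun (congrFun this i) j
    exact Complex.conj_eq_iff_im.1 h2
  have m0 : (0 : ℂ) ∈ Strip r := by simpa using Strip.real_mem hr 0
  have m1 : (0 + 1 : ℂ) ∈ Strip r := by simpa using Strip.real_mem hr 1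
  have hdetU : ∀ z ∈ Strip r, (B (z + 1)).det = U.det * (B z).det := fun z hz => by
    rw [hper z hz, Matrix.det_mul]
  have hUe : U.det = Complex.exp (L (0 + 1) - L 0) := by
    rw [Complex.exp_sub, hLe _ m1, hLe _ m0, hdetU 0 m0, mul_div_assoc, div_self (hdet 0 m0),
        mul_one]
  have hUne : U.det ≠ 0 := hUe ▸ Complex.exp_ne_zero _
  have hle : ‖U.det‖ ≤ 1 := norm_det_le_of_eN_le fun v => by rw [hU, one_mul]
  have hge : ‖(U⁻¹).det‖ ≤ 1 := norm_det_le_of_eN_le fun v => by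
    rw [one_mul, ← hU (U⁻¹.mulVec v), Matrix.mulVec_mulVec,
      Matrix.mul_nonsing_inv _ (isUnit_iff_ne_zero.2 hUne), Matrix.one_mulVec]
  have hL01 : L (0 + 1) - L 0 = 0 := by
    have him : (L (0 + 1) - L 0).im = 0 := by
      have a := hreal 0; have b := hreal 1
      simp only [Complex.ofReal_zero, Complex.ofReal_one] at a b
      rw [zero_add, Complex.sub_im, a, b, sub_zero]
    have hn : ‖U.det‖ = 1 := by
      refine le_antisymm hle ?_
      rw [Matrix.det_nonsing_inv, Ring.inverse_eq_inv', norm_inv] at hge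
      by_contra! hlt
      exact absurd hge (not_le.2 ((one_lt_inv₀ (norm_pos_iff.2 hUne)).2 hlt))
    rw [hUe, Complex.norm_exp, Real.exp_eq_one_iff] at hn
    exact Complex.ext hn him
  have hU1 : U.det = 1 := by rw [hUe, hL01, Complex.exp_zero]
  have hLper : ∀ z ∈ Strip r, L (z + 1) = L z := by
    obtain ⟨k, hk⟩ := exists_int_of_exp_eq_one (Strip.isOpen r) (Strip.convex r).isPreconnected
      (D := fun z => L (z + 1) - L z)
      ((by simpa using hLd.comp_add_real 1 : DifferentiableOn ℂ (fun z => L (z + 1)) _).sub hLd)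
      fun z hz => by
        rw [Complex.exp_sub, hLe _ (Strip.add_one.2 hz), hdetU z hz, hU1, one_mul, hLe z hz,
          div_self (hdet z hz)]
    intro z hz
    have := hk z hz
    rw [← hk 0 m0, hL01] at this
    exact sub_eq_zero.1 this
  set m : ℂ → ℂ := fun z => Complex.exp (-(L z / 2)) with hm
  have hm2 : ∀ z ∈ Strip r, m z ^ 2 * (B z).det = 1 := fun z hz => by
    rw [hm, ← hLe z hz]; simp only
    rw [← Complex.exp_nat_mul, ← Complex.exp_add, ← Complex.exp_zero]
    congr 1; push_cast; ring
  have hDdet : ∀ z ∈ Strip r, (m z • B z).det = 1 := fun z hz => by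
    rw [Matrix.det_smul, Fintype.card_fin, hm2 z hz]
  have hDper : ∀ z ∈ Strip r, m (z + 1) • B (z + 1) = U * (m z • B z) := fun z hz => by
    rw [hper z hz, Matrix.mul_smul, hm]; simp only; rw [hLper z hz]
  have hDre : ∀ x : ℝ, ∀ i j, ((m x • B x) i j).im = 0 := fun x i j => by
    have : (m x).im = 0 := by
      have e : L x = ((L x).re : ℂ) := Complex.ext rfl (by simpa using hreal x)
      rw [hm]; simp only
      rw [e, ← Complex.ofReal_ofNat, ← Complex.ofReal_div, ← Complex.ofReal_neg,
          Complex.exp_ofReal_im]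
    rw [Matrix.smul_apply, smul_eq_mul, Complex.mul_im, this, hBreal]; simp
  refine ⟨fun z => m z • B z, m, ?_, hDdet, hDre, hDper, ?_, hU1, fun z hz => ⟨rfl, hm2 z hz⟩⟩
  · exact (((hLd.div_const 2).neg).cexp).smul hB
  · have e : U = (m (0 + 1) • B (0 + 1)) * (m 0 • B 0).adjugate := by
      rw [hDper 0 m0, Matrix.mul_assoc, Matrix.mul_adjugate, hDdet 0 m0, one_smul, Matrix.mul_one]
    have a := hDre 0; have b := hDre 1
    simp only [Complex.ofReal_zero, Complex.ofReal_one] at a b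
    rw [zero_add] at e
    intro i j
    rw [e, Matrix.mul_apply, Fin.sum_univ_two, Matrix.adjugate_fin_two]
    fin_cases j <;>
        simp only [Complex.add_im, Complex.mul_im, b, Matrix.of_apply, Matrix.cons_val] <;>
      simp [-Matrix.smul_apply, a]

lemma Rot_mul (a b : ℂ) : Rot a * Rot b = Rot (a + b) := by
  ext i j
  fin_cases i <;> fin_cases j <;>
    simp [Rot, Matrix.mul_apply, Fin.sum_univ_two, mul_add, Complex.cos_add, Complex.sin_add] <;>
        ring

lemma Rot_zero : Rot 0 = 1 := by
  ext i j
  fin_cases i <;> fin_cases j <;> simp [Rot]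

lemma det_Rot (a : ℂ) : (Rot a).det = 1 := by
  rw [Rot, Matrix.det_fin_two_of]
  linear_combination Complex.cos_sq_add_sin_sq (2 * π * a)

lemma Rot_inv (a : ℂ) : (Rot a)⁻¹ = Rot (-a) :=
  Matrix.inv_eq_left_inv (by rw [Rot_mul, neg_add_cancel, Rot_zero])

lemma Rot_im (x : ℝ) (i j : Fin 2) : (Rot x i j).im = 0 := by
  have e : (2 * π * x : ℂ) = ((2 * π * x : ℝ) : ℂ) := by push_cast; ring
  rw [Rot, e, ← Complex.ofReal_cos, ← Complex.ofReal_sin]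
  fin_cases i <;> fin_cases j <;> simp [-Complex.ofReal_cos, -Complex.ofReal_sin]

lemma differentiable_Rot : Differentiable ℂ Rot := by
  rw [← differentiableOn_univ]
  refine differentiableOn_matrix fun i j => ?_
  fin_cases i <;> fin_cases j <;> simp [Rot] <;> fun_prop

lemma norm_cos_le_exp (z : ℂ) : ‖Complex.cos z‖ ≤ Real.exp |z.im| := by
  have h1 : ‖Complex.exp (z * Complex.I)‖ ≤ Real.exp |z.im| := by
    rw [Complex.norm_exp]; simpa using neg_le_abs z.im
  have h2 : ‖Complex.exp (-z * Complex.I)‖ ≤ Real.exp |z.im| := by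
    rw [Complex.norm_exp]; simpa using le_abs_self z.im
  rw [Complex.cos, norm_div, Complex.norm_ofNat]
  linarith [norm_add_le (Complex.exp (z * Complex.I)) (Complex.exp (-z * Complex.I))]

lemma norm_sin_le_exp (z : ℂ) : ‖Complex.sin z‖ ≤ Real.exp |z.im| := by
  rw [← Complex.cos_sub_pi_div_two]
  simpa using norm_cos_le_exp (z - π / 2)

lemma norm_Rot_le (a : ℂ) : ‖Rot a‖ ≤ Real.exp (2 * π * |a.im|) := by
  have him : |(2 * π * a : ℂ).im| = 2 * π * |a.im| := by
    have e : (2 * π * a : ℂ) = ((2 * π : ℝ) : ℂ) * a := by push_cast; ring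
    rw [e, Complex.im_ofReal_mul, abs_mul, abs_of_pos Real.two_pi_pos]
  have h1 := norm_cos_le_exp (2 * π * a)
  have h2 := norm_sin_le_exp (2 * π * a)
  rw [him] at h1 h2
  refine (Matrix.norm_le_iff (Real.exp_pos _).le).2 fun i j => ?_
  fin_cases i <;> fin_cases j <;> simpa [Rot]

lemma eN_single (M : M2) : eN (M.mulVec (Pi.single 0 1)) = ‖M 0 0‖ ^ 2 + ‖M 1 0‖ ^ 2 ∧
    eN (M.mulVec (Pi.single 1 1)) = ‖M 0 1‖ ^ 2 + ‖M 1 1‖ ^ 2 := by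
  simp [eN_eq]

lemma eN_single_one (i : Fin 2) : eN (Pi.single i 1) = 1 := by
  fin_cases i <;> simp [eN_eq]

lemma exists_real_matrix {M : M2} (hM : ∀ i j, (M i j).im = 0) :
    ∃ a b c d : ℝ, M = !![(a : ℂ), (b : ℂ); (c : ℂ), (d : ℂ)] := by
  refine ⟨(M 0 0).re, (M 0 1).re, (M 1 0).re, (M 1 1).re, ?_⟩
  ext i j
  fin_cases i <;> fin_cases j <;> exact Complex.ext (by simp) (by simp [hM])

lemma exists_eq_Rot {U : M2} (hre : ∀ i j, (U i j).im = 0) (hdet : U.det = 1)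
    (hU : ∀ v, eN (U.mulVec v) = eN v) : ∃ φ : ℝ, |φ| ≤ 1 ∧ U = Rot φ := by
  obtain ⟨a, b, c, d, rfl⟩ := exists_real_matrix hre
  have h0 := hU (Pi.single 0 1)
  have h1 := hU (Pi.single 1 1)
  rw [eN_single_one] at h0 h1
  rw [(eN_single _).1] at h0
  rw [(eN_single _).2] at h1
  simp at h0 h1
  rw [Matrix.det_fin_two_of] at hdet
  have hdet' : a * d - b * c = 1 := by exact_mod_cast hdet
  have hd : d = a := by nlinarith [sq_nonneg (a - d), sq_nonneg (b + c)]
  have hb : b = -c := by nlinarith [sq_nonneg (a - d), sq_nonneg (b + c)]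
  subst hd hb
  set w : ℂ := ⟨d, c⟩ with hw
  have hnw : ‖w‖ = 1 := by
    rw [← sq_eq_sq₀ (norm_nonneg _) zero_le_one, ← Complex.normSq_eq_norm_sq, Complex.normSq_apply]
    simp [hw]; linarith
  have hw0 : w ≠ 0 := by rw [← norm_pos_iff, hnw]; exact one_pos
  have hc := Complex.cos_arg hw0
  have hs := Complex.sin_arg w
  rw [hnw, div_one] at hc hs
  refine ⟨w.arg / (2 * π), ?_, ?_⟩
  · rw [abs_div, abs_of_pos Real.two_pi_pos, div_le_one Real.two_pi_pos]
    linarith [Complex.abs_arg_le_pi w, Real.pi_pos]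
  · have e : (2 * π * ((w.arg / (2 * π) : ℝ) : ℂ)) = (w.arg : ℂ) := by
      push_cast
      have : (π : ℂ) ≠ 0 := by exact_mod_cast Real.pi_ne_zero
      field_simp
    rw [Rot, e, ← Complex.ofReal_cos, ← Complex.ofReal_sin, hc, hs]
    simp [hw]

lemma exists_near_conformal {M : M2} (hre : ∀ i j, (M i j).im = 0) (hdet : M.det = 1) {κ : ℝ}
    (hκ : κ ≤ 4) (hM : ∀ v, eN (M.mulVec v) ≤ κ * eN v) :
    ∃ R : M2, ‖R‖ ≤ 2 ∧ ‖M - R‖ ≤ √(κ - 1) ∧ ∀ t, Rot t * R = R * Rot t := by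
  obtain ⟨a, b, c, d, rfl⟩ := exists_real_matrix hre
  have h0 := hM (Pi.single 0 1)
  have h1 := hM (Pi.single 1 1)
  rw [eN_single_one] at h0 h1
  rw [(eN_single _).1] at h0
  rw [(eN_single _).2] at h1
  simp at h0 h1
  rw [Matrix.det_fin_two_of] at hdet
  have hdet' : a * d - b * c = 1 := by exact_mod_cast hdet
  have hE1 : |(a - d) / 2| ≤ √(κ - 1) :=
    Real.abs_le_sqrt (by nlinarith [sq_nonneg (a - d), sq_nonneg (b + c)])
  have hE2 : |(b + c) / 2| ≤ √(κ - 1) :=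
    Real.abs_le_sqrt (by nlinarith [sq_nonneg (a - d), sq_nonneg (b + c)])
  have hP : |(a + d) / 2| ≤ 2 := abs_le_of_sq_le_sq (by nlinarith [sq_nonneg (a - d)]) zero_le_two
  have hQ : |(c - b) / 2| ≤ 2 := abs_le_of_sq_le_sq (by nlinarith [sq_nonneg (c + b)]) zero_le_two
  refine ⟨!![(((a + d) / 2 : ℝ) : ℂ), ((-((c - b) / 2) : ℝ) : ℂ);
    (((c - b) / 2 : ℝ) : ℂ), (((a + d) / 2 : ℝ) : ℂ)], ?_, ?_, ?_⟩
  · refine (Matrix.norm_le_iff zero_le_two).2 fun i j => ?_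
    fin_cases i <;> fin_cases j <;>
      simp only [Fin.zero_eta, Fin.mk_one, Matrix.of_apply, Matrix.cons_val, Complex.norm_real,
        Real.norm_eq_abs, abs_neg] <;> assumption
  · refine (Matrix.norm_le_iff (Real.sqrt_nonneg _)).2 fun i j => ?_
    fin_cases i <;> fin_cases j <;>
      simp only [Fin.zero_eta, Fin.mk_one, Matrix.sub_apply, Matrix.of_apply, Matrix.cons_val,
        ← Complex.ofReal_sub, Complex.norm_real, Real.norm_eq_abs]
    · convert hE1 using 2; ring
    · convert hE2 using 2; ring
    · convert hE2 using 2; ring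
    · rw [abs_sub_comm]; convert hE1 using 2; ring
  · intro t
    ext i j
    fin_cases i <;> fin_cases j <;>
      simp [Rot, Matrix.mul_apply, Fin.sum_univ_two] <;> ring

lemma exists_near_rotation {r α κ : ℝ} (hr : 0 < r) (hκ1 : 1 ≤ κ) (hκ : κ ≤ 4) {A D : ℂ → M2}
    {U : M2} (hA : IsSL2Strip r A) (hD : DifferentiableOn ℂ D (Strip r))
    (hDdet : ∀ z ∈ Strip r, (D z).det = 1) (hDre : ∀ x : ℝ, ∀ i j, (D x i j).im = 0)
    (hper : ∀ z ∈ Strip r, D (z + 1) = U * D z) (hUre : ∀ i j, (U i j).im = 0) (hUdet : U.det = 1)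
    (hU : ∀ v, eN (U.mulVec v) = eN v)
    (hlow : ∀ z ∈ Strip r, ∀ v, eN ((D z).mulVec v) ≤ κ * eN ((D (z + α)).mulVec ((A z).mulVec v)))
    (hup : ∀ z ∈ Strip r, ∀ v, eN ((D (z + α)).mulVec ((A z).mulVec v)) ≤ κ * eN ((D z).mulVec v))
    {n : ℕ} (hn : 1 + r / 2 ≤ n * (r / 4)) :
    ∃ B : ℂ → M2, DifferentiableOn ℂ B (Strip (r / 2)) ∧
      (∀ z ∈ Strip (r / 2), B (z + 1) = B z) ∧ (∀ x : ℝ, ∀ i j, (B x i j).im = 0) ∧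
      (∀ z ∈ Strip (r / 2), (B z).det = 1) ∧
      ∃ c : M2, ‖c‖ ≤ 4 ∧ ∀ z ∈ Strip (r / 2), ‖B (z + α) * A z * (B z)⁻¹ - c‖ ≤
        4 * Real.exp (2 * π * r) * ((n + 1) * √(6 * (κ - κ⁻¹))) := by
  obtain ⟨φ, hφ, rfl⟩ := exists_eq_Rot hUre hUdet hU
  have hsub : Strip (r / 2) ⊆ Strip r := Strip.mono (by linarith)
  set B : ℂ → M2 := fun z => Rot (-(φ * z)) * D z with hB
  set Cf : ℂ → M2 := fun z => D (z + α) * A z * (D z)⁻¹ with hCf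
  have hBd : DifferentiableOn ℂ B (Strip r) :=
    (differentiable_Rot.comp_differentiableOn
        ((differentiableOn_id.const_mul (φ : ℂ)).neg)).matrix_mul hD
  have hBdet : ∀ z ∈ Strip r, (B z).det = 1 := fun z hz => by
    rw [hB]; simp only; rw [Matrix.det_mul, det_Rot, hDdet z hz, one_mul]
  have hBper : ∀ z ∈ Strip r, B (z + 1) = B z := fun z hz => by
    rw [hB]; simp only
    rw [hper z hz, ← Matrix.mul_assoc, Rot_mul]; congr 2; ring
  have hBre : ∀ x : ℝ, ∀ i j, (B x i j).im = 0 := fun x i j => by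
    have e : (-(φ * x) : ℂ) = ((-(φ * x) : ℝ) : ℂ) := by push_cast; ring
    rw [hB]; simp only
    rw [Matrix.mul_apply, Fin.sum_univ_two, e]
    simp only [Complex.add_im, Complex.mul_im, Rot_im, hDre]; simp
  have hCd : DifferentiableOn ℂ Cf (Strip r) :=
    ((hD.comp_add_real α).matrix_mul hA.isCSL.1).matrix_mul (hD.matrix_inv hDdet)
  have hDv : ∀ z ∈ Strip r, ∀ v, (D z).mulVec ((D z)⁻¹.mulVec v) = v := fun z hz v => by
    rw [Matrix.mulVec_mulVec, Matrix.mul_nonsing_inv _ (by rw [hDdet z hz]; exact isUnit_one),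
      Matrix.one_mulVec]
  have hCv : ∀ z v, (D (z + α)).mulVec ((A z).mulVec ((D z)⁻¹.mulVec v)) = (Cf z).mulVec v :=
    fun z v => by rw [Matrix.mulVec_mulVec, Matrix.mulVec_mulVec]
  have hClow : ∀ z ∈ Strip r, ∀ v, eN v ≤ κ * eN ((Cf z).mulVec v) := fun z hz v => by
    have := hlow z hz ((D z)⁻¹.mulVec v)
    rwa [hDv z hz, hCv] at this
  have hCup : ∀ z ∈ Strip r, ∀ v, eN ((Cf z).mulVec v) ≤ κ * eN v := fun z hz v => by
    have := hup z hz ((D z)⁻¹.mulVec v)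
    rwa [hDv z hz, hCv] at this
  have m0 : (0 : ℂ) ∈ Strip r := by simpa using Strip.real_mem hr 0
  have hC0re : ∀ i j, (Cf 0 i j).im = 0 := fun i j => by
    have a := hDre α; have b := hDre 0; have c := hA.2.2.1 0
    simp only [Complex.ofReal_zero] at a b c
    rw [hCf]; simp only
    rw [M2.inv_eq_adjugate (hDdet 0 m0), zero_add, Matrix.mul_apply, Fin.sum_univ_two,
      Matrix.adjugate_fin_two, Matrix.mul_apply, Matrix.mul_apply, Fin.sum_univ_two,
          Fin.sum_univ_two]
    fin_cases j <;> simp [a, b, c]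
  have hC0det : (Cf 0).det = 1 := by
    rw [hCf]; simp only
    rw [Matrix.det_mul, Matrix.det_mul, Matrix.det_nonsing_inv, hDdet _ ((Strip.add_real α).2 m0),
      hDdet 0 m0, hA.2.2.2 0 m0]; simp
  obtain ⟨R, hR, hCR, hRc⟩ := exists_near_conformal hC0re hC0det hκ (hCup 0 m0)
  have hκ0 : 0 < κ := by linarith
  have hdist : ∀ z, |z.im| < r / 2 → |z.re| ≤ 1 → ‖Cf z - Cf 0‖ ≤ n * √(6 * (κ - κ⁻¹)) :=
    fun z hz hz' => norm_sub_le_of_near_isometric hr hCd hκ0 hClow hCup n z hz 0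
      (by simpa [Strip] using hr) (by
        rw [sub_zero]
        exact (Complex.norm_le_abs_re_add_abs_im z).trans (by linarith))
  have hE : ∀ z ∈ Strip r, B (z + α) * A z * (B z)⁻¹ - Rot (-(φ * α)) * R =
      Rot (-(φ * (z + α))) * (Cf z - R) * Rot (φ * z) := fun z hz => by
    have e1 : Rot (-(φ * (z + α))) * R * Rot (φ * z) = Rot (-(φ * α)) * R := by
      rw [Matrix.mul_assoc, ← hRc, ← Matrix.mul_assoc, Rot_mul]; congr 2; ring
    rw [hB, hCf]; simp only
    rw [Matrix.mul_inv_rev, Rot_inv, neg_neg, Matrix.mul_sub, Matrix.sub_mul, e1]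
    simp only [Matrix.mul_assoc]
  have hs : √(κ - 1) ≤ √(6 * (κ - κ⁻¹)) := Real.sqrt_le_sqrt (by
    have := inv_le_one_of_one_le₀ hκ1; linarith)
  have hbd : ∀ z ∈ Strip (r / 2), |z.re| ≤ 1 → ‖B (z + α) * A z * (B z)⁻¹ - Rot (-(φ * α)) * R‖ ≤
      4 * Real.exp (2 * π * r) * ((n + 1) * √(6 * (κ - κ⁻¹))) := fun z hz hz' => by
    have hz2 : |z.im| < r / 2 := hz
    rw [hE z (hsub hz)]
    have hφz : |φ * z.im| ≤ r / 2 := by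
      rw [abs_mul]; nlinarith [abs_nonneg φ, abs_nonneg z.im]
    have h1 : ‖Rot (-(φ * (z + α)))‖ ≤ Real.exp (π * r) := (norm_Rot_le _).trans
      (Real.exp_le_exp.2 (by
        have e : (-(φ * (z + α)) : ℂ).im = -(φ * z.im) := by simp
        rw [e, abs_neg]; nlinarith [Real.pi_pos]))
    have h2 : ‖Rot (φ * z)‖ ≤ Real.exp (π * r) := (norm_Rot_le _).trans
      (Real.exp_le_exp.2 (by
        have e : (φ * z : ℂ).im = φ * z.im := by simp
        rw [e]; nlinarith [Real.pi_pos]))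
    have h3 : ‖Cf z - R‖ ≤ (n + 1) * √(6 * (κ - κ⁻¹)) := by
      have := norm_sub_le_norm_sub_add_norm_sub (Cf z) (Cf 0) R
      linarith [hdist z hz hz']
    have hexp : Real.exp (2 * π * r) = Real.exp (π * r) * Real.exp (π * r) := by
      rw [← Real.exp_add]; congr 1; ring
    calc _ ≤ 2 * (2 * ‖Rot (-(φ * (z + α)))‖ * ‖Cf z - R‖) * ‖Rot (φ * z)‖ :=
          (M2.norm_mul_le _ _).trans (by gcongr; exact M2.norm_mul_le _ _)
      _ ≤ 2 * (2 * Real.exp (π * r) * ((n + 1) * √(6 * (κ - κ⁻¹)))) * Real.exp (π * r) := by gcongr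
      _ = _ := by rw [hexp]; ring
  refine ⟨B, hBd.mono hsub, fun z hz => hBper z (hsub hz), hBre, fun z hz => hBdet z (hsub hz),
    Rot (-(φ * α)) * R, ?_, fun z hz => ?_⟩
  · refine (M2.norm_mul_le _ _).trans ?_
    have : ‖Rot (-(φ * α))‖ ≤ 1 := by simpa using norm_Rot_le (-(φ * α))
    nlinarith [norm_nonneg (Rot (-(φ * α))), norm_nonneg R]
  · obtain ⟨g, hg, hgp⟩ := exists_periodic_eqOn (r := r / 2)
      (f := fun z => B (z + α) * A z * (B z)⁻¹) fun z hz => by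
        have := hBper (z + α) ((Strip.add_real α).2 (hsub hz))
        rw [hBper z (hsub hz), hA.2.1, ← this]; congr 3; ring
    obtain ⟨k, hk⟩ := Strip.exists_int_mem_rect (le_of_lt hz)
    have hzk : z + k ∈ Strip (r / 2) := by
      have := (Strip.add_real (r := r / 2) (z := z) k).2 hz; simpa using this
    have := hbd (z + k) hzk (abs_le.2 ⟨by linarith [hk.1.1], hk.1.2⟩)
    have e := (hg hzk).symm.trans ((periodic_int hgp z k).trans (hg hz))
    simp only at e
    rwa [e] at this

lemma eN_smul_mulVec (a : ℂ) (M : M2) (v : V2) :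
    eN ((a • M).mulVec v) = ‖a‖ ^ 2 * eN (M.mulVec v) := by
  rw [Matrix.smul_mulVec, eN_eq, eN_eq]
  simp only [Pi.smul_apply, smul_eq_mul, norm_mul]
  ring

lemma norm_det_le_of_eN_le_eN {M N : M2} {κ : ℝ} (hN : N.det ≠ 0)
    (hMN : ∀ v, eN (M.mulVec v) ≤ κ * eN (N.mulVec v)) : ‖M.det‖ ≤ κ * ‖N.det‖ := by
  have := norm_det_le_of_eN_le (M := M * N⁻¹) (κ := κ) fun v => by
    have := hMN (N⁻¹.mulVec v)
    rwa [Matrix.mulVec_mulVec, Matrix.mulVec_mulVec,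
      Matrix.mul_nonsing_inv _ (isUnit_iff_ne_zero.2 hN), Matrix.one_mulVec] at this
  rw [Matrix.det_mul, Matrix.det_nonsing_inv, Ring.inverse_eq_inv', norm_mul, norm_inv,
    ← div_eq_mul_inv, div_le_iff₀ (norm_pos_iff.2 hN)] at this
  exact this

/-- Near-isometry for unnormalised families passes to families of determinant one. -/
lemma eN_le_of_normalized {M N : M2} {κ : ℝ} {a b : ℂ} (hκ : 0 ≤ κ)
    (ha : a ^ 2 * M.det = 1) (hb : b ^ 2 * N.det = 1)
    (hMN : ∀ v, eN (M.mulVec v) ≤ κ * eN (N.mulVec v))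
    (hNM : ∀ v, eN (N.mulVec v) ≤ κ * eN (M.mulVec v)) (v : V2) :
    eN ((a • M).mulVec v) ≤ κ ^ 2 * eN ((b • N).mulVec v) := by
  have hM : M.det ≠ 0 := right_ne_zero_of_mul (ha ▸ one_ne_zero)
  have hd := norm_det_le_of_eN_le_eN hM hNM
  have h1 : ‖a‖ ^ 2 * ‖M.det‖ = 1 := by rw [← norm_pow, ← norm_mul, ha, norm_one]
  have h2 : ‖b‖ ^ 2 * ‖N.det‖ = 1 := by rw [← norm_pow, ← norm_mul, hb, norm_one]
  have h3 : ‖a‖ ^ 2 ≤ κ * ‖b‖ ^ 2 := by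
    calc ‖a‖ ^ 2 = ‖a‖ ^ 2 * (‖b‖ ^ 2 * ‖N.det‖) := by rw [h2, mul_one]
      _ ≤ ‖a‖ ^ 2 * (‖b‖ ^ 2 * (κ * ‖M.det‖)) := by gcongr
      _ = κ * ‖b‖ ^ 2 * (‖a‖ ^ 2 * ‖M.det‖) := by ring
      _ = _ := by rw [h1, mul_one]
  rw [eN_smul_mulVec, eN_smul_mulVec]
  calc _ ≤ (κ * ‖b‖ ^ 2) * (κ * eN (N.mulVec v)) :=
        mul_le_mul h3 (hMN v) (eN_nonneg _) (by positivity)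
    _ = _ := by ring

lemma IsWeight.exists_near_rotation {H α κ c C : ℝ} (hh : 0 < h) (hH : h < H) {A W : ℂ → M2}
    (hA : IsSL2Strip H A) (hW : IsWeight h W c C) (hκ1 : 1 ≤ κ) (hκ : κ ≤ 2)
    (hper : ∀ z, W (z + 1) = W z)
    (hWc : ∀ z, |z.im| = h → W ((starRingEnd ℂ) z) = conjM (W z))
    (hup : ∀ z, |z.im| = h → ∀ v, (hpair (W (z + α)) ((A z).mulVec v) ((A z).mulVec v)).re ≤
      κ * (hpair (W z) v v).re)
    (hlow : ∀ z, |z.im| = h → ∀ v, (hpair (W z) v v).re ≤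
      κ * (hpair (W (z + α)) ((A z).mulVec v) ((A z).mulVec v)).re)
    {n : ℕ} (hn : 1 + h / 2 / 2 ≤ n * (h / 2 / 4)) :
    ∃ B : ℂ → M2, DifferentiableOn ℂ B (Strip (h / 2 / 2)) ∧
      (∀ z ∈ Strip (h / 2 / 2), B (z + 1) = B z) ∧ (∀ x : ℝ, ∀ i j, (B x i j).im = 0) ∧
      (∀ z ∈ Strip (h / 2 / 2), (B z).det = 1) ∧
      ∃ c : M2, ‖c‖ ≤ 4 ∧ ∀ z ∈ Strip (h / 2 / 2), ‖B (z + α) * A z * (B z)⁻¹ - c‖ ≤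
        4 * Real.exp (2 * π * (h / 2)) * ((n + 1) * √(6 * (κ ^ 2 - (κ ^ 2)⁻¹))) := by
  have hκ0 : 0 ≤ κ := by linarith
  have hcs : CStrip h ⊆ Strip H := fun z hz => lt_of_le_of_lt hz hH
  have hsH : Strip h ⊆ Strip H := Strip.mono hH.le
  have hsub : Strip (h / 2) ⊆ Strip h := Strip.mono (by linarith)
  obtain ⟨K, hK⟩ := exists_bound_strip hA.1.continuousOn hA.2.1 hH
  obtain ⟨B, hB⟩ := hW.exists_extremal hh
  obtain ⟨U, hU, hUB⟩ := hB.exists_period hW hh hper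
  obtain ⟨s, t, x, hs, ht, h0⟩ := hB.base
  have hdet0 : (B 0).det = ((s * t : ℝ) : ℂ) := by rw [h0, Matrix.det_fin_two_of]; simp
  have hh2 : 0 < h / 2 := by linarith
  obtain ⟨D, m, hDd, hDdet, hDre, hDper, hUre, hUdet, hDm⟩ := exists_normalized hh2
    (hB.diff.mono hsub) (fun z hz => hB.det z (hsub hz)) (hB.conj_eq hW hh hWc) (mul_pos hs ht)
    hdet0 hU hUB
  have hAinv : ∀ z ∈ Strip H, ∀ v, (A z).mulVec ((A z)⁻¹.mulVec v) = v := fun z hz v => by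
    rw [Matrix.mulVec_mulVec, Matrix.mul_nonsing_inv _ (by rw [hA.2.2.2 z hz]; exact isUnit_one),
      Matrix.one_mulVec]
  have hAinv' : ∀ z ∈ Strip H, ∀ v, (A z)⁻¹.mulVec ((A z).mulVec v) = v := fun z hz v => by
    rw [Matrix.mulVec_mulVec, Matrix.nonsing_inv_mul _ (by rw [hA.2.2.2 z hz]; exact isUnit_one),
      Matrix.one_mulVec]
  have t1 : ∀ ω ∈ Strip h, ∀ v, eN ((B (ω + α)).mulVec ((A ω).mulVec v)) ≤
      κ * eN ((B ω).mulVec v) := fun ω hω v =>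
    hB.transport hW hh (hA.1.continuousOn.mono hcs) (hA.1.mono hsH) (fun z hz => hK z hz) hκ0 hup hω
        v
  have hId : DifferentiableOn ℂ (fun z => (A (z + ((-α : ℝ) : ℂ)))⁻¹) (Strip H) :=
    (hA.1.comp_add_real (-α)).matrix_inv fun z hz => hA.2.2.2 _ ((Strip.add_real _).2 hz)
  have t2 : ∀ ω ∈ Strip h, ∀ v, eN ((B ω).mulVec v) ≤
      κ * eN ((B (ω + α)).mulVec ((A ω).mulVec v)) := fun ω hω v => by
    have := hB.transport (t := -α) hW hh (hId.continuousOn.mono hcs) (hId.mono hsH)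
      (K := K) (fun z hz => by
        rw [M2.norm_inv (hA.2.2.2 _ ((Strip.add_real _).2 (hcs hz)))]
        exact hK _ (by simpa [CStrip] using hz)) hκ0 (fun z hz u => by
        have h1 :=
            hlow (z + ((-α : ℝ) : ℂ)) (by simpa using hz) ((A (z + ((-α : ℝ) : ℂ)))⁻¹.mulVec u)
        rw [hAinv _ ((Strip.add_real _).2 (hcs hz.le))] at h1
        convert h1 using 4
        push_cast; ring_nf) ((Strip.add_real α).2 hω) ((A ω).mulVec v)
    have e : ω + α + ((-α : ℝ) : ℂ) = ω := by push_cast; ring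
    rwa [e, hAinv' _ (hsH hω)] at this
  have hDB : ∀ z ∈ Strip (h / 2), ∀ v, (D (z + α)).mulVec ((A z).mulVec v) =
      (m (z + α) • (B (z + α) * A z)).mulVec v := fun z hz v => by
    rw [(hDm _ ((Strip.add_real α).2 hz)).1, Matrix.mulVec_mulVec, Matrix.smul_mul]
  have hdetBA : ∀ z ∈ Strip (h / 2), m (z + α) ^ 2 * (B (z + α) * A z).det = 1 := fun z hz => by
    rw [Matrix.det_mul, hA.2.2.2 z (hsH (hsub hz)), mul_one, (hDm _ ((Strip.add_real α).2 hz)).2]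
  have hAr : IsSL2Strip (h / 2) A := hA.mono (by linarith)
  refine _root_.exists_near_rotation hh2 (one_le_pow₀ hκ1) (by nlinarith) hAr hDd hDdet hDre hDper
    hUre hUdet hU (fun z hz v => ?_) (fun z hz v => ?_) hn
  · rw [hDB z hz, (hDm z hz).1]
    exact eN_le_of_normalized hκ0 (hDm z hz).2 (hdetBA z hz)
      (fun v => by rw [← Matrix.mulVec_mulVec]; exact t2 z (hsub hz) v)
      (fun v => by rw [← Matrix.mulVec_mulVec]; exact t1 z (hsub hz) v) v
  · rw [hDB z hz, (hDm z hz).1]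
    exact eN_le_of_normalized hκ0 (hdetBA z hz) (hDm z hz).2
      (fun v => by rw [← Matrix.mulVec_mulVec]; exact t1 z (hsub hz) v)
      (fun v => by rw [← Matrix.mulVec_mulVec]; exact t2 z (hsub hz) v) v

/-- A cocycle preserving weights up to factors arbitrarily close to one is approximately
reducible. -/
lemma approxRed_of_weights {H α : ℝ} (hh : 0 < h) (hH : h < H) {A : ℂ → M2}
    (hA : IsSL2Strip H A)
    (hex : ∀ κ : ℝ, 1 < κ → ∃ (W : ℂ → M2) (c C : ℝ), IsWeight h W c C ∧ (∀ z, W (z + 1) = W z) ∧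
      (∀ z, |z.im| = h → W ((starRingEnd ℂ) z) = conjM (W z)) ∧
      (∀ z, |z.im| = h → ∀ v, (hpair (W (z + α)) ((A z).mulVec v) ((A z).mulVec v)).re ≤
        κ * (hpair (W z) v v).re) ∧
      ∀ z, |z.im| = h → ∀ v, (hpair (W z) v v).re ≤
        κ * (hpair (W (z + α)) ((A z).mulVec v) ((A z).mulVec v)).re) :
    ApproxRed α (h / 2 / 2) A := by
  obtain ⟨n, hn⟩ := exists_nat_ge ((1 + h / 2 / 2) / (h / 2 / 4))
  rw [div_le_iff₀ (by linarith)] at hn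
  refine ApproxRed.of_local 4 fun δ hδ => ?_
  have hcont : ContinuousAt (fun κ : ℝ => 4 * Real.exp (2 * π * (h / 2)) *
      ((n + 1) * √(6 * (κ ^ 2 - (κ ^ 2)⁻¹)))) 1 := by
    have : ContinuousAt (fun κ : ℝ => (κ ^ 2)⁻¹) 1 := ContinuousAt.inv₀ (by fun_prop) (by norm_num)
    fun_prop
  have hlim := hcont.tendsto
  simp only [one_pow, inv_one, sub_self, mul_zero, Real.sqrt_zero] at hlim
  obtain ⟨ρ, hρ, hρ'⟩ := Metric.eventually_nhds_iff.1 (hlim.eventually_lt_const hδ)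
  set κ : ℝ := 1 + min (ρ / 2) 1 with hκ
  have hm : 0 < min (ρ / 2) 1 := lt_min (by linarith) one_pos
  obtain ⟨W, c, C, hW, h1, h2, h3, h4⟩ := hex κ (by linarith)
  obtain ⟨B, b1, b2, b3, b4, c, hc, b5⟩ := hW.exists_near_rotation hh hH hA (by linarith)
    (by linarith [min_le_right (ρ / 2) 1]) h1 h2 h3 h4 hn
  refine ⟨B, b1, ⟨1, Or.inl rfl, fun z hz => by rw [one_smul]; exact b2 z hz⟩, b3, b4, c, hc,
    fun z hz => (b5 z hz).trans (hρ' ?_).le⟩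
  rw [hκ, Real.dist_eq, add_sub_cancel_left, abs_of_pos hm]
  linarith [min_le_left (ρ / 2) 1]

lemma IsSL2Strip.iter {H α : ℝ} {A : ℂ → M2} (hA : IsSL2Strip H A) (n : ℕ) :
    IsSL2Strip H (cocycleIter α A n) :=
  have h1 := hA.isCSL.iter α n
  ⟨h1.1, h1.2.1, fun x i j => hA.cocycleIter_im n x i j, h1.2.2⟩

/-- Schwarz reflection. -/
lemma IsSL2Strip.conj_eq {H : ℝ} (hH : 0 < H) {A : ℂ → M2} (hA : IsSL2Strip H A)
    (hz : z ∈ Strip H) : A ((starRingEnd ℂ) z) = conjM (A z) := by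
  ext i j
  have hf := hA.1.matrix_entry i j
  have hg := differentiableOn_strip_conj hf
  have m0 : (0 : ℂ) ∈ Strip H := by simpa using Strip.real_mem hH 0
  have hfreq : ∃ᶠ w in nhdsWithin (0 : ℂ) {0}ᶜ,
      (fun w => (starRingEnd ℂ) (A ((starRingEnd ℂ) w) i j)) w = A w i j := by
    have ht : Tendsto (fun n : ℕ => ((1 / ((n : ℝ) + 1) : ℝ) : ℂ)) atTop
        (nhdsWithin (0 : ℂ) {0}ᶜ) := by
      refine tendsto_nhdsWithin_iff.2 ⟨?_, Eventually.of_forall fun n => ?_⟩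
      · rw [← Complex.ofReal_zero]
        exact (Complex.continuous_ofReal.tendsto 0).comp tendsto_one_div_add_atTop_nhds_zero_nat
      · have : (0 : ℝ) < 1 / ((n : ℝ) + 1) := by positivity
        simpa only [Set.mem_compl_iff, Set.mem_singleton_iff, Complex.ofReal_eq_zero] using this.ne'
    refine ht.frequently (Eventually.of_forall fun n => ?_).frequently
    simp only
    rw [Complex.conj_ofReal, Complex.conj_eq_iff_im.2 (hA.2.2.1 _ i j)]
  have := (hg.analyticOnNhd (Strip.isOpen H)).eqOn_of_preconnected_of_frequently_eq
    (hf.analyticOnNhd (Strip.isOpen H)) (Strip.convex H).isPreconnected m0 hfreq hz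
  simp only at this
  rw [← Complex.conj_conj (A ((starRingEnd ℂ) z) i j), this]
  rfl

/-- The cocycle between times `-N` and `k - N`, as a function of the base point at time `0`. -/
def orbL (α : ℝ) (A : ℂ → M2) (N k : ℕ) (z : ℂ) : M2 :=
  cocycleIter α A k (z + ((-(N * α) : ℝ) : ℂ)) * (cocycleIter α A N (z + ((-(N * α) : ℝ) : ℂ)))⁻¹

section orbL

variable {H α : ℝ} {A : ℂ → M2} {N : ℕ}

lemma orbL_shift (hA : IsCSL H A) (hz : z ∈ Strip H) (k : ℕ) :
    orbL α A N k (z + α) * A z = orbL α A N (k + 1) z := by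
  set w : ℂ := z + ((-(N * α) : ℝ) : ℂ) with hw
  have hwH : w ∈ Strip H := (Strip.add_real _).2 hz
  have e1 : z + α + ((-(N * α) : ℝ) : ℂ) = w + α := by rw [hw]; ring
  have e2 : w + N * α = z := by rw [hw]; push_cast; ring
  have h1 : cocycleIter α A (N + 1) w = cocycleIter α A N (w + α) * A w := by
    rw [cocycleIter_add, cocycleIter_one, Nat.cast_one, one_mul]
  have h1' : cocycleIter α A (k + 1) w = cocycleIter α A k (w + α) * A w := by
    rw [cocycleIter_add, cocycleIter_one, Nat.cast_one, one_mul]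
  have h2 : cocycleIter α A (N + 1) w = A z * cocycleIter α A N w := by
    change A (w + N * α) * _ = _
    rw [e2]
  have hu1 : IsUnit (cocycleIter α A N w).det := by rw [(hA.iter α N).2.2 w hwH]; exact isUnit_one
  have hu2 : IsUnit (cocycleIter α A N (w + α)).det := by
    rw [(hA.iter α N).2.2 _ ((Strip.add_real α).2 hwH)]; exact isUnit_one
  have hAz : A z = cocycleIter α A N (w + α) * A w * (cocycleIter α A N w)⁻¹ := by
    rw [← h1, h2, Matrix.mul_assoc, Matrix.mul_nonsing_inv _ hu1, Matrix.mul_one]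
  rw [orbL, orbL, e1, ← hw, hAz, h1']
  simp only [Matrix.mul_assoc]
  rw [← Matrix.mul_assoc (cocycleIter α A N (w + α))⁻¹, Matrix.nonsing_inv_mul _ hu2,
      Matrix.one_mul]

lemma orbL_self (hA : IsCSL H A) (hz : z ∈ Strip H) : orbL α A N N z = 1 :=
  Matrix.mul_nonsing_inv _ (by
    rw [(hA.iter α N).2.2 _ ((Strip.add_real _).2 hz)]; exact isUnit_one)

lemma orbL_add (hA : IsCSL H A) (hz : z ∈ Strip H) (k : ℕ) :
    orbL α A N (k + N) z = cocycleIter α A k z := by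
  have e2 : z + ((-(N * α) : ℝ) : ℂ) + N * α = z := by push_cast; ring
  rw [orbL, cocycleIter_add, e2, Matrix.mul_assoc]
  have := orbL_self (α := α) (N := N) hA hz
  rw [orbL] at this
  rw [this, Matrix.mul_one]

lemma orbL_zero (hA : IsCSL H A) (hz : z ∈ Strip H) :
    ‖orbL α A N 0 z‖ = ‖cocycleIter α A N (z + ((-(N * α) : ℝ) : ℂ))‖ := by
  rw [orbL, cocycleIter, Matrix.one_mul,
    M2.norm_inv ((hA.iter α N).2.2 _ ((Strip.add_real _).2 hz))]

lemma differentiableOn_orbL (hA : IsCSL H A) (k : ℕ) :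
    DifferentiableOn ℂ (orbL α A N k) (Strip H) :=
  ((hA.iter α k).1.comp_add_real _).matrix_mul (((hA.iter α N).1.comp_add_real _).matrix_inv
    fun _ hz => (hA.iter α N).2.2 _ ((Strip.add_real _).2 hz))

lemma orbL_periodic (hA : IsCSL H A) (k : ℕ) (z : ℂ) :
    orbL α A N k (z + 1) = orbL α A N k z := by
  rw [orbL, orbL, add_right_comm, (hA.iter α k).2.1, (hA.iter α N).2.1]

lemma conjM_mul (M M' : M2) : conjM (M * M') = conjM M * conjM M' := by
  ext i j; simp [conjM, Matrix.mul_apply]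

lemma conjM_conjTranspose (M : M2) : conjM M.conjTranspose = (conjM M).conjTranspose := by
  ext i j; simp [conjM, Matrix.conjTranspose_apply]

lemma conjM_inv {M : M2} (hM : M.det = 1) : conjM M⁻¹ = (conjM M)⁻¹ := by
  refine (Matrix.inv_eq_left_inv ?_).symm
  rw [← conjM_mul, Matrix.nonsing_inv_mul _ (by rw [hM]; exact isUnit_one)]
  ext i j; fin_cases i <;> fin_cases j <;> simp [conjM]

lemma orbL_conj (hA : IsSL2Strip H A) (hH : 0 < H) (hz : z ∈ Strip H) (k : ℕ) :
    orbL α A N k ((starRingEnd ℂ) z) = conjM (orbL α A N k z) := by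
  have e : (starRingEnd ℂ) z + ((-(N * α) : ℝ) : ℂ) =
      (starRingEnd ℂ) (z + ((-(N * α) : ℝ) : ℂ)) := by rw [map_add, Complex.conj_ofReal]
  have hz' := (Strip.add_real (-(N * α))).2 hz
  rw [orbL, orbL, e, (hA.iter k).conj_eq hH hz', (hA.iter N).conj_eq hH hz', conjM_mul,
    conjM_inv ((hA.iter N).2.2.2 _ hz')]

/-- The averaged weight along an orbit segment, with geometric weights of ratio `c`. -/
def avgW (α : ℝ) (A : ℂ → M2) (N : ℕ) (c : ℝ) (z : ℂ) : M2 :=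
  ∑ k ∈ Finset.range (2 * N + 1),
    ((c ^ ((k - N) + (N - k)) : ℝ) : ℂ) • ((orbL α A N k z).conjTranspose * orbL α A N k z)

lemma hpair_self_gram (M : M2) (v : V2) : hpair (M.conjTranspose * M) v v = eN (M.mulVec v) := by
  rw [hpair, ← Matrix.mulVec_mulVec, Matrix.dotProduct_mulVec, ← Matrix.star_mulVec]
  simp only [dotProduct, Fin.sum_univ_two, Pi.star_apply, eN, Complex.ofReal_add,
    Complex.normSq_eq_conj_mul_self]
  rfl

lemma hpair_avgW (c : ℝ) (v : V2) : (hpair (avgW α A N c z) v v).re =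
    ∑ k ∈ Finset.range (2 * N + 1), c ^ ((k - N) + (N - k)) * eN ((orbL α A N k z).mulVec v) := by
  have : hpair (avgW α A N c z) v v = ∑ k ∈ Finset.range (2 * N + 1),
      ((c ^ ((k - N) + (N - k)) * eN ((orbL α A N k z).mulVec v) : ℝ) : ℂ) := by
    rw [avgW, hpair, Matrix.sum_mulVec, dotProduct_sum]
    refine Finset.sum_congr rfl fun k _ => ?_
    rw [Matrix.smul_mulVec, dotProduct_smul, smul_eq_mul, Complex.ofReal_mul, ← hpair_self_gram,
        hpair]
  rw [this, ← Complex.ofReal_sum, Complex.ofReal_re]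

lemma isHermitian_avgW (c : ℝ) (z : ℂ) : (avgW α A N c z).IsHermitian := by
  rw [Matrix.IsHermitian, avgW, Matrix.conjTranspose_sum]
  refine Finset.sum_congr rfl fun k _ => ?_
  rw [Matrix.conjTranspose_smul, Matrix.conjTranspose_mul, Matrix.conjTranspose_conjTranspose]
  simp

lemma avgW_periodic (hA : IsCSL H A) (c : ℝ) (z : ℂ) : avgW α A N c (z + 1) = avgW α A N c z := by
  simp only [avgW, orbL_periodic hA]

lemma avgW_conj (hA : IsSL2Strip H A) (hH : 0 < H) (hz : z ∈ Strip H) (c : ℝ) :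
    avgW α A N c ((starRingEnd ℂ) z) = conjM (avgW α A N c z) := by
  have hs : ∀ (s : Finset ℕ) (F : ℕ → M2), conjM (∑ k ∈ s, F k) = ∑ k ∈ s, conjM (F k) :=
    fun s F => by ext i j; simp [conjM, Matrix.sum_apply]
  rw [avgW, avgW, hs]
  refine Finset.sum_congr rfl fun k _ => ?_
  rw [orbL_conj hA hH hz, ← conjM_conjTranspose, ← conjM_mul]
  ext i j
  simp [conjM]

lemma continuousOn_avgW (hA : IsCSL H A) (c : ℝ) : ContinuousOn (avgW α A N c) (Strip H) := by
  refine continuousOn_finsetSum _ fun k _ => ?_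
  have h1 : ContinuousOn (orbL α A N k) (Strip H) := (differentiableOn_orbL hA k).continuousOn
  have e1 := fun i j => continuousOn_pi.1 (continuousOn_pi.1 h1 i) j
  refine continuousOn_pi.2 fun i => continuousOn_pi.2 fun j => ?_
  simp only [Matrix.smul_apply, Matrix.mul_apply, Fin.sum_univ_two, Matrix.conjTranspose_apply,
    smul_eq_mul]
  exact continuousOn_const.mul (((e1 0 i).star.mul (e1 0 j)).add ((e1 1 i).star.mul (e1 1 j)))

end orbL

lemma sum_geom_weight_shift_le {g : ℕ → ℝ} (hg : ∀ k, 0 ≤ g k) {c q : ℝ} (hc : 0 < c) (hc1 : c ≤ 1)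
    (hq : q * c = 1) (N : ℕ) :
    ∑ k ∈ Finset.range (2 * N + 1), c ^ ((k - N) + (N - k)) * g (k + 1) ≤
      q * ∑ k ∈ Finset.range (2 * N + 1), c ^ ((k - N) + (N - k)) * g k +
        c ^ N * g (2 * N + 1) := by
  have hq0 : 0 ≤ q := by by_contra! hlt; nlinarith
  rw [Finset.sum_range_succ, show 2 * N - N + (N - 2 * N) = N by omega,
    Finset.sum_range_succ' (fun k => c ^ ((k - N) + (N - k)) * g k)]
  have h1 : ∑ k ∈ Finset.range (2 * N), c ^ ((k - N) + (N - k)) * g (k + 1) ≤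
      q * ∑ k ∈ Finset.range (2 * N), c ^ ((k + 1 - N) + (N - (k + 1))) * g (k + 1) := by
    rw [Finset.mul_sum]
    refine Finset.sum_le_sum fun k _ => ?_
    have : c ^ ((k - N) + (N - k)) * c ≤ c ^ ((k + 1 - N) + (N - (k + 1))) := by
      rw [← pow_succ]; exact pow_le_pow_of_le_one hc.le hc1 (by omega)
    calc _ = q * (c ^ ((k - N) + (N - k)) * c * g (k + 1)) := by
          linear_combination (-c ^ ((k - N) + (N - k)) * g (k + 1)) * hq
      _ ≤ _ := by have := hg (k + 1); gcongr
  have h2 : 0 ≤ q * (c ^ ((0 - N) + (N - 0)) * g 0) := by have := hg 0; positivity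
  linarith

lemma sum_geom_weight_le_shift {g : ℕ → ℝ} (hg : ∀ k, 0 ≤ g k) {c q : ℝ} (hc : 0 < c) (hc1 : c ≤ 1)
    (hq : q * c = 1) (N : ℕ) :
    ∑ k ∈ Finset.range (2 * N + 1), c ^ ((k - N) + (N - k)) * g k ≤
      q * ∑ k ∈ Finset.range (2 * N + 1), c ^ ((k - N) + (N - k)) * g (k + 1) + c ^ N * g 0 := by
  have hq0 : 0 ≤ q := by by_contra! hlt; nlinarith
  rw [Finset.sum_range_succ', show 0 - N + (N - 0) = N by omega,
    Finset.sum_range_succ (fun k => c ^ ((k - N) + (N - k)) * g (k + 1))]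
  have h1 : ∑ k ∈ Finset.range (2 * N), c ^ ((k + 1 - N) + (N - (k + 1))) * g (k + 1) ≤
      q * ∑ k ∈ Finset.range (2 * N), c ^ ((k - N) + (N - k)) * g (k + 1) := by
    rw [Finset.mul_sum]
    refine Finset.sum_le_sum fun k _ => ?_
    have : c ^ ((k + 1 - N) + (N - (k + 1))) * c ≤ c ^ ((k - N) + (N - k)) := by
      rw [← pow_succ]; exact pow_le_pow_of_le_one hc.le hc1 (by omega)
    calc _ = q * (c ^ ((k + 1 - N) + (N - (k + 1))) * c * g (k + 1)) := by
          linear_combination (-c ^ ((k + 1 - N) + (N - (k + 1))) * g (k + 1)) * hq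
      _ ≤ _ := by have := hg (k + 1); gcongr
  have h2 : 0 ≤ q * (c ^ ((2 * N - N) + (N - 2 * N)) * g (2 * N + 1)) := by
    have := hg (2 * N + 1); positivity
  linarith

lemma eN_mulVec_le (M : M2) (v : V2) : eN (M.mulVec v) ≤ 8 * ‖M‖ ^ 2 * eN v := by
  have h1 := M2.norm_mulVec_le M v
  have h2 : eN (M.mulVec v) ≤ 2 * ‖M.mulVec v‖ ^ 2 := by
    rw [eN_eq]
    have a := norm_le_pi_norm (M.mulVec v) 0
    have b := norm_le_pi_norm (M.mulVec v) 1
    nlinarith [norm_nonneg (M.mulVec v 0), norm_nonneg (M.mulVec v 1)]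
  have h3 : ‖M.mulVec v‖ ^ 2 ≤ (2 * ‖M‖ * ‖v‖) ^ 2 := by gcongr
  nlinarith [sq_norm_le_eN v, sq_nonneg ‖M‖]

/-- Zero Lyapunov exponent on the boundary of a strip gives approximate reducibility. -/
theorem IsSL2Strip.approxRed_of_growth_eq_zero {H α : ℝ} (hh : 0 < h) (hH : h < H) {A : ℂ → M2}
    (hA : IsSL2Strip H A) (hg : growth α A h = 0) (hg' : growth α A (-h) = 0) :
    ApproxRed α (h / 2 / 2) A := by
  have hC := hA.isCSL
  refine approxRed_of_weights hh hH hA fun κ hκ => ?_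
  have hκ0 : 0 < κ := by linarith
  set q : ℝ := √κ with hq
  have hq1 : 1 < q := by rw [hq, Real.lt_sqrt zero_le_one]; linarith
  have hqq : q * q = κ := Real.mul_self_sqrt hκ0.le
  set c : ℝ := q⁻¹ with hc
  have hc0 : 0 < c := by positivity
  have hc1 : c < 1 := inv_lt_one_of_one_lt₀ hq1
  have hqc : q * c = 1 := mul_inv_cancel₀ (by positivity)
  set η : ℝ := Real.log q / 4 with hη
  have hη0 : 0 < η := div_pos (Real.log_pos hq1) four_pos
  have hcη : c = Real.exp (-(4 * η)) := by
    rw [hη, Real.exp_neg, hc]; congr 1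
    rw [mul_div_cancel₀ _ (by norm_num), Real.exp_log (by linarith)]
  obtain ⟨K₁, hK₁, h1⟩ := hC.exists_maxLog_le (α := α) (y := h) (by rwa [abs_of_pos hh]) hη0
  obtain ⟨K₂, hK₂, h2⟩ :=
      hC.exists_maxLog_le (α := α) (y := -h) (by rwa [abs_neg, abs_of_pos hh]) hη0
  rw [hg, zero_add] at h1
  rw [hg', zero_add] at h2
  set K := max K₁ K₂ with hK
  have hsH : ∀ z : ℂ, |z.im| = h → z ∈ Strip H := fun z hz => by
    change |z.im| < H; rwa [hz]
  have hnorm : ∀ n : ℕ, ∀ z : ℂ, |z.im| = h → 2 * ‖cocycleIter α A n z‖ ≤ Real.exp (K + n * η) :=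
    fun n z hz => (hC.norm_le_exp_maxLog n (hsH z hz)).trans (Real.exp_le_exp.2 (by
      rcases eq_or_eq_neg_of_abs_eq hz with e | e <;> rw [e]
      · linarith [h1 n, le_max_left K₁ K₂]
      · linarith [h2 n, le_max_right K₁ K₂]))
  obtain ⟨N, hN⟩ := exists_pow_lt_of_lt_one (x := (1 - c) / (2 * Real.exp (2 * K + 2 * η)))
    (y := Real.exp (-(2 * η))) (by have : 0 < 1 - c := by linarith
                                   positivity) (by
        rw [← Real.exp_zero]; exact Real.exp_lt_exp.2 (by linarith))
  rw [lt_div_iff₀ (by positivity)] at hN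
  have hsmall : ∀ M : M2, 2 * ‖M‖ ≤ Real.exp (K + (N + 1 : ℕ) * η) → ∀ v,
      c ^ N * eN (M.mulVec v) ≤ (1 - c) * eN v := fun M hM v => by
    have e1 : (2 * ‖M‖) ^ 2 ≤ Real.exp (K + (N + 1 : ℕ) * η) ^ 2 := by gcongr
    have e2 : c ^ N * Real.exp (K + (N + 1 : ℕ) * η) ^ 2 =
        Real.exp (-(2 * η)) ^ N * Real.exp (2 * K + 2 * η) := by
      rw [hcη, ← Real.exp_nat_mul, ← Real.exp_nat_mul, ← Real.exp_nat_mul, ← Real.exp_add,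
        ← Real.exp_add]
      congr 1; push_cast; ring
    calc c ^ N * eN (M.mulVec v) ≤ c ^ N * (8 * ‖M‖ ^ 2 * eN v) := by
          gcongr; exact eN_mulVec_le M v
      _ = 2 * (c ^ N * (2 * ‖M‖) ^ 2) * eN v := by ring
      _ ≤ 2 * (c ^ N * Real.exp (K + (N + 1 : ℕ) * η) ^ 2) * eN v := by
          have := eN_nonneg v; gcongr
      _ ≤ (1 - c) * eN v := by
          rw [e2]
          exact mul_le_mul_of_nonneg_right (by linarith) (eN_nonneg v)
  have hlowS : ∀ z ∈ Strip H, ∀ v, eN v ≤ (hpair (avgW α A N c z) v v).re := fun z hz v => by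
    rw [hpair_avgW]
    have := Finset.single_le_sum (f := fun k => c ^ ((k - N) + (N - k)) *
      eN ((orbL α A N k z).mulVec v)) (s := Finset.range (2 * N + 1))
      (fun k _ => mul_nonneg (pow_nonneg hc0.le _) (eN_nonneg _))
          (Finset.mem_range.2 (by omega : N < 2 * N + 1))
    simpa [orbL_self hC hz] using this
  have hshift : ∀ z ∈ Strip H, ∀ v, (hpair (avgW α A N c (z + α)) ((A z).mulVec v)
      ((A z).mulVec v)).re = ∑ k ∈ Finset.range (2 * N + 1), c ^ ((k - N) + (N - k)) *
        eN ((orbL α A N (k + 1) z).mulVec v) := fun z hz v => by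
    rw [hpair_avgW]
    refine Finset.sum_congr rfl fun k _ => ?_
    rw [Matrix.mulVec_mulVec, orbL_shift hC hz]
  have hgnn : ∀ (z : ℂ) (v : V2) (k : ℕ), 0 ≤ eN ((orbL α A N k z).mulVec v) :=
    fun _ _ _ => eN_nonneg _
  obtain ⟨C, hCb⟩ := exists_bound_strip (continuousOn_avgW (N := N) (α := α) hC c)
    (avgW_periodic hC c) hH
  have hcs : CStrip h ⊆ Strip H := fun z hz => lt_of_le_of_lt hz hH
  refine ⟨avgW α A N c, 1, C, ⟨(continuousOn_avgW hC c).mono hcs, fun z _ => isHermitian_avgW c z,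
    one_pos, fun z hz v => ?_, fun z hz => hCb z hz⟩, avgW_periodic hC c,
    fun z hz => avgW_conj hA (hh.trans hH) (hsH z hz) c, fun z hz v => ?_, fun z hz v => ?_⟩
  · rw [one_mul]; exact (sq_norm_le_eN v).trans (hlowS z (hcs hz) v)
  · have e1 := sum_geom_weight_shift_le (hgnn z v) hc0 hc1.le hqc N
    rw [← hshift z (hsH z hz), ← hpair_avgW, show 2 * N + 1 = N + 1 + N by ring,
      orbL_add hC (hsH z hz)] at e1
    have e2 := hsmall _ (hnorm (N + 1) z hz) v
    have e3 := hlowS z (hsH z hz) v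
    have e4 : q + (1 - c) ≤ κ := by
      rw [← hqq]; nlinarith [mul_pos (sub_pos.2 hq1) (sub_pos.2 hc1)]
    nlinarith [eN_nonneg v]
  · have e1 := sum_geom_weight_le_shift (hgnn z v) hc0 hc1.le hqc N
    rw [← hshift z (hsH z hz), ← hpair_avgW] at e1
    have e2 := hsmall (orbL α A N 0 z) (by
      rw [orbL_zero hC (hsH z hz)]
      refine (hnorm N _ (by simpa using hz)).trans (Real.exp_le_exp.2 ?_)
      push_cast; nlinarith) v
    have e3 := hlowS z (hsH z hz) v
    set S := (hpair (avgW α A N c z) v v).re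
    set S' := (hpair (avgW α A N c (z + α)) ((A z).mulVec v) ((A z).mulVec v)).re
    have e5 : c * S ≤ q * S' := by nlinarith
    calc S = q * (c * S) := by rw [← mul_assoc, hqc, one_mul]
      _ ≤ q * (q * S') := by gcongr
      _ = κ * S' := by rw [← mul_assoc, hqq]

lemma IsSL2Strip.exists_approxRed_of_iterate_le {α r : ℝ} {C : ℂ → M2} (hα : Irrational α)
    (hr : 0 < r) (hC : IsSL2Strip r C) {n : ℕ} (hn : n ≠ 0)
    (hb : ∀ z ∈ Strip r, 2 * ‖cocycleIter α C n z‖ ≤ Real.exp (n * (r / 160000))) :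
    ∃ ε : ℝ, 0 < ε ∧ ε ≤ r ∧ ApproxRed α ε C := by
  have hn0 : (0 : ℝ) < n := by exact_mod_cast Nat.pos_of_ne_zero hn
  rcases hC.approxRed_or_growth_eq_zero hα hr le_rfl fun y hy => by
    refine (hC.isCSL.growth_le hy hn).trans ((div_le_iff₀' hn0).2 ?_)
    exact hC.isCSL.maxLog_le hy fun x => hb _ (Strip.line_mem hy x) with hred | hzero
  · exact hred
  · have h1 : |r / 8| < r / 4 := by rw [abs_of_pos (by linarith)]; linarith
    exact ⟨r / 8 / 2 / 2, by linarith, by linarith,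
      hC.approxRed_of_growth_eq_zero (by linarith) (by linarith) (hzero _ h1)
        (hzero _ (by rwa [abs_neg]))⟩

lemma M2.norm_mul_sub_mul_le (X Y P Q : M2) :
    ‖X * Y - P * Q‖ ≤ 2 * ‖X - P‖ * ‖Y‖ + 2 * ‖P‖ * ‖Y - Q‖ := by
  rw [show X * Y - P * Q = (X - P) * Y + P * (Y - Q) by noncomm_ring]
  exact (norm_add_le _ _).trans (add_le_add (M2.norm_mul_le _ _) (M2.norm_mul_le _ _))

lemma exists_cocycleIter_near_pow (A₀ : M2) (n : ℕ) {η : ℝ} (hη : 0 < η) :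
    ∃ δ : ℝ, 0 < δ ∧ ∀ (α r : ℝ) (C : ℂ → M2), (∀ z ∈ Strip r, ‖C z - A₀‖ ≤ δ) →
      ∀ z ∈ Strip r, ‖cocycleIter α C n z - A₀ ^ n‖ ≤ η := by
  induction n generalizing η with
  | zero => exact ⟨1, one_pos, fun α r C _ z _ => by simpa [cocycleIter] using hη.le⟩
  | succ n ih =>
    have hP := norm_nonneg A₀
    have hQ := norm_nonneg (A₀ ^ n)
    obtain ⟨δ, hδ, hd⟩ := ih (η := min 1 (η / (4 * (‖A₀‖ + 1)))) (by positivity)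
    refine ⟨min δ (η / (4 * (‖A₀ ^ n‖ + 1))), by positivity, fun α r C hC z hz => ?_⟩
    have h1 := hd α r C (fun z hz => (hC z hz).trans (min_le_left _ _)) z hz
    have h2 := (hC _ ((Strip.add_nat_mul n α).2 hz)).trans (min_le_right _ _)
    have h3 := h1.trans (min_le_left _ _)
    have h4 := h1.trans (min_le_right _ _)
    have h5 : ‖cocycleIter α C n z‖ ≤ ‖A₀ ^ n‖ + 1 := by
      linarith [norm_sub_norm_le (cocycleIter α C n z) (A₀ ^ n)]
    rw [pow_succ']
    change ‖C (z + n * α) * cocycleIter α C n z - A₀ * A₀ ^ n‖ ≤ η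
    calc _ ≤ _ := M2.norm_mul_sub_mul_le _ _ _ _
      _ ≤ 2 * (η / (4 * (‖A₀ ^ n‖ + 1))) * (‖A₀ ^ n‖ + 1)
          + 2 * (‖A₀‖ + 1) * (η / (4 * (‖A₀‖ + 1))) := by gcongr; linarith
      _ = η := by field_simp; norm_num

lemma exists_forall_approxRed_of_near_const {A₀ : M2} (hdet : A₀.det = 1) {r : ℝ} (hr : 0 < r) :
    ∃ δ : ℝ, 0 < δ ∧ ∀ (α : ℝ) (C : ℂ → M2), Irrational α → IsSL2Strip r C →
      (∀ z ∈ Strip r, ‖C z - A₀‖ ≤ δ) → ∃ ε : ℝ, 0 < ε ∧ ε ≤ r ∧ ApproxRed α ε C := by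
  have hdetn (n : ℕ) : (A₀ ^ n).det = 1 := by rw [Matrix.det_pow, hdet, one_pow]
  have h1 (n : ℕ) : 1 ≤ 2 * ‖A₀ ^ n‖ := M2.one_le_two_mul_norm (hdetn n)
  set u : ℕ → ℝ := fun n => Real.log (2 * ‖A₀ ^ n‖) with hu
  have hexp (n : ℕ) : Real.exp (u n) = 2 * ‖A₀ ^ n‖ := Real.exp_log (by linarith [h1 n])
  have hsub : Subadditive u := fun m n => by
    simp only [hu]
    rw [← Real.log_mul (by linarith [h1 m]) (by linarith [h1 n])]
    refine Real.log_le_log (by linarith [h1 (m + n)]) ?_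
    rw [pow_add]
    nlinarith [M2.norm_mul_le (A₀ ^ m) (A₀ ^ n)]
  have hbdd : BddBelow (Set.range fun n : ℕ => u n / n) :=
    ⟨0, by rintro _ ⟨n, rfl⟩; exact div_nonneg (Real.log_nonneg (h1 n)) (Nat.cast_nonneg n)⟩
  have hlim := hsub.tendsto_lim hbdd
  set l := hsub.lim with hl
  rcases lt_or_ge l (r / 160000) with hlt | hge
  · obtain ⟨n, hn, hn0⟩ := ((hlim.eventually_lt_const hlt).and (eventually_gt_atTop 0)).exists
    have hnp : (0 : ℝ) < n := by exact_mod_cast hn0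
    have h2 : 2 * ‖A₀ ^ n‖ < Real.exp (n * (r / 160000)) := by
      rw [← hexp]
      exact Real.exp_lt_exp.2 ((div_lt_iff₀' hnp).1 hn)
    obtain ⟨δ, hδ, hd⟩ := exists_cocycleIter_near_pow A₀ n
      (η := (Real.exp (n * (r / 160000)) - 2 * ‖A₀ ^ n‖) / 2) (by linarith)
    refine ⟨δ, hδ, fun α C hα hC hn => hC.exists_approxRed_of_iterate_le hα hr hn0.ne' ?_⟩
    intro z hz
    linarith [hd α r C hn z hz, norm_sub_norm_le (cocycleIter α C n z) (A₀ ^ n)]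
  · have hl0 : 0 < l := by linarith [show 0 < r / 160000 by positivity]
    obtain ⟨n, ⟨hn, hnl⟩, hn0⟩ := ((hlim.eventually_lt_const (show l < l + l / 10 by linarith)).and
      (tendsto_natCast_atTop_atTop.eventually_ge_atTop (2000 / l)) |>.and
      (eventually_gt_atTop 0)).exists
    have hnp : (0 : ℝ) < n := by exact_mod_cast hn0
    rw [div_le_iff₀ hl0] at hnl
    have hup : 2 * ‖A₀ ^ n‖ ≤ Real.exp (n * (l + l / 10)) := by
      rw [← hexp]
      exact Real.exp_le_exp.2 ((div_lt_iff₀' hnp).1 hn).le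
    have hlow {m : ℕ} (hm : m ≠ 0) : Real.exp (m * l) ≤ 2 * ‖A₀ ^ m‖ := by
      rw [← hexp]
      have hmp : (0 : ℝ) < m := by exact_mod_cast Nat.pos_of_ne_zero hm
      exact Real.exp_le_exp.2 ((le_div_iff₀' hmp).1 (hsub.lim_le_div hbdd hm))
    obtain ⟨δ, hδ, hd⟩ := exists_cocycleIter_near_pow A₀ n (η := 1 / 4) (by norm_num)
    obtain ⟨δ', hδ', hd'⟩ := exists_cocycleIter_near_pow A₀ (n + n) (η := 1 / 4) (by norm_num)
    refine ⟨min δ δ', by positivity, fun α C hα hC hnear => ?_⟩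
    replace hd := hd α r C fun z hz => (hnear z hz).trans (min_le_left _ _)
    replace hd' := hd' α r C fun z hz => (hnear z hz).trans (min_le_right _ _)
    have hlown := hlow hn0.ne'
    have hlow2 := hlow (m := n + n) (by omega)
    push_cast at hlow2
    refine AP.approxRed (θ := Real.exp (-(2 * (n * (l / 10)))) / 4) (n := n) hα hC hr le_rfl
      ⟨by positivity, ?_, fun z hz => ?_, fun z hz => ?_⟩
    · have : Real.exp (-(2 * (n * (l / 10)))) ≤ 1 := Real.exp_le_one_iff.2 (by nlinarith)
      linarith
    · have e1 : ‖cocycleIter α C n z‖ ≤ 3 / 2 * ‖A₀ ^ n‖ := by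
        linarith [hd z hz, norm_sub_norm_le (cocycleIter α C n z) (A₀ ^ n), h1 n]
      have e2 : ‖cocycleIter α C n (z + n * α)‖ ≤ 3 / 2 * ‖A₀ ^ n‖ := by
        linarith [hd _ ((Strip.add_nat_mul n α).2 hz), h1 n,
          norm_sub_norm_le (cocycleIter α C n (z + n * α)) (A₀ ^ n)]
      have e3 : ‖A₀ ^ (n + n)‖ / 2 ≤ ‖cocycleIter α C (n + n) z‖ := by
        linarith [hd' z hz, norm_sub_norm_le (A₀ ^ (n + n)) (cocycleIter α C (n + n) z),
          norm_sub_rev (A₀ ^ (n + n)) (cocycleIter α C (n + n) z), h1 (n + n)]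
      have e4 : Real.exp (-(2 * (n * (l / 10)))) * (2 * ‖A₀ ^ n‖) ^ 2 ≤
          Real.exp ((n + n) * l) := by
        calc _ ≤ Real.exp (-(2 * (n * (l / 10)))) * Real.exp (n * (l + l / 10)) ^ 2 := by gcongr
          _ = _ := by rw [← Real.exp_nat_mul, ← Real.exp_add]; congr 1; push_cast; ring
      have e5 : Real.exp (-(2 * (n * (l / 10)))) / 4 * ‖cocycleIter α C n (z + n * α)‖ *
          ‖cocycleIter α C n z‖ ≤
          Real.exp (-(2 * (n * (l / 10)))) / 4 * (3 / 2 * ‖A₀ ^ n‖) * (3 / 2 * ‖A₀ ^ n‖) := by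
        gcongr
      nlinarith [Real.exp_pos ((n + n : ℝ) * l)]
    · have e1 : Real.exp (n * l) / 4 ≤ ‖cocycleIter α C n z‖ := by
        linarith [hd z hz, norm_sub_norm_le (A₀ ^ n) (cocycleIter α C n z), h1 n,
          norm_sub_rev (A₀ ^ n) (cocycleIter α C n z)]
      have e2 : Real.exp (-(2 * (n * (l / 10)))) / 4 * (Real.exp (n * l) / 4) =
          Real.exp (n * l * (4 / 5)) / 16 := by
        rw [show (n : ℝ) * l * (4 / 5) = -(2 * (n * (l / 10))) + n * l by ring, Real.exp_add]
        ring
      have e3 := Real.add_one_le_exp ((n : ℝ) * l * (4 / 5))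
      have e4 : Real.exp (-(2 * (n * (l / 10)))) / 4 * (Real.exp (n * l) / 4) ≤
          Real.exp (-(2 * (n * (l / 10)))) / 4 * ‖cocycleIter α C n z‖ := by gcongr
      linarith

lemma IsPSL2Strip.mono {ε ε' : ℝ} {B : ℂ → M2} (hB : IsPSL2Strip ε B) (hε : ε' ≤ ε) :
    IsPSL2Strip ε' B :=
  ⟨hB.1.mono (Strip.mono hε), hB.2.1, hB.2.2.1, fun z hz => hB.2.2.2 z (Strip.mono hε hz)⟩

lemma IsPSL2Strip.isSL2Strip_conj {ε α : ℝ} {A B : ℂ → M2} (hB : IsPSL2Strip ε B)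
    (hA : IsSL2Strip ε A) : IsSL2Strip ε fun z => B (z + α) * A z * (B z).adjugate := by
  obtain ⟨hBd, ⟨s, hs, hBp⟩, hBr, hBdet⟩ := hB
  have hss : s * s = 1 := by rcases hs with rfl | rfl <;> norm_num
  refine ⟨((hBd.comp_add_real α).matrix_mul hA.1).matrix_mul hBd.matrix_adjugate, fun z => ?_,
    fun x i j => ?_, fun z hz => ?_⟩
  · simp only
    rw [add_right_comm, hBp, hA.2.1, hBp, Matrix.adjugate_smul]
    simp [smul_smul, hss]
  · have h1 := hBr (x + α)
    push_cast at h1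
    have h2 := hBr x
    have h3 := hA.2.2.1 x
    fin_cases i <;> fin_cases j <;>
      simp [Matrix.mul_apply, Fin.sum_univ_two, Matrix.adjugate_fin_two, h1, h2, h3]
  · rw [Matrix.det_mul, Matrix.det_mul, Matrix.det_adjugate, hBdet z hz, hA.2.2.2 z hz,
      hBdet _ ((Strip.add_real α).2 hz)]
    simp

lemma IsPSL2Strip.double {ε : ℝ} {B : ℂ → M2} (hB : IsPSL2Strip ε B) :
    ContinuousOn (fun w => B (2 * w)) (Strip (ε / 2)) ∧
      ∀ w, B (2 * (w + 1)) = B (2 * w) := by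
  obtain ⟨hBd, ⟨s, hs, hBp⟩, -⟩ := hB
  refine ⟨hBd.continuousOn.comp (by fun_prop) fun w hw => ?_, fun w => ?_⟩
  · simp only [Strip, Set.mem_ofPred_eq, Complex.mul_im, Complex.re_ofNat, Complex.im_ofNat,
      zero_mul, add_zero, abs_mul, abs_two] at hw ⊢
    linarith
  · rw [show 2 * (w + 1) = 2 * w + 1 + 1 by ring, hBp, hBp, smul_smul]
    rcases hs with rfl | rfl <;> simp

lemma IsPSL2Strip.exists_bound {ε r : ℝ} {B : ℂ → M2} (hB : IsPSL2Strip ε B) (hr : r < ε) :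
    ∃ K : ℝ, ∀ z ∈ Strip r, ‖B z‖ ≤ K := by
  obtain ⟨K, hK⟩ := exists_bound_strip (r' := r / 2) hB.double.1 hB.double.2 (by linarith)
  refine ⟨K, fun z hz => ?_⟩
  have h1 := hK (z / 2) (by
    have : |z.im| < r := hz
    simp only [Complex.div_ofNat_im, abs_div, abs_two]
    linarith)
  rwa [mul_div_cancel₀ z two_ne_zero] at h1

lemma IsPSL2Strip.exists_unifcont {ε r η : ℝ} {B : ℂ → M2} (hB : IsPSL2Strip ε B) (hr : r < ε)
    (hη : 0 < η) : ∃ ρ : ℝ, 0 < ρ ∧ ∀ z w, z ∈ Strip r → dist w z < ρ → ‖B w - B z‖ < η := by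
  obtain ⟨ρ, hρ, hu⟩ := exists_unifcont_strip (r' := r / 2) hB.double.1 hB.double.2
    (by linarith) hη
  refine ⟨ρ, hρ, fun z w hz hw => ?_⟩
  have h1 := hu (z / 2) (w / 2) (by
    have : |z.im| < r := hz
    simp only [Complex.div_ofNat_im, abs_div, abs_two]
    linarith) (by
    rw [dist_eq_norm, ← sub_div, norm_div, Complex.norm_ofNat, ← dist_eq_norm]
    linarith [dist_nonneg (x := w) (y := z)])
  rwa [mul_div_cancel₀ z two_ne_zero, mul_div_cancel₀ w two_ne_zero] at h1

lemma IsPSL2Strip.eventually_conj_near {ε r α η : ℝ} {αs : ℕ → ℝ} {A B : ℂ → M2}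
    {As : ℕ → ℂ → M2} (hB : IsPSL2Strip ε B) (hA : IsSL2Strip ε A) (hr : r < ε)
    (hα : Tendsto αs atTop (nhds α))
    (hAs : ∀ δ : ℝ, 0 < δ → ∀ᶠ n in atTop, ∀ z ∈ Strip r, ‖As n z - A z‖ ≤ δ) (hη : 0 < η) :
    ∀ᶠ n in atTop, ∀ z ∈ Strip r, ‖B (z + αs n) * As n z * (B z).adjugate -
      B (z + α) * A z * (B z).adjugate‖ ≤ η := by
  obtain ⟨K, hK⟩ := hB.exists_bound hr
  obtain ⟨a, ha⟩ := exists_bound_strip hA.1.continuousOn hA.2.1 hr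
  set D : ℝ := 4 * |K| * (|a| + 1 + |K|) + 1 with hD
  have hDp : 0 < D := by positivity
  obtain ⟨ρ, hρ, hu⟩ := hB.exists_unifcont (η := η / D) hr (by positivity)
  filter_upwards [Metric.tendsto_nhds.1 hα ρ hρ, hAs (min 1 (η / D)) (by positivity)]
    with n hn1 hn2 z hz
  have hzα : z + α ∈ Strip r := (Strip.add_real α).2 hz
  have e1 : ‖B (z + αs n) - B (z + α)‖ ≤ η / D := by
    refine (hu _ _ hzα ?_).le
    rw [dist_add_left, dist_eq_norm, ← Complex.ofReal_sub, Complex.norm_real, ← dist_eq_norm]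
    exact hn1
  have e2 := hn2 z hz
  have e3 : ‖As n z‖ ≤ |a| + 1 := by
    linarith [e2.trans (min_le_left _ _), norm_sub_norm_le (As n z) (A z), le_abs_self a,
      ha z (le_of_lt hz)]
  have e4 := e2.trans (min_le_right _ _)
  have e5 := (hK z hz).trans (le_abs_self K)
  have e6 := (hK _ hzα).trans (le_abs_self K)
  rw [← sub_mul]
  calc _ ≤ 2 * ‖B (z + αs n) * As n z - B (z + α) * A z‖ * ‖(B z).adjugate‖ :=
        M2.norm_mul_le _ _
    _ ≤ 2 * (2 * ‖B (z + αs n) - B (z + α)‖ * ‖As n z‖ + 2 * ‖B (z + α)‖ * ‖As n z - A z‖) *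
        ‖B z‖ := by
      rw [M2.norm_adjugate]
      gcongr
      exact M2.norm_mul_sub_mul_le _ _ _ _
    _ ≤ 2 * (2 * (η / D) * (|a| + 1) + 2 * |K| * (η / D)) * |K| := by gcongr
    _ = (D - 1) * (η / D) := by rw [hD]; ring
    _ ≤ D * (η / D) := by gcongr; linarith
    _ = η := mul_div_cancel₀ η hDp.ne'

/-- **Corollary.** Almost reducibility is open in `(ℝ ∖ ℚ) × C^ω(ℝ/ℤ, SL(2,ℝ))`: if `(α, A)` is
almost reducible and `(αₙ, Aₙ) → (α, A)` (with all `αₙ` irrational, the maps converging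
uniformly on a common strip), then `(αₙ, Aₙ)` is almost reducible for all large `n`. -/
theorem almostReducible_open
    (α : ℝ) (hirr : Irrational α) (αs : ℕ → ℝ) (hirrs : ∀ n, Irrational (αs n))
    (ε' : ℝ) (hε' : 0 < ε')
    (A : ℂ → M2) (As : ℕ → ℂ → M2)
    (hA : IsSL2Strip ε' A) (hAs : ∀ n, IsSL2Strip ε' (As n))
    (hconvα : Filter.Tendsto αs Filter.atTop (nhds α))
    (hconvA : ∀ δ : ℝ, 0 < δ → ∃ N : ℕ, ∀ n : ℕ, N ≤ n → ∀ z ∈ Strip ε',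
      ‖As n z - A z‖ ≤ δ)
    (hAR : AlmostReducible α ε' A) :
    ∃ N : ℕ, ∀ n : ℕ, N ≤ n → AlmostReducible (αs n) ε' (As n) := by
  obtain ⟨ε, hε, hεε', B, hB, A₀, hlim⟩ := hAR
  have hr : 0 < ε / 2 := by linarith
  have hrε : ε / 2 < ε := by linarith
  have h0 : (0 : ℂ) ∈ Strip ε := by simpa [Strip] using hε
  have hdet : A₀.det = 1 := by
    have ht : Tendsto (fun n => B n (0 + α) * A 0 * (B n 0)⁻¹) atTop (nhds A₀) := by
      refine Metric.tendsto_atTop.2 fun δ hδ => ?_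
      obtain ⟨N, hN⟩ := hlim (δ / 2) (by linarith)
      refine ⟨N, fun n hn => ?_⟩
      rw [dist_eq_norm]
      linarith [hN n hn 0 h0]
    refine tendsto_nhds_unique ((continuous_id.matrix_det.tendsto A₀).comp ht)
      (tendsto_const_nhds.congr fun n => ?_)
    simp only [Function.comp_apply, id_eq]
    rw [M2.inv_eq_adjugate ((hB n).2.2.2 0 h0), Matrix.det_mul, Matrix.det_mul,
      Matrix.det_adjugate, (hB n).2.2.2 0 h0, (hB n).2.2.2 _ ((Strip.add_real α).2 h0),
      (hA.mono hεε').2.2.2 0 h0]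
    simp
  obtain ⟨δ, hδ, hcrit⟩ := exists_forall_approxRed_of_near_const hdet hr
  obtain ⟨m, hm⟩ := hlim (δ / 2) (by linarith)
  have hm := hm m le_rfl
  have hev := (hB m).eventually_conj_near (hA.mono hεε') hrε hconvα (As := As) (fun η hη => by
    obtain ⟨N, hN⟩ := hconvA η hη
    filter_upwards [eventually_ge_atTop N] with n hn z hz
    exact hN n hn z (Strip.mono (by linarith) hz)) (half_pos hδ)
  obtain ⟨N, hN⟩ := eventually_atTop.1 hev
  refine ⟨N, fun n hn => ?_⟩
  have hBr := (hB m).mono hrε.le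
  obtain ⟨ε₁, hε₁, hε₁r, hred⟩ := hcrit (αs n) _ (hirrs n)
    (hBr.isSL2Strip_conj (α := αs n) ((hAs n).mono (by linarith))) fun z hz => by
      have e1 := hm z (Strip.mono hrε.le hz)
      rw [M2.inv_eq_adjugate (hBr.2.2.2 z hz)] at e1
      calc _ ≤ _ := norm_sub_le_norm_sub_add_norm_sub _
            (B m (z + α) * A z * (B m z).adjugate) _
        _ ≤ δ / 2 + δ / 2 := add_le_add (hN n hn z hz) e1
        _ = δ := add_halves δ
  refine (hred.of_conj (hBr.mono hε₁r) fun z hz => ?_).almostReducible hε₁ (by linarith)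
  rw [M2.inv_eq_adjugate (hBr.2.2.2 z (Strip.mono hε₁r hz))]
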